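/- Let D ⊂ ℂⁿ be a bounded domain of class C² with defining function ρ, and suppose D is strongly ℂ-linearly convex. Then for every p with 1 < p < ∞ there is a constant A_p < ∞ such that the truncated Cauchy–Leray integrals are uniformly bounded on L^p(bD, σ): for every ε > 0 and every f ∈ L^p(bD, σ), the function z ↦ ∫_{{w ∈ bD : |⟨∂ρ(w), w−z⟩| > ε}} f(w)·⟨∂ρ(w), w−z⟩^{−n} dσ(w), defined for z ∈ bD, satisfies ‖C_L^ε f‖_{L^p(bD,σ)} ≤ A_p ‖f‖_{L^p(bD,σ)}. -/

import Mathlib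

open MeasureTheory Complex

noncomputable section

/-- ℂⁿ with the Euclidean norm. -/
abbrev Cn (n : ℕ) := EuclideanSpace ℂ (Fin n)

instance (n : ℕ) : MeasurableSpace (Cn n) := borel _
instance (n : ℕ) : BorelSpace (Cn n) := ⟨rfl⟩

/-- Wirtinger derivative ∂f/∂ζⱼ of `f : ℂⁿ → ℂ` at `w`. -/
def wderiv {n : ℕ} (f : Cn n → ℂ) (w : Cn n) (j : Fin n) : ℂ :=
  (1/2) * (fderiv ℝ f w (EuclideanSpace.single j (1:ℂ))
            - Complex.I * fderiv ℝ f w (EuclideanSpace.single j Complex.I))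

/-- Conjugate Wirtinger derivative ∂f/∂ζ̄ⱼ of `f : ℂⁿ → ℂ` at `w`. -/
def wderivBar {n : ℕ} (f : Cn n → ℂ) (w : Cn n) (j : Fin n) : ℂ :=
  (1/2) * (fderiv ℝ f w (EuclideanSpace.single j (1:ℂ))
            + Complex.I * fderiv ℝ f w (EuclideanSpace.single j Complex.I))

/-- A real-valued function regarded as complex valued. -/
def realToC {n : ℕ} (ρ : Cn n → ℝ) : Cn n → ℂ := fun w => (ρ w : ℂ)

/-- ⟨∂ρ(w), ξ⟩ = Σⱼ (∂ρ/∂ζⱼ)(w) ξⱼ. -/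
def delPair {n : ℕ} (ρ : Cn n → ℝ) (w ξ : Cn n) : ℂ :=
  ∑ j, wderiv (realToC ρ) w j * ξ j

/-- Second Wirtinger derivative ∂²ρ/∂ζⱼ∂ζₖ. -/
def wderiv2 {n : ℕ} (ρ : Cn n → ℝ) (w : Cn n) (j k : Fin n) : ℂ :=
  wderiv (fun v => wderiv (realToC ρ) v j) w k

/-- The Levi form L_w(ρ)(ξ) = Σ_{j,k} (∂²ρ/∂ζⱼ∂ζ̄ₖ)(w) ξⱼ ξ̄ₖ (a real number). -/
def leviForm {n : ℕ} (ρ : Cn n → ℝ) (w ξ : Cn n) : ℝ :=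
  (∑ j, ∑ k, wderivBar (fun v => wderiv (realToC ρ) v j) w k * ξ j * (starRingEnd ℂ) (ξ k)).re

/-- Surface measure σ on bD: (2n−1)-dimensional Hausdorff measure restricted to the boundary. -/
def bSigma {n : ℕ} (D : Set (Cn n)) : Measure (Cn n) :=
  (μH[(2*(n:ℝ) - 1)]).restrict (frontier D)

/-- Lebesgue measure dV on ℂⁿ ≅ ℝ²ⁿ, realized as 2n-dimensional Hausdorff measure. -/
def dVol (n : ℕ) : Measure (Cn n) := μH[(2*(n:ℝ))]

noncomputable section

namespace CotlarStein
set_option linter.unusedSectionVars false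

variable {H : Type*} [NormedAddCommGroup H] [InnerProductSpace ℂ H] [CompleteSpace H]

/-- iterated sum over all lists of length `k` with entries in `range N`. -/
def sumL {V : Type*} [AddCommMonoid V] (N : ℕ) : ℕ → (List ℕ → V) → V
  | 0, F => F []
  | k+1, F => ∑ i ∈ Finset.range N, sumL N k (fun l => F (i :: l))

lemma norm_sumL_le {V : Type*} [SeminormedAddCommGroup V] (N k : ℕ) (F : List ℕ → V) :
    ‖sumL N k F‖ ≤ sumL N k (fun l => ‖F l‖) := by
  induction k generalizing F with
  | zero => simp [sumL]
  | succ k ih =>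
    simp only [sumL]
    exact (norm_sum_le _ _).trans (Finset.sum_le_sum fun i _ => ih _)

lemma sumL_mono (N k : ℕ) (F G : List ℕ → ℝ) (h : ∀ l, F l ≤ G l) :
    sumL N k F ≤ sumL N k G := by
  induction k generalizing F G with
  | zero => exact h []
  | succ k ih =>
    simp only [sumL]
    exact Finset.sum_le_sum fun i _ => ih _ _ fun l => h _

lemma sumL_const_mul (N k : ℕ) (F : List ℕ → ℝ) (a : ℝ) :
    sumL N k (fun l => a * F l) = a * sumL N k F := by
  induction k generalizing F with
  | zero => simp [sumL]
  | succ k ih =>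
    simp only [sumL, Finset.mul_sum]
    exact Finset.sum_congr rfl fun i _ => ih _

def ch (b : ℕ → ℕ → ℝ) : ℕ → List ℕ → ℝ
  | _, [] => 1
  | i, j :: l => b i j * ch b j l

def pr (b : ℕ → ℕ → ℝ) (B : ℝ) : List ℕ → ℝ
  | [] => 1
  | [_] => B
  | i :: j :: l => b i j ^ 2 * pr b B l

lemma ch_nonneg (b : ℕ → ℕ → ℝ) (hb : ∀ i j, 0 ≤ b i j) (i : ℕ) (l : List ℕ) : 0 ≤ ch b i l := by
  induction l generalizing i with
  | nil => simp [ch]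
  | cons j l ih => exact mul_nonneg (hb _ _) (ih j)

lemma pr_mul (b : ℕ → ℕ → ℝ) (B : ℝ) (i : ℕ) (l : List ℕ) :
    pr b B (i :: l) * pr b B l = B * ch b i l ^ 2 := by
  induction l generalizing i with
  | nil => simp [pr, ch]
  | cons j l ih =>
    have := ih j
    simp only [pr, ch] at this ⊢
    calc b i j ^ 2 * pr b B l * pr b B (j :: l) = b i j ^ 2 * (pr b B (j :: l) * pr b B l) := by ring
      _ = _ := by rw [this]; ring

lemma sumL_ch_le (b : ℕ → ℕ → ℝ) (hb : ∀ i j, 0 ≤ b i j) (N : ℕ) (A : ℝ)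
    (hA : ∀ i, ∑ j ∈ Finset.range N, b i j ≤ A) (k i : ℕ) :
    sumL N k (fun l => ch b i l) ≤ A ^ k := by
  have hA0 : 0 ≤ A := (Finset.sum_nonneg fun j _ => hb 0 j).trans (hA 0)
  induction k generalizing i with
  | zero => simp [sumL, ch]
  | succ k ih =>
    simp only [sumL, ch, sumL_const_mul]
    calc ∑ j ∈ Finset.range N, b i j * sumL N k (fun l => ch b j l)
        ≤ ∑ j ∈ Finset.range N, b i j * A ^ k :=
          Finset.sum_le_sum fun j _ => mul_le_mul_of_nonneg_left (ih j) (hb _ _)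
      _ = (∑ j ∈ Finset.range N, b i j) * A ^ k := by rw [Finset.sum_mul]
      _ ≤ A * A ^ k := mul_le_mul_of_nonneg_right (hA i) (pow_nonneg hA0 _)
      _ = _ := by ring

/-- alternating words; the flag tells whether the first factor is an adjoint -/
def wd (T : ℕ → H →L[ℂ] H) : Bool → List ℕ → (H →L[ℂ] H)
  | _, [] => 1
  | true, i :: l => star (T i) * wd T false l
  | false, i :: l => T i * wd T true l

lemma wd_le_pr (T : ℕ → H →L[ℂ] H) (b : ℕ → ℕ → ℝ) (B : ℝ)
    (hB : ∀ i, ‖T i‖ ≤ B) (h1 : ∀ i j, ‖star (T i) * T j‖ ≤ b i j ^ 2)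
    (h2 : ∀ i j, ‖T i * star (T j)‖ ≤ b i j ^ 2) :
    ∀ (l : List ℕ) (f : Bool), ‖wd T f l‖ ≤ pr b B l
  | [], f => by
      cases f <;> exact ContinuousLinearMap.norm_id_le (𝕜 := ℂ) (E := H)
  | [i], f => by
      cases f
      · simpa [wd, pr] using hB i
      · simpa [wd, pr] using hB i
  | i :: j :: l, f => by
      have ih := wd_le_pr T b B hB h1 h2 l f
      cases f
      · simp only [wd, pr, ← mul_assoc]
        exact (norm_mul_le _ _).trans
          (mul_le_mul (h2 i j) ih (norm_nonneg _) (sq_nonneg _))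
      · simp only [wd, pr, ← mul_assoc]
        exact (norm_mul_le _ _).trans
          (mul_le_mul (h1 i j) ih (norm_nonneg _) (sq_nonneg _))

lemma wd_le_ch (T : ℕ → H →L[ℂ] H) (b : ℕ → ℕ → ℝ) (hb : ∀ i j, 0 ≤ b i j) (B : ℝ)
    (hB : ∀ i, ‖T i‖ ≤ B) (h1 : ∀ i j, ‖star (T i) * T j‖ ≤ b i j ^ 2)
    (h2 : ∀ i j, ‖T i * star (T j)‖ ≤ b i j ^ 2) (i : ℕ) (l : List ℕ) :
    ‖wd T true (i :: l)‖ ≤ B * ch b i l := by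
  have hB0 : 0 ≤ B := (norm_nonneg _).trans (hB 0)
  have e1 := wd_le_pr T b B hB h1 h2 (i :: l) true
  have e2 : ‖wd T true (i :: l)‖ ≤ B * pr b B l := by
    simp only [wd]
    refine (norm_mul_le _ _).trans (mul_le_mul ?_ (wd_le_pr T b B hB h1 h2 l false)
      (norm_nonneg _) hB0)
    simpa using hB i
  have e3 := pr_mul b B i l
  refine abs_le_of_sq_le_sq' ?_ (mul_nonneg hB0 (ch_nonneg b hb i l)) |>.2
  calc ‖wd T true (i :: l)‖ ^ 2 = ‖wd T true (i :: l)‖ * ‖wd T true (i :: l)‖ := by ring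
    _ ≤ pr b B (i :: l) * (B * pr b B l) :=
      mul_le_mul e1 e2 (norm_nonneg _) ((norm_nonneg _).trans e1)
    _ = B * (pr b B (i :: l) * pr b B l) := by ring
    _ = _ := by rw [e3]; ring

lemma sumL_mul_left (N k : ℕ) (S : H →L[ℂ] H) (F : List ℕ → H →L[ℂ] H) :
    sumL N k (fun l => S * F l) = S * sumL N k F := by
  induction k generalizing F with
  | zero => simp [sumL]
  | succ k ih =>
    simp only [sumL, Finset.mul_sum]
    exact Finset.sum_congr rfl fun i _ => ih _

lemma sumL_wd (T : ℕ → H →L[ℂ] H) (N k : ℕ) :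
    sumL N (2 * k) (wd T true) =
      (star (∑ i ∈ Finset.range N, T i) * ∑ i ∈ Finset.range N, T i) ^ k := by
  induction k with
  | zero => simp [sumL, wd]
  | succ k ih =>
    rw [show 2 * (k+1) = (2 * k + 1) + 1 by ring]
    simp only [sumL, wd]
    rw [pow_succ', ← ih, star_sum, mul_assoc, Finset.sum_mul]
    refine Finset.sum_congr rfl fun i _ => ?_
    rw [Finset.sum_mul, Finset.mul_sum]
    refine Finset.sum_congr rfl fun j _ => ?_
    rw [sumL_mul_left, sumL_mul_left]

theorem cotlar_stein (T : ℕ → H →L[ℂ] H) (b : ℕ → ℕ → ℝ) (hb : ∀ i j, 0 ≤ b i j) (B : ℝ)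
    (hB : ∀ i, ‖T i‖ ≤ B) (h1 : ∀ i j, ‖star (T i) * T j‖ ≤ b i j ^ 2)
    (h2 : ∀ i j, ‖T i * star (T j)‖ ≤ b i j ^ 2) (N : ℕ) (A : ℝ) (hA0 : 0 < A)
    (hA : ∀ i, ∑ j ∈ Finset.range N, b i j ≤ A) :
    ‖∑ i ∈ Finset.range N, T i‖ ≤ A := by
  have hB0 : 0 ≤ B := (norm_nonneg _).trans (hB 0)
  set S := ∑ i ∈ Finset.range N, T i with hS
  have key : ∀ k : ℕ, ‖(star S * S) ^ (k+1)‖ ≤ N * B * A ^ (2 * k + 1) := by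
    intro k
    rw [hS, ← sumL_wd, show 2 * (k+1) = (2 * k + 1) + 1 by ring]
    refine (norm_sumL_le _ _ _).trans ?_
    simp only [sumL]
    calc _ ≤ ∑ i ∈ Finset.range N, B * A ^ (2 * k + 1) := by
          refine Finset.sum_le_sum fun i _ => ?_
          have e : sumL N (2 * k + 1) (fun l => ‖wd T true (i :: l)‖) ≤
              sumL N (2 * k + 1) (fun l => B * ch b i l) :=
            sumL_mono _ _ _ _ fun l => wd_le_ch T b hb B hB h1 h2 i l
          rw [sumL_const_mul] at e
          exact e.trans (mul_le_mul_of_nonneg_left (sumL_ch_le b hb N A hA _ _) hB0)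
      _ = _ := by simp [mul_assoc]
  have hsa : IsSelfAdjoint (star S * S) := IsSelfAdjoint.star_mul_self S
  have hn : ∀ k : ℕ, ‖(star S * S) ^ (2 ^ k)‖ = ‖S‖ ^ (2 * 2 ^ k) := by
    intro k
    have := hsa.nnnorm_pow_two_pow k
    have h' : ‖(star S * S) ^ (2 ^ k)‖ = ‖star S * S‖ ^ (2 ^ k) := by
      simpa only [NNReal.coe_pow, coe_nnnorm] using congrArg NNReal.toReal this
    rw [h', CStarRing.norm_star_mul_self, pow_mul, pow_two]
  by_contra hlt
  push Not at hlt
  have hq : 1 < ‖S‖ / A := by rwa [one_lt_div hA0]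
  have hbd : ∀ k : ℕ, (‖S‖ / A) ^ (2 * 2 ^ k) ≤ N * B / A := by
    intro k
    rw [div_pow, ← hn k, div_le_div_iff₀ (by positivity) hA0]
    have := key (2 ^ k - 1)
    rw [Nat.sub_add_cancel Nat.one_le_two_pow] at this
    calc _ ≤ N * B * A ^ (2 * (2 ^ k - 1) + 1) * A := mul_le_mul_of_nonneg_right this hA0.le
      _ = N * B * A ^ (2 * (2 ^ k - 1) + 1 + 1) := by ring
      _ = _ := by
        congr 2
        have : 1 ≤ 2 ^ k := Nat.one_le_two_pow
        omega
  obtain ⟨m, hm⟩ := pow_unbounded_of_one_lt (N * B / A) hq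
  have h3 : (‖S‖ / A) ^ m ≤ (‖S‖ / A) ^ (2 * 2 ^ m) :=
    pow_le_pow_right₀ hq.le (by have := @Nat.lt_two_pow_self m; omega)
  linarith [hbd m]

end CotlarStein
end

noncomputable section

open scoped ENNReal

lemma schur_lintegral {X : Type*} [MeasurableSpace X] {μ : Measure X} [SFinite μ]
    (k : X → X → ℝ≥0∞) (hk : Measurable (Function.uncurry k)) (C : ℝ≥0∞)
    (hA : ∀ x, ∫⁻ y, k x y ∂μ ≤ C) (hB : ∀ y, ∫⁻ x, k x y ∂μ ≤ C) (p : ℝ) (hp : 1 < p)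
    (F : X → ℝ≥0∞) (hF : AEMeasurable F μ) :
    ∫⁻ x, (∫⁻ y, k x y * F y ∂μ) ^ p ∂μ ≤ C ^ p * ∫⁻ y, F y ^ p ∂μ := by
  obtain ⟨F', hF', hFF⟩ := hF
  have e1 : ∀ x, ∫⁻ y, k x y * F y ∂μ = ∫⁻ y, k x y * F' y ∂μ := fun x =>
    lintegral_congr_ae (hFF.mono fun y hy => by simp [hy])
  have e2 : ∫⁻ y, F y ^ p ∂μ = ∫⁻ y, F' y ^ p ∂μ :=
    lintegral_congr_ae (hFF.mono fun y hy => by simp [hy])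
  simp only [e1, e2]
  have hp0 : 0 < p := by linarith
  set q := Real.conjExponent p with hq
  have hpq : p.HolderConjugate q := Real.HolderConjugate.conjExponent hp
  have hq0 : 0 < q := hpq.symm.pos
  have hkx : ∀ x, Measurable (k x) := fun x => hk.comp measurable_prodMk_left
  have step : ∀ x, (∫⁻ y, k x y * F' y ∂μ) ^ p ≤ C ^ (p / q) * ∫⁻ y, k x y * F' y ^ p ∂μ := by
    intro x
    have h := ENNReal.lintegral_mul_le_Lp_mul_Lq μ hpq.symm
      (f := fun y => k x y ^ (1 / q)) (g := fun y => k x y ^ (1 / p) * F' y)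
      ((hkx x).pow_const _).aemeasurable (((hkx x).pow_const _).mul hF').aemeasurable
    have e3 : ∫⁻ y, ((fun y => k x y ^ (1 / q)) * (fun y => k x y ^ (1 / p) * F' y)) y ∂μ
        = ∫⁻ y, k x y * F' y ∂μ := by
      refine lintegral_congr fun y => ?_
      simp only [Pi.mul_apply]
      rw [← mul_assoc, ← ENNReal.rpow_add_of_nonneg _ _ (by positivity) (by positivity)]
      have : 1 / q + 1 / p = 1 := by
        have := hpq.inv_add_inv_eq_one; simp only [one_div]; linarith
      rw [this, ENNReal.rpow_one]
    rw [e3] at h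
    have e4 : ∫⁻ y, (k x y ^ (1 / q)) ^ q ∂μ = ∫⁻ y, k x y ∂μ := by
      refine lintegral_congr fun y => ?_
      rw [← ENNReal.rpow_mul, one_div, inv_mul_cancel₀ hq0.ne', ENNReal.rpow_one]
    have e5 : ∫⁻ y, (k x y ^ (1 / p) * F' y) ^ p ∂μ = ∫⁻ y, k x y * F' y ^ p ∂μ := by
      refine lintegral_congr fun y => ?_
      rw [ENNReal.mul_rpow_of_nonneg _ _ hp0.le, ← ENNReal.rpow_mul, one_div,
        inv_mul_cancel₀ hp0.ne', ENNReal.rpow_one]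
    rw [e4, e5] at h
    calc (∫⁻ y, k x y * F' y ∂μ) ^ p
        ≤ ((∫⁻ y, k x y ∂μ) ^ (1 / q) * (∫⁻ y, k x y * F' y ^ p ∂μ) ^ (1 / p)) ^ p :=
          ENNReal.rpow_le_rpow h hp0.le
      _ = (∫⁻ y, k x y ∂μ) ^ (p / q) * ∫⁻ y, k x y * F' y ^ p ∂μ := by
          rw [ENNReal.mul_rpow_of_nonneg _ _ hp0.le, ← ENNReal.rpow_mul, ← ENNReal.rpow_mul]
          rw [one_div_mul_cancel hp0.ne', ENNReal.rpow_one]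
          congr 2; ring
      _ ≤ _ := by
          gcongr
          exact hA x
  calc _ ≤ ∫⁻ x, C ^ (p / q) * ∫⁻ y, k x y * F' y ^ p ∂μ ∂μ := lintegral_mono step
    _ = C ^ (p / q) * ∫⁻ x, ∫⁻ y, k x y * F' y ^ p ∂μ ∂μ := by
        rw [lintegral_const_mul]
        refine Measurable.lintegral_prod_right' (f := fun z : X × X => k z.1 z.2 * F' z.2 ^ p) ?_
        exact hk.mul ((hF'.comp measurable_snd).pow_const _)
    _ = C ^ (p / q) * ∫⁻ y, ∫⁻ x, k x y * F' y ^ p ∂μ ∂μ := by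
        rw [lintegral_lintegral_swap]
        exact (hk.mul ((hF'.comp measurable_snd).pow_const _)).aemeasurable
    _ ≤ C ^ (p / q) * ∫⁻ y, C * F' y ^ p ∂μ := by
        gcongr with y
        have hky : Measurable fun x => k x y := hk.comp measurable_prodMk_right
        rw [lintegral_mul_const _ hky]
        gcongr
        exact hB y
    _ = C ^ (p / q) * C * ∫⁻ y, F' y ^ p ∂μ := by
        rw [lintegral_const_mul _ (hF'.pow_const _), mul_assoc]
    _ = _ := by
        congr 1
        have : p = p / q + 1 := by
          have := hpq.sub_one_mul_conj; field_simp; linarith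
        conv_rhs => rw [this, ENNReal.rpow_add_of_nonneg _ _ (by positivity) zero_le_one,
          ENNReal.rpow_one]

lemma schur_eLpNorm {X : Type*} [MeasurableSpace X] {μ : Measure X} [SFinite μ]
    (K : X → X → ℂ) (k : X → X → ℝ≥0∞) (hk : Measurable (Function.uncurry k))
    (hK : ∀ x y, ‖K x y‖ₑ ≤ k x y) (C : ℝ≥0∞)
    (hA : ∀ x, ∫⁻ y, k x y ∂μ ≤ C) (hB : ∀ y, ∫⁻ x, k x y ∂μ ≤ C) (p : ℝ) (hp : 1 < p)
    (f : X → ℂ) (hf : AEStronglyMeasurable f μ) :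
    eLpNorm (fun x => ∫ y, K x y * f y ∂μ) (ENNReal.ofReal p) μ ≤
      C * eLpNorm f (ENNReal.ofReal p) μ := by
  have hp0 : 0 < p := by linarith
  have h0 : ENNReal.ofReal p ≠ 0 := by simpa using hp0
  rw [eLpNorm_eq_lintegral_rpow_enorm_toReal h0 ENNReal.ofReal_ne_top,
    eLpNorm_eq_lintegral_rpow_enorm_toReal h0 ENNReal.ofReal_ne_top, ENNReal.toReal_ofReal hp0.le]
  have h1 : ∫⁻ x, ‖∫ y, K x y * f y ∂μ‖ₑ ^ p ∂μ ≤ C ^ p * ∫⁻ y, ‖f y‖ₑ ^ p ∂μ := by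
    refine le_trans (lintegral_mono fun x => ?_)
      (schur_lintegral k hk C hA hB p hp (fun y => ‖f y‖ₑ) hf.enorm)
    refine ENNReal.rpow_le_rpow ((enorm_integral_le_lintegral_enorm _).trans ?_) hp0.le
    refine lintegral_mono fun y => ?_
    rw [enorm_mul]
    gcongr
    exact hK x y
  calc _ ≤ (C ^ p * ∫⁻ y, ‖f y‖ₑ ^ p ∂μ) ^ (1 / p) := ENNReal.rpow_le_rpow h1 (by positivity)
    _ = _ := by
      rw [ENNReal.mul_rpow_of_nonneg _ _ (by positivity), ← ENNReal.rpow_mul,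
        mul_one_div_cancel hp0.ne', ENNReal.rpow_one]

/-- bounded measurable kernels -/
structure BKer (X : Type*) [MeasurableSpace X] where
  k : X → X → ℂ
  meas : Measurable (Function.uncurry k)
  B : ℝ
  bd : ∀ x y, ‖k x y‖ ≤ B

namespace BKer
set_option linter.unusedSectionVars false
variable {X : Type*} [MeasurableSpace X] (μ : Measure X) [IsFiniteMeasure μ]

lemma sm (K : BKer X) (f : X → ℂ) (hf : StronglyMeasurable f) :
    StronglyMeasurable (fun x => ∫ y, K.k x y * f y ∂μ) := by
  refine StronglyMeasurable.integral_prod_right (f := fun x y => K.k x y * f y) ?_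
  exact K.meas.stronglyMeasurable.mul (hf.comp_measurable measurable_snd)

lemma integ (K : BKer X) (f : X → ℂ) (hf : Integrable f μ) (x : X) :
    Integrable (fun y => K.k x y * f y) μ := by
  refine hf.bdd_mul (c := K.B) ?_ (Filter.Eventually.of_forall fun y => K.bd x y)
  exact (K.meas.comp measurable_prodMk_left).aestronglyMeasurable

lemma bound2 (K : BKer X) (f : X → ℂ) (hf : AEStronglyMeasurable f μ) (C : ℝ)
    (hA : ∀ x, ∫⁻ y, ‖K.k x y‖ₑ ∂μ ≤ ENNReal.ofReal C)
    (hB : ∀ y, ∫⁻ x, ‖K.k x y‖ₑ ∂μ ≤ ENNReal.ofReal C) :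
    eLpNorm (fun x => ∫ y, K.k x y * f y ∂μ) 2 μ ≤ ENNReal.ofReal C * eLpNorm f 2 μ := by
  have := schur_eLpNorm (μ := μ) K.k (fun x y => ‖K.k x y‖ₑ) K.meas.enorm (fun x y => le_rfl)
    (ENNReal.ofReal C) hA hB 2 (by norm_num) f hf
  simpa using this

lemma triv (K : BKer X) : (∀ x, ∫⁻ y, ‖K.k x y‖ₑ ∂μ ≤ ENNReal.ofReal (K.B * μ.real Set.univ)) ∧
    (∀ y, ∫⁻ x, ‖K.k x y‖ₑ ∂μ ≤ ENNReal.ofReal (K.B * μ.real Set.univ)) := by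
  have h : ∀ x y, ‖K.k x y‖ₑ ≤ ENNReal.ofReal K.B := fun x y => by
    rw [← ofReal_norm]; exact ENNReal.ofReal_le_ofReal (K.bd x y)
  have e : ENNReal.ofReal (K.B * μ.real Set.univ) = ENNReal.ofReal K.B * μ Set.univ := by
    rw [ENNReal.ofReal_mul' measureReal_nonneg]; simp [measureReal_def]
  rw [e]
  constructor
  · intro x
    refine (lintegral_mono fun y => h x y).trans ?_
    simp
  · intro y
    refine (lintegral_mono fun x => h x y).trans ?_
    simp

lemma memLp (K : BKer X) (f : Lp ℂ 2 μ) : MemLp (fun x => ∫ y, K.k x y * f y ∂μ) 2 μ :=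
  ⟨(sm μ K f (Lp.stronglyMeasurable f)).aestronglyMeasurable,
    lt_of_le_of_lt (bound2 μ K f (Lp.aestronglyMeasurable f) _ (triv μ K).1 (triv μ K).2)
      (ENNReal.mul_lt_top ENNReal.ofReal_lt_top (Lp.memLp f).2)⟩

lemma integrable_Lp (f : Lp ℂ 2 μ) : Integrable f μ :=
  (Lp.memLp f).integrable (by norm_num)

/-- the operator on `L²` -/
def op (K : BKer X) : Lp ℂ 2 μ →L[ℂ] Lp ℂ 2 μ :=
  LinearMap.mkContinuous
    { toFun := fun f => (memLp μ K f).toLp _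
      map_add' := by
        intro f g
        rw [← MemLp.toLp_add]
        rw [MemLp.toLp_eq_toLp_iff]
        refine Filter.Eventually.of_forall fun x => ?_
        simp only [Pi.add_apply]
        rw [← integral_add (integ μ K f (integrable_Lp μ f) x) (integ μ K g (integrable_Lp μ g) x)]
        refine integral_congr_ae ?_
        filter_upwards [Lp.coeFn_add f g] with y hy
        rw [hy, Pi.add_apply, mul_add]
      map_smul' := by
        intro c f
        rw [RingHom.id_apply, ← MemLp.toLp_const_smul]
        rw [MemLp.toLp_eq_toLp_iff]
        refine Filter.Eventually.of_forall fun x => ?_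
        simp only [Pi.smul_apply, smul_eq_mul]
        rw [← integral_const_mul]
        refine integral_congr_ae ?_
        filter_upwards [Lp.coeFn_smul c f] with y hy
        rw [hy, Pi.smul_apply, smul_eq_mul]; ring }
    (|K.B| * μ.real Set.univ) (by
      intro f
      simp only [LinearMap.coe_mk, AddHom.coe_mk]
      rw [Lp.norm_toLp, Lp.norm_def]
      have h := bound2 μ K f (Lp.aestronglyMeasurable f) _ (triv μ K).1 (triv μ K).2
      have h2 := ENNReal.toReal_mono (ENNReal.mul_ne_top ENNReal.ofReal_ne_top (Lp.memLp f).2.ne) h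
      refine h2.trans ?_
      rw [ENNReal.toReal_mul]
      gcongr
      rw [ENNReal.toReal_ofReal']
      refine max_le ?_ (by positivity)
      gcongr
      exact le_abs_self _)

lemma op_coe (K : BKer X) (f : Lp ℂ 2 μ) :
    (op μ K f : X → ℂ) =ᵐ[μ] fun x => ∫ y, K.k x y * f y ∂μ := (memLp μ K f).coeFn_toLp

lemma op_norm_le (K : BKer X) (C : ℝ) (hC : 0 ≤ C)
    (hA : ∀ x, ∫⁻ y, ‖K.k x y‖ₑ ∂μ ≤ ENNReal.ofReal C)
    (hB : ∀ y, ∫⁻ x, ‖K.k x y‖ₑ ∂μ ≤ ENNReal.ofReal C) : ‖op μ K‖ ≤ C := by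
  refine ContinuousLinearMap.opNorm_le_bound _ hC fun f => ?_
  have h := bound2 μ K f (Lp.aestronglyMeasurable f) _ hA hB
  rw [Lp.norm_def, Lp.norm_def, eLpNorm_congr_ae (op_coe μ K f)]
  have h2 := ENNReal.toReal_mono (ENNReal.mul_ne_top ENNReal.ofReal_ne_top (Lp.memLp f).2.ne) h
  rwa [ENNReal.toReal_mul, ENNReal.toReal_ofReal hC] at h2

/-- adjoint kernel -/
def adj (K : BKer X) : BKer X where
  k := fun x y => (starRingEnd ℂ) (K.k y x)
  meas := by
    have h : Measurable fun z : X × X => K.k z.2 z.1 := K.meas.comp measurable_swap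
    exact continuous_conj.measurable.comp h
  B := K.B
  bd := fun x y => by simpa using K.bd y x

/-- composed kernel -/
def comp (K L : BKer X) : BKer X where
  k := fun x y => ∫ t, K.k x t * L.k t y ∂μ
  meas := by
    refine StronglyMeasurable.measurable ?_
    refine StronglyMeasurable.integral_prod_right
      (f := fun (z : X × X) (t : X) => K.k z.1 t * L.k t z.2) ?_
    refine Measurable.stronglyMeasurable ?_
    refine Measurable.mul ?_ ?_
    · exact K.meas.comp ((measurable_fst.comp measurable_fst).prodMk measurable_snd)
    · exact L.meas.comp (measurable_snd.prodMk (measurable_snd.comp measurable_fst))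
  B := |K.B| * |L.B| * μ.real Set.univ
  bd := fun x y => by
    refine norm_integral_le_of_norm_le_const (Filter.Eventually.of_forall fun t => ?_)
    rw [norm_mul]
    exact mul_le_mul ((K.bd x t).trans (le_abs_self _)) ((L.bd t y).trans (le_abs_self _))
      (norm_nonneg _) (abs_nonneg _)

lemma prod_integrable (K : BKer X) (f h : X → ℂ) (hf : Integrable f μ) (hh : Integrable h μ) :
    Integrable (fun z : X × X => K.k z.1 z.2 * (f z.1 * h z.2)) (μ.prod μ) := by
  refine (hf.mul_prod hh).bdd_mul (c := K.B) ?_ (Filter.Eventually.of_forall fun z => K.bd _ _)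
  exact K.meas.aestronglyMeasurable

lemma op_star (K : BKer X) : star (op μ K) = op μ (adj K) := by
  symm
  rw [ContinuousLinearMap.star_eq_adjoint, ContinuousLinearMap.eq_adjoint_iff]
  intro f h
  rw [L2.inner_def, L2.inner_def]
  have hf := integrable_Lp μ f
  have hh := integrable_Lp μ h
  have hcf : Integrable (fun x => (starRingEnd ℂ) (f x)) μ := by
    simpa using (LinearIsometryEquiv.integrable_comp_iff (μ := μ) conjLIE (φ := f)).2 hf
  have e1 : ∫ x, inner ℂ ((op μ (adj K) f) x) (h x) ∂μ
      = ∫ x, ∫ y, K.k y x * ((starRingEnd ℂ) (f y) * h x) ∂μ ∂μ := by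
    refine integral_congr_ae ?_
    filter_upwards [op_coe μ (adj K) f] with x hx
    rw [hx, RCLike.inner_apply, ← integral_conj, ← integral_const_mul]
    refine integral_congr_ae (Filter.Eventually.of_forall fun y => ?_)
    simp only [adj, map_mul, Complex.conj_conj]; ring
  have e2 : ∫ x, inner ℂ (f x) ((op μ K h) x) ∂μ
      = ∫ y, ∫ x, K.k y x * ((starRingEnd ℂ) (f y) * h x) ∂μ ∂μ := by
    refine integral_congr_ae ?_
    filter_upwards [op_coe μ K h] with x hx
    rw [hx, RCLike.inner_apply, ← integral_mul_const]
    refine integral_congr_ae (Filter.Eventually.of_forall fun y => ?_)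
    simp only []; ring
  rw [e1, e2]
  exact (integral_integral_swap (prod_integrable μ K _ _ hcf hh)).symm

lemma op_mul (K L : BKer X) : op μ K * op μ L = op μ (comp μ K L) := by
  ext1 f
  rw [mul_apply_eq_comp]
  have hf := integrable_Lp μ f
  refine Lp.ext ?_
  filter_upwards [op_coe μ K (op μ L f), op_coe μ (comp μ K L) f] with x hx hx'
  rw [hx, hx']
  have e1 : ∫ y, K.k x y * (op μ L f) y ∂μ = ∫ y, ∫ t, L.k y t * (K.k x y * f t) ∂μ ∂μ := by
    refine integral_congr_ae ?_
    filter_upwards [op_coe μ L f] with y hy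
    rw [hy, ← integral_const_mul]
    refine integral_congr_ae (Filter.Eventually.of_forall fun t => ?_)
    simp only []; ring
  have hK : Integrable (fun y => K.k x y) μ := by
    simpa using integ μ K (fun _ => 1) (integrable_const _) x
  rw [e1, integral_integral_swap (prod_integrable μ L _ _ hK hf)]
  refine integral_congr_ae (Filter.Eventually.of_forall fun t => ?_)
  simp only [comp]
  rw [← integral_mul_const]
  refine integral_congr_ae (Filter.Eventually.of_forall fun y => ?_)
  simp only []; ring

lemma coe_sum (N : ℕ) (F : ℕ → Lp ℂ 2 μ) :
    ((∑ j ∈ Finset.range N, F j : Lp ℂ 2 μ) : X → ℂ) =ᵐ[μ]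
      fun x => ∑ j ∈ Finset.range N, (F j : X → ℂ) x := by
  induction N with
  | zero =>
    simp only [Finset.range_zero, Finset.sum_empty]
    exact Lp.coeFn_zero ℂ 2 μ
  | succ N ih =>
    rw [Finset.sum_range_succ]
    filter_upwards [Lp.coeFn_add (∑ j ∈ Finset.range N, F j) (F N), ih] with x hx hx'
    rw [hx, Pi.add_apply, hx', Finset.sum_range_succ]

/-- sum of operators applied to an `L²` function -/
lemma sum_bound (K : ℕ → BKer X) (N : ℕ) (A : ℝ) (hA : 0 ≤ A)
    (h : ‖∑ j ∈ Finset.range N, op μ (K j)‖ ≤ A) (f : X → ℂ) (hf : MemLp f 2 μ) :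
    eLpNorm (fun x => ∫ y, (∑ j ∈ Finset.range N, (K j).k x y) * f y ∂μ) 2 μ
      ≤ ENNReal.ofReal A * eLpNorm f 2 μ := by
  set F := hf.toLp f
  have hF : (F : X → ℂ) =ᵐ[μ] f := hf.coeFn_toLp
  have h1 : ‖(∑ j ∈ Finset.range N, op μ (K j)) F‖ ≤ A * ‖F‖ :=
    (ContinuousLinearMap.le_opNorm _ _).trans (by gcongr)
  have h2 : ((∑ j ∈ Finset.range N, op μ (K j)) F : X → ℂ) =ᵐ[μ]
      fun x => ∫ y, (∑ j ∈ Finset.range N, (K j).k x y) * f y ∂μ := by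
    rw [sum_apply]
    have h3 : ∀ᵐ x ∂μ, ∀ j, (op μ (K j) F : X → ℂ) x = ∫ y, (K j).k x y * F y ∂μ :=
      ae_all_iff.2 fun j => op_coe μ (K j) F
    filter_upwards [coe_sum μ N (fun j => op μ (K j) F), h3] with x hx hx'
    rw [hx]
    rw [Finset.sum_congr rfl fun j _ => hx' j,
      ← integral_finsetSum _ fun j _ => integ μ (K j) F (integrable_Lp μ F) x]
    refine integral_congr_ae ?_
    filter_upwards [hF] with y hy
    rw [hy, Finset.sum_mul]
  rw [← eLpNorm_congr_ae h2, ← eLpNorm_congr_ae hF]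
  rw [Lp.norm_def, Lp.norm_def] at h1
  rw [← ENNReal.ofReal_toReal (Lp.memLp ((∑ j ∈ Finset.range N, op μ (K j)) F)).2.ne,
    ← ENNReal.ofReal_toReal (Lp.memLp F).2.ne, ← ENNReal.ofReal_mul hA]
  exact ENNReal.ofReal_le_ofReal h1

end BKer
end

noncomputable section
open scoped ENNReal

/-- the basic tail estimate -/
lemma tail_estimate {X : Type*} [MeasurableSpace X] {μ : Measure X} (Q : ℕ) (C : ℝ) (hC : 0 ≤ C)
    (d : X → ℝ) (hd : Measurable d) (hd0 : ∀ x, 0 ≤ d x)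
    (hV : ∀ r : ℝ, 0 < r → μ {x | d x < r} ≤ ENNReal.ofReal (C * r ^ Q)) (r : ℝ) (hr : 0 < r) :
    ∫⁻ x, ENNReal.ofReal (r * ((r + d x) ^ (Q+1))⁻¹) ∂μ ≤ ENNReal.ofReal (C * 2 ^ (Q+2)) := by
  set a : ℕ → ℝ := fun k => (r ^ Q)⁻¹ * 2 ^ (Q+1) * ((2 ^ k) ^ (Q+1))⁻¹ with ha
  have ha0 : ∀ k, 0 ≤ a k := fun k => by positivity
  have hms : ∀ k : ℕ, MeasurableSet {x | d x < 2 ^ k * r} := fun k =>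
    measurableSet_lt hd measurable_const
  have pt : ∀ x, ENNReal.ofReal (r * ((r + d x) ^ (Q+1))⁻¹) ≤
      ∑' k : ℕ, ({x | d x < 2 ^ k * r} : Set X).indicator (fun _ => ENNReal.ofReal (a k)) x := by
    intro x
    have hex : ∃ k : ℕ, d x < 2 ^ k * r := by
      obtain ⟨k, hk⟩ := pow_unbounded_of_one_lt (d x / r) (one_lt_two)
      exact ⟨k, by rwa [div_lt_iff₀ hr] at hk⟩
    classical
    set k := Nat.find hex with hk
    have hk1 : d x < 2 ^ k * r := Nat.find_spec hex
    refine le_trans ?_ (ENNReal.le_tsum k)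
    rw [Set.indicator_of_mem (show x ∈ {x | d x < 2 ^ k * r} from hk1)]
    refine ENNReal.ofReal_le_ofReal ?_
    have hlow : 2 ^ k * r / 2 ≤ r + d x := by
      rcases Nat.eq_zero_or_pos k with h0 | h0
      · rw [h0]; have := hd0 x; linarith
      · have := Nat.find_min hex (m := k - 1) (by omega)
        push Not at this
        have e : (2:ℝ) ^ k = 2 ^ (k-1) * 2 := by
          rw [← pow_succ]; congr 1; omega
        rw [e]; linarith
    have h1 : (2 ^ k * r / 2) ^ (Q+1) ≤ (r + d x) ^ (Q+1) := pow_le_pow_left₀ (by positivity) hlow _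
    calc r * ((r + d x) ^ (Q+1))⁻¹ ≤ r * ((2 ^ k * r / 2) ^ (Q+1))⁻¹ := by gcongr
      _ = a k := by
        simp only [ha]; rw [div_pow, mul_pow, pow_succ r Q]; field_simp
  calc _ ≤ ∫⁻ x, ∑' k : ℕ, ({x | d x < 2 ^ k * r} : Set X).indicator
            (fun _ => ENNReal.ofReal (a k)) x ∂μ := lintegral_mono pt
    _ = ∑' k : ℕ, ENNReal.ofReal (a k) * μ {x | d x < 2 ^ k * r} := by
        rw [lintegral_tsum fun k => (measurable_const.indicator (hms k)).aemeasurable]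
        refine tsum_congr fun k => ?_
        rw [lintegral_indicator_const (hms k)]
    _ ≤ ∑' k : ℕ, ENNReal.ofReal (C * 2 ^ (Q+1) * (1/2) ^ k) := by
        refine ENNReal.tsum_le_tsum fun k => ?_
        refine (mul_le_mul_right (hV _ (by positivity)) _).trans ?_
        rw [← ENNReal.ofReal_mul (ha0 k)]
        refine ENNReal.ofReal_le_ofReal (le_of_eq ?_)
        simp only [ha]
        rw [mul_pow, pow_succ ((2:ℝ)^k) Q, one_div, inv_pow]; field_simp
    _ = _ := by
        rw [← ENNReal.ofReal_tsum_of_nonneg (fun k => by positivity)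
          (summable_geometric_two.mul_left _), tsum_mul_left, tsum_geometric_two]
        congr 1; ring

def kL (n : ℕ) (l : ℝ) (z : ℂ) : ℂ := (l:ℂ) ^ 2 * (((l:ℂ) + z) ^ (n+2))⁻¹
def mL (n : ℕ) (l : ℝ) (z : ℂ) : ℝ := l * ((l + ‖z‖) ^ (n+1))⁻¹
def kap (n : ℕ) (l : ℝ) (z : ℂ) : ℂ :=
  (((l:ℂ) + z) ^ n)⁻¹ + n * l * (((l:ℂ) + z) ^ (n+1))⁻¹

lemma mL_nonneg (n : ℕ) (l : ℝ) (hl : 0 < l) (z : ℂ) : 0 ≤ mL n l z := by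
  unfold mL; positivity

lemma norm_inv_pow_le (c l : ℝ) (hc : 0 < c) (hl : 0 < l) (z : ℂ) (m : ℕ)
    (h : c * (l + ‖z‖) ≤ ‖(l:ℂ) + z‖) :
    ‖(((l:ℂ) + z) ^ m)⁻¹‖ ≤ (c ^ m)⁻¹ * ((l + ‖z‖) ^ m)⁻¹ := by
  rw [norm_inv, norm_pow, ← mul_inv, ← mul_pow]
  have : 0 ≤ ‖z‖ := norm_nonneg z
  gcongr

lemma norm_kL_le (n : ℕ) (c l : ℝ) (hc : 0 < c) (hl : 0 < l) (z : ℂ)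
    (h : c * (l + ‖z‖) ≤ ‖(l:ℂ) + z‖) : ‖kL n l z‖ ≤ (c ^ (n+2))⁻¹ * mL n l z := by
  have h1 := norm_inv_pow_le c l hc hl z (n+2) h
  have hz : 0 ≤ ‖z‖ := norm_nonneg z
  unfold kL mL
  rw [norm_mul, norm_pow, Complex.norm_real, Real.norm_of_nonneg hl.le]
  calc l ^ 2 * ‖(((l:ℂ) + z) ^ (n+2))⁻¹‖ ≤ l ^ 2 * ((c ^ (n+2))⁻¹ * ((l + ‖z‖) ^ (n+2))⁻¹) := by
        gcongr
    _ = (c ^ (n+2))⁻¹ * (l * ((l + ‖z‖) ^ (n+1))⁻¹) * (l / (l + ‖z‖)) := by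
        rw [pow_succ (l + ‖z‖) (n+1)]; field_simp
    _ ≤ (c ^ (n+2))⁻¹ * (l * ((l + ‖z‖) ^ (n+1))⁻¹) * 1 := by
        gcongr
        rw [div_le_one (by positivity)]; linarith
    _ = _ := by ring

lemma mL_le (n : ℕ) (l : ℝ) (hl : 0 < l) (z : ℂ) : mL n l z ≤ (l ^ n)⁻¹ := by
  unfold mL
  have hz : 0 ≤ ‖z‖ := norm_nonneg z
  calc l * ((l + ‖z‖) ^ (n+1))⁻¹ ≤ l * (l ^ (n+1))⁻¹ := by gcongr; linarith
    _ = _ := by rw [pow_succ]; field_simp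

lemma norm_kap_le (n : ℕ) (c l : ℝ) (hc : 0 < c) (hc1 : c ≤ 1) (hl : 0 < l) (z : ℂ)
    (h : c * (l + ‖z‖) ≤ ‖(l:ℂ) + z‖) :
    ‖kap n l z‖ ≤ (n+1) * (c ^ (n+1))⁻¹ * ((l + ‖z‖) ^ n)⁻¹ := by
  have h1 := norm_inv_pow_le c l hc hl z n h
  have h2 := norm_inv_pow_le c l hc hl z (n+1) h
  have hz : 0 ≤ ‖z‖ := norm_nonneg z
  unfold kap
  refine (norm_add_le _ _).trans ?_
  have e1 : (c ^ n)⁻¹ ≤ (c ^ (n+1))⁻¹ := by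
    gcongr ?_⁻¹
    exact pow_le_pow_of_le_one hc.le hc1 (by omega)
  have e2 : ‖(n:ℂ) * l * (((l:ℂ) + z) ^ (n+1))⁻¹‖ ≤ n * ((c ^ (n+1))⁻¹ * ((l + ‖z‖) ^ n)⁻¹) := by
    rw [norm_mul, norm_mul, Complex.norm_real, Real.norm_of_nonneg hl.le, Complex.norm_natCast]
    calc n * l * ‖(((l:ℂ) + z) ^ (n+1))⁻¹‖
        ≤ n * l * ((c ^ (n+1))⁻¹ * ((l + ‖z‖) ^ (n+1))⁻¹) := by gcongr
      _ = n * ((c ^ (n+1))⁻¹ * ((l + ‖z‖) ^ n)⁻¹) * (l / (l + ‖z‖)) := by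
        rw [pow_succ (l + ‖z‖) n]; field_simp
      _ ≤ n * ((c ^ (n+1))⁻¹ * ((l + ‖z‖) ^ n)⁻¹) * 1 := by
        gcongr
        rw [div_le_one (by positivity)]; linarith
      _ = _ := by ring
  have e3 : ‖(((l:ℂ) + z) ^ n)⁻¹‖ ≤ (c ^ (n+1))⁻¹ * ((l + ‖z‖) ^ n)⁻¹ :=
    h1.trans (by gcongr)
  calc _ ≤ (c ^ (n+1))⁻¹ * ((l + ‖z‖) ^ n)⁻¹ + n * ((c ^ (n+1))⁻¹ * ((l + ‖z‖) ^ n)⁻¹) :=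
        add_le_add e3 e2
    _ = _ := by ring

lemma hasDerivAt_kap (n : ℕ) (z : ℂ) (l : ℝ) (h : (l:ℂ) + z ≠ 0) :
    HasDerivAt (fun l : ℝ => kap n l z) (-(n * (n+1) * l * (((l:ℂ) + z) ^ (n+2))⁻¹)) l := by
  have hl : HasDerivAt (fun l : ℝ => (l:ℂ)) 1 l := Complex.ofRealCLM.hasDerivAt (x := l)
  have h0 : HasDerivAt (fun l : ℝ => (l:ℂ) + z) 1 l := hl.add_const z
  have h1 := (h0.fun_pow n).fun_inv (pow_ne_zero n h)
  have h2 := (h0.fun_pow (n+1)).fun_inv (pow_ne_zero (n+1) h)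
  have h3 := h1.fun_add ((hl.const_mul (n:ℂ)).fun_mul h2)
  unfold kap
  refine h3.congr_deriv ?_
  rcases n with _ | n
  · simp
  · simp only [Nat.add_sub_cancel]
    push_cast
    field_simp
    ring

end

noncomputable section
open scoped ENNReal

lemma geom_dist_sum (r : ℝ) (hr0 : 0 ≤ r) (hr1 : r < 1) (i N : ℕ) :
    ∑ j ∈ Finset.range N, r ^ ((i - j) + (j - i)) ≤ 2 * (1 - r)⁻¹ := by
  have hs : Summable fun k : ℕ => r ^ k := summable_geometric_of_lt_one hr0 hr1
  have key : ∀ (s : Finset ℕ) (f : ℕ → ℕ), Set.InjOn f s → ∑ j ∈ s, r ^ (f j) ≤ (1 - r)⁻¹ := by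
    intro s f hf
    rw [← tsum_geometric_of_lt_one hr0 hr1, ← Finset.sum_image (f := fun k => r ^ k) hf]
    exact hs.sum_le_tsum _ fun k _ => pow_nonneg hr0 k
  rw [← Finset.sum_filter_add_sum_filter_not _ (fun j => j ≤ i), two_mul]
  refine add_le_add (key _ _ ?_) (key _ _ ?_)
  · intro a ha b hb hab
    simp at ha hb hab; omega
  · intro a ha b hb hab
    simp at ha hb hab; omega

section L2
set_option linter.unusedSectionVars false
set_option linter.unusedVariables false
variable {X : Type*} [MeasurableSpace X]

lemma measurable_kL (n : ℕ) (l : ℝ) : Measurable (kL n l) := by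
  unfold kL; fun_prop
lemma measurable_mL (n : ℕ) (l : ℝ) : Measurable (mL n l) := by
  unfold mL; fun_prop
lemma measurable_kap (n : ℕ) (l : ℝ) : Measurable (kap n l) := by
  unfold kap; fun_prop

/-- the pieces as bounded kernels -/
def pieceK (n : ℕ) (G : X → X → ℂ) (hG : Measurable (Function.uncurry G)) (c : ℝ) (hc : 0 < c)
    (sec : ∀ x y, ∀ l : ℝ, 0 < l → c * (l + ‖G x y‖) ≤ ‖(l:ℂ) + G x y‖) (l : ℝ) (hl : 0 < l) :
    BKer X where
  k := fun x y => kL n l (G x y)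
  meas := (measurable_kL n l).comp hG
  B := (c ^ (n+2))⁻¹ * (l ^ n)⁻¹
  bd := fun x y => (norm_kL_le n c l hc hl _ (sec x y l hl)).trans (by
    gcongr; exact mL_le n l hl _)

variable (μ : Measure X) [IsFiniteMeasure μ]

lemma mL_int (n : ℕ) (C : ℝ) (hC : 0 ≤ C) (d : X → ℂ) (hd : Measurable d)
    (hV : ∀ r : ℝ, 0 < r → μ {x | ‖d x‖ < r} ≤ ENNReal.ofReal (C * r ^ n)) (l : ℝ) (hl : 0 < l) :
    ∫⁻ x, ENNReal.ofReal (mL n l (d x)) ∂μ ≤ ENNReal.ofReal (C * 2 ^ (n+2)) :=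
  tail_estimate n C hC (fun x => ‖d x‖) hd.norm (fun x => norm_nonneg _) hV l hl

lemma double_int (M M' : X → X → ℝ≥0∞) (hM : Measurable (Function.uncurry M))
    (hM' : Measurable (Function.uncurry M')) (S : ℝ≥0∞) (hA : ∀ x, ∫⁻ y, M' x y ∂μ ≤ S)
    (hB : ∀ y, ∫⁻ x, M x y ∂μ ≤ S) (y : X) :
    ∫⁻ y', ∫⁻ x, M x y * M' x y' ∂μ ∂μ ≤ S * S := by
  have hm1 : Measurable fun x => M x y := hM.comp measurable_prodMk_right
  have hm2 : ∀ x, Measurable fun y => M' x y := fun x => hM'.comp measurable_prodMk_left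
  rw [lintegral_lintegral_swap]
  · calc _ = ∫⁻ x, M x y * ∫⁻ y', M' x y' ∂μ ∂μ := by
          refine lintegral_congr fun x => ?_
          rw [lintegral_const_mul _ (hm2 x)]
      _ ≤ ∫⁻ x, M x y * S ∂μ := by
          gcongr with x; exact hA x
      _ = (∫⁻ x, M x y ∂μ) * S := by
          rw [lintegral_mul_const _ hm1]
      _ ≤ _ := by gcongr; exact hB y
  · refine Measurable.aemeasurable ?_
    exact Measurable.mul (hm1.comp measurable_snd) (hM'.comp measurable_swap)

lemma orth_aux (M M' : X → X → ℝ≥0∞) (hM : Measurable (Function.uncurry M))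
    (hM' : Measurable (Function.uncurry M')) (S : ℝ) (hS : 0 ≤ S)
    (hA : ∀ x, ∫⁻ y, M x y ∂μ ≤ ENNReal.ofReal S) (hB : ∀ y, ∫⁻ x, M x y ∂μ ≤ ENNReal.ofReal S)
    (hA' : ∀ x, ∫⁻ y, M' x y ∂μ ≤ ENNReal.ofReal S) (hB' : ∀ y, ∫⁻ x, M' x y ∂μ ≤ ENNReal.ofReal S)
    (K : BKer X) (E : ℝ) (hE : 0 ≤ E)
    (I : ∀ y y', ‖K.k y y'‖ₑ ≤ ENNReal.ofReal E * ∫⁻ x, M x y * M' x y' ∂μ) :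
    ‖BKer.op μ K‖ ≤ E * (S * S) := by
  have hEE : ENNReal.ofReal E * (ENNReal.ofReal S * ENNReal.ofReal S) = ENNReal.ofReal (E * (S * S)) := by
    rw [ENNReal.ofReal_mul hE, ENNReal.ofReal_mul hS]
  have hm : Measurable fun z : X × X => ∫⁻ x, M x z.1 * M' x z.2 ∂μ := by
    refine Measurable.lintegral_prod_right' (f := fun z : (X × X) × X => M z.2 z.1.1 * M' z.2 z.1.2) ?_
    refine Measurable.mul ?_ ?_
    · exact hM.comp (measurable_snd.prodMk (measurable_fst.comp measurable_fst))
    · exact hM'.comp (measurable_snd.prodMk (measurable_snd.comp measurable_fst))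
  refine BKer.op_norm_le μ _ _ (by positivity) ?_ ?_
  · intro y
    refine (lintegral_mono fun y' => I y y').trans ?_
    have hm' : Measurable fun y' => ∫⁻ x, M x y * M' x y' ∂μ := hm.comp (measurable_prodMk_left (x := y))
    rw [lintegral_const_mul _ hm', ← hEE]
    gcongr
    exact double_int μ M M' hM hM' _ hA' hB y
  · intro y'
    refine (lintegral_mono fun y => I y y').trans ?_
    have hm' : Measurable fun y => ∫⁻ x, M x y * M' x y' ∂μ := hm.comp (measurable_prodMk_right (y := y'))
    rw [lintegral_const_mul _ hm', ← hEE]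
    gcongr
    simp_rw [mul_comm (M _ _)]
    exact double_int μ M' M hM' hM _ hA hB' y'

lemma conj_int_aux (u v : X → ℂ) : ‖∫ x, u x * (starRingEnd ℂ) (v x) ∂μ‖ₑ =
    ‖∫ x, (starRingEnd ℂ) (u x) * v x ∂μ‖ₑ := by
  have e : ∫ x, u x * (starRingEnd ℂ) (v x) ∂μ =
      (starRingEnd ℂ) (∫ t, (starRingEnd ℂ) (u t) * v t ∂μ) := by
    rw [← integral_conj]
    refine integral_congr_ae (Filter.Eventually.of_forall fun x => ?_)
    simp
  rw [e, RCLike.enorm_conj]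

/-- almost orthogonality of the two pieces from the pointwise bound -/
lemma piece_orth (n : ℕ) (G : X → X → ℂ) (hG : Measurable (Function.uncurry G)) (c : ℝ) (hc : 0 < c)
    (sec : ∀ x y, ∀ l : ℝ, 0 < l → c * (l + ‖G x y‖) ≤ ‖(l:ℂ) + G x y‖)
    (S : ℝ) (hS : 0 ≤ S)
    (hA : ∀ l : ℝ, 0 < l → ∀ x, ∫⁻ y, ENNReal.ofReal (mL n l (G x y)) ∂μ ≤ ENNReal.ofReal S)
    (hB : ∀ l : ℝ, 0 < l → ∀ y, ∫⁻ x, ENNReal.ofReal (mL n l (G x y)) ∂μ ≤ ENNReal.ofReal S)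
    (l l' : ℝ) (hl : 0 < l) (hl' : 0 < l') (E : ℝ) (hE : 0 ≤ E)
    (I : ∀ y y', ‖∫ x, kL n l (G x y) * (starRingEnd ℂ) (kL n l' (G x y')) ∂μ‖ₑ ≤
      ENNReal.ofReal E * ∫⁻ x, ENNReal.ofReal (mL n l (G x y) * mL n l' (G x y')) ∂μ) :
    ‖star (BKer.op μ (pieceK n G hG c hc sec l hl)) * BKer.op μ (pieceK n G hG c hc sec l' hl')‖
      ≤ E * (S * S) := by
  rw [BKer.op_star, BKer.op_mul]
  have hm : ∀ l, Measurable (Function.uncurry fun x y => ENNReal.ofReal (mL n l (G x y))) := fun l =>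
    ((measurable_mL n l).comp hG).ennreal_ofReal
  refine orth_aux μ (fun x y => ENNReal.ofReal (mL n l (G x y)))
    (fun x y => ENNReal.ofReal (mL n l' (G x y))) (hm l) (hm l') S hS (hA l hl) (hB l hl)
    (hA l' hl') (hB l' hl') _ E hE ?_
  intro y y'
  have := I y y'
  rw [conj_int_aux μ (fun x => kL n l (G x y)) (fun x => kL n l' (G x y'))] at this
  simp_rw [ENNReal.ofReal_mul (mL_nonneg n l hl _)] at this
  exact this

/-- transposed version -/
lemma piece_orth' (n : ℕ) (G : X → X → ℂ) (hG : Measurable (Function.uncurry G)) (c : ℝ) (hc : 0 < c)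
    (sec : ∀ x y, ∀ l : ℝ, 0 < l → c * (l + ‖G x y‖) ≤ ‖(l:ℂ) + G x y‖)
    (S : ℝ) (hS : 0 ≤ S)
    (hA : ∀ l : ℝ, 0 < l → ∀ x, ∫⁻ y, ENNReal.ofReal (mL n l (G x y)) ∂μ ≤ ENNReal.ofReal S)
    (hB : ∀ l : ℝ, 0 < l → ∀ y, ∫⁻ x, ENNReal.ofReal (mL n l (G x y)) ∂μ ≤ ENNReal.ofReal S)
    (l l' : ℝ) (hl : 0 < l) (hl' : 0 < l') (E : ℝ) (hE : 0 ≤ E)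
    (I : ∀ x x', ‖∫ y, kL n l (G x y) * (starRingEnd ℂ) (kL n l' (G x' y)) ∂μ‖ₑ ≤
      ENNReal.ofReal E * ∫⁻ y, ENNReal.ofReal (mL n l (G x y) * mL n l' (G x' y)) ∂μ) :
    ‖BKer.op μ (pieceK n G hG c hc sec l hl) * star (BKer.op μ (pieceK n G hG c hc sec l' hl'))‖
      ≤ E * (S * S) := by
  rw [BKer.op_star, BKer.op_mul]
  have hG' : Measurable (Function.uncurry fun x y => G y x) := hG.comp measurable_swap
  have hm : ∀ l, Measurable (Function.uncurry fun x y => ENNReal.ofReal (mL n l (G y x))) := fun l =>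
    ((measurable_mL n l).comp hG').ennreal_ofReal
  refine orth_aux μ (fun x y => ENNReal.ofReal (mL n l (G y x)))
    (fun x y => ENNReal.ofReal (mL n l' (G y x))) (hm l) (hm l') S hS (hB l hl) (hA l hl)
    (hB l' hl') (hA l' hl') _ E hE ?_
  intro y y'
  have := I y y'
  simp_rw [ENNReal.ofReal_mul (mL_nonneg n l hl _)] at this
  exact this

end L2
end

noncomputable section
open scoped ENNReal
set_option linter.unusedSectionVars false
set_option linter.unusedVariables false

/-- hypotheses of the abstract `L²` theorem -/
structure L2Hyp {X : Type*} [MeasurableSpace X] (μ : Measure X) (n : ℕ) (G : X → X → ℂ)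
    (c C : ℝ) : Prop where
  hG : Measurable (Function.uncurry G)
  hc : 0 < c
  hc1 : c ≤ 1
  hC : 0 ≤ C
  sec : ∀ x y, ∀ l : ℝ, 0 < l → c * (l + ‖G x y‖) ≤ ‖(l:ℂ) + G x y‖
  V1 : ∀ x, ∀ r : ℝ, 0 < r → μ {y | ‖G x y‖ < r} ≤ ENNReal.ofReal (C * r ^ n)
  V2 : ∀ y, ∀ r : ℝ, 0 < r → μ {x | ‖G x y‖ < r} ≤ ENNReal.ofReal (C * r ^ n)
  I1 : ∀ l l' : ℝ, 0 < l → l ≤ l' → l' ≤ 1 → ∀ y y',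
    ‖∫ x, kL n l (G x y) * (starRingEnd ℂ) (kL n l' (G x y')) ∂μ‖ₑ ≤
      ENNReal.ofReal (C * √(l / l')) *
        ∫⁻ x, ENNReal.ofReal (mL n l (G x y) * mL n l' (G x y')) ∂μ
  I2 : ∀ l l' : ℝ, 0 < l → l ≤ l' → l' ≤ 1 → ∀ x x',
    ‖∫ y, kL n l (G x y) * (starRingEnd ℂ) (kL n l' (G x' y)) ∂μ‖ₑ ≤
      ENNReal.ofReal (C * √(l / l')) *
        ∫⁻ y, ENNReal.ofReal (mL n l (G x y) * mL n l' (G x' y)) ∂μ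

namespace L2Hyp
variable {X : Type*} [MeasurableSpace X] {μ : Measure X} [IsFiniteMeasure μ] {n : ℕ}
  {G : X → X → ℂ} {c C : ℝ}

lemma hA (h : L2Hyp μ n G c C) (l : ℝ) (hl : 0 < l) (x : X) :
    ∫⁻ y, ENNReal.ofReal (mL n l (G x y)) ∂μ ≤ ENNReal.ofReal (C * 2 ^ (n+2)) :=
  mL_int μ n C h.hC (G x) (h.hG.comp measurable_prodMk_left) (h.V1 x) l hl

lemma hB (h : L2Hyp μ n G c C) (l : ℝ) (hl : 0 < l) (y : X) :
    ∫⁻ x, ENNReal.ofReal (mL n l (G x y)) ∂μ ≤ ENNReal.ofReal (C * 2 ^ (n+2)) :=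
  mL_int μ n C h.hC (fun x => G x y) (h.hG.comp measurable_prodMk_right) (h.V2 y) l hl

/-- piece -/
def pc (h : L2Hyp μ n G c C) (l : ℝ) (hl : 0 < l) : BKer X := pieceK n G h.hG c h.hc h.sec l hl

lemma lam_pos (s : ℝ) (hs : 0 < s) (j : ℕ) : 0 < (1/2:ℝ) ^ j * s := by positivity

lemma sqrt_half_pow (k : ℕ) : √((1/2:ℝ) ^ k) = (√(√(1/2)) ^ k) ^ 2 := by
  rw [← pow_mul, mul_comm, pow_mul, Real.sq_sqrt (Real.sqrt_nonneg _)]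
  rw [Real.sqrt_eq_iff_mul_self_eq (by positivity) (by positivity), ← mul_pow,
    Real.mul_self_sqrt (by norm_num)]

/-- the constant -/
def E0 (n : ℕ) (C : ℝ) : ℝ := √(C * ((C * 2 ^ (n+2)) * (C * 2 ^ (n+2))))

lemma E0_sq (n : ℕ) (C : ℝ) (hC : 0 ≤ C) :
    E0 n C ^ 2 = C * ((C * 2 ^ (n+2)) * (C * 2 ^ (n+2))) := Real.sq_sqrt (by positivity)

def A0 (n : ℕ) (C : ℝ) : ℝ := E0 n C * (2 * (1 - √(√(1/2)))⁻¹) + 1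

lemma rr : √(√(1/2)) < (1:ℝ) := by
  rw [Real.sqrt_lt' one_pos, Real.sqrt_lt' (by norm_num)]; norm_num

lemma sum_op_norm (h : L2Hyp μ n G c C) (s : ℝ) (hs : 0 < s) (hs1 : s ≤ 1) (N : ℕ) :
    ‖∑ j ∈ Finset.range N, BKer.op μ (h.pc ((1/2:ℝ)^j * s) (lam_pos s hs j))‖ ≤ A0 n C := by
  have hSnn : 0 ≤ C * 2 ^ (n+2) := mul_nonneg h.hC (by positivity)
  set b : ℕ → ℕ → ℝ := fun i j => E0 n C * √(√(1/2)) ^ ((i - j) + (j - i)) with hb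
  have hb0 : ∀ i j, 0 ≤ b i j := fun i j => by unfold b E0; positivity
  have hsym : ∀ i j, b i j = b j i := fun i j => by simp only [hb]; rw [add_comm]
  have hle1 : ∀ j, (1/2:ℝ)^j * s ≤ 1 := fun j =>
    mul_le_one₀ (pow_le_one₀ (by norm_num) (by norm_num)) hs.le hs1
  have hmono : ∀ i j, i ≤ j → (1/2:ℝ)^j * s ≤ (1/2:ℝ)^i * s := fun i j hij => by
    gcongr ?_ * s
    exact pow_le_pow_of_le_one (by norm_num) (by norm_num) hij
  have hval : ∀ i j, i ≤ j → C * √(((1/2:ℝ)^j * s) / ((1/2:ℝ)^i * s)) *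
      ((C * 2 ^ (n+2)) * (C * 2 ^ (n+2))) = b j i ^ 2 := fun i j hij => by
    have e : ((1/2:ℝ)^j * s) / ((1/2:ℝ)^i * s) = (1/2)^(j - i) := by
      rw [mul_div_mul_right _ _ hs.ne', pow_sub₀ _ (by norm_num) hij]; rfl
    simp only [hb]
    rw [e, sqrt_half_pow, mul_pow, E0_sq n C h.hC, show i - j = 0 by omega]; simp; ring
  have key1 : ∀ i j, i ≤ j → ‖star (BKer.op μ (h.pc _ (lam_pos s hs j))) *
      BKer.op μ (h.pc _ (lam_pos s hs i))‖ ≤ b j i ^ 2 := fun i j hij => by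
    rw [← hval i j hij]
    exact piece_orth μ n G h.hG c h.hc h.sec _ hSnn h.hA h.hB _ _ (lam_pos s hs j) (lam_pos s hs i)
      _ (mul_nonneg h.hC (Real.sqrt_nonneg _)) (h.I1 _ _ (lam_pos s hs j) (hmono i j hij) (hle1 i))
  have key2 : ∀ i j, i ≤ j → ‖BKer.op μ (h.pc _ (lam_pos s hs j)) *
      star (BKer.op μ (h.pc _ (lam_pos s hs i)))‖ ≤ b j i ^ 2 := fun i j hij => by
    rw [← hval i j hij]
    exact piece_orth' μ n G h.hG c h.hc h.sec _ hSnn h.hA h.hB _ _ (lam_pos s hs j) (lam_pos s hs i)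
      _ (mul_nonneg h.hC (Real.sqrt_nonneg _)) (h.I2 _ _ (lam_pos s hs j) (hmono i j hij) (hle1 i))
  have h1 : ∀ i j, ‖star (BKer.op μ (h.pc _ (lam_pos s hs i))) *
      BKer.op μ (h.pc _ (lam_pos s hs j))‖ ≤ b i j ^ 2 := fun i j => by
    rcases le_total j i with hij | hij
    · exact key1 j i hij
    · have := key1 i j hij
      rw [← norm_star, star_mul, star_star, hsym]; exact this
  have h2 : ∀ i j, ‖BKer.op μ (h.pc _ (lam_pos s hs i)) *
      star (BKer.op μ (h.pc _ (lam_pos s hs j)))‖ ≤ b i j ^ 2 := fun i j => by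
    rcases le_total j i with hij | hij
    · exact key2 j i hij
    · have := key2 i j hij
      rw [← norm_star, star_mul, star_star, hsym]; exact this
  refine CotlarStein.cotlar_stein _ b hb0 (E0 n C) ?_ h1 h2 N (A0 n C) ?_ ?_
  · intro i
    have := h1 i i
    have e2 := CStarRing.norm_star_mul_self (x := BKer.op μ (h.pc _ (lam_pos s hs i)))
    replace this := e2.symm.le.trans this
    have e : b i i = E0 n C := by simp [hb]
    rw [e, ← sq] at this
    exact (abs_le_of_sq_le_sq' this (Real.sqrt_nonneg _)).2
  · unfold A0
    have := rr
    have : 0 < 1 - √(√(1/2:ℝ)) := by linarith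
    have : 0 ≤ E0 n C := Real.sqrt_nonneg _
    positivity
  · intro i
    simp only [hb]
    rw [← Finset.mul_sum]
    have := geom_dist_sum (√(√(1/2:ℝ))) (Real.sqrt_nonneg _) rr i N
    unfold A0
    have h0 : 0 ≤ E0 n C := Real.sqrt_nonneg _
    nlinarith [mul_le_mul_of_nonneg_left this h0]

lemma A0_nonneg (n : ℕ) (C : ℝ) : 0 ≤ A0 n C := by
  unfold A0
  have := rr
  have : 0 < 1 - √(√(1/2:ℝ)) := by linarith
  have : 0 ≤ E0 n C := Real.sqrt_nonneg _
  positivity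

lemma sum_pieces (h : L2Hyp μ n G c C) (s : ℝ) (hs : 0 < s) (hs1 : s ≤ 1) (N : ℕ) (f : X → ℂ)
    (hf : MemLp f 2 μ) :
    eLpNorm (fun x => ∫ y, (∑ j ∈ Finset.range N, kL n ((1/2:ℝ)^j * s) (G x y)) * f y ∂μ) 2 μ
      ≤ ENNReal.ofReal (A0 n C) * eLpNorm f 2 μ :=
  BKer.sum_bound μ (fun j => h.pc _ (lam_pos s hs j)) N _ (A0_nonneg n C)
    (h.sum_op_norm s hs hs1 N) f hf

lemma ne_zero (h : L2Hyp μ n G c C) (x y : X) (l : ℝ) (hl : 0 < l) : (l:ℂ) + G x y ≠ 0 := by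
  intro h0
  have := h.sec x y l hl
  rw [h0, norm_zero] at this
  have h1 : 0 < c * (l + ‖G x y‖) := mul_pos h.hc (by positivity)
  linarith

/-- the averaged kernel -/
def avgK (n : ℕ) (N : ℕ) (z : ℂ) (s : ℝ) : ℂ :=
  (n * (n+1) / s) * ∑ j ∈ Finset.range N, kL n ((1/2:ℝ)^j * s) z

lemma telescope (z : ℂ) (hz : ∀ l : ℝ, 0 < l → (l:ℂ) + z ≠ 0) (N : ℕ) :
    kap n ((1/2)^N) z = kap n 1 z + ∫ s in (1/2:ℝ)..1, avgK n N z s := by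
  have hd : ∀ j : ℕ, ∀ s : ℝ, 0 < s → HasDerivAt (fun s : ℝ => -kap n ((1/2)^j * s) z)
      ((n * (n+1) / s) * kL n ((1/2:ℝ)^j * s) z) s := by
    intro j s hs
    have h1 := hasDerivAt_kap n z ((1/2)^j * s) (hz _ (by positivity))
    have h2 : HasDerivAt (fun s : ℝ => (1/2:ℝ)^j * s) ((1/2:ℝ)^j) s := by
      simpa using (hasDerivAt_id s).const_mul ((1/2:ℝ)^j)
    have h3 := (HasDerivAt.scomp s h1 h2).neg
    refine h3.congr_deriv ?_
    have hs' : (s:ℂ) ≠ 0 := by exact_mod_cast hs.ne'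
    simp only [kL, Complex.real_smul]
    push_cast
    field_simp
  have hD : ∀ s : ℝ, 0 < s → HasDerivAt (fun s : ℝ => ∑ j ∈ Finset.range N, -kap n ((1/2)^j * s) z)
      (avgK n N z s) s := by
    intro s hs
    have := HasDerivAt.fun_sum (u := Finset.range N) fun j _ => hd j s hs
    rw [← Finset.mul_sum] at this
    exact this
  have hcont : ContinuousOn (avgK n N z) (Set.uIcc (1/2) 1) := by
    rw [Set.uIcc_of_le (by norm_num)]
    unfold avgK kL
    have : ∀ s ∈ Set.Icc (1/2:ℝ) 1, (s:ℂ) ≠ 0 := fun s hs => by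
      have : 0 < s := by linarith [hs.1]
      exact_mod_cast this.ne'
    refine ContinuousOn.mul (ContinuousOn.div (by fun_prop) (by fun_prop) this) ?_
    refine continuousOn_finsetSum _ fun j _ => ?_
    refine ContinuousOn.mul (by fun_prop) (ContinuousOn.inv₀ (by fun_prop) ?_)
    intro s hs
    have hs0 : 0 < s := by linarith [hs.1]
    exact pow_ne_zero _ (hz _ (by positivity))
  rw [intervalIntegral.integral_eq_sub_of_hasDerivAt (f := fun s : ℝ => ∑ j ∈ Finset.range N, -kap n ((1/2)^j * s) z)
    (fun s hs => hD s ?_) hcont.intervalIntegrable]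
  · rw [← Finset.sum_sub_distrib]
    have : ∀ j, -kap n ((1/2)^j * 1) z - -kap n ((1/2)^j * (1/2)) z =
      kap n ((1/2)^(j+1)) z - kap n ((1/2)^j) z := fun j => by
        rw [pow_succ, mul_one]; ring
    rw [Finset.sum_congr rfl fun j _ => this j, Finset.sum_range_sub (fun j => kap n ((1/2)^j) z)]
    simp
  · rw [Set.uIcc_of_le (by norm_num)] at hs
    linarith [hs.1]

lemma sq_int_le (F : ℝ → ℂ) : ‖∫ s in (1/2:ℝ)..1, F s‖ₑ ^ (2:ℝ) ≤
    ∫⁻ s in Set.Ioc (1/2:ℝ) 1, ‖F s‖ₑ ^ (2:ℝ) := by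
  rw [intervalIntegral.integral_of_le (by norm_num)]
  by_cases hF : AEStronglyMeasurable F (volume.restrict (Set.Ioc (1/2:ℝ) 1))
  · have h1 := ENNReal.lintegral_mul_le_Lp_mul_Lq (volume.restrict (Set.Ioc (1/2:ℝ) 1))
      Real.HolderConjugate.two_two (f := fun s => ‖F s‖ₑ) (g := fun _ => 1) hF.enorm
      aemeasurable_const
    simp only [Pi.mul_apply, mul_one, ENNReal.one_rpow, lintegral_const, Measure.restrict_apply,
      MeasurableSet.univ, Set.univ_inter, Real.volume_Ioc, one_mul] at h1
    have h2 : ENNReal.ofReal (1 - 1/2) ^ (1/2:ℝ) ≤ 1 := by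
      refine ENNReal.rpow_le_one ?_ (by norm_num)
      rw [ENNReal.ofReal_le_one]; norm_num
    have h3 := (enorm_integral_le_lintegral_enorm _).trans (h1.trans (mul_le_mul_right h2 _))
    rw [mul_one] at h3
    calc _ ≤ ((∫⁻ s in Set.Ioc (1/2:ℝ) 1, ‖F s‖ₑ ^ (2:ℝ)) ^ (1/2:ℝ)) ^ (2:ℝ) :=
          ENNReal.rpow_le_rpow h3 (by norm_num)
      _ = _ := by rw [← ENNReal.rpow_mul]; norm_num
  · rw [integral_non_aestronglyMeasurable hF]; simp

lemma avgK_meas (n N : ℕ) (G : X → X → ℂ) (hG : Measurable (Function.uncurry G)) :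
    Measurable fun q : (ℝ × X) × X => avgK n N (G q.1.2 q.2) q.1.1 := by
  have h1 : Measurable fun q : (ℝ × X) × X => G q.1.2 q.2 :=
    hG.comp ((measurable_snd.comp measurable_fst).prodMk measurable_snd)
  have h2 : Measurable fun q : (ℝ × X) × X => (q.1.1 : ℂ) :=
    Complex.measurable_ofReal.comp (measurable_fst.comp measurable_fst)
  unfold avgK
  refine Measurable.mul (measurable_const.div h2) ?_
  refine Finset.measurable_sum _ fun j _ => ?_
  unfold kL
  have h3 : Measurable fun q : (ℝ × X) × X => (((1/2:ℝ)^j * q.1.1 : ℝ) : ℂ) := by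
    refine Complex.measurable_ofReal.comp ?_
    exact (measurable_fst.comp measurable_fst).const_mul _
  exact (h3.pow_const 2).mul ((h3.add h1).pow_const _).inv

lemma eL2 (F : X → ℂ) : eLpNorm F 2 μ = (∫⁻ x, ‖F x‖ₑ ^ (2:ℝ) ∂μ) ^ (1/2:ℝ) := by
  rw [eLpNorm_eq_lintegral_rpow_enorm_toReal (by norm_num) (by norm_num)]; norm_num

lemma mink (k : ℝ → X → X → ℂ) (hmeas : Measurable fun q : (ℝ × X) × X => k q.1.1 q.1.2 q.2)
    (Bd : ℝ) (hbd : ∀ x y, ∀ s ∈ Set.Ioc (1/2:ℝ) 1, ‖k s x y‖ ≤ Bd) (f : X → ℂ) (hf : MemLp f 2 μ)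
    (hfm : StronglyMeasurable f) (E : ℝ≥0∞)
    (h2 : ∀ s ∈ Set.Ioc (1/2:ℝ) 1, eLpNorm (fun x => ∫ y, k s x y * f y ∂μ) 2 μ ≤ E) :
    eLpNorm (fun x => ∫ y, (∫ s in (1/2:ℝ)..1, k s x y) * f y ∂μ) 2 μ ≤ E := by
  have hfi : Integrable f μ := hf.integrable (by norm_num)
  have swap : ∀ x, ∫ y, (∫ s in (1/2:ℝ)..1, k s x y) * f y ∂μ =
      ∫ s in (1/2:ℝ)..1, ∫ y, k s x y * f y ∂μ := by
    intro x
    rw [intervalIntegral.integral_of_le (by norm_num)]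
    simp_rw [intervalIntegral.integral_of_le (show (1/2:ℝ) ≤ 1 by norm_num), ← integral_mul_const]
    rw [integral_integral_swap]
    have h1 : Integrable (fun q : X × ℝ => f q.1) (μ.prod (volume.restrict (Set.Ioc (1/2:ℝ) 1))) :=
      hfi.comp_fst _
    refine h1.bdd_mul (c := Bd) (f := fun q : X × ℝ => k q.2 x q.1) ?_ ?_
    · refine Measurable.aestronglyMeasurable ?_
      exact hmeas.comp ((measurable_snd.prodMk measurable_const).prodMk measurable_fst)
    · have h2 : ∀ᵐ q ∂(μ.prod (volume.restrict (Set.Ioc (1/2:ℝ) 1))), q.2 ∈ Set.Ioc (1/2:ℝ) 1 :=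
        Measure.quasiMeasurePreserving_snd.ae (ae_restrict_mem measurableSet_Ioc)
      filter_upwards [h2] with q hq using hbd x q.1 q.2 hq
  simp_rw [swap]
  have inner : ∀ s ∈ Set.Ioc (1/2:ℝ) 1, ∫⁻ x, ‖∫ y, k s x y * f y ∂μ‖ₑ ^ (2:ℝ) ∂μ ≤
      E ^ (2:ℝ) := by
    intro s hs
    have h2 := h2 s hs
    rw [eL2] at h2
    calc _ = ((∫⁻ x, ‖∫ y, k s x y * f y ∂μ‖ₑ ^ (2:ℝ) ∂μ) ^ (1/2:ℝ)) ^ (2:ℝ) := by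
          rw [← ENNReal.rpow_mul]; norm_num
      _ ≤ _ := ENNReal.rpow_le_rpow h2 (by norm_num)
  have outer : ∫⁻ x, ‖∫ s in (1/2:ℝ)..1, ∫ y, k s x y * f y ∂μ‖ₑ ^ (2:ℝ) ∂μ ≤ E ^ (2:ℝ) := by
    calc _ ≤ ∫⁻ x, (∫⁻ s in Set.Ioc (1/2:ℝ) 1, ‖∫ y, k s x y * f y ∂μ‖ₑ ^ (2:ℝ)) ∂μ :=
          lintegral_mono fun x => sq_int_le _
      _ = ∫⁻ s in Set.Ioc (1/2:ℝ) 1, (∫⁻ x, ‖∫ y, k s x y * f y ∂μ‖ₑ ^ (2:ℝ) ∂μ) := by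
          rw [lintegral_lintegral_swap]
          refine Measurable.aemeasurable ?_
          refine Measurable.pow_const (Measurable.enorm ?_) _
          refine StronglyMeasurable.measurable ?_
          refine StronglyMeasurable.integral_prod_right
            (f := fun (q : X × ℝ) (y : X) => k q.2 q.1 y * f y) ?_
          refine StronglyMeasurable.mul ?_ (hfm.comp_measurable measurable_snd)
          exact (hmeas.comp ((measurable_swap.comp measurable_fst).prodMk
            measurable_snd)).stronglyMeasurable
      _ ≤ ∫⁻ _ in Set.Ioc (1/2:ℝ) 1, E ^ (2:ℝ) :=
          setLIntegral_mono' measurableSet_Ioc inner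
      _ ≤ _ := by
          rw [setLIntegral_const, Real.volume_Ioc]
          refine mul_le_of_le_one_right' ?_
          rw [ENNReal.ofReal_le_one]; norm_num
  rw [eL2]
  calc _ ≤ (E ^ (2:ℝ)) ^ (1/2:ℝ) :=
        ENNReal.rpow_le_rpow outer (by norm_num)
    _ = _ := by rw [← ENNReal.rpow_mul]; norm_num

lemma coef_le (n : ℕ) (s : ℝ) (hs : s ∈ Set.Ioc (1/2:ℝ) 1) :
    ‖((n:ℂ) * (n+1) / s)‖ ≤ 2 * (n * (n+1)) := by
  have hs0 : (0:ℝ) < s := by linarith [hs.1]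
  rw [norm_div, Complex.norm_real, Real.norm_of_nonneg hs0.le, div_le_iff₀ hs0]
  have : ‖(n:ℂ) * (n+1)‖ = n * (n+1) := by
    rw [norm_mul, Complex.norm_natCast]; congr 1
    exact_mod_cast Complex.norm_natCast (n+1)
  rw [this]
  have h0 : (0:ℝ) ≤ n * (n+1) := by positivity
  nlinarith [hs.1]

lemma avg_bound (h : L2Hyp μ n G c C) (N : ℕ) (f : X → ℂ) (hf : MemLp f 2 μ)
    (hfm : StronglyMeasurable f) :
    eLpNorm (fun x => ∫ y, (∫ s in (1/2:ℝ)..1, avgK n N (G x y) s) * f y ∂μ) 2 μ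
      ≤ ENNReal.ofReal (2 * (n * (n+1)) * A0 n C) * eLpNorm f 2 μ := by
  refine mink (fun s x y => avgK n N (G x y) s) (avgK_meas n N G h.hG)
    (2 * (n * (n+1)) * ∑ j ∈ Finset.range N, (c ^ (n+2))⁻¹ * (((1/2:ℝ)^j * (1/2)) ^ n)⁻¹)
    ?_ f hf hfm _ ?_
  · intro x y s hs
    have hs0 : (0:ℝ) < s := by linarith [hs.1]
    unfold avgK
    rw [norm_mul]
    have hc := h.hc
    refine mul_le_mul (coef_le n s hs) ?_ (norm_nonneg _) (by positivity)
    refine (norm_sum_le _ _).trans (Finset.sum_le_sum fun j _ => ?_)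
    have hp := lam_pos s hs0 j
    refine (norm_kL_le n c _ hc hp _ (h.sec x y _ hp)).trans ?_
    gcongr
    refine (mL_le n _ hp _).trans ?_
    gcongr
    exact hs.1.le
  · intro s hs
    have hs0 : (0:ℝ) < s := by linarith [hs.1]
    have h1 := h.sum_pieces s hs0 hs.2 N f hf
    have e : (fun x => ∫ y, avgK n N (G x y) s * f y ∂μ) = ((n * (n+1) / s : ℂ)) •
        (fun x => ∫ y, (∑ j ∈ Finset.range N, kL n ((1/2:ℝ)^j * s) (G x y)) * f y ∂μ) := by
      funext x
      simp only [Pi.smul_apply, smul_eq_mul]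
      rw [← integral_const_mul]
      refine integral_congr_ae (Filter.Eventually.of_forall fun y => ?_)
      simp only [avgK]; ring
    rw [e, eLpNorm_const_smul, ENNReal.ofReal_mul (by positivity), mul_assoc]
    refine mul_le_mul ?_ h1 (by positivity) (by positivity)
    rw [← ofReal_norm]
    exact ENNReal.ofReal_le_ofReal (coef_le n s hs)

/-- abstract `L²` theorem -/
theorem main (h : L2Hyp μ n G c C) : ∃ A : ℝ, 0 ≤ A ∧ ∀ N : ℕ, ∀ f : X → ℂ, MemLp f 2 μ →
    eLpNorm (fun x => ∫ y, kap n ((1/2)^N) (G x y) * f y ∂μ) 2 μ ≤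
      ENNReal.ofReal A * eLpNorm f 2 μ := by
  have hA0 := A0_nonneg n C
  have hc := h.hc
  set B1 : ℝ := (n+1) * (c ^ (n+1))⁻¹ with hB1
  have hB10 : 0 ≤ B1 := by positivity
  have kb : ∀ l : ℝ, 0 < l → ∀ x y, ‖kap n l (G x y)‖ ≤ B1 * (l ^ n)⁻¹ := by
    intro l hl x y
    refine (norm_kap_le n c l hc h.hc1 hl _ (h.sec x y _ hl)).trans ?_
    gcongr
    exact le_add_of_nonneg_right (norm_nonneg _)
  set K : (l : ℝ) → 0 < l → BKer X := fun l hl => ⟨fun x y => kap n l (G x y),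
    (measurable_kap n l).comp h.hG, B1 * (l ^ n)⁻¹, kb l hl⟩ with hK
  refine ⟨B1 * μ.real Set.univ + 2 * (n * (n+1)) * A0 n C, by positivity, ?_⟩
  intro N f hf
  -- reduce to strongly measurable f
  obtain ⟨f', hf'm, hff'⟩ := hf.1
  have hf' : MemLp f' 2 μ := (memLp_congr_ae hff').1 hf
  have e1 : ∀ x, ∫ y, kap n ((1/2)^N) (G x y) * f y ∂μ = ∫ y, kap n ((1/2)^N) (G x y) * f' y ∂μ :=
    fun x => integral_congr_ae (hff'.mono fun y hy => by simp only []; rw [hy])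
  simp_rw [e1]
  rw [eLpNorm_congr_ae hff']
  have hfi : Integrable f' μ := hf'.integrable (by norm_num)
  have hlp : (0:ℝ) < (1/2)^N := by positivity
  have e2 : ∀ x y, ∫ s in (1/2:ℝ)..1, avgK n N (G x y) s = kap n ((1/2)^N) (G x y) - kap n 1 (G x y) :=
    fun x y => by
      rw [telescope (n := n) (G x y) (fun l hl => h.ne_zero x y l hl) N]; ring
  have h1 := h.avg_bound N f' hf' hf'm
  simp_rw [e2] at h1
  have i1 : ∀ x, Integrable (fun y => kap n 1 (G x y) * f' y) μ := fun x =>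
    BKer.integ μ (K 1 one_pos) f' hfi x
  have i2 : ∀ x, Integrable (fun y => kap n ((1/2)^N) (G x y) * f' y) μ := fun x =>
    BKer.integ μ (K _ hlp) f' hfi x
  have h2 := BKer.bound2 μ (K 1 one_pos) f' hf'.1 _ (BKer.triv μ _).1 (BKer.triv μ _).2
  have e3 : (fun x => ∫ y, kap n ((1/2)^N) (G x y) * f' y ∂μ) =
      (fun x => ∫ y, kap n 1 (G x y) * f' y ∂μ) +
      (fun x => ∫ y, (kap n ((1/2)^N) (G x y) - kap n 1 (G x y)) * f' y ∂μ) := by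
    funext x
    simp only [Pi.add_apply, sub_mul]
    rw [integral_sub (i2 x) (i1 x)]; ring
  have m1 := (BKer.sm μ (K 1 one_pos) f' hf'm)
  have m2 := (BKer.sm μ (K _ hlp) f' hf'm)
  have m3 : AEStronglyMeasurable
      (fun x => ∫ y, (kap n ((1/2)^N) (G x y) - kap n 1 (G x y)) * f' y ∂μ) μ := by
    simp_rw [sub_mul]
    simp_rw [fun x => integral_sub (i2 x) (i1 x)]
    exact (m2.sub m1).aestronglyMeasurable
  rw [e3]
  refine (eLpNorm_add_le m1.aestronglyMeasurable m3 (by norm_num)).trans ?_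
  rw [ENNReal.ofReal_add (by positivity) (by positivity), add_mul]
  refine add_le_add ?_ h1
  simpa [hK] using h2

end L2Hyp
end

noncomputable section
open scoped ENNReal
set_option linter.unusedSectionVars false
set_option linter.unusedVariables false

/-- Ahlfors regularity -/
structure AReg {X : Type*} [MetricSpace X] [MeasurableSpace X] (μ : Measure X) (Q : ℕ) (C R0 : ℝ) :
    Prop where
  hC : 1 ≤ C
  hR0 : 0 < R0
  diam : ∀ x y : X, dist x y ≤ R0
  up : ∀ (x : X) (r : ℝ), 0 < r → μ (Metric.closedBall x r) ≤ ENNReal.ofReal (C * r ^ Q)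
  low : ∀ (x : X) (r : ℝ), 0 < r → r ≤ R0 →
    ENNReal.ofReal (r ^ Q) ≤ ENNReal.ofReal C * μ (Metric.closedBall x r)

namespace AReg
variable {X : Type*} [MetricSpace X] [MeasurableSpace X] [BorelSpace X]
  [SecondCountableTopology X] {μ : Measure X} [IsFiniteMeasure μ] {Q : ℕ} {C R0 : ℝ}

lemma dbl (h : AReg μ Q C R0) (x : X) (r : ℝ) (hr : 0 < r) (hrR : r ≤ R0) (k : ℝ) (hk : 0 < k) :
    μ (Metric.closedBall x (k * r)) ≤ ENNReal.ofReal (C ^ 2 * k ^ Q) * μ (Metric.closedBall x r) := by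
  have hC : 0 < C := by linarith [h.hC]
  calc _ ≤ ENNReal.ofReal (C * (k * r) ^ Q) := h.up x _ (by positivity)
    _ = ENNReal.ofReal (C * k ^ Q) * ENNReal.ofReal (r ^ Q) := by
        rw [← ENNReal.ofReal_mul (by positivity), mul_pow]; congr 1; ring
    _ ≤ ENNReal.ofReal (C * k ^ Q) * (ENNReal.ofReal C * μ (Metric.closedBall x r)) := by
        gcongr; exact h.low x r hr hrR
    _ = _ := by
        rw [← mul_assoc, ← ENNReal.ofReal_mul (by positivity)]; congr 2; ring

lemma ball_univ (h : AReg μ Q C R0) (x : X) (r : ℝ) (hr : R0 ≤ r) :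
    Metric.closedBall x r = Set.univ :=
  Set.eq_univ_of_forall fun y => Metric.mem_closedBall.2 ((h.diam y x).trans hr)

lemma unifDbl (h : AReg μ Q C R0) : IsUnifLocDoublingMeasure μ := by
  refine ⟨⟨Real.toNNReal (C ^ 2 * 2 ^ Q), ?_⟩⟩
  have : Set.Ioc 0 R0 ∈ nhdsWithin (0:ℝ) (Set.Ioi 0) := Ioc_mem_nhdsGT h.hR0
  filter_upwards [this] with r hr x
  exact h.dbl x r hr.1 hr.2 2 (by norm_num)

lemma stopping (h : AReg μ Q C R0) (f : X → ℂ) (hf : Integrable f μ) (α : ℝ) (hα : 0 < α)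
    (hsmall : ∫⁻ x, ‖f x‖ₑ ∂μ ≤ ENNReal.ofReal α * μ Set.univ) :
    ∃ (u : Set X) (r : X → ℝ), u.Countable ∧ (∀ x ∈ u, 0 < r x ∧ r x ≤ R0) ∧
      (u.PairwiseDisjoint fun x => Metric.closedBall x (r x)) ∧
      (∀ x ∈ u, ENNReal.ofReal α * μ (Metric.closedBall x (r x)) ≤
        ∫⁻ y in Metric.closedBall x (r x), ‖f y‖ₑ ∂μ) ∧
      (∀ x ∈ u, ∫⁻ y in Metric.closedBall x (5 * r x), ‖f y‖ₑ ∂μ ≤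
        ENNReal.ofReal α * (ENNReal.ofReal (C ^ 2 * 8 ^ Q) * μ (Metric.closedBall x (r x)))) ∧
      (∀ᵐ y ∂μ, (∀ x ∈ u, y ∉ Metric.closedBall x (5 * r x)) → ‖f y‖ ≤ α) := by
  classical
  have hR0 := h.hR0
  set rk : ℕ → ℝ := fun k => R0 / 2 ^ k with hrk
  have rkpos : ∀ k, 0 < rk k := fun k => by simp only [hrk]; positivity
  have rkle : ∀ k, rk k ≤ R0 := fun k => div_le_self hR0.le (one_le_pow₀ (by norm_num))
  set bad : X → ℕ → Prop := fun x k => ENNReal.ofReal α * μ (Metric.closedBall x (rk k)) <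
    ∫⁻ y in Metric.closedBall x (rk k), ‖f y‖ₑ ∂μ with hbad
  set Ω : Set X := {x | ∃ k, bad x k} with hΩ
  set r : X → ℝ := fun x => if hx : ∃ k, bad x k then rk (Nat.find hx) else 1 with hr
  have hrx : ∀ x (hx : x ∈ Ω), r x = rk (Nat.find hx) := fun x hx => dif_pos hx
  obtain ⟨u, huΩ, hdisj, hcov⟩ := Vitali.exists_disjoint_subfamily_covering_enlargement_closedBall
    Ω (fun x => x) r R0 (fun x hx => by rw [hrx x hx]; exact rkle _) 5 (by norm_num)
  have hpos : ∀ x ∈ u, 0 < r x ∧ r x ≤ R0 := fun x hx => by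
    rw [hrx x (huΩ hx)]; exact ⟨rkpos _, rkle _⟩
  refine ⟨u, r, ?_, hpos, hdisj, ?_, ?_, ?_⟩
  · refine hdisj.countable_of_nonempty_interior fun x hx => ?_
    exact ⟨x, Metric.ball_subset_interior_closedBall (Metric.mem_ball_self (hpos x hx).1)⟩
  · intro x hx
    have := Nat.find_spec (huΩ hx)
    rw [hrx x (huΩ hx)]
    exact this.le
  · intro x hx
    have hxΩ := huΩ hx
    set k := Nat.find hxΩ with hk
    have e8 : ∫⁻ y in Metric.closedBall x (8 * r x), ‖f y‖ₑ ∂μ ≤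
        ENNReal.ofReal α * μ (Metric.closedBall x (8 * r x)) := by
      by_cases hk3 : 3 ≤ k
      · have hn := Nat.find_min hxΩ (m := k - 3) (by omega)
        have e : 8 * r x = rk (k - 3) := by
          rw [hrx x hxΩ, ← hk]
          simp only [hrk]
          rw [show k = (k - 3) + 3 by omega, pow_add]
          simp only [Nat.add_sub_cancel]
          field_simp; norm_num
        rw [e]
        simp only [hbad, not_lt] at hn
        exact hn
      · have : Metric.closedBall x (8 * r x) = Set.univ := by
          apply h.ball_univ
          rw [hrx x hxΩ, ← hk]
          simp only [hrk]
          have : (2:ℝ) ^ k ≤ 2 ^ 3 := pow_le_pow_right₀ (by norm_num) (by omega)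
          rw [← mul_div_assoc, le_div_iff₀ (by positivity)]
          nlinarith
        rw [this, Measure.restrict_univ]
        exact hsmall
    calc _ ≤ ∫⁻ y in Metric.closedBall x (8 * r x), ‖f y‖ₑ ∂μ :=
          lintegral_mono_set (Metric.closedBall_subset_closedBall (by nlinarith [(hpos x hx).1]))
      _ ≤ _ := e8
      _ ≤ _ := by
          gcongr
          exact h.dbl x _ (hpos x hx).1 (hpos x hx).2 8 (by norm_num)
  · haveI := h.unifDbl
    have hfn : LocallyIntegrable (fun y => ‖f y‖) μ := hf.norm.locallyIntegrable
    filter_upwards [IsUnifLocDoublingMeasure.ae_tendsto_average μ hfn 1] with y hy hyn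
    have hyΩ : y ∉ Ω := by
      intro hyΩ
      obtain ⟨b, hb, hsub⟩ := hcov y hyΩ
      refine hyn b hb (hsub (Metric.mem_closedBall_self ?_))
      rw [hrx y hyΩ]; exact (rkpos _).le
    have hlim : Filter.Tendsto rk Filter.atTop (nhdsWithin 0 (Set.Ioi 0)) := by
      rw [tendsto_nhdsWithin_iff]
      refine ⟨?_, Filter.Eventually.of_forall rkpos⟩
      have := (tendsto_pow_atTop_nhds_zero_of_lt_one (r := (1/2:ℝ)) (by norm_num) (by norm_num)).const_mul R0
      simpa [hrk, div_eq_mul_inv] using this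
    have ht := hy (fun _ => y) rk hlim (Filter.Eventually.of_forall fun k =>
      Metric.mem_closedBall_self (by rw [one_mul]; exact (rkpos k).le))
    refine le_of_tendsto ht (Filter.Eventually.of_forall fun k => ?_)
    have hnb : ¬ bad y k := fun hb => hyΩ ⟨k, hb⟩
    simp only [hbad, not_lt] at hnb
    rw [setAverage_eq, smul_eq_mul]
    have hb0 : 0 < μ.real (Metric.closedBall y (rk k)) := by
      rw [measureReal_def, ENNReal.toReal_pos_iff]
      refine ⟨?_, measure_lt_top _ _⟩
      have := h.low y (rk k) (rkpos k) (rkle k)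
      rw [pos_iff_ne_zero]
      intro h0
      rw [h0, mul_zero, nonpos_iff_eq_zero, ENNReal.ofReal_eq_zero] at this
      have := pow_pos (rkpos k) Q
      linarith
    rw [inv_mul_le_iff₀ hb0, integral_norm_eq_lintegral_enorm hf.1.restrict]
    have := ENNReal.toReal_mono (ENNReal.mul_ne_top ENNReal.ofReal_ne_top (measure_ne_top _ _)) hnb
    rw [ENNReal.toReal_mul, ENNReal.toReal_ofReal hα.le] at this
    rw [mul_comm]; exact this

end AReg
end

noncomputable section
open scoped ENNReal
set_option linter.unusedSectionVars false
set_option linter.unusedVariables false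

namespace AReg

lemma hasSum_disj {ι X : Type*} (s : ι → Set X) (hs : Pairwise (Function.onFun Disjoint s))
    (F : ι → X → ℂ) (y : X) (i : ι) (hy : y ∈ s i) :
    HasSum (fun j => (s j).indicator (F j) y) (F i y) := by
  have := hasSum_single (f := fun j => (s j).indicator (F j) y) i (fun j hj => by
    apply Set.indicator_of_notMem
    intro hyj
    exact Set.disjoint_left.1 (hs hj) hyj hy)
  simpa [Set.indicator_of_mem hy] using this

lemma hasSum_none {ι X : Type*} (s : ι → Set X) (F : ι → X → ℂ) (y : X) (hy : ∀ i, y ∉ s i) :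
    HasSum (fun j => (s j).indicator (F j) y) 0 := by
  have : (fun j => (s j).indicator (F j) y) = fun _ => 0 := by
    funext j; exact Set.indicator_of_notMem (hy j) _
  rw [this]; exact hasSum_zero

variable {X : Type*} [MetricSpace X] [MeasurableSpace X] [BorelSpace X]
  [SecondCountableTopology X] {μ : Measure X} [IsFiniteMeasure μ] {Q : ℕ} {C R0 : ℝ}

lemma decomp (h : AReg μ Q C R0) (f : X → ℂ) (hf : Integrable f μ) (α : ℝ) (hα : 0 < α)
    (hsmall : ∫⁻ x, ‖f x‖ₑ ∂μ ≤ ENNReal.ofReal α * μ Set.univ) :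
    ∃ (u : Set X) (r : X → ℝ) (b : u → X → ℂ), u.Countable ∧ (∀ x ∈ u, 0 < r x ∧ r x ≤ R0) ∧
      (∀ i, Integrable (b i) μ) ∧
      (∀ i : u, ∀ y, y ∉ Metric.closedBall (i:X) (5 * r i) → b i y = 0) ∧
      (∀ i, ∫ y, b i y ∂μ = 0) ∧
      (∑' i, ∫⁻ y, ‖b i y‖ₑ ∂μ ≤ 2 * ∫⁻ y, ‖f y‖ₑ ∂μ) ∧
      (ENNReal.ofReal α * ∑' i : u, μ (Metric.closedBall (i:X) (r i)) ≤ ∫⁻ y, ‖f y‖ₑ ∂μ) ∧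
      (∀ᵐ y ∂μ, ‖f y - ∑' i, b i y‖ ≤ (1 + C ^ 2 * 8 ^ Q) * α) := by
  classical
  obtain ⟨u, r, hu, hr, hdisj, hbad, hgood, hae⟩ := h.stopping f hf α hα hsmall
  have hCpos : 0 < C := by linarith [h.hC]
  haveI : Countable u := hu.to_subtype
  letI : Encodable u := Encodable.ofCountable u
  set B : u → Set X := fun i => Metric.closedBall (i:X) (r i) with hB
  set BB : u → Set X := fun i => Metric.closedBall (i:X) (5 * r i) with hBB
  set P : u → Set X := fun i => BB i \ ⋃ j : u, ⋃ _ : Encodable.encode j < Encodable.encode i, BB j with hP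
  have hBm : ∀ i, MeasurableSet (B i) := fun i => Metric.isClosed_closedBall.measurableSet
  have hBBm : ∀ i, MeasurableSet (BB i) := fun i => Metric.isClosed_closedBall.measurableSet
  have hPm : ∀ i, MeasurableSet (P i) := fun i =>
    (hBBm i).diff (MeasurableSet.iUnion fun j => MeasurableSet.iUnion fun _ => hBBm j)
  have hPsub : ∀ i, P i ⊆ BB i := fun i => Set.diff_subset
  have hBd : Pairwise (Function.onFun Disjoint B) := fun i j hij =>
    hdisj i.2 j.2 (fun e => hij (Subtype.ext e))
  have hPd : Pairwise (Function.onFun Disjoint P) := by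
    have key : ∀ i j : u, Encodable.encode i < Encodable.encode j → Disjoint (P i) (P j) := by
      intro i j hij
      rw [Set.disjoint_left]
      intro y hyi hyj
      exact hyj.2 (Set.mem_iUnion.2 ⟨i, Set.mem_iUnion.2 ⟨hij, hPsub i hyi⟩⟩)
    intro i j hij
    rcases lt_trichotomy (Encodable.encode i) (Encodable.encode j) with hlt | he | hgt
    · exact key i j hlt
    · exact absurd (Encodable.encode_injective he) hij
    · exact (key j i hgt).symm
  have hPcov : ∀ y, (∃ i, y ∈ BB i) → ∃ i, y ∈ P i := by
    intro y hy
    have hex : ∃ m, ∃ i, Encodable.encode i = m ∧ y ∈ BB i := by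
      obtain ⟨i, hi⟩ := hy; exact ⟨_, i, rfl, hi⟩
    obtain ⟨i, hi, hyi⟩ := Nat.find_spec hex
    refine ⟨i, hyi, ?_⟩
    intro hy'
    obtain ⟨j, hj⟩ := Set.mem_iUnion.1 hy'
    obtain ⟨hji, hyj⟩ := Set.mem_iUnion.1 hj
    exact Nat.find_min hex (hi ▸ hji) ⟨j, rfl, hyj⟩
  have hB0 : ∀ i, 0 < μ.real (B i) := by
    intro i
    rw [measureReal_def, ENNReal.toReal_pos_iff]
    refine ⟨?_, measure_lt_top _ _⟩
    have := h.low i (r i) (hr i i.2).1 (hr i i.2).2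
    rw [pos_iff_ne_zero]
    intro h0
    simp only [hB] at h0
    rw [h0, mul_zero, nonpos_iff_eq_zero, ENNReal.ofReal_eq_zero] at this
    have := pow_pos (hr i i.2).1 Q
    linarith
  set cc : u → ℂ := fun i => (∫ y in P i, f y ∂μ) / (μ.real (B i) : ℂ) with hcc
  have hfe : ∫⁻ y, ‖f y‖ₑ ∂μ < ∞ := hf.2
  have cbound1 : ∀ i, ‖cc i‖ₑ * μ (B i) ≤ ∫⁻ y in P i, ‖f y‖ₑ ∂μ := by
    intro i
    have e : μ (B i) = ENNReal.ofReal (μ.real (B i)) := by simp [measureReal_def]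
    rw [e, ← ofReal_norm, ← ENNReal.ofReal_mul (norm_nonneg _)]
    have : ‖cc i‖ * μ.real (B i) = ‖∫ y in P i, f y ∂μ‖ := by
      simp only [hcc]
      rw [norm_div, Complex.norm_real, Real.norm_of_nonneg (hB0 i).le, div_mul_cancel₀ _ (hB0 i).ne']
    rw [this, ofReal_norm]
    exact enorm_integral_le_lintegral_enorm _
  have cbound2 : ∀ i, ‖cc i‖ ≤ C ^ 2 * 8 ^ Q * α := by
    intro i
    have h1 : ‖cc i‖ₑ * μ (B i) ≤ ENNReal.ofReal (C ^ 2 * 8 ^ Q * α) * μ (B i) := by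
      refine (cbound1 i).trans ((lintegral_mono_set (hPsub i)).trans ((hgood i i.2).trans ?_))
      rw [← mul_assoc, ← ENNReal.ofReal_mul hα.le, mul_comm α]
    have hne : μ (B i) ≠ 0 := fun h0 => by
      have := hB0 i; rw [measureReal_def, h0] at this; simp at this
    have h2 := (ENNReal.mul_le_mul_iff_left hne (measure_ne_top _ _)).1 h1
    rw [← ofReal_norm] at h2
    exact (ENNReal.ofReal_le_ofReal_iff (by positivity)).1 h2
  set b : u → X → ℂ := fun i y => (P i).indicator f y - (B i).indicator (fun _ => cc i) y with hb
  have hbi : ∀ i, Integrable (b i) μ := fun i =>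
    (hf.indicator (hPm i)).sub ((integrable_const _).indicator (hBm i))
  refine ⟨u, r, b, hu, hr, hbi, ?_, ?_, ?_, ?_, ?_⟩
  · intro i y hy
    simp only [hb]
    rw [Set.indicator_of_notMem (fun hy' => hy (hPsub i hy')), Set.indicator_of_notMem, sub_zero]
    intro hy'
    refine hy (Metric.closedBall_subset_closedBall ?_ hy')
    have := (hr i i.2).1; linarith
  · intro i
    simp only [hb]
    rw [integral_sub (hf.indicator (hPm i)) ((integrable_const _).indicator (hBm i)),
      integral_indicator (hPm i), integral_indicator (hBm i), setIntegral_const]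
    simp only [hcc, Complex.real_smul]
    rw [mul_div_cancel₀, sub_self]
    exact_mod_cast (hB0 i).ne'
  · have h1 : ∀ i, ∫⁻ y, ‖b i y‖ₑ ∂μ ≤ 2 * ∫⁻ y in P i, ‖f y‖ₑ ∂μ := by
      intro i
      calc ∫⁻ y, ‖b i y‖ₑ ∂μ ≤ ∫⁻ y, (‖(P i).indicator f y‖ₑ +
            ‖(B i).indicator (fun _ => cc i) y‖ₑ) ∂μ := lintegral_mono fun y => enorm_sub_le
        _ = ∫⁻ y, ‖(P i).indicator f y‖ₑ ∂μ + ∫⁻ y, ‖(B i).indicator (fun _ => cc i) y‖ₑ ∂μ :=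
            lintegral_add_left' (hf.1.indicator (hPm i)).enorm _
        _ = ∫⁻ y in P i, ‖f y‖ₑ ∂μ + ‖cc i‖ₑ * μ (B i) := by
            simp_rw [enorm_indicator_eq_indicator_enorm]
            rw [lintegral_indicator (hPm i), lintegral_indicator_const (hBm i)]
        _ ≤ _ := by rw [two_mul]; gcongr; exact cbound1 i
    calc _ ≤ ∑' i, 2 * ∫⁻ y in P i, ‖f y‖ₑ ∂μ := ENNReal.tsum_le_tsum h1
      _ = 2 * ∫⁻ y in ⋃ i, P i, ‖f y‖ₑ ∂μ := by
          rw [ENNReal.tsum_mul_left, lintegral_iUnion hPm hPd]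
      _ ≤ _ := by gcongr; exact Measure.restrict_le_self
  · rw [← ENNReal.tsum_mul_left]
    calc _ ≤ ∑' i : u, ∫⁻ y in B i, ‖f y‖ₑ ∂μ := ENNReal.tsum_le_tsum fun i => hbad i i.2
      _ = ∫⁻ y in ⋃ i, B i, ‖f y‖ₑ ∂μ := by rw [lintegral_iUnion hBm hBd]
      _ ≤ _ := lintegral_mono' Measure.restrict_le_self le_rfl
  · filter_upwards [hae] with y hy
    have hB1 : ∃ v, ‖v‖ ≤ C ^ 2 * 8 ^ Q * α ∧ HasSum (fun i => (B i).indicator (fun _ => cc i) y) v := by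
      by_cases hy : ∃ i, y ∈ B i
      · obtain ⟨i, hi⟩ := hy
        exact ⟨cc i, cbound2 i, hasSum_disj B hBd (fun i _ => cc i) y i hi⟩
      · push Not at hy
        refine ⟨0, by rw [norm_zero]; positivity, hasSum_none B _ y hy⟩
    obtain ⟨v, hv, hsv⟩ := hB1
    have hP1 : ∃ w, ‖f y - w‖ ≤ α ∧ HasSum (fun i => (P i).indicator f y) w := by
      by_cases hyP : ∃ i, y ∈ P i
      · obtain ⟨i, hi⟩ := hyP
        exact ⟨f y, by simp [hα.le], hasSum_disj P hPd (fun _ => f) y i hi⟩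
      · have hyP' : ∀ i, y ∉ P i := by simpa using hyP
        refine ⟨0, ?_, hasSum_none P _ y hyP'⟩
        rw [sub_zero]
        refine hy fun x hx hyx => hyP (hPcov y ⟨⟨x, hx⟩, hyx⟩)
    obtain ⟨w, hw, hsw⟩ := hP1
    have : ∑' i, b i y = w - v := (hsw.sub hsv).tsum_eq
    rw [this]
    calc ‖f y - (w - v)‖ = ‖(f y - w) + v‖ := by ring_nf
      _ ≤ ‖f y - w‖ + ‖v‖ := norm_add_le _ _
      _ ≤ _ := by nlinarith

end AReg
end

noncomputable section
open scoped ENNReal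
set_option linter.unusedSectionVars false
set_option linter.unusedVariables false

namespace BKer
variable {X : Type*} [MeasurableSpace X] (μ : Measure X) [IsFiniteMeasure μ]

lemma smA (K : BKer X) (f : X → ℂ) (hf : AEStronglyMeasurable f μ) :
    StronglyMeasurable (fun x => ∫ y, K.k x y * f y ∂μ) := by
  have : (fun x => ∫ y, K.k x y * f y ∂μ) = fun x => ∫ y, K.k x y * hf.mk f y ∂μ := by
    funext x
    refine integral_congr_ae ?_
    filter_upwards [hf.ae_eq_mk] with y hy
    rw [hy]
  rw [this]
  exact K.sm μ _ hf.stronglyMeasurable_mk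

end BKer

lemma tsum_aux {X ι : Type*} [MeasurableSpace X] {μ : Measure X} [Countable ι]
    (b : ι → X → ℂ) (hb : ∀ i, Integrable (b i) μ) (hs : ∑' i, ∫⁻ y, ‖b i y‖ₑ ∂μ ≠ ∞) :
    (Summable fun i => ∫ y, ‖b i y‖ ∂μ) ∧
    Integrable (fun y => ∑' i, b i y) μ ∧
    (∫⁻ y, ‖∑' i, b i y‖ₑ ∂μ ≤ ∑' i, ∫⁻ y, ‖b i y‖ₑ ∂μ) := by
  have hm : ∀ i, AEMeasurable (fun y => ‖b i y‖ₑ) μ := fun i => (hb i).1.enorm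
  have hle : ∫⁻ y, ‖∑' i, b i y‖ₑ ∂μ ≤ ∑' i, ∫⁻ y, ‖b i y‖ₑ ∂μ := by
    rw [← lintegral_tsum hm]
    exact lintegral_mono fun y => enorm_tsum_le_tsum_enorm
  refine ⟨?_, ⟨?_, lt_of_le_of_lt hle hs.lt_top⟩, hle⟩
  · have : (fun i => ∫ y, ‖b i y‖ ∂μ) = fun i => (∫⁻ y, ‖b i y‖ₑ ∂μ).toReal := by
      funext i; exact integral_norm_eq_lintegral_enorm (hb i).1
    rw [this]
    exact ENNReal.summable_toReal hs
  · have hfin : ∀ᵐ y ∂μ, ∑' i, ‖b i y‖ₑ < ∞ := by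
      refine ae_lt_top' (AEMeasurable.tsum hm) ?_
      rw [lintegral_tsum hm]; exact hs
    refine aestronglyMeasurable_of_tendsto_ae (u := (Filter.atTop : Filter (Finset ι)))
      (f := fun s y => ∑ i ∈ s, b i y) ?_ ?_
    · intro s
      exact Finset.aestronglyMeasurable_fun_sum s fun i _ => (hb i).1
    · filter_upwards [hfin] with y hy
      have : Summable fun i => b i y := by
        have := tsum_enorm_ne_top_iff_summable_nnnorm.1 hy.ne
        exact Summable.of_nnnorm this
      exact this.hasSum

namespace AReg
variable {X : Type*} [MetricSpace X] [MeasurableSpace X] [BorelSpace X]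
  [SecondCountableTopology X] {μ : Measure X} [IsFiniteMeasure μ] {Q : ℕ} {C R0 : ℝ}

/-- off-diagonal estimate for a mean zero atom -/
lemma atom (h : AReg μ Q C R0) (K : BKer X) (C1 : ℝ) (hC1 : 0 ≤ C1)
    (hreg : ∀ x y y0, 2 * dist y y0 ≤ dist x y0 →
      ‖K.k x y - K.k x y0‖ ≤ C1 * (dist y y0 / dist x y0 ^ (Q+1)))
    (b : X → ℂ) (hb : Integrable b μ) (x0 : X) (r : ℝ) (hr : 0 < r)
    (hsupp : ∀ y, y ∉ Metric.closedBall x0 (5 * r) → b y = 0) (hb0 : ∫ y, b y ∂μ = 0) :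
    ∫⁻ x in (Metric.closedBall x0 (10 * r))ᶜ, ‖∫ y, K.k x y * b y ∂μ‖ₑ ∂μ
      ≤ ENNReal.ofReal (C1 * C * 2 ^ (2*Q+3)) * ∫⁻ y, ‖b y‖ₑ ∂μ := by
  have hCpos : 0 < C := by linarith [h.hC]
  set Fi := ∫⁻ y, ‖b y‖ₑ ∂μ with hFi
  have hpt : ∀ x ∈ (Metric.closedBall x0 (10 * r))ᶜ, ‖∫ y, K.k x y * b y ∂μ‖ₑ ≤
      ENNReal.ofReal (C1 * 2 ^ (Q+1)) * ENNReal.ofReal (5 * r * ((5 * r + dist x x0) ^ (Q+1))⁻¹) * Fi := by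
    intro x hx
    have hx' : 10 * r < dist x x0 := by simpa using hx
    have hd : 0 < dist x x0 := by linarith
    have e1 : ∫ y, K.k x y * b y ∂μ = ∫ y, (K.k x y - K.k x x0) * b y ∂μ := by
      have : (fun y => (K.k x y - K.k x x0) * b y) = fun y => K.k x y * b y - K.k x x0 * b y := by
        funext y; ring
      rw [this, integral_sub (K.integ μ b hb x) (hb.const_mul _), integral_const_mul, hb0]
      simp
    rw [e1]
    refine (enorm_integral_le_lintegral_enorm _).trans ?_
    rw [hFi, ← ENNReal.ofReal_mul (by positivity), ← lintegral_const_mul' _ _ ENNReal.ofReal_ne_top]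
    refine lintegral_mono fun y => ?_
    by_cases hy : y ∈ Metric.closedBall x0 (5 * r)
    · rw [enorm_mul]
      gcongr
      rw [← ofReal_norm]
      apply ENNReal.ofReal_le_ofReal
      have hy' : dist y x0 ≤ 5 * r := hy
      refine (hreg x y x0 (by linarith)).trans ?_
      rw [mul_assoc]
      refine mul_le_mul_of_nonneg_left ?_ hC1
      have h2 : (5 * r + dist x x0) ^ (Q+1) ≤ 2 ^ (Q+1) * dist x x0 ^ (Q+1) := by
        rw [← mul_pow]; gcongr; linarith
      rw [div_le_iff₀ (by positivity)]
      calc dist y x0 ≤ 5 * r := hy'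
        _ = 5 * r * (((5 * r + dist x x0) ^ (Q+1))⁻¹ * (5 * r + dist x x0) ^ (Q+1)) := by
          field_simp
        _ ≤ 5 * r * (((5 * r + dist x x0) ^ (Q+1))⁻¹ * (2 ^ (Q+1) * dist x x0 ^ (Q+1))) := by
          gcongr
        _ = _ := by ring
    · simp [hsupp y hy]
  have hmeas : MeasurableSet (Metric.closedBall x0 (10 * r))ᶜ :=
    Metric.isClosed_closedBall.measurableSet.compl
  have htail := tail_estimate (μ := μ) Q C hCpos.le (fun x => dist x x0)
    (measurable_id.dist measurable_const) (fun x => dist_nonneg)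
    (fun s hs => (measure_mono (fun y hy => (le_of_lt hy : dist y x0 ≤ s))).trans (h.up x0 s hs))
    (5 * r) (by linarith)
  calc _ ≤ ∫⁻ x in (Metric.closedBall x0 (10 * r))ᶜ, ENNReal.ofReal (C1 * 2 ^ (Q+1)) * ENNReal.ofReal (5 * r * ((5 * r + dist x x0) ^ (Q+1))⁻¹) * Fi ∂μ :=
        setLIntegral_mono' hmeas hpt
    _ ≤ ∫⁻ x, ENNReal.ofReal (C1 * 2 ^ (Q+1)) * ENNReal.ofReal (5 * r * ((5 * r + dist x x0) ^ (Q+1))⁻¹) * Fi ∂μ := setLIntegral_le_lintegral _ _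
    _ = ENNReal.ofReal (C1 * 2 ^ (Q+1)) * (∫⁻ x, ENNReal.ofReal (5 * r * ((5 * r + dist x x0) ^ (Q+1))⁻¹) ∂μ) * Fi := by
        rw [lintegral_mul_const' _ _ hb.2.ne, lintegral_const_mul' _ _ ENNReal.ofReal_ne_top]
    _ ≤ ENNReal.ofReal (C1 * 2 ^ (Q+1)) * ENNReal.ofReal (C * 2 ^ (Q + 2)) * Fi := by gcongr
    _ = _ := by
        rw [← ENNReal.ofReal_mul (by positivity)]
        congr 2; ring

lemma weak11 (h : AReg μ Q C R0) (K : BKer X) (A2 C1 : ℝ) (hA2 : 0 ≤ A2) (hC1 : 0 ≤ C1)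
    (hL2 : ∀ f : X → ℂ, MemLp f 2 μ →
      eLpNorm (fun x => ∫ y, K.k x y * f y ∂μ) 2 μ ≤ ENNReal.ofReal A2 * eLpNorm f 2 μ)
    (hreg : ∀ x y y0, 2 * dist y y0 ≤ dist x y0 →
      ‖K.k x y - K.k x y0‖ ≤ C1 * (dist y y0 / dist x y0 ^ (Q+1)))
    (f : X → ℂ) (hf : Integrable f μ) (α : ℝ) (hα : 0 < α) :
    ENNReal.ofReal α * μ {x | α < ‖∫ y, K.k x y * f y ∂μ‖} ≤
      ENNReal.ofReal (12 * A2 ^ 2 * (1 + C ^ 2 * 8 ^ Q) + 4 * (C1 * C * 2 ^ (2*Q+3)) + C ^ 2 * 10 ^ Q + 1)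
        * ∫⁻ x, ‖f x‖ₑ ∂μ := by
  have hCpos : 0 < C := by linarith [h.hC]
  rcases lt_or_ge (ENNReal.ofReal α * μ Set.univ) (∫⁻ x, ‖f x‖ₑ ∂μ) with hbig | hsmall
  · calc _ ≤ ENNReal.ofReal α * μ Set.univ := by gcongr; exact Set.subset_univ _
      _ ≤ 1 * ∫⁻ x, ‖f x‖ₑ ∂μ := by rw [one_mul]; exact hbig.le
      _ ≤ _ := by
        gcongr
        rw [← ENNReal.ofReal_one]
        apply ENNReal.ofReal_le_ofReal
        have : 0 ≤ 12 * A2 ^ 2 * (1 + C ^ 2 * 8 ^ Q) + 4 * (C1 * C * 2 ^ (2*Q+3)) + C ^ 2 * 10 ^ Q := by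
          positivity
        linarith
  obtain ⟨u, r, b, hu, hr, hbi, hbs, hb0, hbsum, hball, hg⟩ := h.decomp f hf α hα hsmall
  have : Countable u := hu.to_subtype
  set F := ∫⁻ x, ‖f x‖ₑ ∂μ with hF
  have hFfin : F ≠ ∞ := hf.2.ne
  have hsfin : ∑' i, ∫⁻ y, ‖b i y‖ₑ ∂μ ≠ ∞ :=
    ne_top_of_le_ne_top (ENNReal.mul_ne_top (by norm_num) hFfin) hbsum
  obtain ⟨hsm, hbint, hble⟩ := tsum_aux b hbi hsfin
  set bb : X → ℂ := fun y => ∑' i, b i y with hbb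
  set g : X → ℂ := fun y => f y - bb y with hgdef
  have hgint : Integrable g μ := hf.sub hbint
  set Dd : ℝ := 1 + C ^ 2 * 8 ^ Q with hDd
  have hDpos : 0 < Dd := by positivity
  have hgF : ∫⁻ y, ‖g y‖ₑ ∂μ ≤ 3 * F := by
    calc ∫⁻ y, ‖g y‖ₑ ∂μ ≤ ∫⁻ y, (‖f y‖ₑ + ‖bb y‖ₑ) ∂μ := lintegral_mono fun y => enorm_sub_le
      _ = F + ∫⁻ y, ‖bb y‖ₑ ∂μ := lintegral_add_left' hf.1.enorm _
      _ ≤ F + 2 * F := by gcongr; exact hble.trans hbsum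
      _ = 3 * F := by ring
  have hgb : ∀ᵐ y ∂μ, ‖g y‖ ≤ Dd * α := hg
  have hg2 : ∫⁻ y, ‖g y‖ₑ ^ (2:ℝ) ∂μ ≤ ENNReal.ofReal (Dd * α) * (3 * F) := by
    calc ∫⁻ y, ‖g y‖ₑ ^ (2:ℝ) ∂μ ≤ ∫⁻ y, ENNReal.ofReal (Dd * α) * ‖g y‖ₑ ∂μ := by
          refine lintegral_mono_ae ?_
          filter_upwards [hgb] with y hy
          have : ‖g y‖ₑ ^ (2:ℝ) = ‖g y‖ₑ * ‖g y‖ₑ := by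
            rw [show (2:ℝ) = ((2:ℕ):ℝ) by norm_num, ENNReal.rpow_natCast, sq]
          rw [this]
          gcongr
          rw [← ofReal_norm]; exact ENNReal.ofReal_le_ofReal hy
      _ = ENNReal.ofReal (Dd * α) * ∫⁻ y, ‖g y‖ₑ ∂μ := lintegral_const_mul' _ _ ENNReal.ofReal_ne_top
      _ ≤ _ := by gcongr
  have hgmem : MemLp g 2 μ := MemLp.of_bound hgint.1 (Dd * α) hgb
  set T : (X → ℂ) → X → ℂ := fun f x => ∫ y, K.k x y * f y ∂μ with hT
  have hTfg : ∀ x, T f x = T g x + T bb x := by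
    intro x
    simp only [hT]
    rw [← integral_add (K.integ μ g hgint x) (K.integ μ bb hbint x)]
    congr 1; funext y; simp only [hgdef]; ring
  have hTb : ∀ x, ‖T bb x‖ₑ ≤ ∑' i, ‖T (b i) x‖ₑ := by
    intro x
    have h1 : ∀ i, Integrable (fun y => K.k x y * b i y) μ := fun i => K.integ μ (b i) (hbi i) x
    have h2 : Summable fun i => ∫ y, ‖K.k x y * b i y‖ ∂μ := by
      refine Summable.of_nonneg_of_le (fun i => integral_nonneg fun y => norm_nonneg _) ?_ (hsm.mul_left K.B)
      intro i
      rw [← integral_const_mul]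
      refine integral_mono (h1 i).norm ((hbi i).norm.const_mul _) fun y => ?_
      simp only [norm_mul]
      exact mul_le_mul_of_nonneg_right (K.bd x y) (norm_nonneg _)
    have h3 := hasSum_integral_of_summable_integral_norm h1 h2
    have h4 : T bb x = ∑' i, T (b i) x := by
      simp only [hT]
      rw [h3.tsum_eq]
      congr 1; funext y
      rw [hbb]; simp only; rw [tsum_mul_left]
    rw [h4]; exact enorm_tsum_le_tsum_enorm
  have hTsm : ∀ i, Measurable (fun x => ‖T (b i) x‖ₑ) := fun i =>
    (K.smA μ (b i) (hbi i).1).measurable.enorm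
  set E : Set X := ⋃ i : u, Metric.closedBall (i:X) (10 * r i) with hE
  have hEm : MeasurableSet E := MeasurableSet.iUnion fun i => Metric.isClosed_closedBall.measurableSet
  -- E
  have hEμ : ENNReal.ofReal α * μ E ≤ ENNReal.ofReal (C ^ 2 * 10 ^ Q) * F := by
    calc ENNReal.ofReal α * μ E ≤ ENNReal.ofReal α * ∑' i : u, μ (Metric.closedBall (i:X) (10 * r i)) := by
          gcongr; exact measure_iUnion_le _
      _ ≤ ENNReal.ofReal α * ∑' i : u, ENNReal.ofReal (C ^ 2 * 10 ^ Q) * μ (Metric.closedBall (i:X) (r i)) := by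
          gcongr with i
          exact h.dbl i (r i) (hr i i.2).1 (hr i i.2).2 10 (by norm_num)
      _ = ENNReal.ofReal (C ^ 2 * 10 ^ Q) * (ENNReal.ofReal α * ∑' i : u, μ (Metric.closedBall (i:X) (r i))) := by
          rw [ENNReal.tsum_mul_left]; ring
      _ ≤ _ := by gcongr
  have hoff : ∫⁻ x in Eᶜ, ‖T bb x‖ₑ ∂μ ≤ ENNReal.ofReal (C1 * C * 2 ^ (2*Q+3)) * (2 * F) := by
    calc ∫⁻ x in Eᶜ, ‖T bb x‖ₑ ∂μ ≤ ∫⁻ x in Eᶜ, ∑' i, ‖T (b i) x‖ₑ ∂μ := lintegral_mono fun x => hTb x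
      _ = ∑' i, ∫⁻ x in Eᶜ, ‖T (b i) x‖ₑ ∂μ := lintegral_tsum fun i => (hTsm i).aemeasurable
      _ ≤ ∑' i, ENNReal.ofReal (C1 * C * 2 ^ (2*Q+3)) * ∫⁻ y, ‖b i y‖ₑ ∂μ := by
          refine ENNReal.tsum_le_tsum fun i => ?_
          refine (lintegral_mono_set ?_).trans
            (h.atom K C1 hC1 hreg (b i) (hbi i) i (r i) (hr i i.2).1 (hbs i) (hb0 i))
          exact Set.compl_subset_compl.2 (Set.subset_iUnion (fun i : u => Metric.closedBall (i:X) (10 * r i)) i)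
      _ ≤ _ := by rw [ENNReal.tsum_mul_left]; gcongr
  have hα2 : ENNReal.ofReal α = 2 * ENNReal.ofReal (α/2) := by
    rw [show (2:ℝ≥0∞) = ENNReal.ofReal 2 by simp, ← ENNReal.ofReal_mul (by norm_num)]; congr 1; ring
  have hbpart : ENNReal.ofReal α * μ {x | x ∈ Eᶜ ∧ α/2 < ‖T bb x‖} ≤
      ENNReal.ofReal (4 * (C1 * C * 2 ^ (2*Q+3))) * F := by
    have hm : Measurable (fun x => ‖T bb x‖ₑ) := (K.smA μ bb hbint.1).measurable.enorm
    have h1 := mul_meas_ge_le_lintegral (μ := μ.restrict Eᶜ) hm (ENNReal.ofReal (α/2))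
    have h2 : μ {x | x ∈ Eᶜ ∧ α/2 < ‖T bb x‖} ≤ (μ.restrict Eᶜ) {x | ENNReal.ofReal (α/2) ≤ ‖T bb x‖ₑ} := by
      rw [Measure.restrict_apply (measurableSet_le measurable_const hm)]
      apply measure_mono
      rintro x ⟨hx, hx'⟩
      refine ⟨?_, hx⟩
      show ENNReal.ofReal (α/2) ≤ ‖T bb x‖ₑ
      rw [← ofReal_norm]; exact ENNReal.ofReal_le_ofReal hx'.le
    calc _ ≤ ENNReal.ofReal α * (μ.restrict Eᶜ) {x | ENNReal.ofReal (α/2) ≤ ‖T bb x‖ₑ} := by gcongr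
      _ = 2 * (ENNReal.ofReal (α/2) * (μ.restrict Eᶜ) {x | ENNReal.ofReal (α/2) ≤ ‖T bb x‖ₑ}) := by
          rw [hα2]; ring
      _ ≤ 2 * (ENNReal.ofReal (C1 * C * 2 ^ (2*Q+3)) * (2 * F)) := mul_le_mul_right (h1.trans hoff) 2
      _ = _ := by
          rw [ENNReal.ofReal_mul (p := 4) (by norm_num), show ENNReal.ofReal 4 = 2 * 2 by
            rw [ENNReal.ofReal_ofNat]; norm_num]
          ring
  have hgpart : ENNReal.ofReal α * μ {x | α/2 < ‖T g x‖} ≤ ENNReal.ofReal (12 * A2 ^ 2 * Dd) * F := by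
    have hm : Measurable (fun x => ‖T g x‖ₑ ^ (2:ℝ)) :=
      (K.smA μ g hgint.1).measurable.enorm.pow_const _
    have h1 := mul_meas_ge_le_lintegral (μ := μ) hm (ENNReal.ofReal ((α/2)^2))
    have h2 : μ {x | α/2 < ‖T g x‖} ≤ μ {x | ENNReal.ofReal ((α/2)^2) ≤ ‖T g x‖ₑ ^ (2:ℝ)} := by
      apply measure_mono
      intro x hx
      show ENNReal.ofReal ((α/2)^2) ≤ ‖T g x‖ₑ ^ (2:ℝ)
      have hx' : α/2 < ‖T g x‖ := hx
      rw [show (2:ℝ) = ((2:ℕ):ℝ) by norm_num, ENNReal.rpow_natCast, ← ofReal_norm,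
        ← ENNReal.ofReal_pow (norm_nonneg _)]
      exact ENNReal.ofReal_le_ofReal (by simpa using (pow_le_pow_left₀ (by positivity) hx'.le 2))
    have h3 : ∫⁻ x, ‖T g x‖ₑ ^ (2:ℝ) ∂μ ≤ ENNReal.ofReal (A2 ^ 2) * ∫⁻ x, ‖g x‖ₑ ^ (2:ℝ) ∂μ := by
      have := hL2 g hgmem
      rw [L2Hyp.eL2, L2Hyp.eL2] at this
      have h4 := ENNReal.rpow_le_rpow this (show (0:ℝ) ≤ 2 by norm_num)
      rw [ENNReal.mul_rpow_of_nonneg _ _ (by norm_num), ← ENNReal.rpow_mul, ← ENNReal.rpow_mul,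
        ENNReal.ofReal_rpow_of_nonneg hA2 (by norm_num)] at h4
      simpa using h4
    have h5 : ENNReal.ofReal ((α/2)^2) * μ {x | α/2 < ‖T g x‖} ≤
        ENNReal.ofReal (α/2) * (ENNReal.ofReal (6 * A2 ^ 2 * Dd) * F) := by
      calc _ ≤ ENNReal.ofReal ((α/2)^2) * μ {x | ENNReal.ofReal ((α/2)^2) ≤ ‖T g x‖ₑ ^ (2:ℝ)} := by gcongr
        _ ≤ ENNReal.ofReal (A2 ^ 2) * (ENNReal.ofReal (Dd * α) * (3 * F)) :=
            h1.trans (h3.trans (by gcongr))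
        _ = (ENNReal.ofReal (A2 ^ 2) * ENNReal.ofReal (Dd * α) * ENNReal.ofReal 3) * F := by
            rw [ENNReal.ofReal_ofNat]; ring
        _ = _ := by
            rw [← mul_assoc, ← ENNReal.ofReal_mul (by positivity), ← ENNReal.ofReal_mul (by positivity),
              ← ENNReal.ofReal_mul (by positivity)]
            congr 2; ring
    rw [sq, ENNReal.ofReal_mul (by positivity), mul_assoc] at h5
    have h6 := (ENNReal.mul_le_mul_iff_right (by simpa using hα) ENNReal.ofReal_ne_top).1 h5
    calc _ = 2 * (ENNReal.ofReal (α/2) * μ {x | α/2 < ‖T g x‖}) := by rw [hα2]; ring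
      _ ≤ 2 * (ENNReal.ofReal (6 * A2 ^ 2 * Dd) * F) := by gcongr
      _ = _ := by
          rw [← mul_assoc, show (2:ℝ≥0∞) = ENNReal.ofReal 2 by simp, ← ENNReal.ofReal_mul (by norm_num)]
          congr 2; ring
  have hcov : μ {x | α < ‖T f x‖} ≤ μ {x | α/2 < ‖T g x‖} + μ {x | x ∈ Eᶜ ∧ α/2 < ‖T bb x‖} + μ E := by
    refine (measure_mono ?_).trans ((measure_union_le _ _).trans (add_le_add_left (measure_union_le _ _) _))
    intro x hx
    by_cases hxE : x ∈ E
    · exact Or.inr hxE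
    left
    by_contra hcon
    simp only [Set.mem_union, Set.mem_ofPred_eq, not_or, not_and, not_lt] at hcon
    have hx' : α < ‖T f x‖ := hx
    rw [hTfg] at hx'
    have := norm_add_le (T g x) (T bb x)
    have := hcon.2 hxE
    linarith [hcon.1]
  calc ENNReal.ofReal α * μ {x | α < ‖T f x‖}
      ≤ ENNReal.ofReal α * (μ {x | α/2 < ‖T g x‖} + μ {x | x ∈ Eᶜ ∧ α/2 < ‖T bb x‖} + μ E) := by gcongr
    _ ≤ ENNReal.ofReal (12 * A2 ^ 2 * Dd) * F + ENNReal.ofReal (4 * (C1 * C * 2 ^ (2*Q+3))) * F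
        + ENNReal.ofReal (C ^ 2 * 10 ^ Q) * F := by
        rw [mul_add, mul_add]; gcongr
    _ = ENNReal.ofReal (12 * A2 ^ 2 * Dd + 4 * (C1 * C * 2 ^ (2*Q+3)) + C ^ 2 * 10 ^ Q) * F := by
        rw [← add_mul, ← add_mul, ← ENNReal.ofReal_add (by positivity) (by positivity),
          ← ENNReal.ofReal_add (by positivity) (by positivity)]
    _ ≤ _ := by
        exact mul_le_mul_left (ENNReal.ofReal_le_ofReal (by linarith)) F

end AReg
end

noncomputable section
open scoped ENNReal
set_option linter.unusedSectionVars false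
set_option linter.unusedVariables false

lemma eLp_eq {X : Type*} [MeasurableSpace X] {μ : Measure X} (F : X → ℂ) (p : ℝ) (hp : 0 < p) :
    eLpNorm F (ENNReal.ofReal p) μ = (∫⁻ x, ‖F x‖ₑ ^ p ∂μ) ^ (1/p) := by
  rw [eLpNorm_eq_lintegral_rpow_enorm_toReal (by simpa using hp) ENNReal.ofReal_ne_top,
    ENNReal.toReal_ofReal hp.le]

namespace BKer
variable {X : Type*} [MeasurableSpace X] (μ : Measure X) [IsFiniteMeasure μ]

/-- transposed kernel -/
def tr (K : BKer X) : BKer X where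
  k := fun x y => K.k y x
  meas := K.meas.comp measurable_swap
  B := K.B
  bd := fun x y => K.bd y x

lemma duality (K : BKer X) (p q : ℝ) (hpq : p.HolderConjugate q) (A : ℝ)
    (hq : ∀ f : X → ℂ, MemLp f (ENNReal.ofReal q) μ →
      eLpNorm (fun x => ∫ y, K.k x y * f y ∂μ) (ENNReal.ofReal q) μ
        ≤ ENNReal.ofReal A * eLpNorm f (ENNReal.ofReal q) μ)
    (f : X → ℂ) (hf : MemLp f (ENNReal.ofReal p) μ) :
    eLpNorm (fun x => ∫ y, K.k y x * f y ∂μ) (ENNReal.ofReal p) μ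
        ≤ ENNReal.ofReal A * eLpNorm f (ENNReal.ofReal p) μ := by
  have hp1 : 1 < p := hpq.lt
  have hp0 : 0 < p := hpq.pos
  have hq0 : 0 < q := hpq.symm.pos
  have hfi : Integrable f μ := hf.integrable (by
    rw [← ENNReal.ofReal_one]; exact ENNReal.ofReal_le_ofReal hp1.le)
  set F : X → ℂ := fun x => ∫ y, K.k y x * f y ∂μ with hF
  have hFm : StronglyMeasurable F := (tr K).smA μ f hfi.1
  set M : ℝ := K.B * ∫ y, ‖f y‖ ∂μ with hM
  have hFb : ∀ x, ‖F x‖ ≤ M := by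
    intro x
    refine (norm_integral_le_integral_norm _).trans ?_
    rw [hM, ← integral_const_mul]
    refine integral_mono ((tr K).integ μ f hfi x).norm (hfi.norm.const_mul _) fun y => ?_
    simp only [norm_mul]
    exact mul_le_mul_of_nonneg_right (K.bd y x) (norm_nonneg _)
  set h : X → ℂ := fun x => (starRingEnd ℂ) (F x) * ((‖F x‖ ^ (p-2) : ℝ) : ℂ) with hh
  have hhm : StronglyMeasurable h := by
    apply Measurable.stronglyMeasurable
    have := hFm.measurable
    exact (continuous_conj.measurable.comp this).mul
      (Complex.measurable_ofReal.comp ((measurable_norm.comp this).pow_const _))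
  have hhn : ∀ x, ‖h x‖ = ‖F x‖ ^ (p-1) := by
    intro x
    simp only [hh, norm_mul, RCLike.norm_conj, Complex.norm_real]
    rw [Real.norm_of_nonneg (by positivity)]
    rcases eq_or_lt_of_le (norm_nonneg (F x)) with h0 | h0
    · rw [← h0, zero_mul, Real.zero_rpow (by linarith)]
    · rw [mul_comm, ← Real.rpow_add_one h0.ne']; congr 1; ring
  have hFh : ∀ x, F x * h x = ((‖F x‖ ^ p : ℝ) : ℂ) := by
    intro x
    simp only [hh]
    rw [← mul_assoc, Complex.mul_conj, ← Complex.ofReal_mul]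
    congr 1
    rw [Complex.normSq_eq_norm_sq]
    rcases eq_or_lt_of_le (norm_nonneg (F x)) with h0 | h0
    · rw [← h0, Real.zero_rpow hp0.ne']; simp
    · rw [← Real.rpow_natCast, ← Real.rpow_add h0]; congr 1; push_cast; ring
  have hhb : ∀ x, ‖h x‖ ≤ M ^ (p-1) := by
    intro x; rw [hhn]
    exact Real.rpow_le_rpow (norm_nonneg _) (hFb x) (by linarith)
  have hhLp : ∀ s : ℝ≥0∞, MemLp h s μ := fun s =>
    MemLp.of_bound hhm.aestronglyMeasurable _ (Filter.Eventually.of_forall hhb)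
  have hhi : Integrable h μ := (hhLp 1).integrable le_rfl
  set I := ∫⁻ x, ‖F x‖ₑ ^ p ∂μ with hI
  have hpow : ∀ x, ‖F x‖ₑ ^ p = ENNReal.ofReal (‖F x‖ ^ p) := by
    intro x; rw [← ofReal_norm, ENNReal.ofReal_rpow_of_nonneg (norm_nonneg _) hp0.le]
  have hIfin : I ≠ ∞ := by
    have : I ≤ ∫⁻ x, ENNReal.ofReal (M ^ p) ∂μ := by
      refine lintegral_mono fun x => ?_
      simp only
      rw [hpow]
      exact ENNReal.ofReal_le_ofReal (Real.rpow_le_rpow (norm_nonneg _) (hFb x) hp0.le)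
    refine ne_top_of_le_ne_top ?_ this
    rw [lintegral_const]
    exact ENNReal.mul_ne_top ENNReal.ofReal_ne_top (measure_ne_top _ _)
  have hIe : I = ‖∫ x, F x * h x ∂μ‖ₑ := by
    simp only [hFh]
    rw [integral_complex_ofReal, ← ofReal_norm, Complex.norm_real,
      Real.norm_of_nonneg (integral_nonneg fun x => by positivity), ofReal_integral_eq_lintegral_ofReal]
    · rw [hI]; congr 1; funext x; exact hpow x
    · refine Integrable.of_bound ?_ (M ^ p) (Filter.Eventually.of_forall fun x => ?_)
      · exact ((measurable_norm.comp hFm.measurable).pow_const p).aestronglyMeasurable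
      · rw [Real.norm_of_nonneg (by positivity)]
        exact Real.rpow_le_rpow (norm_nonneg _) (hFb x) hp0.le
    · exact Filter.Eventually.of_forall fun x => by positivity
  have hswap : ∫ x, F x * h x ∂μ = ∫ y, f y * (∫ x, K.k y x * h x ∂μ) ∂μ := by
    have e1 : ∀ x, F x * h x = ∫ y, K.k y x * (f y * h x) ∂μ := by
      intro x; rw [hF]; simp only; rw [← integral_mul_const]; congr 1; funext y; ring
    have e2 : ∀ y, f y * (∫ x, K.k y x * h x ∂μ) = ∫ x, K.k y x * (f y * h x) ∂μ := by
      intro y; rw [← integral_const_mul]; congr 1; funext x; ring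
    simp only [e1, e2]
    exact (integral_integral_swap (prod_integrable μ K f h hfi hhi)).symm
  have hle : I ≤ ENNReal.ofReal A * eLpNorm f (ENNReal.ofReal p) μ * I ^ (1/q) := by
    rw [hIe, hswap]
    refine (enorm_integral_le_lintegral_enorm _).trans ?_
    have hm2 : StronglyMeasurable (fun y => ∫ x, K.k y x * h x ∂μ) := K.smA μ h hhi.1
    calc _ = ∫⁻ y, ((fun y => ‖f y‖ₑ) * fun y => ‖∫ x, K.k y x * h x ∂μ‖ₑ) y ∂μ := by
          congr 1; funext y; rw [enorm_mul]; rfl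
      _ ≤ (∫⁻ y, ‖f y‖ₑ ^ p ∂μ) ^ (1/p) * (∫⁻ y, ‖∫ x, K.k y x * h x ∂μ‖ₑ ^ q ∂μ) ^ (1/q) :=
          ENNReal.lintegral_mul_le_Lp_mul_Lq μ hpq hfi.1.enorm hm2.measurable.enorm.aemeasurable
      _ ≤ eLpNorm f (ENNReal.ofReal p) μ * (ENNReal.ofReal A * eLpNorm h (ENNReal.ofReal q) μ) := by
          have := hq h (hhLp _)
          rw [eLp_eq _ q hq0] at this
          rw [← eLp_eq _ p hp0]
          gcongr
      _ = ENNReal.ofReal A * eLpNorm f (ENNReal.ofReal p) μ * I ^ (1/q) := by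
          have : eLpNorm h (ENNReal.ofReal q) μ = I ^ (1/q) := by
            rw [eLp_eq _ q hq0, hI]
            congr 2; funext x
            rw [← ofReal_norm, hhn, ENNReal.ofReal_rpow_of_nonneg (by positivity) hq0.le, hpow,
              ← Real.rpow_mul (norm_nonneg _), hpq.sub_one_mul_conj]
          rw [this]; ring
      _ = _ := by rw [← hswap, ← hIe]
  rw [eLp_eq _ p hp0, ← hI]
  rcases eq_or_ne I 0 with h0 | h0
  · rw [h0, ENNReal.zero_rpow_of_pos (by positivity)]; exact zero_le
  · have e : I = I ^ (1/p) * I ^ (1/q) := by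
      rw [← ENNReal.rpow_add _ _ h0 hIfin]
      have := hpq.inv_add_inv_eq_one
      rw [one_div, one_div, this, ENNReal.rpow_one]
    have hk0 : I ^ (1/q) ≠ 0 := by
      simp [ENNReal.rpow_eq_zero_iff, h0, hIfin]
    have hkt : I ^ (1/q) ≠ ∞ := ENNReal.rpow_ne_top_of_nonneg (by positivity) hIfin
    have hle' : I ^ (1/p) * I ^ (1/q) ≤ ENNReal.ofReal A * eLpNorm f (ENNReal.ofReal p) μ * I ^ (1/q) := by
      rw [← e]; exact hle
    exact (ENNReal.mul_le_mul_iff_left hk0 hkt).1 hle'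

end BKer

lemma lint1 (a : ℝ) (ha : 0 ≤ a) (s : ℝ) (hs : -1 < s) :
    ∫⁻ t in Set.Ioi (0:ℝ), (if t < a then ENNReal.ofReal (t ^ s) else 0) ≤
      ENNReal.ofReal (a ^ (s+1) / (s+1)) := by
  have e : ∫⁻ t in Set.Ioi (0:ℝ), (if t < a then ENNReal.ofReal (t ^ s) else 0)
      ≤ ∫⁻ t in Set.Ioc 0 a, ENNReal.ofReal (t ^ s) := by
    rw [← lintegral_indicator measurableSet_Ioi, ← lintegral_indicator measurableSet_Ioc]
    refine lintegral_mono fun t => ?_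
    by_cases h0 : 0 < t
    · by_cases h1 : t < a
      · simp [Set.indicator, h0, h1, h1.le]
      · simp [Set.indicator, h0, h1]
    · simp [Set.indicator, h0]
  refine e.trans ?_
  have hIntg : IntegrableOn (fun t : ℝ => t ^ s) (Set.Ioc 0 a) := by
    have := intervalIntegral.intervalIntegrable_rpow' (a := 0) (b := a) hs
    exact (intervalIntegrable_iff_integrableOn_Ioc_of_le ha).1 this
  rw [← ofReal_integral_eq_lintegral_ofReal hIntg
    ((ae_restrict_iff' measurableSet_Ioc).2 (Filter.Eventually.of_forall fun t ht => Real.rpow_nonneg ht.1.le _))]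
  apply ENNReal.ofReal_le_ofReal
  rw [← intervalIntegral.integral_of_le ha, integral_rpow (Or.inl hs), Real.zero_rpow (by linarith)]
  simp

lemma lint2 (a : ℝ) (ha : 0 < a) (s : ℝ) (hs : s < -1) :
    ∫⁻ t in Set.Ioi (0:ℝ), (if t < a then 0 else ENNReal.ofReal (t ^ s)) ≤
      ENNReal.ofReal (a ^ (s+1) / (-(s+1))) := by
  have e : ∫⁻ t in Set.Ioi (0:ℝ), (if t < a then 0 else ENNReal.ofReal (t ^ s))
      ≤ ∫⁻ t in Set.Ici a, ENNReal.ofReal (t ^ s) := by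
    rw [← lintegral_indicator measurableSet_Ioi, ← lintegral_indicator measurableSet_Ici]
    refine lintegral_mono fun t => ?_
    by_cases h0 : 0 < t
    · by_cases h1 : t < a
      · simp [Set.indicator, h0, h1]
      · simp [Set.indicator, h0, h1, not_lt.1 h1]
    · simp [Set.indicator, h0]
  refine e.trans ?_
  rw [setLIntegral_congr Ioi_ae_eq_Ici.symm]
  have hIntg : IntegrableOn (fun t : ℝ => t ^ s) (Set.Ioi a) := integrableOn_Ioi_rpow_of_lt hs ha
  rw [← ofReal_integral_eq_lintegral_ofReal hIntg
    ((ae_restrict_iff' measurableSet_Ioi).2 (Filter.Eventually.of_forall fun t ht => Real.rpow_nonneg (ha.trans ht).le _))]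
  apply ENNReal.ofReal_le_ofReal
  rw [integral_Ioi_rpow_of_lt hs ha, div_neg, neg_div]

end

noncomputable section
open scoped ENNReal
set_option linter.unusedSectionVars false
set_option linter.unusedVariables false

lemma meas_dist {X : Type*} [MeasurableSpace X] {F : X → ℝ} (hF : Measurable F) :
    MeasurableSet {z : ℝ × X | z.1 < F z.2} :=
  measurableSet_lt measurable_fst (hF.comp measurable_snd)

lemma marc_int {X : Type*} [MeasurableSpace X] (μ : Measure X) [IsFiniteMeasure μ]
    (F : X → ℝ) (hF : Measurable F) (hF0 : ∀ x, 0 ≤ F x) (p : ℝ) (hp : 1 < p) (hp2 : p < 2) :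
    (∫⁻ t in Set.Ioi (0:ℝ), ENNReal.ofReal (t^(p-2)) * (∫⁻ x, (if t < F x then ENNReal.ofReal (F x) else 0) ∂μ)
      ≤ ENNReal.ofReal (1/(p-1)) * ∫⁻ x, ENNReal.ofReal (F x ^ p) ∂μ) ∧
    (∫⁻ t in Set.Ioi (0:ℝ), ENNReal.ofReal (t^(p-3)) * (∫⁻ x, (if t < F x then 0 else ENNReal.ofReal (F x ^ 2)) ∂μ)
      ≤ ENNReal.ofReal (1/(2-p)) * ∫⁻ x, ENNReal.ofReal (F x ^ p) ∂μ) := by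
  have hms := meas_dist hF
  constructor
  · calc _ = ∫⁻ t in Set.Ioi (0:ℝ), ∫⁻ x, ENNReal.ofReal (F x) * (if t < F x then ENNReal.ofReal (t^(p-2)) else 0) ∂μ := by
          congr 1; funext t
          rw [← lintegral_const_mul' _ _ ENNReal.ofReal_ne_top]
          congr 1; funext x
          split_ifs <;> ring
      _ = ∫⁻ x, (∫⁻ t in Set.Ioi (0:ℝ), ENNReal.ofReal (F x) * (if t < F x then ENNReal.ofReal (t^(p-2)) else 0)) ∂μ := by
          apply lintegral_lintegral_swap
          apply Measurable.aemeasurable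
          refine Measurable.mul ?_ (Measurable.ite hms ?_ measurable_const)
          · exact (hF.comp measurable_snd).ennreal_ofReal
          · exact (measurable_fst.pow_const _).ennreal_ofReal
      _ ≤ ∫⁻ x, ENNReal.ofReal (1/(p-1)) * ENNReal.ofReal (F x ^ p) ∂μ := by
          refine lintegral_mono fun x => ?_
          simp only
          rw [lintegral_const_mul' _ _ ENNReal.ofReal_ne_top]
          refine (mul_le_mul_right (lint1 (F x) (hF0 x) (p-2) (by linarith)) _).trans ?_
          rw [← ENNReal.ofReal_mul (hF0 x), ← ENNReal.ofReal_mul (by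
            rw [one_div]; exact inv_nonneg.2 (by linarith))]
          apply ENNReal.ofReal_le_ofReal
          apply le_of_eq
          have : F x ^ p = F x * F x ^ (p - 2 + 1) := by
            rcases eq_or_lt_of_le (hF0 x) with h0 | h0
            · rw [← h0, Real.zero_rpow (by linarith)]; simp
            · rw [mul_comm, ← Real.rpow_add_one h0.ne']; congr 1; ring
          rw [this]; ring
      _ = _ := lintegral_const_mul' _ _ ENNReal.ofReal_ne_top
  · calc _ = ∫⁻ t in Set.Ioi (0:ℝ), ∫⁻ x, ENNReal.ofReal (F x ^ 2) * (if t < F x then 0 else ENNReal.ofReal (t^(p-3))) ∂μ := by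
          congr 1; funext t
          rw [← lintegral_const_mul' _ _ ENNReal.ofReal_ne_top]
          congr 1; funext x
          split_ifs <;> ring
      _ = ∫⁻ x, (∫⁻ t in Set.Ioi (0:ℝ), ENNReal.ofReal (F x ^ 2) * (if t < F x then 0 else ENNReal.ofReal (t^(p-3)))) ∂μ := by
          apply lintegral_lintegral_swap
          apply Measurable.aemeasurable
          refine Measurable.mul ?_ (Measurable.ite hms measurable_const ?_)
          · exact ((hF.comp measurable_snd).pow_const 2).ennreal_ofReal
          · exact (measurable_fst.pow_const _).ennreal_ofReal
      _ ≤ ∫⁻ x, ENNReal.ofReal (1/(2-p)) * ENNReal.ofReal (F x ^ p) ∂μ := by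
          refine lintegral_mono fun x => ?_
          simp only
          rw [lintegral_const_mul' _ _ ENNReal.ofReal_ne_top]
          rcases eq_or_lt_of_le (hF0 x) with h0 | h0
          · rw [← h0]; simp
          refine (mul_le_mul_right (lint2 (F x) h0 (p-3) (by linarith)) _).trans ?_
          rw [← ENNReal.ofReal_mul (by positivity), ← ENNReal.ofReal_mul (by
            rw [one_div]; exact inv_nonneg.2 (by linarith))]
          apply ENNReal.ofReal_le_ofReal
          apply le_of_eq
          have : F x ^ p = F x ^ 2 * F x ^ (p - 3 + 1) := by
            rw [← Real.rpow_natCast, ← Real.rpow_add h0]; congr 1; push_cast; ring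
          rw [this, show -(p - 3 + 1) = 2 - p by ring]; ring
      _ = _ := lintegral_const_mul' _ _ ENNReal.ofReal_ne_top

lemma marcinkiewicz {X : Type*} [MeasurableSpace X] (μ : Measure X) [IsFiniteMeasure μ] (K : BKer X)
    (A2 W : ℝ) (hA2 : 0 ≤ A2) (hW : 0 ≤ W)
    (hL2 : ∀ f : X → ℂ, MemLp f 2 μ →
      eLpNorm (fun x => ∫ y, K.k x y * f y ∂μ) 2 μ ≤ ENNReal.ofReal A2 * eLpNorm f 2 μ)
    (hweak : ∀ f : X → ℂ, Integrable f μ → ∀ α : ℝ, 0 < α →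
      ENNReal.ofReal α * μ {x | α < ‖∫ y, K.k x y * f y ∂μ‖} ≤ ENNReal.ofReal W * ∫⁻ x, ‖f x‖ₑ ∂μ)
    (p : ℝ) (hp : 1 < p) (hp2 : p < 2) (f : X → ℂ) (hf : MemLp f (ENNReal.ofReal p) μ) :
    eLpNorm (fun x => ∫ y, K.k x y * f y ∂μ) (ENNReal.ofReal p) μ ≤
      ENNReal.ofReal ((p * (2 * W * (1/(p-1)) + 4 * A2 ^ 2 * (1/(2-p)))) ^ (1/p)) *
        eLpNorm f (ENNReal.ofReal p) μ := by
  have hp0 : 0 < p := by linarith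
  -- reduce to measurable f
  wlog hfm : StronglyMeasurable f generalizing f with H
  · have h1 := H (hf.1.mk f) ((memLp_congr_ae hf.1.ae_eq_mk).1 hf) hf.1.stronglyMeasurable_mk
    rw [eLpNorm_congr_ae hf.1.ae_eq_mk]
    refine le_of_eq_of_le ?_ h1
    congr 1; funext x
    refine integral_congr_ae ?_
    filter_upwards [hf.1.ae_eq_mk] with y hy
    rw [← hy]
  set F : X → ℝ := fun x => ‖f x‖ with hF
  have hFm : Measurable F := hfm.measurable.norm
  have hF0 : ∀ x, 0 ≤ F x := fun x => norm_nonneg _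
  have hfi : Integrable f μ := hf.integrable (by
    rw [← ENNReal.ofReal_one]; exact ENNReal.ofReal_le_ofReal hp.le)
  set T : (X → ℂ) → X → ℂ := fun f x => ∫ y, K.k x y * f y ∂μ with hT
  have hTm : StronglyMeasurable (T f) := K.sm μ f hfm
  set I := ∫⁻ x, ENNReal.ofReal (F x ^ p) ∂μ with hI
  have hdist : ∀ t : ℝ, 0 < t → μ {x | t < ‖T f x‖} * ENNReal.ofReal (t ^ (p-1)) ≤
      ENNReal.ofReal (2 * W) * (ENNReal.ofReal (t^(p-2)) * (∫⁻ x, (if t < F x then ENNReal.ofReal (F x) else 0) ∂μ)) +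
      ENNReal.ofReal (4 * A2 ^ 2) * (ENNReal.ofReal (t^(p-3)) * (∫⁻ x, (if t < F x then 0 else ENNReal.ofReal (F x ^ 2)) ∂μ)) := by
    intro t ht
    set f1 : X → ℂ := fun x => if t < F x then f x else 0 with hf1
    set f2 : X → ℂ := fun x => if t < F x then 0 else f x with hf2
    have hms : MeasurableSet {x | t < F x} := measurableSet_lt measurable_const hFm
    have hf1m : StronglyMeasurable f1 := StronglyMeasurable.ite hms hfm stronglyMeasurable_const
    have hf2m : StronglyMeasurable f2 := StronglyMeasurable.ite hms stronglyMeasurable_const hfm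
    have hf1i : Integrable f1 μ := hfi.mono hf1m.aestronglyMeasurable
      (Filter.Eventually.of_forall fun x => by simp only [hf1]; split_ifs <;> simp)
    have hf2b : ∀ x, ‖f2 x‖ ≤ t := by
      intro x; simp only [hf2]; split_ifs with h
      · simpa using ht.le
      · exact not_lt.1 h
    have hf2L : MemLp f2 2 μ := MemLp.of_bound hf2m.aestronglyMeasurable t (Filter.Eventually.of_forall hf2b)
    have hf2i : Integrable f2 μ := hf2L.integrable (by norm_num)
    have hsum : ∀ x, T f x = T f1 x + T f2 x := by
      intro x
      simp only [hT]
      rw [← integral_add (K.integ μ f1 hf1i x) (K.integ μ f2 hf2i x)]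
      congr 1; funext y; simp only [hf1, hf2]; split_ifs <;> ring
    have hcov : μ {x | t < ‖T f x‖} ≤ μ {x | t/2 < ‖T f1 x‖} + μ {x | t/2 < ‖T f2 x‖} := by
      refine (measure_mono ?_).trans (measure_union_le _ _)
      intro x hx
      by_contra hcon
      simp only [Set.mem_union, Set.mem_ofPred_eq, not_or, not_lt] at hcon
      have hx' : t < ‖T f x‖ := hx
      rw [hsum] at hx'
      have := norm_add_le (T f1 x) (T f2 x)
      linarith [hcon.1, hcon.2]
    have h1 : μ {x | t/2 < ‖T f1 x‖} * ENNReal.ofReal (t ^ (p-1)) ≤ ENNReal.ofReal (2 * W) * (ENNReal.ofReal (t^(p-2)) * (∫⁻ x, (if t < F x then ENNReal.ofReal (F x) else 0) ∂μ)) := by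
      have h := hweak f1 hf1i (t/2) (by linarith)
      have e : ∫⁻ x, ‖f1 x‖ₑ ∂μ = ∫⁻ x, (if t < F x then ENNReal.ofReal (F x) else 0) ∂μ := by
        congr 1; funext x; simp only [hf1]; split_ifs
        · rw [← ofReal_norm]
        · simp
      rw [e] at h
      have e2 : t ^ (p-1) = (2 * t ^ (p-2)) * (t/2) := by
        have : t ^ (p-1) = t ^ (p-2) * t := by rw [← Real.rpow_add_one ht.ne']; congr 1; ring
        rw [this]; ring
      rw [e2, ENNReal.ofReal_mul (by positivity)]
      calc _ = ENNReal.ofReal (2 * t ^ (p-2)) * (ENNReal.ofReal (t/2) * μ {x | t/2 < ‖T f1 x‖}) := by ring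
        _ ≤ ENNReal.ofReal (2 * t ^ (p-2)) * (ENNReal.ofReal W * ∫⁻ x, (if t < F x then ENNReal.ofReal (F x) else 0) ∂μ) := by gcongr
        _ = _ := by
          rw [ENNReal.ofReal_mul (by positivity), ENNReal.ofReal_mul (p := 2) (by positivity)]; ring
    have h2 : μ {x | t/2 < ‖T f2 x‖} * ENNReal.ofReal (t ^ (p-1)) ≤ ENNReal.ofReal (4 * A2 ^ 2) * (ENNReal.ofReal (t^(p-3)) * (∫⁻ x, (if t < F x then 0 else ENNReal.ofReal (F x ^ 2)) ∂μ)) := by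
      have hm : Measurable (fun x => ‖T f2 x‖ₑ ^ (2:ℝ)) :=
        (K.sm μ f2 hf2m).measurable.enorm.pow_const _
      have h1 := mul_meas_ge_le_lintegral (μ := μ) hm (ENNReal.ofReal ((t/2)^2))
      have h2 : μ {x | t/2 < ‖T f2 x‖} ≤ μ {x | ENNReal.ofReal ((t/2)^2) ≤ ‖T f2 x‖ₑ ^ (2:ℝ)} := by
        apply measure_mono
        intro x hx
        show ENNReal.ofReal ((t/2)^2) ≤ ‖T f2 x‖ₑ ^ (2:ℝ)
        have hx' : t/2 < ‖T f2 x‖ := hx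
        rw [show (2:ℝ) = ((2:ℕ):ℝ) by norm_num, ENNReal.rpow_natCast, ← ofReal_norm,
          ← ENNReal.ofReal_pow (norm_nonneg _)]
        exact ENNReal.ofReal_le_ofReal (by simpa using (pow_le_pow_left₀ (by positivity) hx'.le 2))
      have h3 : ∫⁻ x, ‖T f2 x‖ₑ ^ (2:ℝ) ∂μ ≤ ENNReal.ofReal (A2 ^ 2) * ∫⁻ x, ‖f2 x‖ₑ ^ (2:ℝ) ∂μ := by
        have := hL2 f2 hf2L
        rw [L2Hyp.eL2, L2Hyp.eL2] at this
        have h4 := ENNReal.rpow_le_rpow this (show (0:ℝ) ≤ 2 by norm_num)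
        rw [ENNReal.mul_rpow_of_nonneg _ _ (by norm_num), ← ENNReal.rpow_mul, ← ENNReal.rpow_mul,
          ENNReal.ofReal_rpow_of_nonneg hA2 (by norm_num)] at h4
        simpa using h4
      have e : ∫⁻ x, ‖f2 x‖ₑ ^ (2:ℝ) ∂μ = ∫⁻ x, (if t < F x then 0 else ENNReal.ofReal (F x ^ 2)) ∂μ := by
        congr 1; funext x; simp only [hf2]; split_ifs
        · simp
        · rw [← ofReal_norm, ENNReal.ofReal_rpow_of_nonneg (norm_nonneg _) (by norm_num)]; simp [hF]
      rw [e] at h3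
      have e2 : t ^ (p-1) = (4 * t ^ (p-3)) * (t/2)^2 := by
        have : t ^ (p-1) = t ^ (p-3) * t ^ (2:ℕ) := by
          rw [← Real.rpow_natCast, ← Real.rpow_add ht]; congr 1; push_cast; ring
        rw [this]; ring
      rw [e2, ENNReal.ofReal_mul (by positivity)]
      calc _ = ENNReal.ofReal (4 * t ^ (p-3)) * (ENNReal.ofReal ((t/2)^2) * μ {x | t/2 < ‖T f2 x‖}) := by ring
        _ ≤ ENNReal.ofReal (4 * t ^ (p-3)) * (ENNReal.ofReal (A2 ^ 2) * ∫⁻ x, (if t < F x then 0 else ENNReal.ofReal (F x ^ 2)) ∂μ) :=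
            mul_le_mul_right ((mul_le_mul_right h2 _).trans (h1.trans h3)) _
        _ = _ := by
          rw [ENNReal.ofReal_mul (p := 4) (by positivity), ENNReal.ofReal_mul (p := 4) (by positivity)]; ring
    calc _ ≤ (μ {x | t/2 < ‖T f1 x‖} + μ {x | t/2 < ‖T f2 x‖}) * ENNReal.ofReal (t ^ (p-1)) := by gcongr
      _ ≤ _ := by rw [add_mul]; exact add_le_add h1 h2
  have hms := meas_dist hFm
  have hmain : ∫⁻ x, ENNReal.ofReal (‖T f x‖ ^ p) ∂μ ≤
      ENNReal.ofReal (p * (2 * W * (1/(p-1)) + 4 * A2 ^ 2 * (1/(2-p)))) * I := by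
    rw [lintegral_rpow_eq_lintegral_meas_lt_mul μ (Filter.Eventually.of_forall fun x => norm_nonneg _)
      hTm.measurable.norm.aemeasurable hp0]
    obtain ⟨m1, m2⟩ := marc_int μ F hFm hF0 p hp hp2
    have hp1' : 0 ≤ 1/(p-1) := by rw [one_div]; exact inv_nonneg.2 (by linarith)
    have hp2' : 0 ≤ 1/(2-p) := by rw [one_div]; exact inv_nonneg.2 (by linarith)
    rw [ENNReal.ofReal_mul hp0.le, mul_assoc]
    refine mul_le_mul_right ?_ _
    calc _ ≤ ∫⁻ t in Set.Ioi (0:ℝ), (ENNReal.ofReal (2 * W) * (ENNReal.ofReal (t^(p-2)) * (∫⁻ x, (if t < F x then ENNReal.ofReal (F x) else 0) ∂μ)) +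
      ENNReal.ofReal (4 * A2 ^ 2) * (ENNReal.ofReal (t^(p-3)) * (∫⁻ x, (if t < F x then 0 else ENNReal.ofReal (F x ^ 2)) ∂μ))) :=
          setLIntegral_mono' measurableSet_Ioi fun t ht => hdist t ht
      _ = ENNReal.ofReal (2 * W) * (∫⁻ t in Set.Ioi (0:ℝ), ENNReal.ofReal (t^(p-2)) * (∫⁻ x, (if t < F x then ENNReal.ofReal (F x) else 0) ∂μ)) +
         ENNReal.ofReal (4 * A2 ^ 2) * ∫⁻ t in Set.Ioi (0:ℝ), (ENNReal.ofReal (t^(p-3)) * (∫⁻ x, (if t < F x then 0 else ENNReal.ofReal (F x ^ 2)) ∂μ)) := by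
          rw [lintegral_add_left, lintegral_const_mul' _ _ ENNReal.ofReal_ne_top, lintegral_const_mul' _ _ ENNReal.ofReal_ne_top]
          refine Measurable.const_mul (Measurable.mul (measurable_id.pow_const _).ennreal_ofReal ?_) _
          exact Measurable.lintegral_prod_right' (f := fun z : ℝ × X => if z.1 < F z.2 then ENNReal.ofReal (F z.2) else 0)
            (Measurable.ite hms (hFm.comp measurable_snd).ennreal_ofReal measurable_const)
      _ ≤ ENNReal.ofReal (2 * W) * (ENNReal.ofReal (1/(p-1)) * I) + ENNReal.ofReal (4 * A2 ^ 2) * (ENNReal.ofReal (1/(2-p)) * I) :=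
          add_le_add (mul_le_mul_right m1 _) (mul_le_mul_right m2 _)
      _ = _ := by
          rw [ENNReal.ofReal_add (by positivity) (by positivity), ENNReal.ofReal_mul (p := 2 * W) (by positivity),
            ENNReal.ofReal_mul (p := 4 * A2 ^ 2) (by positivity)]
          ring
  have hpw : ∀ g : X → ℂ, ∫⁻ x, ‖g x‖ₑ ^ p ∂μ = ∫⁻ x, ENNReal.ofReal (‖g x‖ ^ p) ∂μ := by
    intro g; congr 1; funext x
    rw [← ofReal_norm, ENNReal.ofReal_rpow_of_nonneg (norm_nonneg _) hp0.le]
  rw [eLp_eq _ p hp0, eLp_eq _ p hp0, hpw, hpw]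
  refine (ENNReal.rpow_le_rpow hmain (by positivity)).trans ?_
  rw [ENNReal.mul_rpow_of_nonneg _ _ (by positivity), ENNReal.ofReal_rpow_of_nonneg _ (by positivity)]
  have hp1' : 0 ≤ 1/(p-1) := by rw [one_div]; exact inv_nonneg.2 (by linarith)
  have hp2' : 0 ≤ 1/(2-p) := by rw [one_div]; exact inv_nonneg.2 (by linarith)
  positivity

/-- Calderon-Zygmund theorem -/
theorem AReg.CZ {X : Type*} [MetricSpace X] [MeasurableSpace X] [BorelSpace X]
  [SecondCountableTopology X] {μ : Measure X} [IsFiniteMeasure μ] {Q : ℕ} {C R0 : ℝ}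
    (h : AReg μ Q C R0) (A2 C1 : ℝ) (hA2 : 0 ≤ A2) (hC1 : 0 ≤ C1) (p : ℝ) (hp : 1 < p) :
    ∃ A : ℝ, 0 ≤ A ∧ ∀ K : BKer X,
    (∀ f : X → ℂ, MemLp f 2 μ →
      eLpNorm (fun x => ∫ y, K.k x y * f y ∂μ) 2 μ ≤ ENNReal.ofReal A2 * eLpNorm f 2 μ) →
    (∀ x y y0, 2 * dist y y0 ≤ dist x y0 →
      ‖K.k x y - K.k x y0‖ ≤ C1 * (dist y y0 / dist x y0 ^ (Q+1))) →
    (∀ x y y0, 2 * dist y y0 ≤ dist x y0 →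
      ‖K.k y x - K.k y0 x‖ ≤ C1 * (dist y y0 / dist x y0 ^ (Q+1))) →
    ∀ f : X → ℂ, MemLp f (ENNReal.ofReal p) μ →
      eLpNorm (fun x => ∫ y, K.k x y * f y ∂μ) (ENNReal.ofReal p) μ ≤
        ENNReal.ofReal A * eLpNorm f (ENNReal.ofReal p) μ := by
  have hCpos : 0 < C := by linarith [h.hC]
  set W := 12 * A2 ^ 2 * (1 + C ^ 2 * 8 ^ Q) + 4 * (C1 * C * 2 ^ (2*Q+3)) + C ^ 2 * 10 ^ Q + 1 with hW
  have hW0 : 0 ≤ W := by positivity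
  have two : ENNReal.ofReal 2 = 2 := by simp
  rcases lt_trichotomy p 2 with hlt | heq | hgt
  · refine ⟨(p * (2 * W * (1/(p-1)) + 4 * A2 ^ 2 * (1/(2-p)))) ^ (1/p), ?_, ?_⟩
    · have hp1' : 0 ≤ 1/(p-1) := by rw [one_div]; exact inv_nonneg.2 (by linarith)
      have hp2' : 0 ≤ 1/(2-p) := by rw [one_div]; exact inv_nonneg.2 (by linarith)
      positivity
    intro K hL2 hr1 hr2 f hf
    exact marcinkiewicz μ K A2 W hA2 hW0 hL2
      (fun f hf α hα => h.weak11 K A2 C1 hA2 hC1 hL2 hr1 f hf α hα) p hp hlt f hf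
  · subst heq
    refine ⟨A2, hA2, fun K hL2 _ _ f hf => ?_⟩
    rw [two] at hf ⊢
    exact hL2 f hf
  · set q := p.conjExponent with hq
    have hpq : p.HolderConjugate q := Real.HolderConjugate.conjExponent hp
    have hq1 : 1 < q := hpq.symm.lt
    have hq2 : q < 2 := by
      rw [hq, Real.conjExponent, div_lt_iff₀ (by linarith)]; linarith
    have hp1' : 0 ≤ 1/(q-1) := by rw [one_div]; exact inv_nonneg.2 (by linarith)
    have hp2' : 0 ≤ 1/(2-q) := by rw [one_div]; exact inv_nonneg.2 (by linarith)
    refine ⟨(q * (2 * W * (1/(q-1)) + 4 * A2 ^ 2 * (1/(2-q)))) ^ (1/q), by positivity, ?_⟩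
    intro K hL2 hr1 hr2 f hf
    have hL2t : ∀ f : X → ℂ, MemLp f 2 μ →
      eLpNorm (fun x => ∫ y, K.tr.k x y * f y ∂μ) 2 μ ≤ ENNReal.ofReal A2 * eLpNorm f 2 μ := by
      intro f hf
      have := BKer.duality μ K 2 2 Real.HolderConjugate.two_two A2 (by rw [two]; exact hL2) f (by rw [two]; exact hf)
      rw [two] at this
      exact this
    have := BKer.duality μ K.tr p q hpq _ (fun f hf => marcinkiewicz μ K.tr A2 W hA2 hW0 hL2t
      (fun f hf α hα => h.weak11 K.tr A2 C1 hA2 hC1 hL2t hr2 f hf α hα) q hq1 hq2 f hf) f hf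
    exact this

end

noncomputable section
open scoped ENNReal
set_option linter.unusedSectionVars false
set_option linter.unusedVariables false

/-- difference of inverse powers -/
lemma inv_pow_sub_le (a b : ℂ) (m : ℝ) (hm : 0 < m) (ha : m ≤ ‖a‖) (hb : m ≤ ‖b‖) (n : ℕ) :
    ‖(a ^ n)⁻¹ - (b ^ n)⁻¹‖ ≤ n * ‖a - b‖ * (m ^ (n+1))⁻¹ := by
  have ha0 : a ≠ 0 := norm_pos_iff.1 (hm.trans_le ha)
  have hb0 : b ≠ 0 := norm_pos_iff.1 (hm.trans_le hb)
  have hinv : ∀ z : ℂ, m ≤ ‖z‖ → ‖z⁻¹‖ ≤ m⁻¹ := fun z hz => by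
    rw [norm_inv]; exact inv_anti₀ hm hz
  induction n with
  | zero => simp
  | succ n ih =>
    have e : (a ^ (n+1))⁻¹ - (b ^ (n+1))⁻¹ = ((a ^ n)⁻¹ - (b ^ n)⁻¹) * a⁻¹ + (b ^ n)⁻¹ * ((b - a) * (a⁻¹ * b⁻¹)) := by
      field_simp; ring
    rw [e]
    refine (norm_add_le _ _).trans ?_
    have h1 : ‖((a ^ n)⁻¹ - (b ^ n)⁻¹) * a⁻¹‖ ≤ n * ‖a - b‖ * (m ^ (n+1))⁻¹ * m⁻¹ := by
      rw [norm_mul]; exact mul_le_mul ih (hinv a ha) (norm_nonneg _) (by positivity)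
    have h2 : ‖(b ^ n)⁻¹ * ((b - a) * (a⁻¹ * b⁻¹))‖ ≤ (m ^ n)⁻¹ * (‖a - b‖ * (m⁻¹ * m⁻¹)) := by
      rw [norm_mul, norm_mul, norm_mul, norm_sub_rev b a]
      have : ‖(b ^ n)⁻¹‖ ≤ (m ^ n)⁻¹ := by
        rw [norm_inv, norm_pow]; gcongr
      gcongr
      · exact hinv a ha
      · exact hinv b hb
    refine (add_le_add h1 h2).trans (le_of_eq ?_)
    push_cast
    rw [pow_succ m (n+1), pow_succ m n, mul_inv, mul_inv]
    ring

lemma kap_sub_le (n : ℕ) (l : ℝ) (hl : 0 < l) (c : ℝ) (hc : 0 < c) (hc1 : c ≤ 1) (z w : ℂ) (M : ℝ) (hM : 0 < M)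
    (hz : M ≤ ‖z‖) (hw : M ≤ ‖w‖)
    (h1 : c * (l + ‖z‖) ≤ ‖(l:ℂ) + z‖) (h2 : c * (l + ‖w‖) ≤ ‖(l:ℂ) + w‖) :
    ‖kap n l z - kap n l w‖ ≤ ((n+1)^2 * (c ^ (n+2))⁻¹) * ‖z - w‖ * (M ^ (n+1))⁻¹ := by
  set m := c * (l + M) with hm
  have hmpos : 0 < m := by positivity
  have ha : m ≤ ‖(l:ℂ) + z‖ := le_trans (by rw [hm]; gcongr) h1
  have hb : m ≤ ‖(l:ℂ) + w‖ := le_trans (by rw [hm]; gcongr) h2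
  have e1 := inv_pow_sub_le _ _ m hmpos ha hb n
  have e2 := inv_pow_sub_le _ _ m hmpos ha hb (n+1)
  have ed : (l:ℂ) + z - (l + w) = z - w := by ring
  rw [ed] at e1 e2
  have e : kap n l z - kap n l w = ((((l:ℂ) + z) ^ n)⁻¹ - (((l:ℂ) + w) ^ n)⁻¹) +
      (n * l : ℂ) * ((((l:ℂ) + z) ^ (n+1))⁻¹ - (((l:ℂ) + w) ^ (n+1))⁻¹) := by
    unfold kap; ring
  rw [e]
  refine (norm_add_le _ _).trans ?_
  rw [norm_mul]
  have hnl : ‖(n * l : ℂ)‖ = n * l := by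
    rw [norm_mul]; simp [abs_of_pos hl]
  rw [hnl]
  have hcM : c * M ≤ m := by rw [hm]; gcongr; linarith
  have hcl : c * l ≤ m := by rw [hm]; gcongr; linarith
  have i1 : (m ^ (n+1))⁻¹ ≤ (c ^ (n+2))⁻¹ * (M ^ (n+1))⁻¹ := by
    rw [← mul_inv]
    apply inv_anti₀ (by positivity)
    calc c ^ (n+2) * M ^ (n+1) = c * (c * M) ^ (n+1) := by rw [mul_pow]; ring
      _ ≤ 1 * m ^ (n+1) := by gcongr
      _ = _ := one_mul _
  have i2 : l * (m ^ (n+1+1))⁻¹ ≤ (c ^ (n+2))⁻¹ * (M ^ (n+1))⁻¹ := by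
    rw [← mul_inv, ← div_eq_mul_inv, div_le_iff₀ (by positivity)]
    rw [inv_mul_eq_div, le_div_iff₀ (by positivity)]
    calc l * (c ^ (n+2) * M ^ (n+1)) = (c * M) ^ (n+1) * (c * l) := by rw [mul_pow]; ring
      _ ≤ m ^ (n+1) * m := by gcongr
      _ = _ := by ring
  calc _ ≤ n * ‖z - w‖ * (m ^ (n+1))⁻¹ + n * l * (((n+1 : ℕ) : ℝ) * ‖z - w‖ * (m ^ (n+1+1))⁻¹) := by
        gcongr
    _ = n * ‖z - w‖ * (m ^ (n+1))⁻¹ + n * (n+1) * ‖z - w‖ * (l * (m ^ (n+1+1))⁻¹) := by push_cast; ring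
    _ ≤ n * ‖z - w‖ * ((c ^ (n+2))⁻¹ * (M ^ (n+1))⁻¹) + n * (n+1) * ‖z - w‖ * ((c ^ (n+2))⁻¹ * (M ^ (n+1))⁻¹) := by
        gcongr
    _ = (n + n * (n+1)) * ((c ^ (n+2))⁻¹ * ‖z - w‖ * (M ^ (n+1))⁻¹) := by ring
    _ ≤ (n+1)^2 * ((c ^ (n+2))⁻¹ * ‖z - w‖ * (M ^ (n+1))⁻¹) := by
        gcongr; nlinarith
    _ = _ := by ring

/-- full set of hypotheses on the kernel generating function G -/
structure QHyp {X : Type*} [MeasurableSpace X] (μ : Measure X) (n : ℕ) (G : X → X → ℂ)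
    (c C : ℝ) : Prop where
  l2 : L2Hyp μ n G c C
  low : ∀ x, ∀ r : ℝ, 0 < r → r ≤ 1 → ENNReal.ofReal (c * r ^ n) ≤ μ {y | ‖G x y‖ < r}
  bdd : ∀ x y, ‖G x y‖ ≤ C
  R1 : ∀ x y u, ‖G x u - G y u‖ ≤ C * (‖G x y‖ + √‖G x y‖ * √‖G y u‖)
  R2 : ∀ x y u, ‖G u x - G u y‖ ≤ C * (‖G x y‖ + √‖G x y‖ * √‖G u y‖)

namespace QHyp
variable {X : Type*}

lemma areg [MetricSpace X] [MeasurableSpace X] {μ : Measure X} [IsFiniteMeasure μ] {n : ℕ}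
    {G : X → X → ℂ} {c C : ℝ} (h : QHyp μ n G c C) (B : ℝ) (hB : 1 ≤ B)
    (hd1 : ∀ x y, √‖G x y‖ ≤ dist x y) (hd2 : ∀ x y, dist x y ≤ B * √‖G x y‖) :
    ∃ C', AReg μ (2*n) C' (B * (C+1)) := by
  have hc := h.l2.hc
  have hC := h.l2.hC
  set R0 := B * (C+1) with hR0
  have hR0B : B ≤ R0 := by rw [hR0]; nlinarith
  have hR1 : 1 ≤ R0 := by linarith
  refine ⟨1 + C * 2 ^ n + c⁻¹ * R0 ^ (2*n), ?_, by positivity, ?_, ?_, ?_⟩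
  · have : 0 ≤ C * 2 ^ n + c⁻¹ * R0 ^ (2*n) := by positivity
    linarith
  · intro x y
    refine (hd2 x y).trans ?_
    rw [hR0]
    gcongr
    rw [Real.sqrt_le_left (by linarith)]
    refine (h.bdd x y).trans ?_
    nlinarith
  · intro x r hr
    have hsub : Metric.closedBall x r ⊆ {y | ‖G x y‖ < 2 * r ^ 2} := by
      intro y hy
      have h1 : √‖G x y‖ ≤ r := (hd1 x y).trans (by rw [dist_comm]; exact hy)
      have h2 : ‖G x y‖ ≤ r ^ 2 := (Real.sqrt_le_left hr.le).1 h1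
      show ‖G x y‖ < 2 * r ^ 2
      have : 0 < r ^ 2 := by positivity
      linarith
    refine (measure_mono hsub).trans ((h.l2.V1 x _ (by positivity)).trans ?_)
    apply ENNReal.ofReal_le_ofReal
    have e : C * (2 * r ^ 2) ^ n = C * 2 ^ n * r ^ (2*n) := by rw [mul_pow, ← pow_mul]; ring
    rw [e]
    gcongr
    have : 0 ≤ c⁻¹ * R0 ^ (2*n) := by positivity
    linarith
  · intro x r hr hrR
    have hs1 : (r / R0) ^ 2 ≤ 1 := pow_le_one₀ (by positivity) (by rw [div_le_one (by positivity)]; exact hrR)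
    have hl := h.low x ((r / R0) ^ 2) (by positivity) hs1
    have hsub : {y | ‖G x y‖ < (r / R0) ^ 2} ⊆ Metric.closedBall x r := by
      intro y hy
      have hy' : ‖G x y‖ < (r / R0) ^ 2 := hy
      have h1 : √‖G x y‖ ≤ r / R0 := (Real.sqrt_le_left (by positivity)).2 hy'.le
      show dist y x ≤ r
      rw [dist_comm]
      refine (hd2 x y).trans ?_
      calc B * √‖G x y‖ ≤ R0 * (r / R0) := by gcongr
        _ = r := by field_simp
    have h2 := hl.trans (measure_mono hsub)
    calc ENNReal.ofReal (r ^ (2*n)) = ENNReal.ofReal (c⁻¹ * R0 ^ (2*n)) * ENNReal.ofReal (c * ((r / R0) ^ 2) ^ n) := by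
          rw [← ENNReal.ofReal_mul (by positivity)]
          congr 1
          rw [← pow_mul, div_pow]; field_simp
      _ ≤ ENNReal.ofReal (1 + C * 2 ^ n + c⁻¹ * R0 ^ (2*n)) * μ (Metric.closedBall x r) := by
          refine mul_le_mul' (ENNReal.ofReal_le_ofReal ?_) h2
          have : 0 ≤ 1 + C * 2 ^ n := by positivity
          linarith

/-- The kernel as bounded kernel -/
def ker [MeasurableSpace X] {μ : Measure X} {n : ℕ}
    {G : X → X → ℂ} {c C : ℝ} (h : L2Hyp μ n G c C) (l : ℝ) (hl : 0 < l) : BKer X where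
  k := fun x y => kap n l (G x y)
  meas := (measurable_kap n l).comp h.hG
  B := (n+1) * (c ^ (n+1))⁻¹ * (l ^ n)⁻¹
  bd := fun x y => by
    have hc := h.hc
    refine (norm_kap_le n c l h.hc h.hc1 hl _ (h.sec x y l hl)).trans ?_
    gcongr
    have := norm_nonneg (G x y)
    linarith

lemma kreg {n : ℕ} {c C : ℝ} (hc : 0 < c) (hc1 : c ≤ 1) (hC : 0 ≤ C) (B : ℝ) (hB : 1 ≤ B)
    (z w : ℂ) (e d d0 : ℝ) (he : 0 ≤ e) (hed : 2 * e ≤ d0) (hd : d0 ≤ 2 * d)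
    (hz : d ≤ B * √‖z‖) (hw : d0 ≤ B * √‖w‖) (hw' : √‖w‖ ≤ d0)
    (hzw : ‖z - w‖ ≤ C * (e ^ 2 + e * √‖w‖))
    (l : ℝ) (hl : 0 < l) (h1 : c * (l + ‖z‖) ≤ ‖(l:ℂ) + z‖) (h2 : c * (l + ‖w‖) ≤ ‖(l:ℂ) + w‖) :
    ‖kap n l z - kap n l w‖ ≤
      (((n+1)^2 * (c ^ (n+2))⁻¹) * (2 * C * (4 * B ^ 2) ^ (n+1))) * (e / d0 ^ (2*n+1)) := by
  rcases eq_or_lt_of_le (show 0 ≤ d0 by linarith) with h0 | h0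
  · have he0 : e = 0 := by linarith
    rw [he0] at hzw
    have : z = w := by
      have h3 : ‖z - w‖ ≤ 0 := by simpa using hzw
      exact sub_eq_zero.1 (norm_le_zero_iff.1 h3)
    rw [this, ← h0]; simp
  have hB0 : 0 < B := by linarith
  set M := d0 ^ 2 / (4 * B ^ 2) with hM
  have hMpos : 0 < M := by positivity
  have key : ∀ u : ℂ, d0 ≤ 2 * (B * √‖u‖) → M ≤ ‖u‖ := by
    intro u hu
    rw [hM, div_le_iff₀ (by positivity)]
    have : d0 ^ 2 ≤ (2 * (B * √‖u‖)) ^ 2 := by gcongr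
    rw [mul_pow, mul_pow, Real.sq_sqrt (norm_nonneg _)] at this
    linarith
  have k1 := kap_sub_le n l hl c hc hc1 z w M hMpos (key z (by linarith)) (key w (by nlinarith [Real.sqrt_nonneg ‖w‖])) h1 h2
  refine k1.trans ?_
  rw [mul_assoc, mul_assoc ((n+1:ℝ)^2 * (c ^ (n+2))⁻¹)]
  refine mul_le_mul_of_nonneg_left ?_ (by positivity)
  have hb : ‖z - w‖ ≤ 2 * C * (e * d0) := by
    refine hzw.trans ?_
    have : e ^ 2 + e * √‖w‖ ≤ 2 * (e * d0) := by
      have : e * √‖w‖ ≤ e * d0 := by gcongr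
      nlinarith
    calc _ ≤ C * (2 * (e * d0)) := by gcongr
      _ = _ := by ring
  have hMi : (M ^ (n+1))⁻¹ = (4 * B ^ 2) ^ (n+1) / d0 ^ (2 * n + 2) := by
    rw [hM, div_pow, inv_div, ← pow_mul]; ring_nf
  rw [hMi]
  calc _ ≤ 2 * C * (e * d0) * ((4 * B ^ 2) ^ (n+1) / d0 ^ (2 * n + 2)) := by gcongr
    _ = _ := by
      have : d0 ^ (2*n+2) = d0 ^ (2*n+1) * d0 := by rw [← pow_succ]
      rw [this]; field_simp

theorem czMetric [MetricSpace X] [MeasurableSpace X] [BorelSpace X] [SecondCountableTopology X]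
    {μ : Measure X} [IsFiniteMeasure μ] {n : ℕ}
    {G : X → X → ℂ} {c C : ℝ} (h : QHyp μ n G c C) (B : ℝ) (hB : 1 ≤ B)
    (hd1 : ∀ x y, √‖G x y‖ ≤ dist x y) (hd2 : ∀ x y, dist x y ≤ B * √‖G x y‖) (p : ℝ) (hp : 1 < p) :
    ∃ A : ℝ, 0 ≤ A ∧ ∀ (N : ℕ) (f : X → ℂ), MemLp f (ENNReal.ofReal p) μ →
      eLpNorm (fun x => ∫ y, kap n ((1/2)^N) (G x y) * f y ∂μ) (ENNReal.ofReal p) μ ≤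
        ENNReal.ofReal A * eLpNorm f (ENNReal.ofReal p) μ := by
  obtain ⟨C', hA⟩ := h.areg B hB hd1 hd2
  obtain ⟨A2, hA20, hA2⟩ := h.l2.main
  have hc := h.l2.hc
  have hc1 := h.l2.hc1
  have hC := h.l2.hC
  obtain ⟨A, hA0, hAA⟩ := hA.CZ A2 (((n+1)^2 * (c ^ (n+2))⁻¹) * (2 * C * (4 * B ^ 2) ^ (n+1)))
    hA20 (by positivity) p hp
  refine ⟨A, hA0, fun N f hf => ?_⟩
  have hl : 0 < ((1/2:ℝ)^N) := by positivity
  refine hAA (ker h.l2 _ hl) (fun f hf => hA2 N f hf) ?_ ?_ f hf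
  · intro x y y0 hxy
    refine kreg hc hc1 hC B hB (G x y) (G x y0) (dist y y0) (dist x y) (dist x y0) dist_nonneg hxy ?_
      (hd2 _ _) (hd2 _ _) (hd1 _ _) ?_ _ hl (h.l2.sec _ _ _ hl) (h.l2.sec _ _ _ hl)
    · have := dist_triangle x y y0
      linarith
    · refine (h.R2 y y0 x).trans ?_
      have e := hd1 y y0
      have e2 : ‖G y y0‖ = √‖G y y0‖ ^ 2 := (Real.sq_sqrt (norm_nonneg _)).symm
      rw [e2, Real.sqrt_sq (Real.sqrt_nonneg _)]
      gcongr
  · intro x y y0 hxy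
    have hsym : ∀ a b : X, √‖G a b‖ ≤ dist b a := fun a b => by rw [dist_comm]; exact hd1 a b
    have hsym2 : ∀ a b : X, dist a b ≤ B * √‖G b a‖ := fun a b => by rw [dist_comm]; exact hd2 _ _
    refine kreg hc hc1 hC B hB (G y x) (G y0 x) (dist y y0) (dist x y) (dist x y0) dist_nonneg hxy ?_
      (hsym2 _ _) (hsym2 _ _) (hsym _ _) ?_ _ hl (h.l2.sec _ _ _ hl) (h.l2.sec _ _ _ hl)
    · have := dist_triangle x y y0
      linarith
    · refine (h.R1 y y0 x).trans ?_
      have e := hd1 y y0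
      have e2 : ‖G y y0‖ = √‖G y y0‖ ^ 2 := (Real.sq_sqrt (norm_nonneg _)).symm
      rw [e2, Real.sqrt_sq (Real.sqrt_nonneg _)]
      gcongr

end QHyp
end

noncomputable section
open scoped ENNReal
set_option linter.unusedSectionVars false
set_option linter.unusedVariables false

namespace QHyp

lemma sqrt_aux (a b e C : ℝ) (ha : 0 ≤ a) (hb : 0 ≤ b) (he : 0 ≤ e) (hC : 0 ≤ C)
    (h : |a ^ 2 - b ^ 2| ≤ C * (e ^ 2 + e * b)) : |a - b| ≤ (2 * C + 1) * e := by
  have h' := abs_le.1 h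
  rw [abs_le]
  constructor
  · by_contra hcon
    push Not at hcon
    have h1 : (2 * C + 1) * e < b - a := by linarith
    have h2 : e ≤ (2 * C + 1) * e := by nlinarith
    have hbe : e < b := by linarith
    have h3 : (b - a) * (b + a) ≤ C * e * (e + b) := by nlinarith [h'.1]
    have hba : 0 < b + a := by linarith
    have h4 : ((2 * C + 1) * e) * (b + a) < (b - a) * (b + a) := by nlinarith
    have h5 : C * e * (e + b) ≤ C * e * (2 * (b + a)) := by
      have : e + b ≤ 2 * (b + a) := by linarith
      exact mul_le_mul_of_nonneg_left this (by positivity)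
    nlinarith [mul_nonneg he hba.le]
  · by_contra hcon
    push Not at hcon
    have h2 : e ≤ (2 * C + 1) * e := by nlinarith
    have hae : e < a := by linarith
    have h3 : (a - b) * (a + b) ≤ C * e * (e + b) := by nlinarith [h'.2]
    have hba : 0 < a + b := by linarith
    have h4 : ((2 * C + 1) * e) * (a + b) < (a - b) * (a + b) := by nlinarith
    have h5 : C * e * (e + b) ≤ C * e * (2 * (a + b)) := by
      have : e + b ≤ 2 * (a + b) := by linarith
      exact mul_le_mul_of_nonneg_left this (by positivity)
    nlinarith [mul_nonneg he hba.le]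

variable {X : Type*}

/-- the quasi-distance turned into a distance -/
def qd (G : X → X → ℂ) (x y : X) : ℝ := ⨆ u, |√‖G x u‖ - √‖G y u‖|

section
variable [MeasurableSpace X] {μ : Measure X} {n : ℕ} {G : X → X → ℂ} {c C : ℝ}

lemma qd_term (h : QHyp μ n G c C) (x y u : X) : |√‖G x u‖ - √‖G y u‖| ≤ (2 * C + 1) * √‖G x y‖ := by
  refine sqrt_aux _ _ _ C (Real.sqrt_nonneg _) (Real.sqrt_nonneg _) (Real.sqrt_nonneg _) h.l2.hC ?_
  rw [Real.sq_sqrt (norm_nonneg _), Real.sq_sqrt (norm_nonneg _), Real.sq_sqrt (norm_nonneg _)]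
  exact (abs_norm_sub_norm_le _ _).trans (h.R1 x y u)

lemma qd_bdd (h : QHyp μ n G c C) (x y : X) : BddAbove (Set.range fun u => |√‖G x u‖ - √‖G y u‖|) :=
  ⟨_, by rintro _ ⟨u, rfl⟩; exact h.qd_term x y u⟩

lemma qd_le (h : QHyp μ n G c C) (x y : X) : qd G x y ≤ (2 * C + 1) * √‖G x y‖ := by
  haveI : Nonempty X := ⟨x⟩
  exact ciSup_le fun u => h.qd_term x y u

lemma le_qd (h : QHyp μ n G c C) (h0 : ∀ x, G x x = 0) (x y : X) : √‖G x y‖ ≤ qd G x y := by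
  have := le_ciSup (h.qd_bdd x y) y
  simp only [h0, norm_zero, Real.sqrt_zero, sub_zero] at this
  exact (le_abs_self _).trans this

lemma qd_self (x : X) : qd G x x = 0 := by
  haveI : Nonempty X := ⟨x⟩
  simp [qd]

lemma qd_comm (x y : X) : qd G x y = qd G y x := by
  unfold qd; congr 1; funext u; exact abs_sub_comm _ _

lemma qd_tri (h : QHyp μ n G c C) (x y z : X) : qd G x z ≤ qd G x y + qd G y z := by
  haveI : Nonempty X := ⟨x⟩
  refine ciSup_le fun u => ?_
  have h1 := le_ciSup (h.qd_bdd x y) u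
  have h2 := le_ciSup (h.qd_bdd y z) u
  have := abs_sub_le (√‖G x u‖) (√‖G y u‖) (√‖G z u‖)
  unfold qd
  linarith
end

/-- the metric -/
def qMetric [MetricSpace X] [MeasurableSpace X] {μ : Measure X} {n : ℕ} {G : X → X → ℂ} {c C : ℝ}
    (h : QHyp μ n G c C) (h0 : ∀ x, G x x = 0) (dlow : ∀ x y, c * dist x y ^ 2 ≤ ‖G x y‖)
    (dup : ∀ x y, ‖G x y‖ ≤ C * dist x y) : MetricSpace X :=
  MetricSpace.ofDistTopology (qd G) qd_self qd_comm h.qd_tri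
    (by
      have hc := h.l2.hc
      have hC := h.l2.hC
      intro s
      rw [Metric.isOpen_iff]
      constructor
      · intro hs x hx
        obtain ⟨ε, hε, hb⟩ := hs x hx
        refine ⟨√(c * ε ^ 2), by positivity, fun y hy => hb ?_⟩
        have h1 := (h.le_qd h0 x y).trans_lt hy
        have h2 := lt_of_le_of_lt (dlow x y) ((Real.sqrt_lt_sqrt_iff (norm_nonneg _)).1 h1)
        have h3 : dist x y ^ 2 < ε ^ 2 := lt_of_mul_lt_mul_left h2 hc.le
        rw [Metric.mem_ball, dist_comm]
        exact lt_of_pow_lt_pow_left₀ 2 hε.le h3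
      · intro hs x hx
        obtain ⟨ε, hε, hb⟩ := hs x hx
        refine ⟨(ε / (2 * C + 1)) ^ 2 / (C + 1), by positivity, fun y hy => hb y ?_⟩
        rw [Metric.mem_ball, dist_comm, lt_div_iff₀ (by positivity)] at hy
        have h1 : ‖G x y‖ < (ε / (2 * C + 1)) ^ 2 := by
          refine (dup x y).trans_lt (lt_of_le_of_lt ?_ hy)
          nlinarith [dist_nonneg (x := x) (y := y)]
        have h2 : √‖G x y‖ < ε / (2 * C + 1) := (Real.sqrt_lt' (by positivity)).2 h1
        refine (h.qd_le x y).trans_lt ?_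
        rw [lt_div_iff₀ (by positivity)] at h2
        linarith)
    (by
      intro x y hxy
      have h1 := h.le_qd h0 x y
      rw [hxy] at h1
      have h2 : √‖G x y‖ = 0 := le_antisymm h1 (Real.sqrt_nonneg _)
      rw [Real.sqrt_eq_zero (norm_nonneg _)] at h2
      have h3 := dlow x y
      rw [h2] at h3
      have hc := h.l2.hc
      have h4 : dist x y ^ 2 ≤ 0 := by
        by_contra hcon
        push Not at hcon
        nlinarith
      have : dist x y = 0 := by
        have := sq_nonneg (dist x y)
        exact pow_eq_zero_iff (two_ne_zero) |>.1 (le_antisymm h4 this)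
      exact dist_eq_zero.1 this)

theorem cz [MetricSpace X] [MeasurableSpace X] [BorelSpace X] [SecondCountableTopology X]
    {μ : Measure X} [IsFiniteMeasure μ] {n : ℕ}
    {G : X → X → ℂ} {c C : ℝ} (h : QHyp μ n G c C) (h0 : ∀ x, G x x = 0)
    (dlow : ∀ x y, c * dist x y ^ 2 ≤ ‖G x y‖)
    (dup : ∀ x y, ‖G x y‖ ≤ C * dist x y) (p : ℝ) (hp : 1 < p) :
    ∃ A : ℝ, 0 ≤ A ∧ ∀ (N : ℕ) (f : X → ℂ), MemLp f (ENNReal.ofReal p) μ →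
      eLpNorm (fun x => ∫ y, kap n ((1/2)^N) (G x y) * f y ∂μ) (ENNReal.ofReal p) μ ≤
        ENNReal.ofReal A * eLpNorm f (ENNReal.ofReal p) μ :=
  @czMetric X (qMetric h h0 dlow dup) _ (by assumption) (by assumption) μ _ n G c C h (2 * C + 1)
    (by have := h.l2.hC; linarith) (fun x y => h.le_qd h0 x y) (fun x y => h.qd_le x y) p hp

end QHyp
end

noncomputable section
open scoped ENNReal
set_option linter.unusedSectionVars false
set_option linter.unusedVariables false

/-- the truncated kernel function -/
def trK (n : ℕ) (ε : ℝ) (g : ℂ) : ℂ := if ε < ‖g‖ then (g ^ n)⁻¹ else 0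

/-- weight -/
def wG (n : ℕ) (z : ℂ) : ℝ := ‖z‖ * (‖z‖ ^ n)⁻¹

lemma wG_nonneg (n : ℕ) (z : ℂ) : 0 ≤ wG n z := by unfold wG; positivity

lemma measurable_wG (n : ℕ) : Measurable (wG n) := by unfold wG; fun_prop

lemma measurable_trK (n : ℕ) (ε : ℝ) : Measurable (trK n ε) := by
  unfold trK
  refine Measurable.ite ?_ (by fun_prop) measurable_const
  exact measurableSet_lt measurable_const measurable_norm

lemma trK_bd (n : ℕ) (ε : ℝ) (hε : 0 < ε) (g : ℂ) : ‖trK n ε g‖ ≤ (ε ^ n)⁻¹ := by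
  unfold trK
  split_ifs with h
  · rw [norm_inv, norm_pow]; gcongr
  · simp; positivity

lemma trK_sub (n : ℕ) (c B l ε : ℝ) (hc : 0 < c) (hc1 : c ≤ 1) (hB : 1 ≤ B) (hl : 0 < l)
    (hle : l ≤ ε) (hel : ε ≤ 2 * l) (g G : ℂ) (h1 : ‖g - G‖ ≤ B * ‖G‖ ^ 2) (h2 : ‖g‖ ≤ B * ‖G‖)
    (h3 : ‖G‖ ≤ B * ‖g‖) (hs : c * (l + ‖G‖) ≤ ‖(l:ℂ) + G‖) :
    ‖trK n ε g - kap n l G‖ ≤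
      ((n+1) * (c ^ (n+1))⁻¹ * (1 + 2 * B) + n * B ^ (n+2) + n * ((2 * B) ^ (n+1) * (c ^ (n+1))⁻¹)
        + n * (c ^ (n+1))⁻¹) * (mL n l G + wG n G) := by
  have hB0 : 0 < B := by linarith
  have hG0 := norm_nonneg G
  have hm := mL_nonneg n l hl G
  have hw := wG_nonneg n G
  set a := ((n:ℝ)+1) * (c ^ (n+1))⁻¹ * (1 + 2 * B) with ha
  set b := (n:ℝ) * B ^ (n+2) with hb
  set d := (n:ℝ) * ((2 * B) ^ (n+1) * (c ^ (n+1))⁻¹) with hd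
  set e := (n:ℝ) * (c ^ (n+1))⁻¹ with he
  have ha0 : 0 ≤ a := by positivity
  have hb0 : 0 ≤ b := by positivity
  have hd0 : 0 ≤ d := by positivity
  have he0 : 0 ≤ e := by positivity
  unfold trK
  split_ifs with h
  · have hGl : l < B * ‖G‖ := by
      have : l < ‖g‖ := by linarith
      linarith
    have hGp : 0 < ‖G‖ := by
      by_contra hh
      have : ‖G‖ = 0 := by linarith
      rw [this] at hGl; linarith
    have e1 : ‖(g ^ n)⁻¹ - (G ^ n)⁻¹‖ ≤ b * wG n G := by
      refine (inv_pow_sub_le g G (‖G‖ / B) (by positivity) ?_ ?_ n).trans ?_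
      · rw [div_le_iff₀ hB0]; linarith
      · rw [div_le_iff₀ hB0]; nlinarith
      · calc (n:ℝ) * ‖g - G‖ * ((‖G‖ / B) ^ (n+1))⁻¹ ≤ n * (B * ‖G‖ ^ 2) * ((‖G‖ / B) ^ (n+1))⁻¹ := by gcongr
          _ = b * wG n G := by rw [hb]; unfold wG; rw [div_pow]; field_simp; ring
    have e2 : ‖(G ^ n)⁻¹ - (((l:ℂ) + G) ^ n)⁻¹‖ ≤ d * mL n l G := by
      refine (inv_pow_sub_le G ((l:ℂ) + G) (c * (l + ‖G‖) / (2 * B)) (by positivity) ?_ ?_ n).trans ?_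
      · rw [div_le_iff₀ (by positivity)]
        nlinarith
      · refine le_trans ?_ hs
        exact div_le_self (by positivity) (by linarith)
      · have : ‖G - ((l:ℂ) + G)‖ = l := by
          have : G - ((l:ℂ) + G) = -(l:ℂ) := by ring
          rw [this, norm_neg, Complex.norm_real, Real.norm_of_nonneg hl.le]
        rw [this, hd]; unfold mL
        apply le_of_eq; rw [div_pow, mul_pow]; field_simp
    have e3 : ‖(n:ℂ) * l * (((l:ℂ) + G) ^ (n+1))⁻¹‖ ≤ e * mL n l G := by
      rw [norm_mul, norm_mul, Complex.norm_natCast, Complex.norm_real, Real.norm_of_nonneg hl.le]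
      have := norm_inv_pow_le c l hc hl G (n+1) hs
      calc (n:ℝ) * l * ‖(((l:ℂ) + G) ^ (n+1))⁻¹‖ ≤ n * l * ((c ^ (n+1))⁻¹ * ((l + ‖G‖) ^ (n+1))⁻¹) := by gcongr
        _ = _ := by rw [he]; unfold mL; ring
    have : (g ^ n)⁻¹ - kap n l G = ((g ^ n)⁻¹ - (G ^ n)⁻¹) + ((G ^ n)⁻¹ - (((l:ℂ) + G) ^ n)⁻¹)
        - (n:ℂ) * l * (((l:ℂ) + G) ^ (n+1))⁻¹ := by unfold kap; ring
    rw [this]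
    refine (norm_sub_le _ _).trans ?_
    have := norm_add_le ((g ^ n)⁻¹ - (G ^ n)⁻¹) ((G ^ n)⁻¹ - (((l:ℂ) + G) ^ n)⁻¹)
    nlinarith [mul_nonneg ha0 hm, mul_nonneg ha0 hw, mul_nonneg hb0 hm, mul_nonneg hd0 hw, mul_nonneg he0 hw]
  · rw [zero_sub, norm_neg]
    push Not at h
    have h5 : ‖kap n l G‖ ≤ a * mL n l G := by
      refine (norm_kap_le n c l hc hc1 hl G hs).trans ?_
      rw [ha]; unfold mL
      have h6 : l + ‖G‖ ≤ (1 + 2 * B) * l := by nlinarith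
      have : ((l + ‖G‖) ^ n)⁻¹ ≤ (1 + 2 * B) * (l * ((l + ‖G‖) ^ (n+1))⁻¹) := by
        have e : ((l + ‖G‖) ^ n)⁻¹ = (l + ‖G‖) * ((l + ‖G‖) ^ (n+1))⁻¹ := by
          have : 0 < l + ‖G‖ := by linarith
          field_simp
          ring
        rw [e, ← mul_assoc]
        gcongr
      calc _ ≤ ((n:ℝ)+1) * (c ^ (n+1))⁻¹ * ((1 + 2 * B) * (l * ((l + ‖G‖) ^ (n+1))⁻¹)) := by gcongr
        _ = _ := by ring
    nlinarith [mul_nonneg ha0 hw, mul_nonneg hb0 hm, mul_nonneg hb0 hw, mul_nonneg hd0 hm, mul_nonneg hd0 hw, mul_nonneg he0 hw, mul_nonneg he0 hm]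

lemma wG_le (n : ℕ) (C : ℝ) (z : ℂ) (hz : ‖z‖ ≤ C) :
    ENNReal.ofReal (wG n z) ≤ ENNReal.ofReal C +
      ENNReal.ofReal (4 ^ (n+1)) * ∑' j : ℕ, ENNReal.ofReal ((1/2)^j) * ENNReal.ofReal (mL n ((1/2)^j) z) := by
  rcases le_or_gt ‖z‖ 1 with h1 | h1
  · rcases eq_or_lt_of_le (norm_nonneg z) with h0 | h0
    · have : wG n z = 0 := by unfold wG; rw [← h0]; simp
      rw [this]; simp
    · obtain ⟨j, hj1, hj2⟩ := exists_nat_pow_near_of_lt_one h0 h1 (show (0:ℝ) < 1/2 by norm_num) (by norm_num)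
      refine le_trans ?_ le_add_self
      refine le_trans ?_ (mul_le_mul_right (ENNReal.le_tsum j) _)
      rw [← ENNReal.ofReal_mul (by positivity), ← ENNReal.ofReal_mul (by positivity)]
      refine ENNReal.ofReal_le_ofReal ?_
      set t : ℝ := (1/2)^j with ht
      have htp : 0 < t := by positivity
      have hj3 : t < 2 * ‖z‖ := by
        have : (1/2:ℝ)^(j+1) = t / 2 := by rw [pow_succ]; ring
        rw [this] at hj1; linarith
      unfold wG mL
      have hb : ((4 * ‖z‖) ^ (n+1))⁻¹ ≤ ((t + ‖z‖) ^ (n+1))⁻¹ := by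
        gcongr; linarith
      calc ‖z‖ * (‖z‖ ^ n)⁻¹ = 4 ^ (n+1) * (‖z‖ * (‖z‖ * ((4 * ‖z‖) ^ (n+1))⁻¹)) := by
            rw [mul_pow]; field_simp; ring
        _ ≤ 4 ^ (n+1) * (t * (t * ((t + ‖z‖) ^ (n+1))⁻¹)) := by gcongr
  · refine le_trans (ENNReal.ofReal_le_ofReal ?_) le_self_add
    unfold wG
    refine (mul_le_of_le_one_right (norm_nonneg _) ?_).trans hz
    exact inv_le_one_of_one_le₀ (one_le_pow₀ h1.le)

lemma wG_int {X : Type*} [MeasurableSpace X] (μ : Measure X) (n : ℕ) (C M : ℝ) (F : X → ℂ) (hF : Measurable F)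
    (hb : ∀ x, ‖F x‖ ≤ C) (hm : ∀ l : ℝ, 0 < l → ∫⁻ x, ENNReal.ofReal (mL n l (F x)) ∂μ ≤ ENNReal.ofReal M) :
    ∫⁻ x, ENNReal.ofReal (wG n (F x)) ∂μ ≤ ENNReal.ofReal C * μ Set.univ +
      ENNReal.ofReal (4 ^ (n+1)) * ((∑' j : ℕ, ENNReal.ofReal ((1/2)^j)) * ENNReal.ofReal M) := by
  have hmm : ∀ l, Measurable fun x => ENNReal.ofReal (mL n l (F x)) := fun l =>
    ((measurable_mL n l).comp hF).ennreal_ofReal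
  refine (lintegral_mono fun x => wG_le n C _ (hb x)).trans ?_
  rw [lintegral_add_left measurable_const, lintegral_const]
  refine add_le_add_right ?_ _
  rw [lintegral_const_mul _ (Measurable.tsum fun j => (hmm _).const_mul _)]
  refine mul_le_mul_right ?_ _
  rw [lintegral_tsum (fun j => ((hmm _).const_mul _).aemeasurable), ← ENNReal.tsum_mul_right]
  refine ENNReal.tsum_le_tsum fun j => ?_
  rw [lintegral_const_mul _ (hmm _)]
  exact mul_le_mul_right (hm _ (by positivity)) _

lemma geo_ne_top : (∑' j : ℕ, ENNReal.ofReal ((1/2)^j)) ≠ ⊤ := by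
  rw [← ENNReal.ofReal_tsum_of_nonneg (fun j => by positivity) (summable_geometric_of_lt_one (by norm_num) (by norm_num))]
  exact ENNReal.ofReal_ne_top

/-- operator norm statement for bounded kernels -/
lemma BKer.close {X : Type*} [MeasurableSpace X] {μ : Measure X} [IsFiniteMeasure μ]
    (K L : BKer X) (k : X → X → ℝ≥0∞) (hk : Measurable (Function.uncurry k))
    (hK : ∀ x y, ‖K.k x y - L.k x y‖ₑ ≤ k x y) (C A : ℝ≥0∞)
    (hA : ∀ x, ∫⁻ y, k x y ∂μ ≤ C) (hB : ∀ y, ∫⁻ x, k x y ∂μ ≤ C) (p : ℝ) (hp : 1 < p)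
    (f : X → ℂ) (hf : MemLp f (ENNReal.ofReal p) μ)
    (hL : eLpNorm (fun x => ∫ y, L.k x y * f y ∂μ) (ENNReal.ofReal p) μ ≤
      A * eLpNorm f (ENNReal.ofReal p) μ) :
    eLpNorm (fun x => ∫ y, K.k x y * f y ∂μ) (ENNReal.ofReal p) μ ≤
      (C + A) * eLpNorm f (ENNReal.ofReal p) μ := by
  have hp1 : 1 ≤ ENNReal.ofReal p := by
    rw [← ENNReal.ofReal_one]; exact ENNReal.ofReal_le_ofReal hp.le
  have hfi : Integrable f μ := hf.integrable hp1
  have e : (fun x => ∫ y, K.k x y * f y ∂μ) =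
      (fun x => ∫ y, (K.k x y - L.k x y) * f y ∂μ) + fun x => ∫ y, L.k x y * f y ∂μ := by
    funext x
    rw [Pi.add_apply, ← integral_add]
    · congr 1; funext y; ring
    · simp_rw [sub_mul]
      exact (K.integ μ f hfi x).sub (L.integ μ f hfi x)
    · exact L.integ μ f hfi x
  have hsm : AEStronglyMeasurable (fun x => ∫ y, (K.k x y - L.k x y) * f y ∂μ) μ := by
    have : (fun x => ∫ y, (K.k x y - L.k x y) * f y ∂μ) =
      (fun x => ∫ y, K.k x y * f y ∂μ) - fun x => ∫ y, L.k x y * f y ∂μ := by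
      funext x
      rw [Pi.sub_apply, ← integral_sub (K.integ μ f hfi x) (L.integ μ f hfi x)]
      congr 1; funext y; ring
    rw [this]
    exact ((K.smA μ f hf.1).sub (L.smA μ f hf.1)).aestronglyMeasurable
  rw [e]
  refine (eLpNorm_add_le hsm (L.smA μ f hf.1).aestronglyMeasurable hp1).trans ?_
  rw [add_mul]
  exact add_le_add (schur_eLpNorm _ k hk hK C hA hB p hp f hf.1) hL

/-- bounded truncated kernel -/
def trB {X : Type*} [MeasurableSpace X] (n : ℕ) (g : X → X → ℂ) (hg : Measurable (Function.uncurry g))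
    (ε : ℝ) (hε : 0 < ε) : BKer X where
  k := fun x y => trK n ε (g x y)
  meas := (measurable_trK n ε).comp hg
  B := (ε ^ n)⁻¹
  bd := fun x y => trK_bd n ε hε _

theorem QHyp.trunc {X : Type*} [MetricSpace X] [MeasurableSpace X] [BorelSpace X] [SecondCountableTopology X]
    {μ : Measure X} [IsFiniteMeasure μ] {n : ℕ}
    {G : X → X → ℂ} {c C : ℝ} (h : QHyp μ n G c C) (h0 : ∀ x, G x x = 0)
    (dlow : ∀ x y, c * dist x y ^ 2 ≤ ‖G x y‖)
    (dup : ∀ x y, ‖G x y‖ ≤ C * dist x y)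
    (g : X → X → ℂ) (hg : Measurable (Function.uncurry g)) (B : ℝ) (hB : 1 ≤ B)
    (h1 : ∀ x y, ‖g x y - G x y‖ ≤ B * ‖G x y‖ ^ 2) (h2 : ∀ x y, ‖g x y‖ ≤ B * ‖G x y‖)
    (h3 : ∀ x y, ‖G x y‖ ≤ B * ‖g x y‖) (p : ℝ) (hp : 1 < p) :
    ∃ A : ℝ≥0∞, A ≠ ⊤ ∧ ∀ (ε : ℝ), 0 < ε → ∀ (f : X → ℂ), MemLp f (ENNReal.ofReal p) μ →
      eLpNorm (fun x => ∫ y, trK n ε (g x y) * f y ∂μ) (ENNReal.ofReal p) μ ≤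
        A * eLpNorm f (ENNReal.ofReal p) μ := by
  obtain ⟨A, hA0, hA⟩ := h.cz h0 dlow dup p hp
  have hc := h.l2.hc
  have hC := h.l2.hC
  set K : ℝ := ((n+1) * (c ^ (n+1))⁻¹ * (1 + 2 * B) + n * B ^ (n+2) + n * ((2 * B) ^ (n+1) * (c ^ (n+1))⁻¹)
        + n * (c ^ (n+1))⁻¹) with hK
  have hK0 : 0 ≤ K := by positivity
  set W : ℝ≥0∞ := ENNReal.ofReal C * μ Set.univ +
      ENNReal.ofReal (4 ^ (n+1)) * ((∑' j : ℕ, ENNReal.ofReal ((1/2)^j)) * ENNReal.ofReal (C * 2 ^ (n+2))) with hW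
  have hWt : W ≠ ⊤ := by
    refine ENNReal.add_ne_top.2 ⟨ENNReal.mul_ne_top ENNReal.ofReal_ne_top (measure_ne_top _ _), ?_⟩
    exact ENNReal.mul_ne_top ENNReal.ofReal_ne_top (ENNReal.mul_ne_top geo_ne_top ENNReal.ofReal_ne_top)
  set S : ℝ≥0∞ := ENNReal.ofReal K * (ENNReal.ofReal (C * 2 ^ (n+2)) + W) with hS
  refine ⟨μ Set.univ + (S + ENNReal.ofReal A), ?_, ?_⟩
  · refine ENNReal.add_ne_top.2 ⟨measure_ne_top _ _, ENNReal.add_ne_top.2 ⟨?_, ENNReal.ofReal_ne_top⟩⟩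
    exact ENNReal.mul_ne_top ENNReal.ofReal_ne_top (ENNReal.add_ne_top.2 ⟨ENNReal.ofReal_ne_top, hWt⟩)
  intro ε hε f hf
  rcases le_or_gt 1 ε with h1ε | h1ε
  · refine le_trans (schur_eLpNorm (μ := μ) (fun x y => trK n ε (g x y)) (fun _ _ => 1) measurable_const
      ?_ (μ Set.univ) (by simp) (by simp) p hp f hf.1) ?_
    · intro x y
      rw [← ofReal_norm, ← ENNReal.ofReal_one]
      refine ENNReal.ofReal_le_ofReal ((trK_bd n ε hε _).trans ?_)
      exact inv_le_one_of_one_le₀ (one_le_pow₀ h1ε)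
    · rw [add_mul]; exact le_self_add
  · obtain ⟨N, hN1, hN2⟩ := exists_nat_pow_near_of_lt_one hε h1ε.le (show (0:ℝ) < 1/2 by norm_num) (by norm_num)
    set l : ℝ := (1/2)^(N+1) with hl
    have hlp : 0 < l := by positivity
    have hmm : Measurable (Function.uncurry fun x y => ENNReal.ofReal (mL n l (G x y))) :=
      ((measurable_mL n l).comp h.l2.hG).ennreal_ofReal
    have hww : Measurable (Function.uncurry fun x y => ENNReal.ofReal (wG n (G x y))) :=
      ((measurable_wG n).comp h.l2.hG).ennreal_ofReal
    have key := BKer.close (μ := μ) (trB n g hg ε hε) (QHyp.ker h.l2 l hlp)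
      (fun x y => ENNReal.ofReal K * (ENNReal.ofReal (mL n l (G x y)) + ENNReal.ofReal (wG n (G x y))))
      ((hmm.add hww).const_mul _) ?_ S (ENNReal.ofReal A) ?_ ?_ p hp f hf (hA (N+1) f hf)
    · refine le_trans key ?_
      exact mul_le_mul_left le_add_self _
    · intro x y
      rw [← ENNReal.ofReal_add (mL_nonneg _ _ hlp _) (wG_nonneg _ _), ← ENNReal.ofReal_mul hK0, ← ofReal_norm]
      refine ENNReal.ofReal_le_ofReal ?_
      have hεl : ε ≤ 2 * l := by
        have : (1/2:ℝ)^N = 2 * l := by rw [hl, pow_succ]; ring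
        rw [← this]; exact hN2
      exact trK_sub n c B l ε hc h.l2.hc1 hB hlp hN1.le hεl _ _ (h1 x y) (h2 x y) (h3 x y) (h.l2.sec x y l hlp)
    · intro x
      have hGx : Measurable (G x) := h.l2.hG.comp measurable_prodMk_left
      have m1 : Measurable fun y => ENNReal.ofReal (mL n l (G x y)) :=
        ((measurable_mL n l).comp hGx).ennreal_ofReal
      have m2 : Measurable fun y => ENNReal.ofReal (wG n (G x y)) :=
        ((measurable_wG n).comp hGx).ennreal_ofReal
      rw [lintegral_const_mul' _ _ ENNReal.ofReal_ne_top, lintegral_add_left m1]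
      refine mul_le_mul_right (add_le_add (h.l2.hA l hlp x) ?_) _
      exact wG_int μ n C _ (G x) hGx (h.bdd x) (fun l hl => h.l2.hA l hl x)
    · intro y
      have hGx : Measurable (fun x => G x y) := h.l2.hG.comp measurable_prodMk_right
      have m1 : Measurable fun x => ENNReal.ofReal (mL n l (G x y)) :=
        ((measurable_mL n l).comp hGx).ennreal_ofReal
      have m2 : Measurable fun x => ENNReal.ofReal (wG n (G x y)) :=
        ((measurable_wG n).comp hGx).ennreal_ofReal
      rw [lintegral_const_mul' _ _ ENNReal.ofReal_ne_top, lintegral_add_left m1]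
      refine mul_le_mul_right (add_le_add (h.l2.hB l hlp y) ?_) _
      exact wG_int μ n C _ (fun x => G x y) hGx (fun x => h.bdd x y) (fun l hl => h.l2.hB l hl y)
end

noncomputable section
open scoped ENNReal
set_option linter.unusedSectionVars false
set_option linter.unusedVariables false

theorem change_measure {X : Type*} [MeasurableSpace X] {μ σ : Measure X} [IsFiniteMeasure μ] [IsFiniteMeasure σ]
    (a : ℝ≥0∞) (ha : a ≠ ⊤) (h1 : σ ≤ a • μ) (h2 : μ ≤ a • σ) (K : X → X → ℂ) (A : ℝ≥0∞) (p : ℝ) (hp : 1 < p)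
    (hA : ∀ f : X → ℂ, MemLp f (ENNReal.ofReal p) μ →
      eLpNorm (fun x => ∫ y, K x y * f y ∂μ) (ENNReal.ofReal p) μ ≤ A * eLpNorm f (ENNReal.ofReal p) μ)
    (f : X → ℂ) (hf : MemLp f (ENNReal.ofReal p) σ) :
    eLpNorm (fun x => ∫ y, K x y * f y ∂σ) (ENNReal.ofReal p) σ ≤
      (a ^ (1 / p) * (a * (A * a ^ (1 / p)))) * eLpNorm f (ENNReal.ofReal p) σ := by
  set q := ENNReal.ofReal p with hq
  have hp0 : 0 < p := by linarith
  have hqt : q ≠ ⊤ := ENNReal.ofReal_ne_top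
  have hq1 : q.toReal = p := ENNReal.toReal_ofReal hp0.le
  have hee : (1 / q.toReal) = 1 / p := by rw [hq1]
  have hfm : MemLp f q μ := hf.of_measure_le_smul ha h2
  haveI : IsFiniteMeasure (a • μ) := μ.smul_finite ha
  have hac : σ ≪ a • μ := Measure.absolutelyContinuous_of_le h1
  set ψ : X → ℝ := fun y => (σ.rnDeriv (a • μ) y).toReal with hψ
  have hψm : Measurable ψ := (Measure.measurable_rnDeriv _ _).ennreal_toReal
  set F : X → ℂ := fun y => (min (ψ y) 1 : ℝ) * f y with hF
  have hFm : AEStronglyMeasurable F μ := by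
    refine AEStronglyMeasurable.mul ?_ hfm.1
    exact (Complex.measurable_ofReal.comp (hψm.min measurable_const)).aestronglyMeasurable
  have hFle : ∀ y, ‖F y‖ ≤ ‖f y‖ := by
    intro y
    have h0 : 0 ≤ ψ y := ENNReal.toReal_nonneg
    rw [hF, norm_mul, Complex.norm_real, Real.norm_of_nonneg (le_min h0 zero_le_one)]
    exact mul_le_of_le_one_left (norm_nonneg _) (min_le_right _ _)
  have hFL : MemLp F q μ := hfm.mono hFm (Filter.Eventually.of_forall hFle)
  have hle1 : ∀ᵐ y ∂(a • μ), ψ y ≤ 1 := by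
    filter_upwards [Measure.rnDeriv_le_one_of_le h1] with y hy
    exact ENNReal.toReal_le_of_le_ofReal zero_le_one (by simpa using hy)
  have e : (fun x => ∫ y, K x y * f y ∂σ) = fun x => a.toReal • ∫ y, K x y * F y ∂μ := by
    funext x
    rw [← integral_rnDeriv_smul hac, ← integral_smul_measure]
    refine integral_congr_ae ?_
    filter_upwards [hle1] with y hy
    rw [hF]
    simp only []
    rw [min_eq_left hy, Complex.real_smul]
    ring
  rw [e]
  have b1 : eLpNorm (fun x => a.toReal • ∫ y, K x y * F y ∂μ) q μ ≤ a * (A * eLpNorm f q μ) := by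
    refine (eLpNorm_const_smul_le (c := a.toReal) (f := fun x => ∫ y, K x y * F y ∂μ)).trans ?_
    have : ‖a.toReal‖ₑ = a := by
      rw [Real.enorm_of_nonneg ENNReal.toReal_nonneg, ENNReal.ofReal_toReal ha]
    rw [this]
    refine mul_le_mul_right ((hA F hFL).trans (mul_le_mul_right ?_ _)) _
    exact eLpNorm_mono hFle
  have b2 : ∀ (h : X → ℂ), eLpNorm h q σ ≤ a ^ (1/p) * eLpNorm h q μ := by
    intro h
    refine (eLpNorm_mono_measure h h1).trans ?_
    rw [eLpNorm_smul_measure_of_ne_top hqt]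
    simp [hq1]
  have b3 : ∀ (h : X → ℂ), eLpNorm h q μ ≤ a ^ (1/p) * eLpNorm h q σ := by
    intro h
    refine (eLpNorm_mono_measure h h2).trans ?_
    rw [eLpNorm_smul_measure_of_ne_top hqt]
    simp [hq1]
  refine (b2 _).trans ?_
  rw [mul_assoc]
  refine mul_le_mul_right (b1.trans ?_) _
  rw [mul_assoc, mul_assoc]
  exact mul_le_mul_right (mul_le_mul_right (b3 f) _) _

/-- transfer from a measurable subset as a subtype -/
theorem subtype_transfer {E : Type*} [MeasurableSpace E] (S : Set E) (hS : MeasurableSet S) (σ : Measure E)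
    (g : E → E → ℂ) (n : ℕ) (ε : ℝ) (hg : ∀ z : S, Measurable fun w : S => g w z)
    (p : ℝ) (A : ℝ≥0∞)
    (hA : ∀ f : S → ℂ, MemLp f (ENNReal.ofReal p) (Measure.comap Subtype.val σ) →
      eLpNorm (fun x : S => ∫ y : S, trK n ε (g y x) * f y ∂(Measure.comap Subtype.val σ)) (ENNReal.ofReal p)
        (Measure.comap Subtype.val σ) ≤ A * eLpNorm f (ENNReal.ofReal p) (Measure.comap Subtype.val σ))
    (f : E → ℂ) (hf : MemLp f (ENNReal.ofReal p) (σ.restrict S)) :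
    eLpNorm (fun z => ∫ w in {w | ε < ‖g w z‖}, f w * (g w z ^ n)⁻¹ ∂(σ.restrict S)) (ENNReal.ofReal p) (σ.restrict S)
     ≤ A * eLpNorm f (ENNReal.ofReal p) (σ.restrict S) := by
  have hme : MeasurableEmbedding (Subtype.val : S → E) := MeasurableEmbedding.subtype_coe hS
  have hmap : σ.restrict S = Measure.map Subtype.val (Measure.comap (Subtype.val : S → E) σ) := by
    rw [hme.map_comap]; simp
  rw [hmap, hme.eLpNorm_map_measure, hme.eLpNorm_map_measure]
  have hf' : MemLp (f ∘ Subtype.val) (ENNReal.ofReal p) (Measure.comap (Subtype.val : S → E) σ) := by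
    rw [hmap] at hf
    exact (hme.memLp_map_measure_iff).1 hf
  refine le_trans (le_of_eq ?_) (hA (f ∘ Subtype.val) hf')
  congr 1
  funext z
  simp only [Function.comp_apply]
  rw [hme.setIntegral_map, ← integral_indicator]
  · congr 1
    funext w
    unfold trK
    by_cases hw : ε < ‖g w z‖
    · rw [Set.indicator_of_mem (show w ∈ Subtype.val ⁻¹' {w | ε < ‖g w z‖} from hw), if_pos hw, mul_comm]
    · rw [Set.indicator_of_notMem (show w ∉ Subtype.val ⁻¹' {w | ε < ‖g w z‖} from hw), if_neg hw, zero_mul]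
  · exact measurableSet_lt measurable_const (hg z).norm
end

noncomputable section
open scoped ENNReal
set_option linter.unusedSectionVars false
set_option linter.unusedVariables false

/-- multiplication by `i` as a real linear map -/
def Jm (n : ℕ) : Cn n →L[ℝ] Cn n := (ContinuousLinearMap.lsmul ℝ ℂ Complex.I).restrictScalars ℝ

/-- the (1,0)-differential as an `ℝ`-linear operator of the differential -/
def toD (n : ℕ) : (Cn n →L[ℝ] ℝ) →L[ℝ] (Cn n →L[ℝ] ℂ) :=
  ((1/2:ℝ)) • (ContinuousLinearMap.compL ℝ (Cn n) ℝ ℂ Complex.ofRealCLM -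
    ((Complex.I) • (ContinuousLinearMap.compL ℝ (Cn n) ℝ ℂ Complex.ofRealCLM)).comp 
      ((ContinuousLinearMap.compL ℝ (Cn n) (Cn n) ℝ).flip (Jm n)))

/-- `⟨∂ρ(w), ·⟩` -/
def D1 {n : ℕ} (ρ : Cn n → ℝ) (w : Cn n) : Cn n →L[ℝ] ℂ := toD n (fderiv ℝ ρ w)

lemma toD_apply (n : ℕ) (L : Cn n →L[ℝ] ℝ) (ξ : Cn n) :
    toD n L ξ = (1/2) * ((L ξ : ℂ) - Complex.I * (L (Complex.I • ξ) : ℝ)) := by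
  simp [toD, Jm]

lemma toD_re (n : ℕ) (L : Cn n →L[ℝ] ℝ) (ξ : Cn n) : (toD n L ξ).re = (1/2) * L ξ := by
  rw [toD_apply]; simp

lemma toD_I (n : ℕ) (L : Cn n →L[ℝ] ℝ) (ξ : Cn n) : toD n L (Complex.I • ξ) = Complex.I * toD n L ξ := by
  rw [toD_apply, toD_apply, smul_smul, Complex.I_mul_I, neg_one_smul, map_neg]
  push_cast
  linear_combination (1/2) * (L (Complex.I • ξ) : ℂ) * Complex.I_mul_I

lemma toD_smul (n : ℕ) (L : Cn n →L[ℝ] ℝ) (a : ℂ) (ξ : Cn n) : toD n L (a • ξ) = a * toD n L ξ := by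
  have : a • ξ = a.re • ξ + a.im • (Complex.I • ξ) := by
    rw [← Complex.coe_smul, ← Complex.coe_smul, smul_smul, ← add_smul, Complex.re_add_im]
  rw [this, map_add, map_smul, map_smul, toD_I]
  conv_rhs => rw [← Complex.re_add_im a]
  simp only [Complex.real_smul]
  ring

lemma delPair_eq {n : ℕ} (ρ : Cn n → ℝ) (w ξ : Cn n) (h : DifferentiableAt ℝ ρ w) :
    delPair ρ w ξ = D1 ρ w ξ := by
  have hf : ∀ v, fderiv ℝ (realToC ρ) w v = (fderiv ℝ ρ w v : ℂ) := by
    intro v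
    have : HasFDerivAt (realToC ρ) (Complex.ofRealCLM.comp (fderiv ℝ ρ w)) w :=
      Complex.ofRealCLM.hasFDerivAt.comp w h.hasFDerivAt
    rw [this.fderiv]; simp
  have hw : ∀ j, wderiv (realToC ρ) w j = D1 ρ w (EuclideanSpace.single j (1:ℂ)) := by
    intro j
    rw [D1, toD_apply, wderiv, hf, hf]
    congr 4
    congr 1
    ext i
    simp [Pi.single_apply]
  unfold delPair
  simp_rw [hw]
  have hx : ξ = ∑ j, ξ j • EuclideanSpace.single j (1:ℂ) := by
    ext i
    simp [Pi.single_apply]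
  conv_rhs => rw [hx, map_sum]
  refine Finset.sum_congr rfl fun j _ => ?_
  rw [D1, toD_smul, mul_comm]

lemma toD_norm (n : ℕ) (L : Cn n →L[ℝ] ℝ) (ξ : Cn n) : ‖toD n L ξ‖ ≤ ‖L‖ * ‖ξ‖ := by
  rw [toD_apply, norm_mul]
  have h1 : ‖(L ξ : ℂ)‖ ≤ ‖L‖ * ‖ξ‖ := by rw [Complex.norm_real]; exact L.le_opNorm ξ
  have h2 : ‖Complex.I * ((L (Complex.I • ξ) : ℝ) : ℂ)‖ ≤ ‖L‖ * ‖ξ‖ := by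
    rw [norm_mul, Complex.norm_I, one_mul, Complex.norm_real]
    refine (L.le_opNorm _).trans ?_
    rw [norm_smul, Complex.norm_I, one_mul]
  have h3 := norm_sub_le (L ξ : ℂ) (Complex.I * ((L (Complex.I • ξ) : ℝ) : ℂ))
  have : ‖(1/2:ℂ)‖ = 1/2 := by norm_num
  rw [this]; linarith

/-- basic quantitative facts on the boundary -/
structure PreGeo {n : ℕ} (D U : Set (Cn n)) (ρ : Cn n → ℝ) (M δ : ℝ) : Prop where
  hM : 1 ≤ M
  hδ : 0 < δ
  comp : IsCompact (frontier D)
  zero : ∀ w ∈ U, (ρ w = 0 ↔ w ∈ frontier D)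
  p1 : ∀ w ∈ frontier D, ‖fderiv ℝ ρ w‖ ≤ M
  p2 : ∀ w ∈ frontier D, ∀ z ∈ frontier D, ‖fderiv ℝ ρ w - fderiv ℝ ρ z‖ ≤ M * ‖w - z‖
  p3 : ∀ w ∈ frontier D, ∀ z, ‖z - w‖ ≤ δ → z ∈ U ∧ |ρ z - ρ w - fderiv ℝ ρ w (z - w)| ≤ M * ‖z - w‖ ^ 2
  p4 : ∀ w ∈ frontier D, ∃ N, D1 ρ w N = 1 ∧ ‖N‖ ≤ M
  p5 : ∀ w ∈ frontier D, ∀ z ∈ frontier D, ‖w - z‖ ≤ M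

lemma frontier_zero {n : ℕ} (D U : Set (Cn n)) (ρ : Cn n → ℝ)
    (hDo : IsOpen D) (hUo : IsOpen U) (hρ : ContDiffOn ℝ 2 ρ U)
    (hdef : U ∩ D = {w ∈ U | ρ w < 0}) (hgrad : ∀ w ∈ U, fderiv ℝ ρ w ≠ 0) (w : Cn n) (hw : w ∈ U) :
    ρ w = 0 ↔ w ∈ frontier D := by
  have hda : DifferentiableAt ℝ ρ w := (hρ.contDiffAt (hUo.mem_nhds hw)).differentiableAt (by norm_num)
  have hmem : ∀ z ∈ U, (z ∈ D ↔ ρ z < 0) := by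
    intro z hz
    have : z ∈ U ∩ D ↔ z ∈ {w ∈ U | ρ w < 0} := by rw [hdef]
    constructor
    · intro h; exact (this.1 ⟨hz, h⟩).2
    · intro h; exact (this.2 ⟨hz, h⟩).2
  rw [hDo.frontier_eq]
  constructor
  · intro h0
    refine ⟨?_, fun hD => by have := (hmem w hw).1 hD; linarith⟩
    by_contra hcl
    -- local minimum
    have : IsLocalMin ρ w := by
      have : ∀ᶠ z in nhds w, z ∈ U ∧ z ∉ closure D :=
        (hUo.eventually_mem hw).and (isClosed_closure.isOpen_compl.mem_nhds hcl)
      filter_upwards [this] with z hz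
      rw [h0]
      by_contra hh
      push Not at hh
      exact hz.2 (subset_closure ((hmem z hz.1).2 hh))
    exact hgrad w hw this.fderiv_eq_zero
  · rintro ⟨hcl, hnD⟩
    have h1 : 0 ≤ ρ w := by
      by_contra hh; push Not at hh; exact hnD ((hmem w hw).2 hh)
    refine le_antisymm ?_ h1
    by_contra hh
    push Not at hh
    have : ∀ᶠ z in nhds w, z ∈ U ∧ 0 < ρ z :=
      (hUo.eventually_mem hw).and (hda.continuousAt.eventually (lt_mem_nhds hh))
    obtain ⟨z, hz, hzD⟩ := mem_closure_iff_nhds.1 hcl _ this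
    have := (hmem z hz.1).1 hzD
    linarith [hz.2]

lemma preGeo_exists {n : ℕ} (D U : Set (Cn n)) (ρ : Cn n → ℝ)
    (hDo : IsOpen D) (hDb : Bornology.IsBounded D) (hUo : IsOpen U) (hUb : frontier D ⊆ U)
    (hρ : ContDiffOn ℝ 2 ρ U) (hdef : U ∩ D = {w ∈ U | ρ w < 0}) (hgrad : ∀ w ∈ U, fderiv ℝ ρ w ≠ 0) :
    ∃ M δ, PreGeo D U ρ M δ := by
  have hcomp : IsCompact (frontier D) :=
    Metric.isCompact_of_isClosed_isBounded isClosed_frontier (hDb.closure.subset frontier_subset_closure)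
  obtain ⟨δ, hδ, hT⟩ := hcomp.exists_cthickening_subset_open hUo hUb
  have hTc : IsCompact (Metric.cthickening δ (frontier D)) := hcomp.cthickening
  set T := Metric.cthickening δ (frontier D) with hTdef
  have hST : frontier D ⊆ T := Metric.self_subset_cthickening _
  have hC1 : ContDiffOn ℝ 1 (fderiv ℝ ρ) U := hρ.fderiv_of_isOpen hUo (by norm_num)
  have hll : LocallyLipschitzOn T (fderiv ℝ ρ) := by
    intro x hx
    obtain ⟨K, t, ht, hK⟩ := (hC1.contDiffAt (hUo.mem_nhds (hT hx))).exists_lipschitzOnWith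
    exact ⟨K, t, mem_nhdsWithin_of_mem_nhds ht, hK⟩
  obtain ⟨L, hL⟩ := hll.exists_lipschitzOnWith_of_compact hTc
  obtain ⟨B, hB⟩ := hTc.exists_bound_of_continuousOn (hC1.continuousOn.mono hT)
  have hci : ContinuousOn (fun w => ‖fderiv ℝ ρ w‖⁻¹) (frontier D) :=
    ContinuousOn.inv₀ (hC1.continuousOn.mono hUb).norm fun w hw => norm_ne_zero_iff.2 (hgrad w (hUb hw))
  obtain ⟨b, hb⟩ := hcomp.exists_bound_of_continuousOn hci
  obtain ⟨d, hd⟩ := hcomp.isBounded.exists_norm_le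
  set M : ℝ := max 1 (max L (max B (max (4 * b) (2 * d)))) with hM
  have hM1 : 1 ≤ M := le_max_left _ _
  have hMr : ∀ x, x ≤ max (L:ℝ) (max B (max (4 * b) (2 * d))) → x ≤ M := fun x hx => hx.trans (le_max_right _ _)
  have hML : (L:ℝ) ≤ M := hMr _ (le_max_left _ _)
  have hMB : B ≤ M := hMr _ ((le_max_left _ _).trans (le_max_right _ _))
  have hMb : 4 * b ≤ M := hMr _ (((le_max_left _ _).trans (le_max_right _ _)).trans (le_max_right _ _))
  have hMd : 2 * d ≤ M := hMr _ (((le_max_right _ _).trans (le_max_right _ _)).trans (le_max_right _ _))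
  refine ⟨M, δ, hM1, hδ, hcomp, frontier_zero D U ρ hDo hUo hρ hdef hgrad, ?_, ?_, ?_, ?_, ?_⟩
  · intro w hw; exact (hB w (hST hw)).trans hMB
  · intro w hw z hz
    have := hL.dist_le_mul w (hST hw) z (hST hz)
    rw [dist_eq_norm, dist_eq_norm] at this
    exact this.trans (by gcongr)
  · intro w hw z hz
    have hball : Metric.closedBall w δ ⊆ T := Metric.closedBall_subset_cthickening hw δ
    have hzU : z ∈ Metric.closedBall w δ := by rwa [Metric.mem_closedBall, dist_eq_norm]
    refine ⟨hT (hball hzU), ?_⟩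
    have hsub : Metric.closedBall w ‖z - w‖ ⊆ T := (Metric.closedBall_subset_closedBall hz).trans hball
    have := (convex_closedBall w ‖z - w‖).norm_image_sub_le_of_norm_fderiv_le' (𝕜 := ℝ) (f := ρ)
      (φ := fderiv ℝ ρ w) (C := M * ‖z - w‖) (x := w) (y := z) ?_ ?_ ?_ ?_
    · rw [Real.norm_eq_abs] at this
      linarith [this]
    · intro x hx
      exact (hρ.contDiffAt (hUo.mem_nhds (hT (hsub hx)))).differentiableAt (by norm_num)
    · intro x hx
      have := hL.dist_le_mul x (hsub hx) w (hST hw)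
      rw [dist_eq_norm] at this
      have hx' : dist x w ≤ ‖z - w‖ := hx
      exact this.trans (by gcongr)
    · simp
    · simp [dist_eq_norm]
  · intro w hw
    have hn0 : 0 < ‖fderiv ℝ ρ w‖ := norm_pos_iff.2 (hgrad w (hUb hw))
    obtain ⟨x, hx1, hx2⟩ := (fderiv ℝ ρ w).exists_lt_apply_of_lt_opNorm (half_lt_self hn0)
    have hre := toD_re n (fderiv ℝ ρ w) x
    have hge : ‖fderiv ℝ ρ w‖ / 4 ≤ ‖D1 ρ w x‖ := by
      have := Complex.abs_re_le_norm (D1 ρ w x)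
      rw [D1, hre, abs_mul] at this
      rw [Real.norm_eq_abs] at hx2
      have h2 : |(1/2:ℝ)| = 1/2 := by norm_num
      rw [h2] at this
      rw [D1]
      linarith
    have hne : D1 ρ w x ≠ 0 := by
      rw [← norm_pos_iff]; linarith
    refine ⟨(D1 ρ w x)⁻¹ • x, ?_, ?_⟩
    · rw [D1, toD_smul]; exact inv_mul_cancel₀ hne
    · rw [norm_smul, norm_inv]
      have hbw := hb w hw
      rw [norm_inv, norm_norm] at hbw
      have : ‖D1 ρ w x‖⁻¹ ≤ (‖fderiv ℝ ρ w‖ / 4)⁻¹ := by gcongr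
      rw [inv_div] at this
      have h4 : 4 / ‖fderiv ℝ ρ w‖ = 4 * ‖fderiv ℝ ρ w‖⁻¹ := div_eq_mul_inv _ _
      have h5 : ‖D1 ρ w x‖⁻¹ * ‖x‖ ≤ ‖D1 ρ w x‖⁻¹ := mul_le_of_le_one_right (by positivity) hx1.le
      linarith
  · intro w hw z hz
    have := norm_sub_le w z
    linarith [hd w hw, hd z hz]
end

noncomputable section
open scoped ENNReal
set_option linter.unusedSectionVars false
set_option linter.unusedVariables false

/-- the Leray function -/
def gg {n : ℕ} (ρ : Cn n → ℝ) (w z : Cn n) : ℂ := D1 ρ w (w - z)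
/-- the modified Leray function -/
def GG {n : ℕ} (ρ : Cn n → ℝ) (A : ℝ) (w z : Cn n) : ℂ := gg ρ w z + ((A * (‖w - z‖ ^ 2) ^ 2 : ℝ) : ℂ)

structure Geo {n : ℕ} (D U : Set (Cn n)) (ρ : Cn n → ℝ) (M δ c A K : ℝ) : Prop where
  pre : PreGeo D U ρ M δ
  hc : 0 < c
  hc1 : c ≤ 1
  hA : 0 ≤ A
  hK : 1 ≤ K
  Uo : IsOpen U
  SU : frontier D ⊆ U
  smooth : ContDiffOn ℝ 2 ρ U
  grad : ∀ w ∈ U, fderiv ℝ ρ w ≠ 0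
  low : ∀ w ∈ frontier D, ∀ z ∈ frontier D, c * ‖w - z‖ ^ 2 ≤ ‖gg ρ w z‖
  sec : ∀ w ∈ frontier D, ∀ z ∈ frontier D, -(K * |(GG ρ A w z).im|) ≤ (GG ρ A w z).re
  cmp : ∀ w ∈ frontier D, ∀ z ∈ frontier D, ‖gg ρ w z‖ ≤ K * ‖GG ρ A w z‖

lemma D1_norm {n : ℕ} {D U : Set (Cn n)} {ρ : Cn n → ℝ} {M δ : ℝ} (h : PreGeo D U ρ M δ) (w : Cn n)
    (hw : w ∈ frontier D) (ξ : Cn n) : ‖D1 ρ w ξ‖ ≤ M * ‖ξ‖ :=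
  (toD_norm n _ ξ).trans (by have := h.p1 w hw; gcongr)

lemma near_sector {n : ℕ} (D U : Set (Cn n)) (ρ : Cn n → ℝ)
    (hUb : frontier D ⊆ U)
    (hρ : ContDiffOn ℝ 2 ρ U) (hdef : U ∩ D = {w ∈ U | ρ w < 0})
    (c : ℝ) (hc : 0 < c)
    (hconv : ∀ w ∈ frontier D, ∀ z ∈ closure D, c * ‖w - z‖ ^ 2 ≤ ‖D1 ρ w (w - z)‖)
    (M δ : ℝ) (h : PreGeo D U ρ M δ) (δ0 : ℝ) (hδ0 : 0 < δ0) (hδ1 : δ0 ≤ δ) (hδ2 : M ^ 2 * δ0 ≤ 1 / 4)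
    (w : Cn n) (hw : w ∈ frontier D) (z : Cn n) (hz : z ∈ frontier D) (hwz : ‖w - z‖ ≤ δ0)
    (hre : (gg ρ w z).re < 0) : |(gg ρ w z).re| ≤ (4 * M / c) * |(gg ρ w z).im| := by
  have hM := h.hM
  set d := ‖w - z‖ with hd
  have hd0 : 0 ≤ d := norm_nonneg _
  set g := gg ρ w z with hg
  set t := -g.re with ht
  have htpos : 0 < t := by linarith
  have hρw : ρ w = 0 := (h.zero w (hUb hw)).2 hw
  have hρz : ρ z = 0 := (h.zero z (hUb hz)).2 hz
  have hgre : g.re = 1/2 * fderiv ℝ ρ w (w - z) := toD_re n _ _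
  have htd : t ≤ M * d ^ 2 := by
    have h1 := (h.p3 w hw z (by rw [norm_sub_rev]; linarith)).2
    rw [hρw, hρz, norm_sub_rev, ← neg_sub w z, map_neg, ← hd] at h1
    have := (abs_le.1 h1)
    have h2 : 0 ≤ M * d ^ 2 := by positivity
    rw [ht, hgre]
    have e : (0:ℝ) - 0 - -(fderiv ℝ ρ w) (w - z) = (fderiv ℝ ρ w) (w - z) := by ring
    rw [e] at this
    linarith [this.1]
  obtain ⟨N, hN1, hN2⟩ := h.p4 w hw
  have hMd : M ^ 2 * d ≤ 1 / 4 := le_trans (by gcongr) hδ2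
  set z' := z - t • N with hz'
  have htN : ‖t • N‖ ≤ M ^ 2 * d ^ 2 := by
    rw [norm_smul, Real.norm_of_nonneg htpos.le]
    calc t * ‖N‖ ≤ (M * d ^ 2) * M := by gcongr
      _ = _ := by ring
  have hzz : ‖z' - z‖ = ‖t • N‖ := by rw [hz', sub_sub_cancel_left, norm_neg]
  have hzz2 : ‖z' - z‖ ≤ δ := by
    rw [hzz]; refine htN.trans ?_
    nlinarith
  obtain ⟨hz'U, hz'ρ⟩ := h.p3 z hz z' hzz2
  have hdN : fderiv ℝ ρ w N = 2 := by
    have := toD_re n (fderiv ℝ ρ w) N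
    have h2 : toD n (fderiv ℝ ρ w) N = 1 := hN1
    rw [h2] at this
    simp at this; linarith
  have hdzN : 2 - M ^ 2 * d ≤ fderiv ℝ ρ z N := by
    have h1 := (fderiv ℝ ρ w - fderiv ℝ ρ z).le_opNorm N
    have h2 := h.p2 w hw z hz
    have h3 : ‖fderiv ℝ ρ w - fderiv ℝ ρ z‖ * ‖N‖ ≤ (M * d) * M := by gcongr
    rw [ContinuousLinearMap.sub_apply, hdN, Real.norm_eq_abs] at h1
    have := (abs_le.1 h1).2
    nlinarith
  have hneg : ρ z' < 0 := by
    have h1 : fderiv ℝ ρ z (z' - z) = -(t * fderiv ℝ ρ z N) := by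
      rw [hz', sub_sub_cancel_left, map_neg, map_smul, smul_eq_mul]
    rw [hρz, h1, hzz, norm_smul, Real.norm_of_nonneg htpos.le] at hz'ρ
    have h2 := (abs_le.1 hz'ρ).2
    have h3 : M * (t * ‖N‖) ^ 2 ≤ M * (t * M) ^ 2 := by gcongr
    have h4 : M ^ 3 * t ≤ 1 / 16 := by
      calc M ^ 3 * t ≤ M ^ 3 * (M * d ^ 2) := by gcongr
        _ = (M ^ 2 * d) ^ 2 := by ring
        _ ≤ (1/4) ^ 2 := by gcongr
        _ = 1 / 16 := by norm_num
    have h5 : t * (2 - M ^ 2 * d) ≤ t * fderiv ℝ ρ z N := by gcongr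
    have h6 : M * (t * M) ^ 2 = t * (M ^ 3 * t) := by ring
    have h7 : t * (M ^ 3 * t) ≤ t * (1/16) := by gcongr
    have h8 : t * (M ^ 2 * d) ≤ t * (1/4) := by gcongr
    nlinarith
  have hz'D : z' ∈ D := by
    have : z' ∈ U ∩ D := by rw [hdef]; exact ⟨hz'U, hneg⟩
    exact this.2
  have hcv := hconv w hw z' (subset_closure hz'D)
  have he : D1 ρ w (w - z') = g + t := by
    have : w - z' = (w - z) + t • N := by rw [hz']; abel
    rw [this, map_add, map_smul, hN1, Complex.real_smul, mul_one]; rfl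
  have he2 : ‖g + (t:ℂ)‖ = |g.im| := by
    have : g + (t:ℂ) = (g.im : ℂ) * Complex.I := by
      apply Complex.ext <;> simp [ht]
    rw [this, norm_mul, Complex.norm_I, mul_one, Complex.norm_real, Real.norm_eq_abs]
  rw [he, he2] at hcv
  have hlow : d / 2 ≤ ‖w - z'‖ := by
    have h1 : w - z = (w - z') - t • N := by rw [hz']; abel
    have h2 : d ≤ ‖w - z'‖ + ‖t • N‖ := by rw [hd, h1]; exact norm_sub_le _ _
    nlinarith
  have h9 : c * (d / 2) ^ 2 ≤ |g.im| := le_trans (by gcongr) hcv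
  rw [abs_of_neg hre]
  have h10 : 4 * M / c * (c * (d / 2) ^ 2) ≤ 4 * M / c * |g.im| := by gcongr
  have h11 : 4 * M / c * (c * (d / 2) ^ 2) = M * d ^ 2 := by field_simp; ring
  linarith

lemma geo_exists {n : ℕ} (D U : Set (Cn n)) (ρ : Cn n → ℝ)
    (hDo : IsOpen D) (hDb : Bornology.IsBounded D) (hUo : IsOpen U) (hUb : frontier D ⊆ U)
    (hρ : ContDiffOn ℝ 2 ρ U) (hdef : U ∩ D = {w ∈ U | ρ w < 0}) (hgrad : ∀ w ∈ U, fderiv ℝ ρ w ≠ 0)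
    (c : ℝ) (hc : 0 < c)
    (hconv : ∀ w ∈ frontier D, ∀ z ∈ closure D, c * ‖w - z‖ ^ 2 ≤ ‖delPair ρ w (w - z)‖) :
    ∃ M δ c A K, Geo D U ρ M δ c A K := by
  obtain ⟨M, δ, h⟩ := preGeo_exists D U ρ hDo hDb hUo hUb hρ hdef hgrad
  have hM := h.hM
  have hδ := h.hδ
  have hconv' : ∀ w ∈ frontier D, ∀ z ∈ closure D, c * ‖w - z‖ ^ 2 ≤ ‖D1 ρ w (w - z)‖ := by
    intro w hw z hz
    rw [← delPair_eq ρ w _ ((hρ.contDiffAt (hUo.mem_nhds (hUb hw))).differentiableAt (by norm_num))]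
    exact hconv w hw z hz
  set δ0 : ℝ := min δ (1 / (4 * M ^ 2)) with hδ0
  have hδ0p : 0 < δ0 := lt_min hδ (by positivity)
  have hδ2 : M ^ 2 * δ0 ≤ 1 / 4 := by
    calc M ^ 2 * δ0 ≤ M ^ 2 * (1 / (4 * M ^ 2)) := by gcongr; exact min_le_right _ _
      _ = 1 / 4 := by field_simp
  set A : ℝ := 2 * M ^ 2 / (δ0 ^ 2) ^ 2 with hA
  set K : ℝ := 4 * M / c + 1 with hK
  have hK0 : 0 ≤ 4 * M / c := by positivity
  have hgn : ∀ w ∈ frontier D, ∀ z ∈ frontier D, ‖gg ρ w z‖ ≤ M ^ 2 := by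
    intro w hw z hz
    refine (D1_norm h w hw _).trans ?_
    have := h.p5 w hw z hz
    nlinarith
  have hA0 : 0 ≤ A := by positivity
  have him : ∀ w z, (GG ρ A w z).im = (gg ρ w z).im := by intro w z; unfold GG; rw [Complex.add_im, Complex.ofReal_im, add_zero]
  have hre : ∀ w z, (GG ρ A w z).re = (gg ρ w z).re + A * (‖w - z‖ ^ 2) ^ 2 := by
    intro w z; unfold GG; rw [Complex.add_re, Complex.ofReal_re]
  have hrege : ∀ w z, (gg ρ w z).re ≤ (GG ρ A w z).re := by
    intro w z; rw [hre]; have : 0 ≤ A * (‖w - z‖ ^ 2) ^ 2 := by positivity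
    linarith
  have hfar : ∀ w ∈ frontier D, ∀ z ∈ frontier D, δ0 < ‖w - z‖ → ‖gg ρ w z‖ ≤ (GG ρ A w z).re := by
    intro w hw z hz hd
    have h1 : A * (δ0 ^ 2) ^ 2 ≤ A * (‖w - z‖ ^ 2) ^ 2 := by gcongr
    have h2 : A * (δ0 ^ 2) ^ 2 = 2 * M ^ 2 := by rw [hA]; field_simp
    have h3 := hgn w hw z hz
    have h4 := (abs_le.1 ((Complex.abs_re_le_norm (gg ρ w z)).trans h3)).1
    rw [hre]; linarith
  have hnear : ∀ w ∈ frontier D, ∀ z ∈ frontier D, ‖w - z‖ ≤ δ0 → (gg ρ w z).re < 0 →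
      |(gg ρ w z).re| ≤ (4 * M / c) * |(gg ρ w z).im| := fun w hw z hz hd hr =>
    near_sector D U ρ hUb hρ hdef c hc hconv' M δ h δ0 hδ0p (min_le_left _ _) hδ2 w hw z hz hd hr
  have hcc : 0 < min c 1 := lt_min hc one_pos
  refine ⟨M, δ, min c 1, A, K, h, hcc, min_le_right _ _, hA0, by linarith, hUo, hUb, hρ, hgrad, ?_, ?_, ?_⟩
  · intro w hw z hz
    refine le_trans ?_ (hconv' w hw z (frontier_subset_closure hz))
    gcongr; exact min_le_left _ _
  · intro w hw z hz
    have hi := abs_nonneg (gg ρ w z).im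
    rw [him]
    rcases le_or_gt ‖w - z‖ δ0 with hd | hd
    · rcases lt_or_ge (gg ρ w z).re 0 with hr | hr
      · have h1 := hnear w hw z hz hd hr
        have h2 := neg_abs_le (gg ρ w z).re
        have h3 := hrege w z
        nlinarith
      · have h3 := hrege w z
        have : 0 ≤ K * |(gg ρ w z).im| := by positivity
        linarith
    · have h1 := hfar w hw z hz hd
      have := norm_nonneg (gg ρ w z)
      have : 0 ≤ K * |(gg ρ w z).im| := by positivity
      linarith
  · intro w hw z hz
    have hG := norm_nonneg (GG ρ A w z)
    have hKG : ‖GG ρ A w z‖ ≤ K * ‖GG ρ A w z‖ := le_mul_of_one_le_left hG (by linarith)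
    have hn2 := Complex.abs_im_le_norm (GG ρ A w z)
    rw [him] at hn2
    rcases le_or_gt ‖w - z‖ δ0 with hd | hd
    · rcases lt_or_ge (gg ρ w z).re 0 with hr | hr
      · have h1 := hnear w hw z hz hd hr
        have h2 := Complex.norm_le_abs_re_add_abs_im (gg ρ w z)
        have h3 : (4 * M / c) * |(gg ρ w z).im| ≤ (4 * M / c) * ‖GG ρ A w z‖ := by gcongr
        rw [hK, add_mul, one_mul]; linarith
      · refine le_trans ?_ hKG
        rw [Complex.norm_def, Complex.norm_def]
        apply Real.sqrt_le_sqrt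
        rw [Complex.normSq_apply, Complex.normSq_apply, him]
        have := hrege w z
        nlinarith
    · exact ((hfar w hw z hz hd).trans (Complex.re_le_norm _)).trans hKG
end

noncomputable section
open scoped ENNReal
set_option linter.unusedSectionVars false
set_option linter.unusedVariables false

lemma sector_aux (K : ℝ) (hK : 1 ≤ K) (z : ℂ) (hz : -(K * |z.im|) ≤ z.re) (l : ℝ) (hl : 0 < l) :
    l + ‖z‖ ≤ (4 * K) * ‖(l:ℂ) + z‖ := by
  have h1 : (l + z.re) ≤ ‖(l:ℂ) + z‖ := by
    have := Complex.re_le_norm ((l:ℂ) + z)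
    simpa using this
  have h2 : |z.im| ≤ ‖(l:ℂ) + z‖ := by
    have := Complex.abs_im_le_norm ((l:ℂ) + z)
    simpa using this
  have h3 := Complex.norm_le_abs_re_add_abs_im z
  have h4 := abs_nonneg z.im
  have h5 := norm_nonneg ((l:ℂ) + z)
  rcases le_or_gt 0 z.re with h | h
  · rw [abs_of_nonneg h] at h3
    nlinarith
  · rw [abs_of_neg h] at h3
    have h6 : K * |z.im| ≤ K * ‖(l:ℂ) + z‖ := by gcongr
    have h7 : ‖(l:ℂ) + z‖ ≤ K * ‖(l:ℂ) + z‖ := le_mul_of_one_le_left h5 hK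
    linarith

/-- consequences for the modified Leray function, with one constant -/
structure GeoC {n : ℕ} (D : Set (Cn n)) (ρ : Cn n → ℝ) (A B : ℝ) : Prop where
  hB : 1 ≤ B
  sec : ∀ w ∈ frontier D, ∀ z ∈ frontier D, ∀ l : ℝ, 0 < l → l + ‖GG ρ A w z‖ ≤ B * ‖(l:ℂ) + GG ρ A w z‖
  up : ∀ w ∈ frontier D, ∀ z ∈ frontier D, ‖GG ρ A w z‖ ≤ B * ‖gg ρ w z‖
  dn : ∀ w ∈ frontier D, ∀ z ∈ frontier D, ‖gg ρ w z‖ ≤ B * ‖GG ρ A w z‖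
  dif : ∀ w ∈ frontier D, ∀ z ∈ frontier D, ‖gg ρ w z - GG ρ A w z‖ ≤ B * ‖GG ρ A w z‖ ^ 2
  d2 : ∀ w ∈ frontier D, ∀ z ∈ frontier D, ‖w - z‖ ^ 2 ≤ B * ‖GG ρ A w z‖
  d1 : ∀ w ∈ frontier D, ∀ z ∈ frontier D, ‖w - z‖ ≤ B * √‖GG ρ A w z‖
  dup : ∀ w ∈ frontier D, ∀ z ∈ frontier D, ‖GG ρ A w z‖ ≤ B * ‖w - z‖
  bdd : ∀ w ∈ frontier D, ∀ z ∈ frontier D, ‖GG ρ A w z‖ ≤ B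
  R1 : ∀ x ∈ frontier D, ∀ y ∈ frontier D, ∀ u ∈ frontier D, ‖GG ρ A u x - GG ρ A u y‖ ≤
    B * (‖GG ρ A y x‖ + √‖GG ρ A y x‖ * √‖GG ρ A u y‖)
  R2 : ∀ x ∈ frontier D, ∀ y ∈ frontier D, ∀ u ∈ frontier D, ‖GG ρ A x u - GG ρ A y u‖ ≤
    B * (‖GG ρ A y x‖ + √‖GG ρ A y x‖ * √‖GG ρ A y u‖)
  re : ∀ w ∈ frontier D, ∀ z ∈ frontier D, |(gg ρ w z).re| ≤ B * ‖w - z‖ ^ 2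
  sym : ∀ w ∈ frontier D, ∀ z ∈ frontier D, ‖GG ρ A w z‖ ≤ B * ‖GG ρ A z w‖

lemma quart_aux (M a b d : ℝ) (hM : 1 ≤ M) (ha : 0 ≤ a) (hb : 0 ≤ b) (haM : a ≤ M) (hbM : b ≤ M) (hab : |a - b| ≤ d) :
    |(a ^ 2) ^ 2 - (b ^ 2) ^ 2| ≤ 2 * M ^ 2 * (2 * (d * b) + d ^ 2) := by
  have e : (a ^ 2) ^ 2 - (b ^ 2) ^ 2 = (a - b) * ((a + b) * (a ^ 2 + b ^ 2)) := by ring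
  have hd : 0 ≤ d := (abs_nonneg _).trans hab
  have h1 : a + b ≤ 2 * b + d := by have := (abs_le.1 hab).2; linarith
  have h2 : a ^ 2 + b ^ 2 ≤ 2 * M ^ 2 := by nlinarith
  rw [e, abs_mul, abs_of_nonneg (by positivity : 0 ≤ (a + b) * (a ^ 2 + b ^ 2))]
  calc |a - b| * ((a + b) * (a ^ 2 + b ^ 2)) ≤ d * ((2 * b + d) * (2 * M ^ 2)) := by gcongr
    _ = _ := by ring

set_option maxHeartbeats 1000000 in
lemma Geo.conseq {n : ℕ} {D U : Set (Cn n)} {ρ : Cn n → ℝ} {M δ c A K : ℝ} (h : Geo D U ρ M δ c A K) :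
    ∃ B, GeoC D ρ A B := by
  have hp := h.pre
  have hM := hp.hM
  have hδ := hp.hδ
  have hc := h.hc
  have hK := h.hK
  have hA := h.hA
  have hn : ∀ w z, 0 ≤ ‖GG ρ A w z‖ := fun w z => norm_nonneg _
  have hKc : 1 ≤ K / c := by rw [le_div_iff₀ hc]; linarith [h.hc1]
  set E : ℝ := K / c with hE
  have hE0 : 0 ≤ E := by linarith
  have d2 : ∀ w ∈ frontier D, ∀ z ∈ frontier D, ‖w - z‖ ^ 2 ≤ E * ‖GG ρ A w z‖ := by
    intro w hw z hz
    have h1 := (h.low w hw z hz).trans (h.cmp w hw z hz)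
    rw [hE, div_mul_eq_mul_div, le_div_iff₀ hc]; linarith
  have d1 : ∀ w ∈ frontier D, ∀ z ∈ frontier D, ‖w - z‖ ≤ E * √‖GG ρ A w z‖ := by
    intro w hw z hz
    refine (sq_le_sq₀ (norm_nonneg _) (by positivity)).1 ?_
    rw [mul_pow, Real.sq_sqrt (hn _ _)]
    refine (d2 w hw z hz).trans ?_
    have := hn w z
    gcongr
    nlinarith
  have hdM : ∀ w ∈ frontier D, ∀ z ∈ frontier D, ‖w - z‖ ≤ M := hp.p5
  have hD1 : ∀ w ∈ frontier D, ∀ z ∈ frontier D, ∀ ξ, ‖D1 ρ w ξ - D1 ρ z ξ‖ ≤ M * ‖w - z‖ * ‖ξ‖ := by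
    intro w hw z hz ξ
    have e : D1 ρ w ξ - D1 ρ z ξ = toD n (fderiv ℝ ρ w - fderiv ℝ ρ z) ξ := by
      rw [map_sub]; rfl
    rw [e]
    refine (toD_norm n _ ξ).trans ?_
    have := hp.p2 w hw z hz
    gcongr
  have hggd : ∀ w ∈ frontier D, ∀ z ∈ frontier D, ‖gg ρ w z‖ ≤ M * ‖w - z‖ := fun w hw z hz => D1_norm hp w hw _
  have hQ : ∀ w ∈ frontier D, ∀ z ∈ frontier D, (‖w - z‖ ^ 2) ^ 2 ≤ M ^ 2 * ‖w - z‖ ^ 2 := by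
    intro w hw z hz
    have := hdM w hw z hz
    have h0 := norm_nonneg (w - z)
    rw [sq (‖w - z‖ ^ 2)]
    gcongr
  have hGs : ∀ w z, ‖GG ρ A w z‖ ≤ ‖gg ρ w z‖ + A * (‖w - z‖ ^ 2) ^ 2 := by
    intro w z
    unfold GG
    refine (norm_add_le _ _).trans ?_
    rw [Complex.norm_real, Real.norm_eq_abs, abs_of_nonneg (by positivity)]
  have dup : ∀ w ∈ frontier D, ∀ z ∈ frontier D, ‖GG ρ A w z‖ ≤ (M + A * M ^ 3) * ‖w - z‖ := by
    intro w hw z hz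
    have h1 := hGs w z
    have h2 := hggd w hw z hz
    have h3 : A * (‖w - z‖ ^ 2) ^ 2 ≤ A * (M ^ 3 * ‖w - z‖) := by
      have h0 := norm_nonneg (w - z)
      have e : (‖w - z‖ ^ 2) ^ 2 = ‖w - z‖ ^ 3 * ‖w - z‖ := by ring
      rw [e]
      have := hdM w hw z hz
      gcongr
    nlinarith
  have s1 : ∀ x y u v : Cn n, x ∈ frontier D → y ∈ frontier D → u ∈ frontier D → v ∈ frontier D →
      ‖u - v‖ * ‖y - x‖ ≤ E ^ 2 * (√‖GG ρ A y x‖ * √‖GG ρ A u v‖) := by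
    intro x y u v hx hy hu hv
    calc ‖u - v‖ * ‖y - x‖ ≤ (E * √‖GG ρ A u v‖) * (E * √‖GG ρ A y x‖) :=
        mul_le_mul (d1 u hu v hv) (d1 y hy x hx) (norm_nonneg _) (by positivity)
      _ = _ := by ring
  have qd : ∀ x ∈ frontier D, ∀ y ∈ frontier D, ∀ u ∈ frontier D,
      ‖((A * (‖u - x‖ ^ 2) ^ 2 : ℝ) : ℂ) - ((A * (‖u - y‖ ^ 2) ^ 2 : ℝ) : ℂ)‖ ≤
        A * (2 * M ^ 2 * (2 * (‖y - x‖ * ‖u - y‖) + ‖y - x‖ ^ 2)) := by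
    intro x hx y hy u hu
    rw [← Complex.ofReal_sub, Complex.norm_real, Real.norm_eq_abs, ← mul_sub, abs_mul, abs_of_nonneg hA]
    gcongr
    refine quart_aux M _ _ _ hM (norm_nonneg _) (norm_nonneg _) (hdM u hu x hx) (hdM u hu y hy) ?_
    refine (abs_norm_sub_norm_le _ _).trans (le_of_eq ?_)
    congr 1; abel
  set T : ℝ := A * (2 * M ^ 2 * 2) with hT
  have hT0 : 0 ≤ T := by positivity
  set B0 : ℝ := K + (M + T) * E ^ 2 + (M + T) * E with hB0
  have R1 : ∀ x ∈ frontier D, ∀ y ∈ frontier D, ∀ u ∈ frontier D, ‖GG ρ A u x - GG ρ A u y‖ ≤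
    B0 * (‖GG ρ A y x‖ + √‖GG ρ A y x‖ * √‖GG ρ A u y‖) := by
    intro x hx y hy u hu
    have e : GG ρ A u x - GG ρ A u y = gg ρ y x + (D1 ρ u (y - x) - D1 ρ y (y - x)) +
       (((A * (‖u - x‖ ^ 2) ^ 2 : ℝ) : ℂ) - ((A * (‖u - y‖ ^ 2) ^ 2 : ℝ) : ℂ)) := by
      unfold GG gg
      have : u - x = (u - y) + (y - x) := by abel
      rw [this, map_add, ← this]; ring
    rw [e]
    refine (norm_add₃_le).trans ?_
    have t1 := h.cmp y hy x hx
    have t2 := hD1 u hu y hy (y - x)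
    have t3 := qd x hx y hy u hu
    have t4 := s1 x y u y hx hy hu hy
    have t5 := d2 y hy x hx
    set P := ‖GG ρ A y x‖
    set Q := √P * √‖GG ρ A u y‖
    have hP : 0 ≤ P := norm_nonneg _
    have hQ : 0 ≤ Q := by positivity
    set a := ‖u - y‖ * ‖y - x‖ with ha
    have e2 : ‖y - x‖ * ‖u - y‖ = a := mul_comm _ _
    have e3 : M * ‖u - y‖ * ‖y - x‖ = M * a := by rw [ha]; ring
    rw [e2] at t3
    rw [e3] at t2
    have u1 : M * a ≤ M * (E ^ 2 * Q) := by gcongr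
    have u2 : A * (2 * M ^ 2 * (2 * a + ‖y - x‖ ^ 2)) ≤ T * (E ^ 2 * Q) + T * (E * P) := by
      calc A * (2 * M ^ 2 * (2 * a + ‖y - x‖ ^ 2)) ≤ A * (2 * M ^ 2 * (2 * (E ^ 2 * Q) + 2 * (E * P))) := by
            gcongr; linarith [mul_nonneg hE0 hP]
        _ = _ := by rw [hT]; ring
    have u3 : 0 ≤ K * Q := by positivity
    have u4 : 0 ≤ (M + T) * E ^ 2 * P := by positivity
    have u5 : 0 ≤ (M + T) * E * Q := by positivity
    have u6 : 0 ≤ M * E * P := by positivity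
    rw [hB0]
    nlinarith
  have R2 : ∀ x ∈ frontier D, ∀ y ∈ frontier D, ∀ u ∈ frontier D, ‖GG ρ A x u - GG ρ A y u‖ ≤
    B0 * (‖GG ρ A y x‖ + √‖GG ρ A y x‖ * √‖GG ρ A y u‖) := by
    intro x hx y hy u hu
    have e : GG ρ A x u - GG ρ A y u = -gg ρ y x + (D1 ρ x (x - u) - D1 ρ y (x - u)) +
       (((A * (‖u - x‖ ^ 2) ^ 2 : ℝ) : ℂ) - ((A * (‖u - y‖ ^ 2) ^ 2 : ℝ) : ℂ)) := by
      unfold GG gg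
      have : y - u = (y - x) + (x - u) := by abel
      rw [norm_sub_rev u x, norm_sub_rev u y]
      conv_lhs => enter [2,1,2]; rw [this]
      rw [map_add]; ring
    rw [e]
    refine (norm_add₃_le).trans ?_
    rw [norm_neg]
    have t1 := h.cmp y hy x hx
    have t2 := hD1 x hx y hy (x - u)
    have t3 := qd x hx y hy u hu
    have t4 := s1 x y y u hx hy hy hu
    have t5 := d2 y hy x hx
    have t6 : ‖x - u‖ ≤ ‖y - x‖ + ‖y - u‖ := by
      have : x - u = -(y - x) + (y - u) := by abel
      rw [this]; refine (norm_add_le _ _).trans ?_; rw [norm_neg]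
    set P := ‖GG ρ A y x‖
    set Q := √P * √‖GG ρ A y u‖
    have hP : 0 ≤ P := norm_nonneg _
    have hQ : 0 ≤ Q := by positivity
    set a := ‖y - u‖ * ‖y - x‖ with ha
    have e2 : ‖y - x‖ * ‖u - y‖ = a := by rw [ha, norm_sub_rev u y]; ring
    have e3 : M * ‖x - y‖ * ‖x - u‖ ≤ M * (a + ‖y - x‖ ^ 2) := by
      rw [norm_sub_rev x y, mul_assoc]
      calc M * (‖y - x‖ * ‖x - u‖) ≤ M * (‖y - x‖ * (‖y - x‖ + ‖y - u‖)) := by gcongr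
        _ = _ := by rw [ha]; ring
    rw [e2] at t3
    have u1 : M * (a + ‖y - x‖ ^ 2) ≤ M * (E ^ 2 * Q) + M * (E * P) := by rw [← mul_add]; gcongr
    have u2 : A * (2 * M ^ 2 * (2 * a + ‖y - x‖ ^ 2)) ≤ T * (E ^ 2 * Q) + T * (E * P) := by
      calc A * (2 * M ^ 2 * (2 * a + ‖y - x‖ ^ 2)) ≤ A * (2 * M ^ 2 * (2 * (E ^ 2 * Q) + 2 * (E * P))) := by
            gcongr; linarith [mul_nonneg hE0 hP]
        _ = _ := by rw [hT]; ring
    have u3 : 0 ≤ K * Q := by positivity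
    have u4 : 0 ≤ (M + T) * E ^ 2 * P := by positivity
    have u5 : 0 ≤ (M + T) * E * Q := by positivity
    rw [hB0]
    nlinarith
  have hre : ∀ w ∈ frontier D, ∀ z ∈ frontier D, |(gg ρ w z).re| ≤ (M + M ^ 2 / δ ^ 2) * ‖w - z‖ ^ 2 := by
    intro w hw z hz
    have hρw : ρ w = 0 := (hp.zero w (h.SU hw)).2 hw
    have hρz : ρ z = 0 := (hp.zero z (h.SU hz)).2 hz
    have h00 : 0 ≤ M ^ 2 / δ ^ 2 * ‖w - z‖ ^ 2 := by positivity
    have h01 : 0 ≤ M * ‖w - z‖ ^ 2 := by positivity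
    rcases le_or_gt ‖w - z‖ δ with hd | hd
    · have h1 := (hp.p3 w hw z (by rw [norm_sub_rev]; linarith)).2
      rw [hρw, hρz, norm_sub_rev, ← neg_sub w z, map_neg] at h1
      have hgre : (gg ρ w z).re = 1/2 * fderiv ℝ ρ w (w - z) := toD_re n _ _
      have e : (0:ℝ) - 0 - -(fderiv ℝ ρ w) (w - z) = (fderiv ℝ ρ w) (w - z) := by ring
      rw [e] at h1
      rw [hgre, abs_mul, abs_of_pos (by norm_num : (0:ℝ) < 1/2)]
      have := abs_nonneg (fderiv ℝ ρ w (w - z))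
      linarith
    · have h1 := (Complex.abs_re_le_norm (gg ρ w z)).trans (hggd w hw z hz)
      have h2 : M * ‖w - z‖ ≤ M ^ 2 := by have := hdM w hw z hz; nlinarith
      have h3 : M ^ 2 ≤ M ^ 2 / δ ^ 2 * ‖w - z‖ ^ 2 := by
        rw [div_mul_eq_mul_div, le_div_iff₀ (by positivity)]; gcongr
      linarith
  have hGyy : ∀ y, GG ρ A y y = 0 := by intro y; simp [GG, gg]
  have hB01 : 1 ≤ B0 := by
    have : 0 ≤ (M + T) * E ^ 2 := by positivity
    have : 0 ≤ (M + T) * E := by positivity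
    linarith
  have sym : ∀ w ∈ frontier D, ∀ z ∈ frontier D, ‖GG ρ A w z‖ ≤ B0 * ‖GG ρ A z w‖ := by
    intro w hw z hz
    have := R2 w hw z hz z hz
    rw [hGyy, norm_zero, Real.sqrt_zero, mul_zero, add_zero, sub_zero] at this
    exact this
  have up : ∀ w ∈ frontier D, ∀ z ∈ frontier D, ‖GG ρ A w z‖ ≤ (1 + A * M ^ 2 / c) * ‖gg ρ w z‖ := by
    intro w hw z hz
    have h1 := hGs w z
    have h2 : A * (‖w - z‖ ^ 2) ^ 2 ≤ A * M ^ 2 / c * ‖gg ρ w z‖ := by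
      calc A * (‖w - z‖ ^ 2) ^ 2 ≤ A * (M ^ 2 * ‖w - z‖ ^ 2) := by have := hQ w hw z hz; gcongr
        _ = A * M ^ 2 / c * (c * ‖w - z‖ ^ 2) := by field_simp
        _ ≤ _ := by have := h.low w hw z hz; gcongr
    linarith
  have dif : ∀ w ∈ frontier D, ∀ z ∈ frontier D, ‖gg ρ w z - GG ρ A w z‖ ≤ (A * E ^ 2) * ‖GG ρ A w z‖ ^ 2 := by
    intro w hw z hz
    have e : gg ρ w z - GG ρ A w z = -((A * (‖w - z‖ ^ 2) ^ 2 : ℝ) : ℂ) := by unfold GG; ring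
    rw [e, norm_neg, Complex.norm_real, Real.norm_eq_abs, abs_of_nonneg (by positivity), mul_assoc, ← mul_pow]
    have := d2 w hw z hz
    gcongr
  have bdd : ∀ w ∈ frontier D, ∀ z ∈ frontier D, ‖GG ρ A w z‖ ≤ (M + A * M ^ 3) * M := by
    intro w hw z hz
    refine (dup w hw z hz).trans ?_
    have := hdM w hw z hz
    gcongr
  have hrw : 0 ≤ M + M ^ 2 / δ ^ 2 := by positivity
  have hdp : 0 ≤ M + A * M ^ 3 := by positivity
  have hupp : 0 ≤ 1 + A * M ^ 2 / c := by positivity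
  set B : ℝ := 4 * K + (1 + A * M ^ 2 / c) + A * E ^ 2 + E + (M + A * M ^ 3) + (M + A * M ^ 3) * M + B0
    + (M + M ^ 2 / δ ^ 2) with hB
  have q1 : 0 ≤ A * E ^ 2 := by positivity
  have q2 : 0 ≤ (M + A * M ^ 3) * M := by positivity
  refine ⟨B, ⟨by linarith, ?_, ?_, ?_, ?_, ?_, ?_, ?_, ?_, ?_, ?_, ?_, ?_⟩⟩
  · intro w hw z hz l hl
    exact (sector_aux K hK _ (h.sec w hw z hz) l hl).trans (by gcongr; linarith)
  · intro w hw z hz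
    exact (up w hw z hz).trans (by gcongr; linarith)
  · intro w hw z hz
    exact (h.cmp w hw z hz).trans (by gcongr; linarith)
  · intro w hw z hz
    exact (dif w hw z hz).trans (by gcongr; linarith)
  · intro w hw z hz
    exact (d2 w hw z hz).trans (by gcongr; linarith)
  · intro w hw z hz
    exact (d1 w hw z hz).trans (by gcongr; linarith)
  · intro w hw z hz
    exact (dup w hw z hz).trans (by gcongr; linarith)
  · intro w hw z hz
    exact (bdd w hw z hz).trans (by linarith)
  · intro x hx y hy u hu
    exact (R1 x hx y hy u hu).trans (by gcongr; linarith)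
  · intro x hx y hy u hu
    exact (R2 x hx y hy u hu).trans (by gcongr; linarith)
  · intro w hw z hz
    exact (hre w hw z hz).trans (by gcongr; linarith)
  · intro w hw z hz
    exact (sym w hw z hz).trans (by gcongr; linarith)
end

noncomputable section
open scoped ENNReal
set_option linter.unusedSectionVars false
set_option linter.unusedVariables false

/-- primitive of `kL` -/
def fL (n : ℕ) (l : ℝ) (z : ℂ) : ℂ := -((l:ℂ) ^ 2 * (((l:ℂ) + z) ^ (n+1))⁻¹) / (n+1)
/-- derivative of `kL` -/
def kL' (n : ℕ) (l : ℝ) (z : ℂ) : ℂ := -((n:ℂ)+2) * ((l:ℂ) ^ 2 * (((l:ℂ) + z) ^ (n+3))⁻¹)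

lemma hasDerivAt_fL (n : ℕ) (l : ℝ) (z : ℂ) (h : (l:ℂ) + z ≠ 0) : HasDerivAt (fL n l) (kL n l z) z := by
  have h1 : HasDerivAt (fun z : ℂ => (l:ℂ) + z) 1 z := (hasDerivAt_id z).const_add _
  have h2 := ((((h1.pow (n+1)).inv (pow_ne_zero _ h)).const_mul ((l:ℂ)^2)).neg).div_const ((n:ℂ)+1)
  refine h2.congr_deriv ?_
  have h3 : (n:ℂ) + 1 ≠ 0 := by exact_mod_cast Nat.succ_ne_zero n
  unfold kL
  simp only [Nat.add_sub_cancel, Pi.pow_apply]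
  push_cast
  field_simp
  try ring

lemma hasDerivAt_kL (n : ℕ) (l : ℝ) (z : ℂ) (h : (l:ℂ) + z ≠ 0) : HasDerivAt (kL n l) (kL' n l z) z := by
  have h1 : HasDerivAt (fun z : ℂ => (l:ℂ) + z) 1 z := (hasDerivAt_id z).const_add _
  have h2 := (((h1.pow (n+2)).inv (pow_ne_zero _ h)).const_mul ((l:ℂ)^2))
  refine h2.congr_deriv ?_
  unfold kL'
  simp only [Pi.pow_apply, show n + 2 - 1 = n + 1 from rfl]
  push_cast
  field_simp
  try ring

lemma norm_fL_le (n : ℕ) (c l : ℝ) (hc : 0 < c) (hl : 0 < l) (z : ℂ)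
    (h : c * (l + ‖z‖) ≤ ‖(l:ℂ) + z‖) : ‖fL n l z‖ ≤ (c ^ (n+1))⁻¹ * (l * mL n l z) := by
  have h1 := norm_inv_pow_le c l hc hl z (n+1) h
  have hz : 0 ≤ ‖z‖ := norm_nonneg z
  unfold fL mL
  have h3 : ‖(n:ℂ) + 1‖ = n + 1 := by
    have : ((n:ℂ) + 1) = ((n+1:ℕ):ℂ) := by push_cast; rfl
    rw [this, Complex.norm_natCast]; push_cast; rfl
  rw [norm_div, h3, norm_neg, norm_mul, norm_pow, Complex.norm_real, Real.norm_eq_abs, abs_of_pos hl]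
  refine (div_le_self (by positivity) (by linarith [(Nat.cast_nonneg n : (0:ℝ) ≤ n)])).trans ?_
  calc l ^ 2 * ‖(((l:ℂ) + z) ^ (n+1))⁻¹‖ ≤ l ^ 2 * ((c ^ (n+1))⁻¹ * ((l + ‖z‖) ^ (n+1))⁻¹) := by gcongr
    _ = _ := by ring

lemma norm_kL'_le (n : ℕ) (c l : ℝ) (hc : 0 < c) (hl : 0 < l) (z : ℂ)
    (h : c * (l + ‖z‖) ≤ ‖(l:ℂ) + z‖) : ‖kL' n l z‖ ≤ (n+2) * (c ^ (n+3))⁻¹ * (mL n l z / l) := by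
  have h1 := norm_inv_pow_le c l hc hl z (n+3) h
  have hz : 0 ≤ ‖z‖ := norm_nonneg z
  unfold kL' mL
  have h3 : ‖-((n:ℂ) + 2)‖ = n + 2 := by
    have : ((n:ℂ) + 2) = ((n+2:ℕ):ℂ) := by push_cast; rfl
    rw [norm_neg, this, Complex.norm_natCast]; push_cast; rfl
  rw [norm_mul, h3, norm_mul, norm_pow, Complex.norm_real, Real.norm_eq_abs, abs_of_pos hl, mul_assoc]
  refine mul_le_mul_of_nonneg_left ?_ (by positivity)
  have h4 : ((l + ‖z‖) ^ (n+3))⁻¹ ≤ (l ^ 2)⁻¹ * ((l + ‖z‖) ^ (n+1))⁻¹ := by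
    rw [← mul_inv]
    gcongr
    rw [show n + 3 = 2 + (n+1) by ring, pow_add (l + ‖z‖) 2]
    gcongr; linarith
  calc l ^ 2 * ‖(((l:ℂ) + z) ^ (n+3))⁻¹‖ ≤ l ^ 2 * ((c ^ (n+3))⁻¹ * ((l ^ 2)⁻¹ * ((l + ‖z‖) ^ (n+1))⁻¹)) := by
        gcongr; exact h1.trans (by gcongr)
    _ = _ := by field_simp

lemma norm_kL_sqrt_le (n : ℕ) (c l : ℝ) (hc : 0 < c) (hl : 0 < l) (z : ℂ)
    (h : c * (l + ‖z‖) ≤ ‖(l:ℂ) + z‖) : ‖kL n l z‖ * √‖z‖ ≤ (c ^ (n+2))⁻¹ * (√l * mL n l z) := by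
  have h1 := norm_inv_pow_le c l hc hl z (n+2) h
  have hz : 0 ≤ ‖z‖ := norm_nonneg z
  unfold kL mL
  rw [norm_mul, norm_pow, Complex.norm_real, Real.norm_eq_abs, abs_of_pos hl]
  have h4 : √l * √‖z‖ ≤ l + ‖z‖ := by
    have h5 := Real.sq_sqrt hl.le
    have h6 := Real.sq_sqrt hz
    nlinarith [sq_nonneg (√l - √‖z‖), Real.sqrt_nonneg l, Real.sqrt_nonneg ‖z‖]
  calc l ^ 2 * ‖(((l:ℂ) + z) ^ (n+2))⁻¹‖ * √‖z‖ ≤ l ^ 2 * ((c ^ (n+2))⁻¹ * ((l + ‖z‖) ^ (n+2))⁻¹) * √‖z‖ := by gcongr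
    _ = (c ^ (n+2))⁻¹ * ((√l * √l) * l * ((l + ‖z‖) ^ (n+2))⁻¹) * √‖z‖ := by
        rw [Real.mul_self_sqrt hl.le]; ring
    _ = (c ^ (n+2))⁻¹ * (√l * l * ((l + ‖z‖) ^ (n+2))⁻¹) * (√l * √‖z‖) := by ring
    _ ≤ (c ^ (n+2))⁻¹ * (√l * l * ((l + ‖z‖) ^ (n+2))⁻¹) * (l + ‖z‖) := by gcongr
    _ = _ := by
        have : 0 < l + ‖z‖ := by linarith
        rw [pow_succ (l + ‖z‖) (n+1)]; field_simp

lemma ibp_pt (n : ℕ) (c C l l' : ℝ) (hc : 0 < c) (hc1 : c ≤ 1) (hC : 1 ≤ C) (hl : 0 < l) (hll : l ≤ l') (hl1 : l' ≤ 1)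
    (b b' α a a' e e' : ℂ) (ha : c * (l + ‖a‖) ≤ ‖(l:ℂ) + a‖) (he : c * (l' + ‖e‖) ≤ ‖(l':ℂ) + e‖)
    (hb : ‖b‖ ≤ C) (hb' : ‖b'‖ ≤ C) (ha' : ‖a' - α‖ ≤ C * √‖a‖) (he' : ‖e'‖ ≤ C) :
    ‖b * α * (kL n l a * (starRingEnd ℂ) (kL n l' e)) -
      ((b' * fL n l a + b * (kL n l a * a')) * (starRingEnd ℂ) (kL n l' e) +
        (b * fL n l a) * (starRingEnd ℂ) (kL' n l' e * e'))‖ ≤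
      (3 * (n+2) * C ^ 2 * ((c ^ (n+3))⁻¹) ^ 2) * √(l / l') * (mL n l a * mL n l' e) := by
  have hl' : 0 < l' := hl.trans_le hll
  set s := √(l / l') with hs
  have hs0 : 0 ≤ s := Real.sqrt_nonneg _
  have hq : l / l' ≤ 1 := by rw [div_le_one hl']; exact hll
  have hls : l ≤ s := by
    rw [hs]; apply Real.le_sqrt_of_sq_le
    rw [le_div_iff₀ hl']; nlinarith [mul_nonneg hl.le hl.le]
  have hls2 : √l ≤ s := by
    apply Real.sqrt_le_sqrt
    rw [le_div_iff₀ hl']; nlinarith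
  have hls3 : l / l' ≤ s := by
    rw [hs]; apply Real.le_sqrt_of_sq_le
    nlinarith [div_pos hl hl']
  set c3 := (c ^ (n+3))⁻¹ with hc3
  have hc1' : (c ^ (n+1))⁻¹ ≤ c3 := by
    rw [hc3]; gcongr ?_⁻¹; exact pow_le_pow_of_le_one hc.le hc1 (by omega)
  have hc2' : (c ^ (n+2))⁻¹ ≤ c3 := by
    rw [hc3]; gcongr ?_⁻¹; exact pow_le_pow_of_le_one hc.le hc1 (by omega)
  have hc30 : 0 < c3 := by positivity
  set m := mL n l a with hm
  set m' := mL n l' e with hm'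
  have hm0 : 0 ≤ m := mL_nonneg n l hl a
  have hm0' : 0 ≤ m' := mL_nonneg n l' hl' e
  have f1 : ‖fL n l a‖ ≤ c3 * (l * m) := (norm_fL_le n c l hc hl a ha).trans (by gcongr)
  have k1 : ‖kL n l a‖ * √‖a‖ ≤ c3 * (√l * m) := (norm_kL_sqrt_le n c l hc hl a ha).trans (by gcongr)
  have k2 : ‖kL n l' e‖ ≤ c3 * m' := (norm_kL_le n c l' hc hl' e he).trans (by gcongr)
  have k3 : ‖kL' n l' e‖ ≤ (n+2) * c3 * (m' / l') := norm_kL'_le n c l' hc hl' e he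
  have eq : b * α * (kL n l a * (starRingEnd ℂ) (kL n l' e)) -
      ((b' * fL n l a + b * (kL n l a * a')) * (starRingEnd ℂ) (kL n l' e) +
        (b * fL n l a) * (starRingEnd ℂ) (kL' n l' e * e')) =
      -(b' * fL n l a * (starRingEnd ℂ) (kL n l' e)) - b * (kL n l a * (a' - α)) * (starRingEnd ℂ) (kL n l' e)
       - (b * fL n l a) * (starRingEnd ℂ) (kL' n l' e * e') := by ring
  rw [eq]
  refine (norm_sub_le _ _).trans ?_
  have t12 := norm_sub_le (-(b' * fL n l a * (starRingEnd ℂ) (kL n l' e))) (b * (kL n l a * (a' - α)) * (starRingEnd ℂ) (kL n l' e))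
  rw [norm_neg] at t12
  have hn : (1:ℝ) ≤ n + 2 := by linarith [(Nat.cast_nonneg n : (0:ℝ) ≤ n)]
  set W := (n+2) * C ^ 2 * c3 ^ 2 * s * (m * m') with hW
  have t1 : ‖b' * fL n l a * (starRingEnd ℂ) (kL n l' e)‖ ≤ W := by
    rw [norm_mul, norm_mul, RCLike.norm_conj]
    calc ‖b'‖ * ‖fL n l a‖ * ‖kL n l' e‖ ≤ C * (c3 * (l * m)) * (c3 * m') := by gcongr
      _ = 1 * (C * 1) * c3 ^ 2 * l * (m * m') := by ring
      _ ≤ (n+2) * (C * C) * c3 ^ 2 * s * (m * m') := by gcongr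
      _ = W := by rw [hW]; ring
  have t2 : ‖b * (kL n l a * (a' - α)) * (starRingEnd ℂ) (kL n l' e)‖ ≤ W := by
    rw [norm_mul, norm_mul, RCLike.norm_conj, norm_mul]
    calc ‖b‖ * (‖kL n l a‖ * ‖a' - α‖) * ‖kL n l' e‖ ≤ C * (‖kL n l a‖ * (C * √‖a‖)) * (c3 * m') := by gcongr
      _ = C * C * (‖kL n l a‖ * √‖a‖) * (c3 * m') := by ring
      _ ≤ C * C * (c3 * (√l * m)) * (c3 * m') := by gcongr
      _ = 1 * (C * C) * c3 ^ 2 * √l * (m * m') := by ring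
      _ ≤ (n+2) * (C * C) * c3 ^ 2 * s * (m * m') := by gcongr
      _ = W := by rw [hW]; ring
  have t3 : ‖(b * fL n l a) * (starRingEnd ℂ) (kL' n l' e * e')‖ ≤ W := by
    rw [norm_mul, norm_mul, RCLike.norm_conj, norm_mul]
    calc ‖b‖ * ‖fL n l a‖ * (‖kL' n l' e‖ * ‖e'‖) ≤ C * (c3 * (l * m)) * (((n+2) * c3 * (m' / l')) * C) := by gcongr
      _ = (n+2) * C ^ 2 * c3 ^ 2 * (l / l') * (m * m') := by ring
      _ ≤ W := by rw [hW]; gcongr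
  calc _ ≤ W + W + W := by linarith
    _ = _ := by rw [hW]; ring

lemma contDiff_of_tsupp {H F : Type*} [NormedAddCommGroup H] [NormedSpace ℝ H] [NormedAddCommGroup F] [NormedSpace ℝ F]
    {m : WithTop ℕ∞} {f : H → F}
    (h : ∀ x ∈ tsupport f, ContDiffAt ℝ m f x) : ContDiff ℝ m f := by
  rw [contDiff_iff_contDiffAt]
  intro x
  by_cases hx : x ∈ tsupport f
  · exact h x hx
  · exact (contDiffAt_const (c := (0:F))).congr_of_eventuallyEq (notMem_tsupport_iff_eventuallyEq.1 hx)

theorem ibp_lemma {H : Type*} [NormedAddCommGroup H] [NormedSpace ℝ H] [FiniteDimensional ℝ H]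
    [MeasurableSpace H] [BorelSpace H] (μ : Measure H) [μ.IsAddHaarMeasure] (n : ℕ)
    (c C l l' : ℝ) (hc : 0 < c) (hc1 : c ≤ 1) (hC : 1 ≤ C) (hl : 0 < l) (hll : l ≤ l') (hl1 : l' ≤ 1)
    (v : H) (β α A E : H → ℂ) (hβ : ContDiff ℝ 1 β) (hβc : HasCompactSupport β)
    (hA : ∀ u ∈ tsupport β, ContDiffAt ℝ 1 A u) (hE : ∀ u ∈ tsupport β, ContDiffAt ℝ 1 E u)
    (sA : ∀ u ∈ tsupport β, c * (l + ‖A u‖) ≤ ‖(l:ℂ) + A u‖)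
    (sE : ∀ u ∈ tsupport β, c * (l' + ‖E u‖) ≤ ‖(l':ℂ) + E u‖)
    (b1 : ∀ u ∈ tsupport β, ‖β u‖ ≤ C) (b2 : ∀ u ∈ tsupport β, ‖fderiv ℝ β u v‖ ≤ C)
    (dA : ∀ u ∈ tsupport β, ‖fderiv ℝ A u v - α u‖ ≤ C * √‖A u‖)
    (dE : ∀ u ∈ tsupport β, ‖fderiv ℝ E u v‖ ≤ C) :
    ‖∫ u, β u * α u * (kL n l (A u) * (starRingEnd ℂ) (kL n l' (E u))) ∂μ‖ₑ ≤
      ∫⁻ u in tsupport β, ENNReal.ofReal ((3 * (n+2) * C ^ 2 * ((c ^ (n+3))⁻¹) ^ 2) * √(l / l') *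
        (mL n l (A u) * mL n l' (E u))) ∂μ := by
  have hl' : 0 < l' := hl.trans_le hll
  have nA : ∀ u ∈ tsupport β, (l:ℂ) + A u ≠ 0 := by
    intro u hu h0
    have := sA u hu
    rw [h0, norm_zero] at this
    have : 0 < c * (l + ‖A u‖) := by positivity
    linarith
  have nE : ∀ u ∈ tsupport β, (l':ℂ) + E u ≠ 0 := by
    intro u hu h0
    have := sE u hu
    rw [h0, norm_zero] at this
    have : 0 < c * (l' + ‖E u‖) := by positivity
    linarith
  set Ψ : H → ℂ := fun u => β u * (fL n l (A u) * (starRingEnd ℂ) (kL n l' (E u))) with hΨ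
  have hts : tsupport Ψ ⊆ tsupport β := tsupport_mul_subset_left
  have hΨ1 : ContDiff ℝ 1 Ψ := by
    refine contDiff_of_tsupp fun u hu => ?_
    have hu' := hts hu
    have h1 : ContDiffAt ℝ 1 (fun u => fL n l (A u)) u := by
      unfold fL
      exact ((contDiffAt_const.mul ((((contDiffAt_const.add (hA u hu')).pow (n+1))).inv
        (pow_ne_zero _ (nA u hu')))).neg).div_const _
    have h2 : ContDiffAt ℝ 1 (fun u => kL n l' (E u)) u := by
      unfold kL
      exact (contDiffAt_const.mul ((((contDiffAt_const.add (hE u hu')).pow (n+2))).inv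
        (pow_ne_zero _ (nE u hu'))))
    have h3 : ContDiffAt ℝ 1 (fun u => (starRingEnd ℂ) (kL n l' (E u))) u :=
      (Complex.conjCLE.contDiff.contDiffAt).comp u h2
    exact hβ.contDiffAt.mul (h1.mul h3)
  have hΨc : HasCompactSupport Ψ := hβc.mul_right
  have hcd : Continuous (fun u => fderiv ℝ Ψ u v) := (hΨ1.continuous_fderiv (by norm_num)).clm_apply continuous_const
  have hcs : HasCompactSupport (fun u => fderiv ℝ Ψ u v) := hΨc.fderiv_apply ℝ v
  have hIntg : Integrable (fun u => fderiv ℝ Ψ u v) μ := hcd.integrable_of_hasCompactSupport hcs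
  have hzero : ∫ u, fderiv ℝ Ψ u v ∂μ = 0 := by
    have := integral_mul_fderiv_eq_neg_fderiv_mul_of_integrable (𝕜 := ℂ) (μ := μ) (f := fun _ => (1:ℂ)) (g := Ψ) (v := v)
      (by simp) (by simpa using hIntg) (by simpa using hΨ1.continuous.integrable_of_hasCompactSupport hΨc)
      (fun x _ => differentiableAt_const _) (fun x _ => hΨ1.differentiable (by norm_num) x)
    simpa using this
  by_cases hm : Integrable (fun u => β u * α u * (kL n l (A u) * (starRingEnd ℂ) (kL n l' (E u)))) μ
  swap
  · rw [integral_undef hm]; simp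
  have e1 : ∫ u, β u * α u * (kL n l (A u) * (starRingEnd ℂ) (kL n l' (E u))) ∂μ =
      ∫ u, (β u * α u * (kL n l (A u) * (starRingEnd ℂ) (kL n l' (E u))) - fderiv ℝ Ψ u v) ∂μ := by
    rw [integral_sub hm hIntg, hzero, sub_zero]
  rw [e1]
  refine (enorm_integral_le_lintegral_enorm _).trans ?_
  rw [← lintegral_indicator (isClosed_tsupport β).measurableSet]
  refine lintegral_mono fun u => ?_
  by_cases hu : u ∈ tsupport β
  · rw [Set.indicator_of_mem hu]
    rw [← ofReal_norm]
    refine ENNReal.ofReal_le_ofReal ?_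
    have hline : HasDerivAt (fun t : ℝ => u + t • v) v 0 := by
      simpa using ((hasDerivAt_id (0:ℝ)).smul_const v).const_add u
    have key : ∀ f : H → ℂ, DifferentiableAt ℝ f u → HasDerivAt (fun t : ℝ => f (u + t • v)) (fderiv ℝ f u v) 0 := by
      intro f hf
      have h0 : u + (0:ℝ) • v = u := by simp
      have hf' : HasFDerivAt f (fderiv ℝ f u) (u + (0:ℝ) • v) := by rw [h0]; exact hf.hasFDerivAt
      exact hf'.comp_hasDerivAt (0:ℝ) hline
    have kb := key β (hβ.differentiable (by norm_num) u)
    have ka := key A ((hA u hu).differentiableAt (by norm_num))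
    have ke := key E ((hE u hu).differentiableAt (by norm_num))
    have kp := key Ψ (hΨ1.differentiable (by norm_num) u)
    have h0 : u + (0:ℝ) • v = u := by simp
    have kf : HasDerivAt (fun t : ℝ => fL n l (A (u + t • v))) (kL n l (A u) * fderiv ℝ A u v) 0 := by
      have := hasDerivAt_fL n l (A (u + (0:ℝ) • v)) (by rw [h0]; exact nA u hu)
      have := HasDerivAt.comp (h := fun t : ℝ => A (u + t • v)) (0:ℝ) this ka
      rw [h0] at this; exact this
    have kk : HasDerivAt (fun t : ℝ => kL n l' (E (u + t • v))) (kL' n l' (E u) * fderiv ℝ E u v) 0 := by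
      have := hasDerivAt_kL n l' (E (u + (0:ℝ) • v)) (by rw [h0]; exact nE u hu)
      have := HasDerivAt.comp (h := fun t : ℝ => E (u + t • v)) (0:ℝ) this ke
      rw [h0] at this; exact this
    have ks := (kb.mul (kf.mul kk.star))
    have hu' := kp.unique ks
    simp only [h0] at hu'
    rw [hu']
    have := ibp_pt n c C l l' hc hc1 hC hl hll hl1 (β u) (fderiv ℝ β u v) (α u) (A u) (fderiv ℝ A u v) (E u)
      (fderiv ℝ E u v) (sA u hu) (sE u hu) (b1 u hu) (b2 u hu) (dA u hu) (dE u hu)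
    refine le_trans (le_of_eq ?_) this
    congr 1
    simp only [starRingEnd_apply, h0, Pi.mul_apply]
    ring
  · rw [Set.indicator_of_notMem hu]
    have h1 : β u = 0 := image_eq_zero_of_notMem_tsupport hu
    have h2 : fderiv ℝ Ψ u = 0 := fderiv_of_notMem_tsupport ℝ (fun h => hu (hts h))
    rw [h1, h2]; simp
end

noncomputable section
open scoped ENNReal
set_option linter.unusedSectionVars false
set_option linter.unusedVariables false

/-- a local graph chart of the boundary near `w0` -/
structure Chart {n : ℕ} (D : Set (Cn n)) (ρ : Cn n → ℝ) (w0 ν : Cn n) {H : Type} [NormedAddCommGroup H]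
    [NormedSpace ℝ H] (i : H →L[ℝ] Cn n) (q : Cn n →L[ℝ] H) (v : H) (Φ : H → Cn n) (R L : ℝ) : Prop where
  hR : 0 < R
  hL : 1 ≤ L
  iv : i v = Complex.I • ν
  dec : ∀ ξ, ∃ s : ℝ, ξ = i (q ξ) + s • ν
  grad : ∀ u ∈ Metric.ball (q w0) (2 * R), 1 ≤ L * |fderiv ℝ ρ (Φ u) ν|
  mem : ∀ u ∈ Metric.ball (q w0) (2 * R), Φ u ∈ frontier D
  smooth : ∀ u ∈ Metric.ball (q w0) (2 * R), ContDiffAt ℝ 2 Φ u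
  lip : ∀ u ∈ Metric.ball (q w0) (2 * R), ∀ u' ∈ Metric.ball (q w0) (2 * R), ‖Φ u - Φ u'‖ ≤ L * ‖u - u'‖
  qΦ : ∀ u ∈ Metric.ball (q w0) (2 * R), q (Φ u) = u
  surj : ∀ᶠ w in nhds w0, w ∈ frontier D → q w ∈ Metric.ball (q w0) (R / 2) ∧ Φ (q w) = w
  qn : ∀ ξ, ‖q ξ‖ ≤ L * ‖ξ‖
  inn : ∀ ξ, ‖i ξ‖ ≤ L * ‖ξ‖
  νn : ‖ν‖ ≤ L
  vn : ‖v‖ ≤ L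

/-- the projection functional -/
def phiν {n : ℕ} (ν : Cn n) : Cn n →L[ℝ] ℝ :=
  ((‖ν‖ ^ 2)⁻¹ : ℝ) • (Complex.reCLM.comp ((innerSL ℂ ν).restrictScalars ℝ))

lemma phiν_self {n : ℕ} (ν : Cn n) (h : ν ≠ 0) : phiν ν ν = 1 := by
  have h1 : (‖ν‖ ^ 2) ≠ 0 := pow_ne_zero _ (norm_ne_zero_iff.2 h)
  have : (inner ℂ ν ν).re = ‖ν‖ ^ 2 := by
    rw [inner_self_eq_norm_sq_to_K]; norm_cast
  simp only [phiν, _root_.smul_apply, ContinuousLinearMap.comp_apply, ContinuousLinearMap.coe_restrictScalars', innerSL_apply_apply, Complex.reCLM_apply, this, smul_eq_mul]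
  field_simp

lemma phiν_I {n : ℕ} (ν : Cn n) : phiν ν (Complex.I • ν) = 0 := by
  have : (inner ℂ ν (Complex.I • ν)).re = 0 := by
    rw [inner_smul_right, inner_self_eq_norm_sq_to_K, Complex.mul_re]
    have e : ((RCLike.ofReal ‖ν‖ : ℂ)) ^ 2 = ((‖ν‖ ^ 2 : ℝ) : ℂ) := by push_cast; rfl
    rw [e, Complex.ofReal_im]; simp
  simp only [phiν, _root_.smul_apply, ContinuousLinearMap.comp_apply, ContinuousLinearMap.coe_restrictScalars', innerSL_apply_apply, Complex.reCLM_apply, this, smul_eq_mul, mul_zero]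

lemma finrank_ker_phi {n : ℕ} (ν : Cn n) (h : ν ≠ 0) (hn : 1 ≤ n) : Module.finrank ℝ (LinearMap.ker (phiν ν).toLinearMap) = 2 * n - 1 := by
  have h1 := LinearMap.finrank_range_add_finrank_ker (phiν ν).toLinearMap
  have h2 : LinearMap.range (phiν ν).toLinearMap = ⊤ := by
    rw [LinearMap.range_eq_top]
    intro t
    refine ⟨t • ν, ?_⟩
    simp [phiν_self ν h]
  have h3 : Module.finrank ℝ (Cn n) = 2 * n := by
    rw [finrank_real_of_complex]; simp
  rw [h2, h3] at h1
  simp at h1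
  omega

set_option maxHeartbeats 1000000 in
lemma chart_exists {n : ℕ} {D U : Set (Cn n)} {ρ : Cn n → ℝ} {M δ c A K : ℝ} (h : Geo D U ρ M δ c A K)
    (w0 : Cn n) (hw0 : w0 ∈ frontier D) :
    ∃ (ν : Cn n) (hν : ν ≠ 0) (i : LinearMap.ker (phiν ν).toLinearMap →L[ℝ] Cn n)
      (q : Cn n →L[ℝ] LinearMap.ker (phiν ν).toLinearMap) (v : LinearMap.ker (phiν ν).toLinearMap)
      (Φ : LinearMap.ker (phiν ν).toLinearMap → Cn n) (R L : ℝ), Chart D ρ w0 ν i q v Φ R L := by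
  have hU0 := h.SU hw0
  obtain ⟨ν, hν⟩ : ∃ ν, fderiv ℝ ρ w0 ν ≠ 0 := by
    by_contra hcon
    push Not at hcon
    exact h.grad w0 hU0 (ContinuousLinearMap.ext hcon)
  have hν0 : ν ≠ 0 := by rintro rfl; simp at hν
  have hρ0 : ρ w0 = 0 := (h.pre.zero w0 hU0).2 hw0
  have hρs : ContDiffAt ℝ 2 ρ w0 := h.smooth.contDiffAt (h.Uo.mem_nhds hU0)
  set φ := phiν ν with hφ
  have hφν : φ ν = 1 := phiν_self ν hν0
  set H := LinearMap.ker φ.toLinearMap with hH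
  set i : H →L[ℝ] Cn n := H.subtypeL with hi
  set q0 : Cn n →L[ℝ] Cn n := ContinuousLinearMap.id ℝ _ - φ.smulRight ν with hq0
  have hq0a : ∀ ξ, q0 ξ = ξ - φ ξ • ν := by intro ξ; simp [hq0]
  have hq0m : ∀ ξ, q0 ξ ∈ H := by
    intro ξ
    rw [LinearMap.mem_ker]
    change φ (q0 ξ) = 0
    rw [hq0a, map_sub, map_smul, hφν]; simp
  set q : Cn n →L[ℝ] H := q0.codRestrict H hq0m with hq
  have hiq : ∀ ξ, i (q ξ) = ξ - φ ξ • ν := by intro ξ; exact hq0a ξ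
  have hφi : ∀ u : H, φ (i u) = 0 := fun u => u.2
  have hqi : ∀ u : H, q (i u) = u := by
    intro u
    apply Subtype.ext
    change i (q (i u)) = i u
    rw [hiq, hφi]; simp
  have hqν : q ν = 0 := by
    apply Subtype.ext
    change i (q ν) = 0
    rw [hiq, hφν]; simp
  set v : H := ⟨Complex.I • ν, phiν_I ν⟩ with hv
  -- the straightening map
  set F : Cn n → Cn n := fun ξ => i (q ξ) + ρ ξ • ν with hF
  have hF2 : ContDiffAt ℝ 2 F w0 := by
    refine ContDiffAt.add ?_ (hρs.smul contDiffAt_const)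
    exact (i.comp q).contDiff.contDiffAt
  set F' : Cn n →L[ℝ] Cn n := i.comp q + (fderiv ℝ ρ w0).smulRight ν with hF'
  have hFd : HasFDerivAt F F' w0 := by
    refine ((i.comp q).hasFDerivAt).add ?_
    exact (hρs.differentiableAt (by norm_num)).hasFDerivAt.smul_const ν
  have hinj : Function.Injective F'.toLinearMap := by
    rw [← LinearMap.ker_eq_bot, LinearMap.ker_eq_bot']
    intro ξ hξ
    have h1 : i (q ξ) + fderiv ℝ ρ w0 ξ • ν = 0 := hξ
    have h2 : q ξ = 0 := by
      have := congrArg q h1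
      rw [map_add, map_smul, hqi, hqν, smul_zero, add_zero, map_zero] at this; exact this
    rw [h2, map_zero, zero_add] at h1
    have h3 : fderiv ℝ ρ w0 ξ = 0 := (smul_eq_zero.1 h1).resolve_right hν0
    have h4 : ξ = φ ξ • ν := by
      have := hiq ξ
      rw [h2, map_zero] at this
      exact (sub_eq_zero.1 this.symm)
    rw [h4, map_smul, smul_eq_mul, mul_eq_zero] at h3
    rw [h4, h3.resolve_right hν, zero_smul]
  set Fe : Cn n ≃L[ℝ] Cn n := (LinearEquiv.ofInjectiveEndo F'.toLinearMap hinj).toContinuousLinearEquiv with hFe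
  have hFd' : HasFDerivAt F (Fe : Cn n →L[ℝ] Cn n) w0 := by
    have : (Fe : Cn n →L[ℝ] Cn n) = F' := by ext1 ξ; rfl
    rw [this]; exact hFd
  set e := hF2.toOpenPartialHomeomorph F hFd' (by norm_num) with he
  have heF : ∀ ξ, e ξ = F ξ := fun ξ => rfl
  have hes : w0 ∈ e.source := hF2.mem_toOpenPartialHomeomorph_source hFd' (by norm_num)
  have hFw0 : F w0 = i (q w0) := by simp [hF, hρ0]
  have het : i (q w0) ∈ e.target := by rw [← hFw0]; exact hF2.image_mem_toOpenPartialHomeomorph_target hFd' (by norm_num)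
  have hsymm0 : e.symm (i (q w0)) = w0 := by rw [← hFw0, ← heF]; exact e.left_inv hes
  have hsm : ContDiffAt ℝ 2 e.symm (i (q w0)) := by
    rw [← hFw0]; exact hF2.to_localInverse hFd' (by norm_num)
  set Φ : H → Cn n := fun u => e.symm (i u) with hΦ
  have hic : ContinuousAt i (q w0) := i.continuous.continuousAt
  have hΦ0 : Φ (q w0) = w0 := hsymm0
  have hΦs : ContDiffAt ℝ 2 Φ (q w0) := ContDiffAt.comp (q w0) hsm i.contDiff.contDiffAt
  have E1 : ∀ᶠ u in nhds (q w0), ContDiffAt ℝ 2 Φ u := hΦs.eventually (by simp)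
  have E2 : ∀ᶠ u in nhds (q w0), i u ∈ e.target := hic.eventually (e.open_target.eventually_mem het)
  have E3 : ∀ᶠ u in nhds (q w0), Φ u ∈ U := hΦs.continuousAt.eventually (by rw [hΦ0]; exact h.Uo.eventually_mem hU0)
  have hdc : ContinuousAt (fun w => fderiv ℝ ρ w ν) w0 := by
    have : ContDiffAt ℝ 1 (fderiv ℝ ρ) w0 := hρs.fderiv_right (by norm_num)
    exact this.continuousAt.clm_apply continuousAt_const
  have hg0 : 0 < |fderiv ℝ ρ w0 ν| := abs_pos.2 hν
  have E4 : ∀ᶠ u in nhds (q w0), |fderiv ℝ ρ w0 ν| / 2 < |fderiv ℝ ρ (Φ u) ν| := by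
    refine hΦs.continuousAt.eventually (p := fun w => |fderiv ℝ ρ w0 ν| / 2 < |fderiv ℝ ρ w ν|) ?_
    rw [hΦ0]
    exact hdc.abs.eventually (lt_mem_nhds (by linarith))
  obtain ⟨L1, t, ht, hL1⟩ := (hΦs.of_le (by norm_num : (1:WithTop ℕ∞) ≤ 2)).exists_lipschitzOnWith
  obtain ⟨R2, hR2, hball⟩ := Metric.eventually_nhds_iff_ball.1 (E1.and (E2.and (E3.and (E4.and ht))))
  set R := R2 / 2 with hR
  have hRR : 2 * R = R2 := by rw [hR]; ring
  have hRp : 0 < R := by rw [hR]; linarith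
  set L : ℝ := 1 + L1 + 2 / |fderiv ℝ ρ w0 ν| + ‖q‖ + ‖i‖ + ‖ν‖ + ‖v‖ with hL
  have n1 : (0:ℝ) ≤ L1 := L1.2
  have n2 : 0 ≤ 2 / |fderiv ℝ ρ w0 ν| := by positivity
  have n3 := norm_nonneg q
  have n4 := norm_nonneg i
  have n5 := norm_nonneg ν
  have n6 := norm_nonneg v
  have hFsymm : ∀ u, i u ∈ e.target → F (Φ u) = i u := fun u hu => e.right_inv hu
  have hqΦ : ∀ u, i u ∈ e.target → q (Φ u) = u := by
    intro u hu
    have := congrArg q (hFsymm u hu)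
    simp only [hF] at this
    rw [map_add, map_smul, hqi, hqν, smul_zero, add_zero, hqi] at this
    exact this
  have hρΦ : ∀ u, i u ∈ e.target → ρ (Φ u) = 0 := by
    intro u hu
    have h1 := hFsymm u hu
    simp only [hF] at h1
    rw [hqΦ u hu] at h1
    have h2 : ρ (Φ u) • ν = 0 := by simpa using h1
    exact (smul_eq_zero.1 h2).resolve_right hν0
  refine ⟨ν, hν0, i, q, v, Φ, R, L, ⟨hRp, by linarith, rfl, ?_, ?_, ?_, ?_, ?_, ?_, ?_, ?_, ?_, by linarith, by linarith⟩⟩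
  · intro ξ; exact ⟨φ ξ, by rw [hiq]; abel⟩
  · intro u hu
    rw [hRR] at hu
    have h4 := (hball u hu).2.2.2.1
    calc (1:ℝ) = (2 / |fderiv ℝ ρ w0 ν|) * (|fderiv ℝ ρ w0 ν| / 2) := by field_simp
      _ ≤ L * |fderiv ℝ ρ (Φ u) ν| := by gcongr; linarith
  · intro u hu
    rw [hRR] at hu
    have h4 := (hball u hu)
    exact (h.pre.zero _ h4.2.2.1).1 (hρΦ u h4.2.1)
  · intro u hu
    rw [hRR] at hu
    exact (hball u hu).1
  · intro u hu u' hu'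
    rw [hRR] at hu hu'
    have := hL1.dist_le_mul _ (hball u hu).2.2.2.2 _ (hball u' hu').2.2.2.2
    rw [dist_eq_norm, dist_eq_norm] at this
    refine this.trans ?_
    gcongr; linarith
  · intro u hu
    rw [hRR] at hu
    exact hqΦ u (hball u hu).2.1
  · have e1 : ∀ᶠ w in nhds w0, w ∈ e.source := e.open_source.eventually_mem hes
    have e2 : ∀ᶠ w in nhds w0, w ∈ U := h.Uo.eventually_mem hU0
    have e3 : ∀ᶠ w in nhds w0, q w ∈ Metric.ball (q w0) (R/2) :=
      q.continuous.continuousAt.eventually (Metric.ball_mem_nhds _ (by linarith))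
    filter_upwards [e1, e2, e3] with w h1 h2 h3 hw
    refine ⟨h3, ?_⟩
    have h4 : ρ w = 0 := (h.pre.zero w h2).2 hw
    have h5 : F w = i (q w) := by simp [hF, h4]
    change e.symm (i (q w)) = w
    rw [← h5, ← heF]; exact e.left_inv h1
  · intro ξ; exact (q.le_opNorm ξ).trans (by gcongr; linarith)
  · intro ξ; exact (i.le_opNorm ξ).trans (by gcongr; linarith)
end

noncomputable section
open scoped ENNReal
set_option linter.unusedSectionVars false
set_option linter.unusedVariables false

lemma dil_exists {H : Type} [NormedAddCommGroup H] [NormedSpace ℝ H] [FiniteDimensional ℝ H]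
    [MeasurableSpace H] [BorelSpace H] (μ : Measure H) [μ.IsAddHaarMeasure] (n : ℕ) (hn : 1 ≤ n)
    (hf : Module.finrank ℝ H = 2 * n - 1) (ℓ : H →L[ℝ] ℝ) (v : H) (hv : ℓ v ≠ 0) (r : ℝ) (hr : 0 < r) :
    ∃ T : H →ₗ[ℝ] H, (∀ k, T k = √r • k + ((r - √r) * (ℓ k / ℓ v)) • v) ∧
      ∀ s, μ (T '' s) = ENNReal.ofReal (r ^ n) * μ s := by
  have hsr : 0 < √r := Real.sqrt_pos.2 hr
  set f : Module.Dual ℝ H := ((√r - 1) / ℓ v) • ℓ.toLinearMap with hfdef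
  refine ⟨√r • LinearMap.transvection f v, ?_, ?_⟩
  · intro k
    have e : r - √r = √r * (√r - 1) := by rw [mul_sub, Real.mul_self_sqrt hr.le, mul_one]
    rw [LinearMap.smul_apply, LinearMap.transvection.apply, smul_add, smul_smul, e, hfdef]
    congr 2
    simp
    ring
  · intro s
    rw [Measure.addHaar_image_linearMap, LinearMap.det_smul, LinearMap.transvection.det, hf]
    congr 2
    have e : 1 + f v = √r := by simp [hfdef]; field_simp; ring
    rw [e, ← pow_succ, show 2 * n - 1 + 1 = 2 * n by omega, pow_mul, Real.sq_sqrt hr.le, abs_of_pos (by positivity)]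

/-- upper volume bound for the anisotropic box -/
lemma box_upper {H : Type} [NormedAddCommGroup H] [NormedSpace ℝ H] [FiniteDimensional ℝ H]
    [MeasurableSpace H] [BorelSpace H] (μ : Measure H) [μ.IsAddHaarMeasure] (n : ℕ) (hn : 1 ≤ n)
    (hf : Module.finrank ℝ H = 2 * n - 1) (ℓ : H →L[ℝ] ℝ) (v : H) (L C : ℝ) (hL : 1 ≤ L) (hC : 0 ≤ C)
    (hv : 1 ≤ L * |ℓ v|) (hvn : ‖v‖ ≤ L) (r : ℝ) (hr : 0 < r) (hr1 : r ≤ 1) :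
    μ {k | ‖k‖ ≤ C * √r ∧ |ℓ k| ≤ C * r} ≤ ENNReal.ofReal (r ^ n) * μ (Metric.closedBall 0 (C + C * L ^ 2)) := by
  have hv0 : ℓ v ≠ 0 := by rintro h; rw [h] at hv; simp at hv; linarith
  obtain ⟨T, hT, hTm⟩ := dil_exists μ n hn hf ℓ v hv0 r hr
  rw [← hTm]
  refine measure_mono ?_
  rintro k ⟨hk1, hk2⟩
  have hsr : 0 < √r := Real.sqrt_pos.2 hr
  have hrs : r ≤ √r := by
    apply Real.le_sqrt_of_sq_le; nlinarith
  set a : ℝ := (r⁻¹ - (√r)⁻¹) * (ℓ k / ℓ v) with ha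
  refine ⟨(√r)⁻¹ • k + a • v, ?_, ?_⟩
  · rw [mem_closedBall_zero_iff]
    refine (norm_add_le _ _).trans ?_
    rw [norm_smul, norm_smul, Real.norm_eq_abs, Real.norm_eq_abs, abs_of_pos (by positivity : 0 < (√r)⁻¹)]
    have h1 : (√r)⁻¹ * ‖k‖ ≤ C := by
      rw [inv_mul_le_iff₀ hsr]; linarith
    have h2 : |a| ≤ C * L := by
      rw [ha, abs_mul, abs_div]
      have h3 : (√r)⁻¹ ≤ r⁻¹ := by gcongr
      rw [abs_of_nonneg (by linarith)]
      have h4 : |ℓ k| / |ℓ v| ≤ L * (C * r) := by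
        have : 0 < |ℓ v| := abs_pos.2 hv0
        rw [div_le_iff₀ this]
        calc |ℓ k| ≤ C * r := hk2
          _ = 1 * (C * r) := by ring
          _ ≤ (L * |ℓ v|) * (C * r) := by gcongr
          _ = _ := by ring
      calc (r⁻¹ - (√r)⁻¹) * (|ℓ k| / |ℓ v|) ≤ r⁻¹ * (L * (C * r)) := by
            gcongr; linarith [inv_pos.2 hsr]
        _ = C * L := by field_simp
    calc (√r)⁻¹ * ‖k‖ + |a| * ‖v‖ ≤ C + (C * L) * L := by gcongr
      _ = _ := by ring
  · rw [hT, map_add, map_smul, map_smul, smul_add, smul_smul, smul_smul, smul_eq_mul, smul_eq_mul,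
      mul_inv_cancel₀ hsr.ne', one_smul, add_assoc, ← add_smul]
    have : (√r * a + (r - √r) * (((√r)⁻¹ * ℓ k + a * ℓ v) / ℓ v)) = 0 := by
      have e : r = √r * √r := (Real.mul_self_sqrt hr.le).symm
      rw [ha]
      generalize √r = t at *
      rw [e]
      have : t ≠ 0 := hsr.ne'
      field_simp
      ring
    rw [this, zero_smul, add_zero]

/-- lower volume bound for the anisotropic box -/
lemma box_lower {H : Type} [NormedAddCommGroup H] [NormedSpace ℝ H] [FiniteDimensional ℝ H]
    [MeasurableSpace H] [BorelSpace H] (μ : Measure H) [μ.IsAddHaarMeasure] (n : ℕ) (hn : 1 ≤ n)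
    (hf : Module.finrank ℝ H = 2 * n - 1) (ℓ : H →L[ℝ] ℝ) (v : H) (L η : ℝ) (hL : 1 ≤ L) (hη : 0 < η)
    (hv : 1 ≤ L * |ℓ v|) (hvn : ‖v‖ ≤ L) (hℓ : ∀ k, |ℓ k| ≤ L * ‖k‖) (r : ℝ) (hr : 0 < r) (hr1 : r ≤ 1) :
    ENNReal.ofReal (r ^ n) * μ (Metric.closedBall 0 (η / (2 * L ^ 3))) ≤ μ {k | ‖k‖ ≤ η * √r ∧ |ℓ k| ≤ η * r} := by
  have hv0 : ℓ v ≠ 0 := by rintro h; rw [h] at hv; simp at hv; linarith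
  obtain ⟨T, hT, hTm⟩ := dil_exists μ n hn hf ℓ v hv0 r hr
  rw [← hTm]
  refine measure_mono ?_
  rintro _ ⟨k, hk, rfl⟩
  rw [mem_closedBall_zero_iff] at hk
  have hsr : 0 < √r := Real.sqrt_pos.2 hr
  have hrs : r ≤ √r := by
    apply Real.le_sqrt_of_sq_le; nlinarith
  have hk2 : 2 * L ^ 3 * ‖k‖ ≤ η := by
    rw [le_div_iff₀ (by positivity)] at hk; linarith
  have hL3 : 1 ≤ L ^ 2 := one_le_pow₀ hL
  have hn0 := norm_nonneg k
  have hLk : L * ‖k‖ ≤ L ^ 3 * ‖k‖ := by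
    have : L ≤ L ^ 3 := by nlinarith
    gcongr
  have hkk : ‖k‖ ≤ L ^ 3 * ‖k‖ := by
    have : 1 ≤ L ^ 3 := one_le_pow₀ hL
    nlinarith
  refine ⟨?_, ?_⟩
  · rw [hT]
    refine (norm_add_le _ _).trans ?_
    rw [norm_smul, norm_smul, Real.norm_eq_abs, Real.norm_eq_abs, abs_of_pos hsr, abs_mul, abs_div]
    have h4 : |ℓ k| / |ℓ v| ≤ L * (L * ‖k‖) := by
      have : 0 < |ℓ v| := abs_pos.2 hv0
      rw [div_le_iff₀ this]
      calc |ℓ k| ≤ L * ‖k‖ := hℓ k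
        _ = 1 * (L * ‖k‖) := by ring
        _ ≤ (L * |ℓ v|) * (L * ‖k‖) := by gcongr
        _ = _ := by ring
    have h5 : |r - √r| ≤ √r := by rw [abs_le]; constructor <;> linarith
    calc √r * ‖k‖ + |r - √r| * (|ℓ k| / |ℓ v|) * ‖v‖ ≤ √r * ‖k‖ + √r * (L * (L * ‖k‖)) * L := by gcongr
      _ = √r * (‖k‖ + L ^ 3 * ‖k‖) := by ring
      _ ≤ √r * η := by gcongr; linarith
      _ = _ := by ring
  · have : ℓ (T k) = r * ℓ k := by
      rw [hT, map_add, map_smul, map_smul, smul_eq_mul, smul_eq_mul]; field_simp; ring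
    rw [this, abs_mul, abs_of_pos hr, mul_comm]
    gcongr
    have := hℓ k
    have : 0 ≤ L ^ 3 * ‖k‖ := by positivity
    linarith
end

noncomputable section
open scoped ENNReal
set_option linter.unusedSectionVars false
set_option linter.unusedVariables false

lemma GG_self {n : ℕ} (ρ : Cn n → ℝ) (A : ℝ) (y : Cn n) : GG ρ A y y = 0 := by simp [GG, gg]

lemma chart_ell {n : ℕ} {D U : Set (Cn n)} {ρ : Cn n → ℝ} {M δ c A K B : ℝ} (h : Geo D U ρ M δ c A K)
    (hB : GeoC D ρ A B) {H : Type} [NormedAddCommGroup H] [NormedSpace ℝ H] {w0 ν : Cn n}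
    {i : H →L[ℝ] Cn n} {q : Cn n →L[ℝ] H} {v : H} {Φ : H → Cn n} {R L : ℝ} (ch : Chart D ρ w0 ν i q v Φ R L) :
    ∃ C, 1 ≤ C ∧ ∀ u1 ∈ Metric.ball (q w0) (2 * R), ∃ ℓ : H →L[ℝ] ℝ, 1 ≤ C * |ℓ v| ∧ (∀ k, |ℓ k| ≤ C * ‖k‖) ∧
      ∀ u ∈ Metric.ball (q w0) (2 * R), |(gg ρ (Φ u1) (Φ u)).im + ℓ (u - u1)| ≤ C * ‖u - u1‖ ^ 2 := by
  have hL := ch.hL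
  have hM := h.pre.hM
  have hB1 := hB.hB
  set C : ℝ := 2 * L + (M * L + M * L * L * (M * L)) + 2 * (B * L ^ 2) * (M * L) * L with hC
  have p1 : 0 ≤ M * L + M * L * L * (M * L) := by positivity
  have p2 : 0 ≤ 2 * (B * L ^ 2) * (M * L) * L := by positivity
  refine ⟨C, by linarith, ?_⟩
  intro u1 hu1
  have hz0 := ch.mem u1 hu1
  set z0 := Φ u1 with hz0d
  set P := D1 ρ z0 with hP
  set dρ := fderiv ℝ ρ z0 with hdρ
  have hPre : ∀ ξ, (P ξ).re = 1/2 * dρ ξ := fun ξ => toD_re n _ ξ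
  have hPI : ∀ ξ, P (Complex.I • ξ) = Complex.I * P ξ := fun ξ => toD_I n _ ξ
  have hPn : ∀ ξ, ‖P ξ‖ ≤ M * ‖ξ‖ := fun ξ => D1_norm h.pre z0 hz0 ξ
  have hdn : ∀ ξ, |dρ ξ| ≤ M * ‖ξ‖ := fun ξ => by
    rw [← Real.norm_eq_abs]
    exact (dρ.le_opNorm ξ).trans (by have := h.pre.p1 z0 hz0; gcongr)
  set ρν := dρ ν with hρν
  have hg : 1 ≤ L * |ρν| := ch.grad u1 hu1
  have hρν0 : ρν ≠ 0 := by intro h0; rw [h0] at hg; simp at hg; linarith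
  have hap : 0 < |ρν| := abs_pos.2 hρν0
  have hinv : |ρν|⁻¹ ≤ L := by rw [inv_le_iff_one_le_mul₀ hap]; linarith
  have hPν : |(P ν).im| ≤ M * L :=
    (Complex.abs_im_le_norm _).trans ((hPn ν).trans (by have := ch.νn; gcongr))
  set ℓ : H →L[ℝ] ℝ := (Complex.imCLM.comp (P.comp i)) - ((P ν).im / ρν) • (dρ.comp i) with hℓ
  have hℓa : ∀ k, ℓ k = (P (i k)).im - (P ν).im / ρν * dρ (i k) := by intro k; simp [hℓ]
  refine ⟨ℓ, ?_, ?_, ?_⟩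
  · have e1 : ℓ v * ρν = 1/2 * ρν ^ 2 + 2 * (P ν).im ^ 2 := by
      rw [hℓa, ch.iv]
      have e2 : (P (Complex.I • ν)).im = 1/2 * ρν := by rw [hPI, Complex.mul_im]; simp [hPre]; rfl
      have e3 : dρ (Complex.I • ν) = -2 * (P ν).im := by
        have := hPre (Complex.I • ν)
        rw [hPI, Complex.mul_re] at this
        simp at this
        linarith
      rw [e2, e3]; field_simp; ring
    have e2 : 1/2 * |ρν| ^ 2 ≤ |ℓ v| * |ρν| := by
      rw [← abs_mul, e1, sq_abs]
      refine le_trans ?_ (le_abs_self _)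
      nlinarith [sq_nonneg (P ν).im]
    have e3 : |ρν| ≤ 2 * |ℓ v| := by
      by_contra hcon; push Not at hcon; nlinarith
    have : 0 ≤ (M * L + M * L * L * (M * L) + 2 * (B * L ^ 2) * (M * L) * L) * |ℓ v| := by positivity
    calc 1 ≤ L * |ρν| := hg
      _ ≤ L * (2 * |ℓ v|) := by gcongr
      _ ≤ C * |ℓ v| := by rw [hC]; linarith
  · intro k
    rw [hℓa]
    refine (abs_sub _ _).trans ?_
    have hik := ch.inn k
    have a1 : |(P (i k)).im| ≤ M * (L * ‖k‖) :=
      (Complex.abs_im_le_norm _).trans ((hPn _).trans (by gcongr))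
    have a2 : |(P ν).im / ρν * dρ (i k)| ≤ (M * L) * L * (M * (L * ‖k‖)) := by
      rw [abs_mul, abs_div, div_eq_mul_inv]
      have := (hdn (i k)).trans (by gcongr : M * ‖i k‖ ≤ M * (L * ‖k‖))
      gcongr
    have : 0 ≤ (2 * L + 2 * (B * L ^ 2) * (M * L) * L) * ‖k‖ := by positivity
    rw [hC]; linarith
  · intro u hu
    have hz := ch.mem u hu
    obtain ⟨s, hs⟩ := ch.dec (Φ u - z0)
    rw [map_sub, ch.qΦ u hu, hz0d, ch.qΦ u1 hu1, ← hz0d] at hs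
    set k := u - u1 with hk
    have egg : gg ρ z0 (Φ u) = -(P (i k) + s * P ν) := by
      have : z0 - Φ u = -(i k + s • ν) := by rw [← hs]; abel
      rw [gg, this, map_neg, map_add, map_smul, Complex.real_smul]
    have ere : (gg ρ z0 (Φ u)).re = -(1/2 * dρ (i k) + s * (1/2 * ρν)) := by
      rw [egg, Complex.neg_re, Complex.add_re, Complex.re_ofReal_mul, hPre, hPre]
    have eim : (gg ρ z0 (Φ u)).im = -((P (i k)).im + s * (P ν).im) := by
      rw [egg, Complex.neg_im, Complex.add_im, Complex.im_ofReal_mul]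
    have key : (gg ρ z0 (Φ u)).im + ℓ k = 2 * (gg ρ z0 (Φ u)).re * (P ν).im * ρν⁻¹ := by
      rw [eim, ere, hℓa]; field_simp; ring
    rw [key, abs_mul, abs_mul, abs_mul, abs_inv]
    have hre : |(gg ρ z0 (Φ u)).re| ≤ B * L ^ 2 * ‖k‖ ^ 2 := by
      refine (hB.re z0 hz0 (Φ u) hz).trans ?_
      have hl := ch.lip u1 hu1 u hu
      rw [norm_sub_rev u1 u] at hl
      calc B * ‖z0 - Φ u‖ ^ 2 ≤ B * (L * ‖k‖) ^ 2 := by gcongr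
        _ = _ := by ring
    have : 0 ≤ (2 * L + (M * L + M * L * L * (M * L))) * ‖k‖ ^ 2 := by positivity
    calc |2| * |(gg ρ z0 (Φ u)).re| * |(P ν).im| * |ρν|⁻¹ ≤ 2 * (B * L ^ 2 * ‖k‖ ^ 2) * (M * L) * L := by
          rw [abs_two]; gcongr
      _ ≤ C * ‖k‖ ^ 2 := by rw [hC]; linarith

lemma chart_V {n : ℕ} (hn : 1 ≤ n) {D U : Set (Cn n)} {ρ : Cn n → ℝ} {M δ c A K B : ℝ} (h : Geo D U ρ M δ c A K)
    (hB : GeoC D ρ A B) {H : Type} [NormedAddCommGroup H] [NormedSpace ℝ H] [FiniteDimensional ℝ H]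
    [MeasurableSpace H] [BorelSpace H] (μ : Measure H) [μ.IsAddHaarMeasure]
    (hf : Module.finrank ℝ H = 2 * n - 1) {w0 ν : Cn n}
    {i : H →L[ℝ] Cn n} {q : Cn n →L[ℝ] H} {v : H} {Φ : H → Cn n} {R L : ℝ} (ch : Chart D ρ w0 ν i q v Φ R L) :
    ∃ C : ℝ, 1 ≤ C ∧ ∀ w ∈ frontier D, ∀ r : ℝ, 0 < r →
      μ {u ∈ Metric.closedBall (q w0) (3 / 2 * R) | ‖GG ρ A w (Φ u)‖ < r} ≤ ENNReal.ofReal (C * r ^ n) := by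
  obtain ⟨C1, hC1, hell⟩ := chart_ell h hB ch
  have hL := ch.hL
  have hB1 := hB.hB
  have hR := ch.hR
  have hsub : Metric.closedBall (q w0) (3 / 2 * R) ⊆ Metric.ball (q w0) (2 * R) :=
    Metric.closedBall_subset_ball (by linarith)
  set Z : ℝ := 1 + 2 * B with hZ
  -- size of the box
  set Q : ℝ := L * B * Z + B * Z + C1 * (L ^ 2 * B * Z) with hQ
  have hZ1 : 1 ≤ Z := by linarith
  have hQ0 : 0 ≤ Q := by positivity
  set L' := max C1 L with hL'
  set V := μ (Metric.closedBall 0 (Q + Q * L' ^ 2)) with hV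
  have hVf : V ≠ ⊤ := (isCompact_closedBall _ _).measure_lt_top.ne
  set V2 := μ (Metric.closedBall (q w0) (3 / 2 * R)) with hV2
  have hV2f : V2 ≠ ⊤ := (isCompact_closedBall _ _).measure_lt_top.ne
  refine ⟨1 + V.toReal + V2.toReal, by linarith [V.toReal_nonneg, V2.toReal_nonneg], ?_⟩
  intro w hw r hr
  rcases le_or_gt r 1 with hr1 | hr1
  swap
  · refine (measure_mono (fun u hu => hu.1)).trans ?_
    rw [← hV2]
    refine (ENNReal.ofReal_toReal hV2f).symm.le.trans ?_
    refine ENNReal.ofReal_le_ofReal ?_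
    have : 1 ≤ r ^ n := one_le_pow₀ hr1.le
    have h1 := V.toReal_nonneg
    have h2 := V2.toReal_nonneg
    nlinarith
  rcases Set.eq_empty_or_nonempty {u ∈ Metric.closedBall (q w0) (3 / 2 * R) | ‖GG ρ A w (Φ u)‖ < r} with he | ⟨u1, hu1⟩
  · rw [he]; simp
  obtain ⟨ℓ, hℓ1, hℓ2, hℓ3⟩ := hell u1 (hsub hu1.1)
  have hz0 := ch.mem u1 (hsub hu1.1)
  have hsr : 0 ≤ √r := Real.sqrt_nonneg _
  have hincl : {u ∈ Metric.closedBall (q w0) (3 / 2 * R) | ‖GG ρ A w (Φ u)‖ < r} ⊆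
      (fun k => u1 + k) '' {k | ‖k‖ ≤ Q * √r ∧ |ℓ k| ≤ Q * r} := by
    rintro u ⟨hu, hur⟩
    have hz := ch.mem u (hsub hu)
    refine ⟨u - u1, ?_, by simp⟩
    have hG : ‖GG ρ A (Φ u1) (Φ u)‖ ≤ Z * r := by
      have h2 := hB.R2 (Φ u1) hz0 w hw (Φ u) hz
      have h3 := norm_le_norm_add_norm_sub' (GG ρ A (Φ u1) (Φ u)) (GG ρ A w (Φ u))
      have h4 : √‖GG ρ A w (Φ u1)‖ * √‖GG ρ A w (Φ u)‖ ≤ √r * √r := by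
        gcongr
        · exact hu1.2.le
      rw [Real.mul_self_sqrt hr.le] at h4
      have h5 := hu1.2
      have h6 : B * (‖GG ρ A w (Φ u1)‖ + √‖GG ρ A w (Φ u1)‖ * √‖GG ρ A w (Φ u)‖) ≤ B * (r + r) := by gcongr
      rw [hZ]; linarith
    have hd1 : ‖Φ u1 - Φ u‖ ^ 2 ≤ B * Z * r := (hB.d2 _ hz0 _ hz).trans (by rw [mul_assoc]; gcongr)
    have hk : ‖u - u1‖ ≤ L * ‖Φ u1 - Φ u‖ := by
      have := ch.qn (Φ u1 - Φ u)
      rw [map_sub, ch.qΦ u (hsub hu), ch.qΦ u1 (hsub hu1.1), norm_sub_rev] at this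
      exact this
    have hk2 : ‖u - u1‖ ^ 2 ≤ L ^ 2 * B * Z * r := by
      calc ‖u - u1‖ ^ 2 ≤ (L * ‖Φ u1 - Φ u‖) ^ 2 := by gcongr
        _ = L ^ 2 * ‖Φ u1 - Φ u‖ ^ 2 := by ring
        _ ≤ L ^ 2 * (B * Z * r) := by gcongr
        _ = _ := by ring
    refine ⟨?_, ?_⟩
    · refine (sq_le_sq₀ (norm_nonneg _) (by positivity)).1 ?_
      refine hk2.trans ?_
      rw [mul_pow, Real.sq_sqrt hr.le]
      gcongr
      have hBZ : 1 ≤ B * Z := by nlinarith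
      have : L * B * Z ≤ Q := by
        have : 0 ≤ B * Z + C1 * (L ^ 2 * B * Z) := by positivity
        linarith
      calc L ^ 2 * B * Z = L ^ 2 * (B * Z * 1) := by ring
        _ ≤ L ^ 2 * (B * Z * (B * Z)) := by gcongr
        _ = (L * B * Z) ^ 2 := by ring
        _ ≤ Q ^ 2 := by gcongr
    · have h1 := hℓ3 u (hsub hu)
      have h2 : |(gg ρ (Φ u1) (Φ u)).im| ≤ B * Z * r := by
        refine (Complex.abs_im_le_norm _).trans ((hB.dn _ hz0 _ hz).trans ?_)
        rw [mul_assoc]; gcongr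
      have h3 : |ℓ (u - u1)| ≤ |(gg ρ (Φ u1) (Φ u)).im + ℓ (u - u1)| + |(gg ρ (Φ u1) (Φ u)).im| := by
        have := abs_sub ((gg ρ (Φ u1) (Φ u)).im + ℓ (u - u1)) (gg ρ (Φ u1) (Φ u)).im
        simpa using this
      have h4 : C1 * ‖u - u1‖ ^ 2 ≤ C1 * (L ^ 2 * B * Z * r) := by gcongr
      have : 0 ≤ L * B * Z * r := by positivity
      rw [hQ]; nlinarith
  refine (measure_mono hincl).trans ?_
  rw [Set.image_add_left, measure_preimage_add]
  have hbox := box_upper μ n hn hf ℓ v L' Q (hL.trans (le_max_right _ _)) hQ0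
    (hℓ1.trans (by gcongr; exact le_max_left _ _)) (ch.vn.trans (le_max_right _ _)) r hr hr1
  refine hbox.trans ?_
  rw [← hV, ← ENNReal.ofReal_toReal hVf, ← ENNReal.ofReal_mul (by positivity)]
  simp only [ENNReal.ofReal_toReal hVf]
  refine ENNReal.ofReal_le_ofReal ?_
  have h1 := V.toReal_nonneg
  have h2 := V2.toReal_nonneg
  have : 0 < r ^ n := by positivity
  rw [mul_comm]
  gcongr
  linarith

lemma chart_low {n : ℕ} (hn : 1 ≤ n) {D U : Set (Cn n)} {ρ : Cn n → ℝ} {M δ c A K B : ℝ} (h : Geo D U ρ M δ c A K)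
    (hB : GeoC D ρ A B) {H : Type} [NormedAddCommGroup H] [NormedSpace ℝ H] [FiniteDimensional ℝ H]
    [MeasurableSpace H] [BorelSpace H] (μ : Measure H) [μ.IsAddHaarMeasure]
    (hf : Module.finrank ℝ H = 2 * n - 1) {w0 ν : Cn n}
    {i : H →L[ℝ] Cn n} {q : Cn n →L[ℝ] H} {v : H} {Φ : H → Cn n} {R L : ℝ} (ch : Chart D ρ w0 ν i q v Φ R L) :
    ∃ a : ℝ, 0 < a ∧ ∀ u1 ∈ Metric.ball (q w0) (R / 2), ∀ r : ℝ, 0 < r → r ≤ 1 →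
      ENNReal.ofReal (a * r ^ n) ≤ μ {u ∈ Metric.ball (q w0) R | ‖GG ρ A (Φ u) (Φ u1)‖ < r} := by
  obtain ⟨C1, hC1, hell⟩ := chart_ell h hB ch
  have hL := ch.hL
  have hB1 := hB.hB
  have hR := ch.hR
  set L' := max C1 L with hL'
  have hL'1 : 1 ≤ L' := hL.trans (le_max_right _ _)
  set W : ℝ := B * (B * (B * L ^ 2 + (1 + C1))) with hW
  have hW0 : 0 < W := by positivity
  set η : ℝ := min 1 (min (R / 3) (1 / (2 * W))) with hη
  have hη0 : 0 < η := by
    refine lt_min one_pos (lt_min (by linarith) (by positivity))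
  have hη1 : η ≤ 1 := min_le_left _ _
  have hηR : η ≤ R / 3 := (min_le_right _ _).trans (min_le_left _ _)
  have hηW : W * η ≤ 1 / 2 := by
    calc W * η ≤ W * (1 / (2 * W)) := by gcongr; exact (min_le_right _ _).trans (min_le_right _ _)
      _ = 1 / 2 := by field_simp
  set V := μ (Metric.closedBall 0 (η / (2 * L' ^ 3))) with hV
  have hVf : V ≠ ⊤ := (isCompact_closedBall _ _).measure_lt_top.ne
  have hV0 : V ≠ 0 := by
    have := Metric.measure_closedBall_pos μ (0:H) (by positivity : 0 < η / (2 * L' ^ 3))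
    exact this.ne'
  refine ⟨V.toReal, ENNReal.toReal_pos hV0 hVf, ?_⟩
  intro u1 hu1 r hr hr1
  have hu1' : u1 ∈ Metric.ball (q w0) (2 * R) := Metric.ball_subset_ball (by linarith) hu1
  obtain ⟨ℓ, hℓ1, hℓ2, hℓ3⟩ := hell u1 hu1'
  have hz0 := ch.mem u1 hu1'
  have hsr : 0 ≤ √r := Real.sqrt_nonneg _
  have hsr1 : √r ≤ 1 := Real.sqrt_le_one.2 hr1
  have hincl : (fun k => u1 + k) '' {k | ‖k‖ ≤ η * √r ∧ |ℓ k| ≤ η * r} ⊆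
      {u ∈ Metric.ball (q w0) R | ‖GG ρ A (Φ u) (Φ u1)‖ < r} := by
    rintro _ ⟨k, ⟨hk1, hk2⟩, rfl⟩
    have hkR : ‖k‖ ≤ R / 3 := hk1.trans ((mul_le_of_le_one_right hη0.le hsr1).trans hηR)
    have huR : u1 + k ∈ Metric.ball (q w0) R := by
      rw [Metric.mem_ball, dist_eq_norm] at hu1 ⊢
      have : u1 + k - q w0 = (u1 - q w0) + k := by abel
      rw [this]; refine (norm_add_le _ _).trans_lt ?_; linarith
    have huR' : u1 + k ∈ Metric.ball (q w0) (2 * R) := Metric.ball_subset_ball (by linarith) huR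
    refine ⟨huR, ?_⟩
    have hz := ch.mem _ huR'
    have h1 := hℓ3 _ huR'
    rw [add_sub_cancel_left] at h1
    have hkk : ‖k‖ ^ 2 ≤ η * r := by
      calc ‖k‖ ^ 2 ≤ (η * √r) ^ 2 := by gcongr
        _ = η * (η * r) := by rw [mul_pow, Real.sq_sqrt hr.le]; ring
        _ ≤ 1 * (η * r) := by gcongr
        _ = _ := one_mul _
    have him : |(gg ρ (Φ u1) (Φ (u1 + k))).im| ≤ (1 + C1) * (η * r) := by
      have h3 : |(gg ρ (Φ u1) (Φ (u1 + k))).im| ≤ |(gg ρ (Φ u1) (Φ (u1 + k))).im + ℓ k| + |ℓ k| := by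
        have := abs_sub ((gg ρ (Φ u1) (Φ (u1 + k))).im + ℓ k) (ℓ k)
        simpa using this
      have : C1 * ‖k‖ ^ 2 ≤ C1 * (η * r) := by gcongr
      linarith
    have hre : |(gg ρ (Φ u1) (Φ (u1 + k))).re| ≤ B * L ^ 2 * (η * r) := by
      refine (hB.re _ hz0 _ hz).trans ?_
      have hl := ch.lip u1 hu1' _ huR'
      rw [sub_add_cancel_left, norm_neg] at hl
      calc B * ‖Φ u1 - Φ (u1 + k)‖ ^ 2 ≤ B * (L * ‖k‖) ^ 2 := by gcongr
        _ = B * L ^ 2 * ‖k‖ ^ 2 := by ring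
        _ ≤ _ := by gcongr
    have hgg : ‖gg ρ (Φ u1) (Φ (u1 + k))‖ ≤ (B * L ^ 2 + (1 + C1)) * (η * r) := by
      have := Complex.norm_le_abs_re_add_abs_im (gg ρ (Φ u1) (Φ (u1 + k)))
      linarith
    calc ‖GG ρ A (Φ (u1 + k)) (Φ u1)‖ ≤ B * ‖GG ρ A (Φ u1) (Φ (u1 + k))‖ := hB.sym _ hz _ hz0
      _ ≤ B * (B * ‖gg ρ (Φ u1) (Φ (u1 + k))‖) := by have := hB.up _ hz0 _ hz; gcongr
      _ ≤ B * (B * ((B * L ^ 2 + (1 + C1)) * (η * r))) := by gcongr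
      _ = (W * η) * r := by rw [hW]; ring
      _ ≤ (1 / 2) * r := by gcongr
      _ < r := by linarith
  refine le_trans ?_ (measure_mono hincl)
  rw [Set.image_add_left, measure_preimage_add]
  have hbox := box_lower μ n hn hf ℓ v L' η hL'1 hη0
    (hℓ1.trans (by gcongr; exact le_max_left _ _)) (ch.vn.trans (le_max_right _ _))
    (fun k => (hℓ2 k).trans (by gcongr; exact le_max_left _ _)) r hr hr1
  refine le_trans ?_ hbox
  rw [← hV, ← ENNReal.ofReal_toReal hVf, ← ENNReal.ofReal_mul (by positivity)]
  refine ENNReal.ofReal_le_ofReal (le_of_eq ?_)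
  rw [mul_comm]; simp [hVf]
end

noncomputable section
open scoped ENNReal
set_option linter.unusedSectionVars false
set_option linter.unusedVariables false

lemma quart_deriv {n : ℕ} {H : Type} [NormedAddCommGroup H] [NormedSpace ℝ H] (F : H → Cn n) (u v : H) (A M : ℝ) (hA : 0 ≤ A)
    (hF : ContDiffAt ℝ 1 F u) (hM : ‖F u‖ ≤ M) :
    ContDiffAt ℝ 1 (fun u => ((A * (‖F u‖ ^ 2) ^ 2 : ℝ) : ℂ)) u ∧
    ‖fderiv ℝ (fun u => ((A * (‖F u‖ ^ 2) ^ 2 : ℝ) : ℂ)) u v‖ ≤ 4 * A * M ^ 2 * ‖fderiv ℝ F u v‖ * ‖F u‖ := by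
  have h1 : ContDiffAt ℝ 1 (fun u => ‖F u‖ ^ 2) u := hF.norm_sq ℂ
  have hq : ContDiffAt ℝ 1 (fun u => (A * (‖F u‖ ^ 2) ^ 2 : ℝ)) u := contDiffAt_const.mul (h1.pow 2)
  refine ⟨Complex.ofRealCLM.contDiff.contDiffAt.comp u hq, ?_⟩
  have hd : HasFDerivAt F (fderiv ℝ F u) u := (hF.differentiableAt (by norm_num)).hasFDerivAt
  have h2 := hd.norm_sq
  have h3 := (h2.pow 2).const_mul A
  have h4 := Complex.ofRealCLM.hasFDerivAt.comp u h3
  have h5 : fderiv ℝ (fun u => ((A * (‖F u‖ ^ 2) ^ 2 : ℝ) : ℂ)) u = _ := h4.fderiv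
  rw [h5]
  have hin : |inner ℝ (F u) (fderiv ℝ F u v)| ≤ ‖F u‖ * ‖fderiv ℝ F u v‖ := abs_real_inner_le_norm _ _
  have e : ‖(ofRealCLM.comp (A • ((2 • (‖F u‖ ^ 2) ^ (2-1)) • (2 • (innerSL ℝ (F u)).comp (fderiv ℝ F u))))) v‖ = 4 * A * ‖F u‖ ^ 2 * |inner ℝ (F u) (fderiv ℝ F u v)| := by
    simp only [ContinuousLinearMap.comp_apply, _root_.smul_apply, innerSL_apply_apply, ofRealCLM_apply, Complex.norm_real, Real.norm_eq_abs]
    simp [abs_mul, abs_of_nonneg hA]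
    ring
  refine (le_of_eq e).trans ?_
  calc 4 * A * ‖F u‖ ^ 2 * |inner ℝ (F u) (fderiv ℝ F u v)| ≤ 4 * A * M ^ 2 * (‖F u‖ * ‖fderiv ℝ F u v‖) := by gcongr
    _ = _ := by ring

/-- a function on the chart to which the integration by parts applies -/
structure Adm {H : Type} [NormedAddCommGroup H] [NormedSpace ℝ H] (S : Set H) (v : H) (α : H → ℂ) (C : ℝ)
    (E : H → ℂ) : Prop where
  smooth : ∀ u ∈ S, ContDiffAt ℝ 1 E u
  sec : ∀ u ∈ S, ∀ l : ℝ, 0 < l → l + ‖E u‖ ≤ C * ‖(l:ℂ) + E u‖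
  bdd : ∀ u ∈ S, ‖E u‖ ≤ C
  der : ∀ u ∈ S, ‖fderiv ℝ E u v - α u‖ ≤ C * √‖E u‖

/-- the leading derivative -/
def alph {n : ℕ} (ρ : Cn n → ℝ) {H : Type} [NormedAddCommGroup H] [NormedSpace ℝ H] (Φ : H → Cn n) (v u : H) : ℂ :=
  D1 ρ (Φ u) (fderiv ℝ Φ u v)

section
variable {n : ℕ} {D U : Set (Cn n)} {ρ : Cn n → ℝ} {M δ c A K B : ℝ} 
  {H : Type} [NormedAddCommGroup H] [NormedSpace ℝ H] {w0 ν : Cn n}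
  {i : H →L[ℝ] Cn n} {q : Cn n →L[ℝ] H} {v : H} {Φ : H → Cn n} {R L : ℝ}

lemma Chart.dΦ (ch : Chart D ρ w0 ν i q v Φ R L) (u : H) (hu : u ∈ Metric.ball (q w0) (2 * R)) :
    HasFDerivAt Φ (fderiv ℝ Φ u) u ∧ ‖fderiv ℝ Φ u v‖ ≤ L ^ 2 := by
  have h1 : HasFDerivAt Φ (fderiv ℝ Φ u) u := ((ch.smooth u hu).differentiableAt (by norm_num)).hasFDerivAt
  refine ⟨h1, ?_⟩
  have hL := ch.hL
  have h2 : ‖fderiv ℝ Φ u‖ ≤ L := by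
    refine h1.le_of_lip' (by linarith) ?_
    filter_upwards [Metric.isOpen_ball.mem_nhds hu] with u' hu'
    exact ch.lip u' hu' u hu
  calc ‖fderiv ℝ Φ u v‖ ≤ ‖fderiv ℝ Φ u‖ * ‖v‖ := ContinuousLinearMap.le_opNorm _ _
    _ ≤ L * L := by have := ch.vn; gcongr
    _ = _ := by ring

lemma Chart.P_smooth (h : Geo D U ρ M δ c A K) (ch : Chart D ρ w0 ν i q v Φ R L) (u : H)
    (hu : u ∈ Metric.ball (q w0) (2 * R)) :
    ContDiffAt ℝ 1 (fun u => D1 ρ (Φ u)) u := by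
  have h1 : ContDiffAt ℝ 1 Φ u := (ch.smooth u hu).of_le (by norm_num)
  have hU := h.SU (ch.mem u hu)
  have h2 : ContDiffAt ℝ 2 ρ (Φ u) := h.smooth.contDiffAt (h.Uo.mem_nhds hU)
  have h3 : ContDiffAt ℝ 1 (fderiv ℝ ρ) (Φ u) := h2.fderiv_right (by norm_num)
  have h4 : ContDiffAt ℝ 1 (fun w => D1 ρ w) (Φ u) := (toD n).contDiff.contDiffAt.comp (Φ u) h3
  exact h4.comp u h1

lemma Chart.alph_smooth (h : Geo D U ρ M δ c A K) (ch : Chart D ρ w0 ν i q v Φ R L) (u : H)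
    (hu : u ∈ Metric.ball (q w0) (2 * R)) :
    ContDiffAt ℝ 1 (alph ρ Φ v) u := by
  have h1 := ch.P_smooth h u hu
  have h2 : ContDiffAt ℝ 1 (fderiv ℝ Φ) u := (ch.smooth u hu).fderiv_right (by norm_num)
  exact h1.clm_apply (h2.clm_apply contDiffAt_const)

lemma Chart.alph_low (h : Geo D U ρ M δ c A K) (ch : Chart D ρ w0 ν i q v Φ R L) (u : H)
    (hu : u ∈ Metric.ball (q w0) (2 * R)) : alph ρ Φ v u ≠ 0 := by
  obtain ⟨h1, -⟩ := ch.dΦ u hu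
  set ξ := fderiv ℝ Φ u v with hξ
  have hq : q ξ = v := by
    have h2 : HasFDerivAt (fun u => q (Φ u)) (q.comp (fderiv ℝ Φ u)) u := q.hasFDerivAt.comp u h1
    have h3 : HasFDerivAt (fun u => q (Φ u)) (ContinuousLinearMap.id ℝ H) u := by
      refine (hasFDerivAt_id u).congr_of_eventuallyEq ?_
      filter_upwards [Metric.isOpen_ball.mem_nhds hu] with u' hu'
      exact ch.qΦ u' hu'
    have := h2.unique h3
    have := congrArg (fun T => T v) this
    simpa using this
  obtain ⟨s, hs⟩ := ch.dec ξ
  rw [hq, ch.iv] at hs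
  have e : alph ρ Φ v u = (Complex.I + s) * D1 ρ (Φ u) ν := by
    rw [alph, ← hξ, hs, map_add, D1, toD_I, map_smul, Complex.real_smul]; ring
  rw [e]
  refine mul_ne_zero ?_ ?_
  · intro h0
    have := congrArg Complex.im h0
    simp at this
  · intro h0
    have h3 := congrArg Complex.re h0
    rw [D1, toD_re] at h3
    have h4 := ch.grad u hu
    have : fderiv ℝ ρ (Φ u) ν = 0 := by simpa using h3
    rw [this] at h4
    simp at h4
    linarith

lemma D1_sub (h : PreGeo D U ρ M δ) (w z : Cn n)
    (hw : w ∈ frontier D) (hz : z ∈ frontier D) (ξ : Cn n) : ‖D1 ρ w ξ - D1 ρ z ξ‖ ≤ M * ‖w - z‖ * ‖ξ‖ := by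
  have : D1 ρ w ξ - D1 ρ z ξ = toD n (fderiv ℝ ρ w - fderiv ℝ ρ z) ξ := by
    rw [map_sub]; rfl
  rw [this]
  exact (toD_norm n _ ξ).trans (by have := h.p2 w hw z hz; gcongr)

/-- first variable frozen -/
lemma Chart.adm1 (h : Geo D U ρ M δ c A K) (hB : GeoC D ρ A B) (ch : Chart D ρ w0 ν i q v Φ R L) :
    ∃ C : ℝ, 1 ≤ C ∧ ∀ y ∈ frontier D, Adm (Metric.ball (q w0) (2 * R)) v (fun u => -alph ρ Φ v u) C
      (fun u => GG ρ A y (Φ u)) := by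
  have hL := ch.hL
  have hM := h.pre.hM
  have hB1 := hB.hB
  have hA := h.hA
  set C : ℝ := B + (M * L ^ 2 + 4 * A * M ^ 2 * L ^ 2) * B with hC
  have hCB : B ≤ C := by
    have : 0 ≤ (M * L ^ 2 + 4 * A * M ^ 2 * L ^ 2) * B := by positivity
    linarith
  refine ⟨C, hB1.trans hCB, fun y hy => ?_⟩
  have key : ∀ u ∈ Metric.ball (q w0) (2 * R), 
      ContDiffAt ℝ 1 (fun u => GG ρ A y (Φ u)) u ∧ 
      ‖fderiv ℝ (fun u => GG ρ A y (Φ u)) u v - -alph ρ Φ v u‖ ≤ C * √‖GG ρ A y (Φ u)‖ := by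
    intro u hu
    have hz := ch.mem u hu
    obtain ⟨hd, hdn⟩ := ch.dΦ u hu
    have hs : ContDiffAt ℝ 1 Φ u := (ch.smooth u hu).of_le (by norm_num)
    have hs1 : ContDiffAt ℝ 1 (fun u => y - Φ u) u := contDiffAt_const.sub hs
    have hfd : fderiv ℝ (fun u => y - Φ u) u = -fderiv ℝ Φ u := by
      rw [fderiv_const_sub]
    obtain ⟨hq1, hq2⟩ := quart_deriv (fun u => y - Φ u) u v A M hA hs1 (h.pre.p5 y hy _ hz)
    have hs2 : ContDiffAt ℝ 1 (fun u => gg ρ y (Φ u)) u := (D1 ρ y).contDiff.contDiffAt.comp u hs1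
    refine ⟨hs2.add hq1, ?_⟩
    have e1 : fderiv ℝ (fun u => gg ρ y (Φ u)) u v = - D1 ρ y (fderiv ℝ Φ u v) := by
      have : HasFDerivAt (fun u => gg ρ y (Φ u)) ((D1 ρ y).comp (-fderiv ℝ Φ u)) u :=
        (D1 ρ y).hasFDerivAt.comp u (hd.const_sub y)
      rw [this.fderiv]; simp
    have e2 : fderiv ℝ (fun u => GG ρ A y (Φ u)) u v = - D1 ρ y (fderiv ℝ Φ u v) +
        fderiv ℝ (fun u => ((A * (‖y - Φ u‖ ^ 2) ^ 2 : ℝ) : ℂ)) u v := by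
      have : fderiv ℝ (fun u => GG ρ A y (Φ u)) u = fderiv ℝ (fun u => gg ρ y (Φ u)) u +
          fderiv ℝ (fun u => ((A * (‖y - Φ u‖ ^ 2) ^ 2 : ℝ) : ℂ)) u :=
        fderiv_fun_add (hs2.differentiableAt (by norm_num)) (hq1.differentiableAt (by norm_num))
      rw [this, _root_.add_apply, e1]
    rw [hfd, _root_.neg_apply, norm_neg] at hq2
    set Q := fderiv ℝ (fun u => ((A * (‖y - Φ u‖ ^ 2) ^ 2 : ℝ) : ℂ)) u v
    rw [e2]
    have e3 : - D1 ρ y (fderiv ℝ Φ u v) + Q - -alph ρ Φ v u =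
      (D1 ρ (Φ u) (fderiv ℝ Φ u v) - D1 ρ y (fderiv ℝ Φ u v)) + Q := by rw [alph]; ring
    rw [e3]
    have t1 := D1_sub h.pre (Φ u) y hz hy (fderiv ℝ Φ u v)
    rw [norm_sub_rev] at t1
    have t2 := hB.d1 y hy _ hz
    have t0 := Real.sqrt_nonneg ‖GG ρ A y (Φ u)‖
    rw [norm_sub_rev (Φ u) y] at t1
    calc _ ≤ M * ‖y - Φ u‖ * ‖fderiv ℝ Φ u v‖ + 4 * A * M ^ 2 * ‖fderiv ℝ Φ u v‖ * ‖y - Φ u‖ :=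
          (norm_add_le _ _).trans (add_le_add (by rw [norm_sub_rev]; exact t1) hq2)
      _ ≤ M * (B * √‖GG ρ A y (Φ u)‖) * L ^ 2 + 4 * A * M ^ 2 * L ^ 2 * (B * √‖GG ρ A y (Φ u)‖) := by gcongr
      _ ≤ C * √‖GG ρ A y (Φ u)‖ := by
        have : 0 ≤ B * √‖GG ρ A y (Φ u)‖ := by positivity
        rw [hC]; linarith
  refine ⟨fun u hu => (key u hu).1, fun u hu l hl => (hB.sec y hy _ (ch.mem u hu) l hl).trans (by gcongr),
    fun u hu => (hB.bdd y hy _ (ch.mem u hu)).trans hCB, fun u hu => (key u hu).2⟩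

/-- second variable frozen -/
lemma Chart.adm2 (h : Geo D U ρ M δ c A K) (hB : GeoC D ρ A B) (ch : Chart D ρ w0 ν i q v Φ R L) :
    ∃ C : ℝ, 1 ≤ C ∧ ∀ y ∈ frontier D, Adm (Metric.ball (q w0) (2 * R)) v (fun u => alph ρ Φ v u) C
      (fun u => GG ρ A (Φ u) y) := by
  have hL := ch.hL
  have hM := h.pre.hM
  have hB1 := hB.hB
  have hA := h.hA
  set C : ℝ := B + (M * L * L + 4 * A * M ^ 2 * L ^ 2) * B with hC
  have hCB : B ≤ C := by
    have : 0 ≤ (M * L * L + 4 * A * M ^ 2 * L ^ 2) * B := by positivity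
    linarith
  refine ⟨C, hB1.trans hCB, fun y hy => ?_⟩
  have key : ∀ u ∈ Metric.ball (q w0) (2 * R), 
      ContDiffAt ℝ 1 (fun u => GG ρ A (Φ u) y) u ∧ 
      ‖fderiv ℝ (fun u => GG ρ A (Φ u) y) u v - alph ρ Φ v u‖ ≤ C * √‖GG ρ A (Φ u) y‖ := by
    intro u hu
    have hz := ch.mem u hu
    obtain ⟨hd, hdn⟩ := ch.dΦ u hu
    have hs : ContDiffAt ℝ 1 Φ u := (ch.smooth u hu).of_le (by norm_num)
    have hs1 : ContDiffAt ℝ 1 (fun u => Φ u - y) u := hs.sub contDiffAt_const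
    have hfd : fderiv ℝ (fun u => Φ u - y) u = fderiv ℝ Φ u := by
      rw [fderiv_sub_const]
    obtain ⟨hq1, hq2⟩ := quart_deriv (fun u => Φ u - y) u v A M hA hs1 (h.pre.p5 _ hz y hy)
    have hP := ch.P_smooth h u hu
    have hPd : HasFDerivAt (fun u => D1 ρ (Φ u)) (fderiv ℝ (fun u => D1 ρ (Φ u)) u) u :=
      (hP.differentiableAt (by norm_num)).hasFDerivAt
    set P' := fderiv ℝ (fun u => D1 ρ (Φ u)) u with hP'
    have hP'n : ‖P'‖ ≤ M * L := by
      refine hPd.le_of_lip' (by positivity) ?_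
      filter_upwards [Metric.isOpen_ball.mem_nhds hu] with u' hu'
      refine ContinuousLinearMap.opNorm_le_bound _ (by positivity) (fun ξ => ?_)
      have h1 := D1_sub h.pre (Φ u') (Φ u) (ch.mem u' hu') hz ξ
      have h2 := ch.lip u' hu' u hu
      calc _ ≤ M * ‖Φ u' - Φ u‖ * ‖ξ‖ := h1
        _ ≤ M * (L * ‖u' - u‖) * ‖ξ‖ := by gcongr
        _ = _ := by ring
    have hs2 : ContDiffAt ℝ 1 (fun u => gg ρ (Φ u) y) u := hP.clm_apply hs1
    refine ⟨hs2.add hq1, ?_⟩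
    have e1 : fderiv ℝ (fun u => gg ρ (Φ u) y) u v = P' v (Φ u - y) + alph ρ Φ v u := by
      have := hPd.clm_apply (hd.sub_const y)
      have t : fderiv ℝ (fun u => gg ρ (Φ u) y) u = _ := this.fderiv
      rw [t]; simp [alph, add_comm]
    have e2 : fderiv ℝ (fun u => GG ρ A (Φ u) y) u v = P' v (Φ u - y) + alph ρ Φ v u +
        fderiv ℝ (fun u => ((A * (‖Φ u - y‖ ^ 2) ^ 2 : ℝ) : ℂ)) u v := by
      have : fderiv ℝ (fun u => GG ρ A (Φ u) y) u = fderiv ℝ (fun u => gg ρ (Φ u) y) u +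
          fderiv ℝ (fun u => ((A * (‖Φ u - y‖ ^ 2) ^ 2 : ℝ) : ℂ)) u :=
        fderiv_fun_add (hs2.differentiableAt (by norm_num)) (hq1.differentiableAt (by norm_num))
      rw [this, _root_.add_apply, e1]
    rw [hfd] at hq2
    set Q := fderiv ℝ (fun u => ((A * (‖Φ u - y‖ ^ 2) ^ 2 : ℝ) : ℂ)) u v
    rw [e2]
    have e3 : P' v (Φ u - y) + alph ρ Φ v u + Q - alph ρ Φ v u = P' v (Φ u - y) + Q := by ring
    rw [e3]
    have t1 : ‖P' v (Φ u - y)‖ ≤ M * L * L * ‖Φ u - y‖ := by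
      refine (ContinuousLinearMap.le_opNorm _ _).trans ?_
      have := (P'.le_opNorm v).trans (by have := ch.vn; gcongr : ‖P'‖ * ‖v‖ ≤ M * L * L)
      gcongr
    have t2 := hB.d1 _ hz y hy
    have t0 := Real.sqrt_nonneg ‖GG ρ A (Φ u) y‖
    calc _ ≤ M * L * L * ‖Φ u - y‖ + 4 * A * M ^ 2 * ‖fderiv ℝ Φ u v‖ * ‖Φ u - y‖ :=
          (norm_add_le _ _).trans (add_le_add t1 hq2)
      _ ≤ M * L * L * (B * √‖GG ρ A (Φ u) y‖) + 4 * A * M ^ 2 * L ^ 2 * (B * √‖GG ρ A (Φ u) y‖) := by gcongr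
      _ ≤ C * √‖GG ρ A (Φ u) y‖ := by
        have : 0 ≤ B * √‖GG ρ A (Φ u) y‖ := by positivity
        rw [hC]; linarith
  refine ⟨fun u hu => (key u hu).1, fun u hu l hl => (hB.sec _ (ch.mem u hu) y hy l hl).trans (by gcongr),
    fun u hu => (hB.bdd _ (ch.mem u hu) y hy).trans hCB, fun u hu => (key u hu).2⟩

end

/-- integration by parts for admissible pairs -/
lemma adm_ibp {H : Type} [NormedAddCommGroup H] [NormedSpace ℝ H] [FiniteDimensional ℝ H]
    [MeasurableSpace H] [BorelSpace H] (μ : Measure H) [μ.IsAddHaarMeasure] (n : ℕ) (S T : Set H) (v : H) (α : H → ℂ)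
    (hα : ∀ u ∈ S, ContDiffAt ℝ 1 α u) (hα0 : ∀ u ∈ S, α u ≠ 0) (χ : H → ℝ) (hχ : ContDiff ℝ 1 χ)
    (hχT : tsupport χ ⊆ T) (hTS : T ⊆ S) (hT : IsCompact T) (C0 : ℝ) (hC0 : 1 ≤ C0) :
    ∃ C : ℝ, 1 ≤ C ∧ ∀ l l' : ℝ, 0 < l → l ≤ l' → l' ≤ 1 → ∀ E E' : H → ℂ, Adm S v α C0 E → Adm S v α C0 E' →
      ‖∫ u, (χ u : ℂ) * (kL n l (E u) * (starRingEnd ℂ) (kL n l' (E' u))) ∂μ‖ₑ ≤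
      ∫⁻ u in T, ENNReal.ofReal (C * √(l / l') * (mL n l (E u) * mL n l' (E' u))) ∂μ := by
  set β : H → ℂ := fun u => (χ u : ℂ) * (α u)⁻¹ with hβ
  have hsupp : tsupport β ⊆ tsupport χ := by
    refine closure_mono (fun u hu => ?_)
    rw [Function.mem_support] at hu ⊢
    intro h0; apply hu; simp [hβ, h0]
  have hβT := hsupp.trans hχT
  have hβS := hβT.trans hTS
  have hβ1 : ContDiff ℝ 1 β := by
    refine contDiff_of_tsupp (fun u hu => ?_)
    have h1 : ContDiffAt ℝ 1 (fun u => (χ u : ℂ)) u := Complex.ofRealCLM.contDiff.contDiffAt.comp u hχ.contDiffAt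
    exact h1.mul ((hα u (hβS hu)).inv (hα0 u (hβS hu)))
  have hβc : HasCompactSupport β := hT.of_isClosed_subset (isClosed_tsupport _) hβT
  obtain ⟨b1, hb1⟩ := hβc.exists_bound_of_continuous hβ1.continuous
  obtain ⟨b2, hb2⟩ := (hβc.fderiv_apply (𝕜 := ℝ) v).exists_bound_of_continuous 
    ((hβ1.continuous_fderiv (by norm_num)).clm_apply continuous_const)
  have hαc : ContinuousOn α T := fun u hu => (hα u (hTS hu)).continuousAt.continuousWithinAt
  obtain ⟨b3, hb3⟩ := hT.exists_bound_of_continuousOn hαc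
  set C1 : ℝ := max (max b1 b2) (|b3| + C0 * √C0) with hC1
  have hC01 : C0 ≤ C0 * √C0 := le_mul_of_one_le_right (by linarith) (Real.one_le_sqrt.2 hC0)
  have hC0C : C0 ≤ C1 := (hC01.trans (by linarith [abs_nonneg b3])).trans (le_max_right _ _)
  have hC11 : 1 ≤ C1 := hC0.trans hC0C
  set C : ℝ := 1 + (3 * (n+2) * C1 ^ 2 * (((C0⁻¹) ^ (n+3))⁻¹) ^ 2) with hC
  have hX0 : 0 ≤ (3 * (n+2) * C1 ^ 2 * (((C0⁻¹) ^ (n+3))⁻¹) ^ 2) := by positivity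
  refine ⟨C, by linarith, fun l l' hl hll hl1 E E' hE hE' => ?_⟩
  have hl' : 0 < l' := hl.trans_le hll
  have hsec : ∀ E : H → ℂ, Adm S v α C0 E → ∀ l : ℝ, 0 < l → ∀ u ∈ tsupport β, C0⁻¹ * (l + ‖E u‖) ≤ ‖(l:ℂ) + E u‖ := by
    intro E hE l hl u hu
    rw [inv_mul_le_iff₀ (by linarith)]
    exact hE.sec u (hβS hu) l hl
  have hib := ibp_lemma μ n C0⁻¹ C1 l l' (by positivity) (inv_le_one_of_one_le₀ hC0) hC11 hl hll hl1 v β α E E' hβ1 hβc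
    (fun u hu => hE.smooth u (hβS hu)) (fun u hu => hE'.smooth u (hβS hu)) (hsec E hE l hl) (hsec E' hE' l' hl')
    (fun u hu => (hb1 u).trans ((le_max_left _ _).trans (le_max_left _ _)))
    (fun u hu => (hb2 u).trans ((le_max_right _ _).trans (le_max_left _ _)))
    (fun u hu => (hE.der u (hβS hu)).trans (by gcongr))
    (fun u hu => by
      have h1 := hE'.der u (hβS hu)
      have h2 := hE'.bdd u (hβS hu)
      have h3 := hb3 u (hβT hu)
      have h4 : C0 * √‖E' u‖ ≤ C0 * √C0 := by gcongr
      have h5 := norm_le_norm_add_norm_sub' (fderiv ℝ E' u v) (α u)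
      refine le_trans ?_ (le_max_right _ _)
      have := le_abs_self b3
      linarith)
  have e : ∀ u, (χ u : ℂ) * (kL n l (E u) * (starRingEnd ℂ) (kL n l' (E' u))) = 
      β u * α u * (kL n l (E u) * (starRingEnd ℂ) (kL n l' (E' u))) := by
    intro u
    by_cases hu : u ∈ tsupport χ
    · have := hα0 u (hTS (hχT hu))
      simp only [hβ]; rw [mul_assoc (χ u : ℂ), inv_mul_cancel₀ this, mul_one]
    · have h0 : χ u = 0 := image_eq_zero_of_notMem_tsupport hu
      simp [hβ, h0]
  simp_rw [e]
  refine hib.trans ?_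
  refine (lintegral_mono_set hβT).trans ?_
  refine lintegral_mono (fun u => ENNReal.ofReal_le_ofReal ?_)
  have hm : ∀ l, 0 < l → ∀ z, 0 ≤ mL n l z := fun l hl z => by rw [mL]; positivity
  have := hm l hl (E u)
  have := hm l' hl' (E' u)
  have := Real.sqrt_nonneg (l / l')
  gcongr
  linarith
end

noncomputable section
open scoped ENNReal
set_option linter.unusedSectionVars false
set_option linter.unusedVariables false

/-- surface measure on the boundary as a type -/
def sig {n : ℕ} (D : Set (Cn n)) : Measure (frontier D) :=
  Measure.comap Subtype.val (Measure.hausdorffMeasure (2 * (n:ℝ) - 1))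

lemma sig_apply {n : ℕ} (D : Set (Cn n)) (s : Set (frontier D)) :
    sig D s = Measure.hausdorffMeasure (2 * (n:ℝ) - 1) (Subtype.val '' s) :=
  (MeasurableEmbedding.subtype_coe isClosed_frontier.measurableSet).comap_apply _ _

lemma gg_cont {n : ℕ} {D U : Set (Cn n)} {ρ : Cn n → ℝ} {M δ c A K : ℝ} (h : Geo D U ρ M δ c A K) :
    Continuous (fun p : frontier D × frontier D => gg ρ p.1 p.2) := by
  have h1 : ContinuousOn (fderiv ℝ ρ) U := h.smooth.continuousOn_fderiv_of_isOpen h.Uo (by norm_num)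
  have h2 : Continuous (fun w : frontier D => fderiv ℝ ρ w) :=
    h1.comp_continuous continuous_subtype_val (fun w => h.SU w.2)
  have h3 : Continuous (fun w : frontier D => D1 ρ w) := (toD n).continuous.comp h2
  have h4 : Continuous (fun p : frontier D × frontier D => (p.1 : Cn n) - (p.2 : Cn n)) := by fun_prop
  exact (h3.comp continuous_fst).clm_apply h4

lemma GG_cont {n : ℕ} {D U : Set (Cn n)} {ρ : Cn n → ℝ} {M δ c A K : ℝ} (h : Geo D U ρ M δ c A K) :
    Continuous (fun p : frontier D × frontier D => GG ρ A p.1 p.2) := by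
  refine (gg_cont h).add ?_
  have h4 : Continuous (fun p : frontier D × frontier D => (A * (‖(p.1 : Cn n) - (p.2 : Cn n)‖ ^ 2) ^ 2 : ℝ)) := by fun_prop
  exact Complex.continuous_ofReal.comp h4

/-- local piece of the measure -/
structure LocM {n : ℕ} (D : Set (Cn n)) (ρ : Cn n → ℝ) (A : ℝ) (m : Measure (frontier D)) (N : Set (frontier D))
    (C c : ℝ) : Prop where
  hC : 1 ≤ C
  hc : 0 < c
  m1 : m ≤ ENNReal.ofReal C • sig D
  m2 : (sig D).restrict N ≤ ENNReal.ofReal C • m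
  fin : m Set.univ ≤ ENNReal.ofReal C
  V : ∀ y : frontier D, ∀ r : ℝ, 0 < r → m {x : frontier D | ‖GG ρ A y x‖ < r} ≤ ENNReal.ofReal (C * r ^ n)
  low : ∀ x ∈ N, ∀ r : ℝ, 0 < r → r ≤ 1 →
    ENNReal.ofReal (c * r ^ n) ≤ m {y : frontier D | ‖GG ρ A y x‖ < r}
  I1 : ∀ l l' : ℝ, 0 < l → l ≤ l' → l' ≤ 1 → ∀ y y' : frontier D,
    ‖∫ x : frontier D, kL n l (GG ρ A y x) * (starRingEnd ℂ) (kL n l' (GG ρ A y' x)) ∂m‖ₑ ≤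
      ENNReal.ofReal (C * √(l / l')) *
        ∫⁻ x : frontier D, ENNReal.ofReal (mL n l (GG ρ A y x) * mL n l' (GG ρ A y' x)) ∂(sig D)
  I2 : ∀ l l' : ℝ, 0 < l → l ≤ l' → l' ≤ 1 → ∀ y y' : frontier D,
    ‖∫ x : frontier D, kL n l (GG ρ A x y) * (starRingEnd ℂ) (kL n l' (GG ρ A x y')) ∂m‖ₑ ≤
      ENNReal.ofReal (C * √(l / l')) *
        ∫⁻ x : frontier D, ENNReal.ofReal (mL n l (GG ρ A x y) * mL n l' (GG ρ A x y')) ∂(sig D)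

/-- transfer of an oscillatory estimate by push forward -/
lemma push_ibp {H X : Type} [MeasurableSpace H] [MeasurableSpace X] (μ : Measure H) (σ : Measure X) (T : Set H)
    (hT : MeasurableSet T) (Ψ : H → X) (hΨ : Measurable Ψ) (χ : H → ℝ) (hχ : Measurable χ) (hχ0 : ∀ u, 0 ≤ χ u)
    (hχT : ∀ u, u ∉ T → χ u = 0) (C1 C2 : ℝ) (hC1 : 1 ≤ C1) (hC2 : 1 ≤ C2)
    (hpush : Measure.map Ψ (μ.restrict T) ≤ ENNReal.ofReal C2 • σ) (n : ℕ) (l l' : ℝ) (hl : 0 < l) (hl' : 0 < l')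
    (f f' : X → ℂ) (hf : Measurable f) (hf' : Measurable f') (E E' : H → ℂ) (hE : ∀ u ∈ T, E u = f (Ψ u))
    (hE' : ∀ u ∈ T, E' u = f' (Ψ u))
    (hI : ‖∫ u, (χ u : ℂ) * (kL n l (E u) * (starRingEnd ℂ) (kL n l' (E' u))) ∂μ‖ₑ ≤
      ∫⁻ u in T, ENNReal.ofReal (C1 * √(l / l') * (mL n l (E u) * mL n l' (E' u))) ∂μ) :
    ‖∫ x, kL n l (f x) * (starRingEnd ℂ) (kL n l' (f' x)) ∂(Measure.map Ψ (μ.withDensity (fun u => ENNReal.ofReal (χ u))))‖ₑ ≤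
      ENNReal.ofReal ((C1 * C2) * √(l / l')) * ∫⁻ x, ENNReal.ofReal (mL n l (f x) * mL n l' (f' x)) ∂σ := by
  have m1 : Measurable (fun x => kL n l (f x)) := (measurable_kL n l).comp hf
  have m2 : Measurable (fun x => kL n l' (f' x)) := (measurable_kL n l').comp hf'
  have m3 : Measurable (fun x => kL n l (f x) * (starRingEnd ℂ) (kL n l' (f' x))) :=
    m1.mul (Complex.continuous_conj.measurable.comp m2)
  have m4 : Measurable (fun x => mL n l (f x)) := (measurable_mL n l).comp hf
  have m5 : Measurable (fun x => mL n l' (f' x)) := (measurable_mL n l').comp hf'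
  have m6 : Measurable (fun x => ENNReal.ofReal (mL n l (f x) * mL n l' (f' x))) := (m4.mul m5).ennreal_ofReal
  rw [integral_map hΨ.aemeasurable m3.aestronglyMeasurable]
  have e1 : ∫ u, kL n l (f (Ψ u)) * (starRingEnd ℂ) (kL n l' (f' (Ψ u))) ∂(μ.withDensity (fun u => ENNReal.ofReal (χ u))) =
      ∫ u, (χ u : ℂ) * (kL n l (E u) * (starRingEnd ℂ) (kL n l' (E' u))) ∂μ := by
    have := integral_withDensity_eq_integral_smul (μ := μ) hχ.real_toNNReal
      (fun u => kL n l (f (Ψ u)) * (starRingEnd ℂ) (kL n l' (f' (Ψ u))))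
    refine this.trans (integral_congr_ae (Filter.Eventually.of_forall fun u => ?_))
    by_cases hu : u ∈ T
    · simp only [hE u hu, hE' u hu]
      rw [NNReal.smul_def, Real.coe_toNNReal _ (hχ0 u), Complex.real_smul]
    · simp [hχT u hu]
  rw [e1]
  refine hI.trans ?_
  calc ∫⁻ u in T, ENNReal.ofReal (C1 * √(l / l') * (mL n l (E u) * mL n l' (E' u))) ∂μ
      = ∫⁻ u in T, ENNReal.ofReal (C1 * √(l / l')) * ENNReal.ofReal (mL n l (f (Ψ u)) * mL n l' (f' (Ψ u))) ∂μ := by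
        refine setLIntegral_congr_fun hT (fun u hu => ?_)
        simp only [hE u hu, hE' u hu]
        rw [ENNReal.ofReal_mul (by positivity)]
    _ = ENNReal.ofReal (C1 * √(l / l')) * ∫⁻ x, ENNReal.ofReal (mL n l (f x) * mL n l' (f' x)) ∂(Measure.map Ψ (μ.restrict T)) := by
        rw [lintegral_const_mul' _ _ ENNReal.ofReal_ne_top, lintegral_map m6 hΨ]
    _ ≤ ENNReal.ofReal (C1 * √(l / l')) * ∫⁻ x, ENNReal.ofReal (mL n l (f x) * mL n l' (f' x)) ∂(ENNReal.ofReal C2 • σ) := by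
        gcongr
    _ = _ := by
        rw [lintegral_smul_measure, smul_eq_mul, ← mul_assoc, ← ENNReal.ofReal_mul (by positivity)]
        congr 2; ring

set_option maxHeartbeats 1000000 in
lemma locM_chart {n : ℕ} (hn : 1 ≤ n) {D U : Set (Cn n)} {ρ : Cn n → ℝ} {M δ c A K B : ℝ} (h : Geo D U ρ M δ c A K)
    (hB : GeoC D ρ A B) {H : Type} [NormedAddCommGroup H] [NormedSpace ℝ H] [FiniteDimensional ℝ H]
    [MeasurableSpace H] [BorelSpace H]
    (hf : Module.finrank ℝ H = 2 * n - 1) {w0 ν : Cn n} (hw0 : w0 ∈ frontier D)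
    {i : H →L[ℝ] Cn n} {q : Cn n →L[ℝ] H} {v : H} {Φ : H → Cn n} {R L : ℝ} (ch : Chart D ρ w0 ν i q v Φ R L) :
    ∃ m N C c, N ∈ nhds (⟨w0, hw0⟩ : frontier D) ∧ LocM D ρ A m N C c := by
  classical
  set μ : Measure H := Measure.hausdorffMeasure (2 * (n:ℝ) - 1) with hμ
  have hdim : (2 * (n:ℝ) - 1) = (Module.finrank ℝ H : ℕ) := by
    rw [hf, Nat.cast_sub (by omega)]; push_cast; ring
  have hd0 : 0 ≤ 2 * (n:ℝ) - 1 := by rw [hdim]; positivity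
  have : μ.IsAddHaarMeasure := by
    rw [hμ, hdim]; exact isAddHaarMeasure_hausdorffMeasure
  have hR := ch.hR
  have hL := ch.hL
  have hB1 := hB.hB
  set T : Set H := Metric.closedBall (q w0) (3 / 2 * R) with hT
  set S : Set H := Metric.ball (q w0) (2 * R) with hS
  have hTS : T ⊆ S := Metric.closedBall_subset_ball (by linarith)
  have hTc : IsCompact T := isCompact_closedBall _ _
  have hTm : MeasurableSet T := hTc.measurableSet
  let χ : ContDiffBump (q w0) := ⟨R, 3 / 2 * R, hR, by linarith⟩
  have hχ1 : ∀ u ∈ Metric.closedBall (q w0) R, χ u = 1 := fun u hu => χ.one_of_mem_closedBall hu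
  have hχs : tsupport χ = T := χ.tsupport_eq
  have hχ0 : ∀ u, u ∉ T → χ u = 0 := fun u hu => image_eq_zero_of_notMem_tsupport (by rw [hχs]; exact hu)
  have hχm : Measurable (fun u => χ u) := χ.continuous.measurable
  -- the parametrization
  let Ψ0 : H → Cn n := T.piecewise Φ (fun _ => w0)
  have hΨ0m : Measurable Ψ0 := by
    refine ContinuousOn.measurable_piecewise ?_ continuousOn_const hTm
    exact fun u hu => (ch.smooth u (hTS hu)).continuousAt.continuousWithinAt
  have hΨ0 : ∀ u, Ψ0 u ∈ frontier D := by
    intro u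
    by_cases hu : u ∈ T
    · rw [show Ψ0 u = Φ u from Set.piecewise_eq_of_mem _ _ _ hu]; exact ch.mem u (hTS hu)
    · rw [show Ψ0 u = w0 from Set.piecewise_eq_of_notMem _ _ _ hu]; exact hw0
  let Ψ : H → frontier D := fun u => ⟨Ψ0 u, hΨ0 u⟩
  have hΨ : Measurable Ψ := hΨ0m.subtype_mk
  have hΨT : ∀ u ∈ T, (Ψ u : Cn n) = Φ u := fun u hu =>
    show Ψ0 u = Φ u from Set.piecewise_eq_of_mem _ _ _ hu
  set m : Measure (frontier D) := Measure.map Ψ (μ.withDensity (fun u => ENNReal.ofReal (χ u))) with hm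
  have hmT : m ≤ Measure.map Ψ (μ.restrict T) := by
    refine Measure.map_mono ?_ hΨ
    rw [← withDensity_indicator_one hTm]
    refine withDensity_mono (Filter.Eventually.of_forall fun u => ?_)
    by_cases hu : u ∈ T
    · simp [hu, χ.le_one]
    · simp [hu, hχ0 u hu]
  have hmR : Measure.map Ψ (μ.restrict (Metric.ball (q w0) R)) ≤ m := by
    refine Measure.map_mono ?_ hΨ
    rw [← withDensity_indicator_one Metric.isOpen_ball.measurableSet]
    refine withDensity_mono (Filter.Eventually.of_forall fun u => ?_)
    by_cases hu : u ∈ Metric.ball (q w0) R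
    · simp [hu, hχ1 u (Metric.ball_subset_closedBall hu)]
    · simp [hu]
  set Ld : ℝ := L ^ (2 * (n:ℝ) - 1) with hLd
  have hLd1 : 1 ≤ Ld := Real.one_le_rpow hL hd0
  have hLdE : ((L.toNNReal : ℝ≥0∞)) ^ (2 * (n:ℝ) - 1) = ENNReal.ofReal Ld := by
    rw [hLd, ← ENNReal.ofReal_rpow_of_nonneg (by linarith) hd0]; rfl
  have hq : LipschitzWith L.toNNReal q := by
    refine LipschitzWith.of_dist_le_mul (fun a b => ?_)
    rw [dist_eq_norm, dist_eq_norm, ← map_sub, Real.coe_toNNReal _ (by linarith)]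
    exact ch.qn _
  have hΦ : LipschitzOnWith L.toNNReal Φ S := by
    refine LipschitzOnWith.of_dist_le_mul (fun a ha b hb => ?_)
    rw [dist_eq_norm, dist_eq_norm, Real.coe_toNNReal _ (by linarith)]
    exact ch.lip a ha b hb
  have hpush : Measure.map Ψ (μ.restrict T) ≤ ENNReal.ofReal Ld • sig D := by
    refine Measure.le_iff.2 (fun s hs => ?_)
    rw [Measure.map_apply hΨ hs, Measure.restrict_apply (hΨ hs), Measure.smul_apply, smul_eq_mul, sig_apply]
    have hsub : Ψ ⁻¹' s ∩ T ⊆ q '' (Subtype.val '' s) := by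
      rintro u ⟨hu1, hu2⟩
      exact ⟨Ψ u, ⟨Ψ u, hu1, rfl⟩, by rw [hΨT u hu2, ch.qΦ u (hTS hu2)]⟩
    refine (measure_mono hsub).trans ?_
    have := hq.hausdorffMeasure_image_le hd0 (Subtype.val '' s)
    rw [hLdE] at this
    exact this
  set N : Set (frontier D) := {x | q (x : Cn n) ∈ Metric.ball (q w0) (R / 2) ∧ Φ (q x) = x} with hN
  have hNn : N ∈ nhds (⟨w0, hw0⟩ : frontier D) := by
    have h1 := (continuous_subtype_val (p := fun x => x ∈ frontier D)).continuousAt (x := ⟨w0, hw0⟩)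
    have h2 := h1.eventually ch.surj
    filter_upwards [h2] with x hx
    exact hx x.2
  have hball : Metric.ball (q w0) (R / 2) ⊆ Metric.ball (q w0) R := Metric.ball_subset_ball (by linarith)
  have hballT : Metric.ball (q w0) R ⊆ T :=
    Metric.ball_subset_closedBall.trans (Metric.closedBall_subset_closedBall (by linarith))
  have hNm : (sig D).restrict N ≤ ENNReal.ofReal Ld • m := by
    refine Measure.le_iff.2 (fun s hs => ?_)
    rw [Measure.restrict_apply hs, sig_apply, Measure.smul_apply, smul_eq_mul]
    have hsub : Subtype.val '' (s ∩ N) ⊆ Φ '' (Ψ ⁻¹' s ∩ Metric.ball (q w0) R) := by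
      rintro _ ⟨x, ⟨hx1, hx2, hx3⟩, rfl⟩
      refine ⟨q x, ⟨?_, hball hx2⟩, hx3⟩
      have : Ψ (q x) = x := Subtype.ext ((hΨT _ (hballT (hball hx2))).trans hx3)
      rw [Set.mem_preimage, this]; exact hx1
    refine (measure_mono hsub).trans ?_
    have := (hΦ.mono (Set.inter_subset_right.trans (hballT.trans hTS)) :
      LipschitzOnWith L.toNNReal Φ (Ψ ⁻¹' s ∩ Metric.ball (q w0) R)).hausdorffMeasure_image_le hd0
    rw [hLdE] at this
    refine this.trans ?_
    gcongr
    have h2 := hmR s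
    rw [Measure.map_apply hΨ hs, Measure.restrict_apply (hΨ hs)] at h2
    exact h2
  have hcG := GG_cont h
  have hmeas1 : ∀ y : frontier D, Measurable (fun x : frontier D => GG ρ A y x) := fun y =>
    (hcG.comp (by fun_prop : Continuous fun x : frontier D => (y, x))).measurable
  have hmeas2 : ∀ y : frontier D, Measurable (fun x : frontier D => GG ρ A x y) := fun y =>
    (hcG.comp (by fun_prop : Continuous fun x : frontier D => (x, y))).measurable
  obtain ⟨CV, hCV1, hCV⟩ := chart_V hn h hB μ hf ch
  obtain ⟨a, ha0, ha⟩ := chart_low hn h hB μ hf ch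
  obtain ⟨C1, hC11, hC1⟩ := ch.adm1 h hB
  obtain ⟨C2, hC21, hC2⟩ := ch.adm2 h hB
  obtain ⟨C3, hC31, hC3⟩ := adm_ibp μ n S T v (fun u => -alph ρ Φ v u) (fun u hu => (ch.alph_smooth h u hu).neg)
    (fun u hu => neg_ne_zero.2 (ch.alph_low h u hu)) χ χ.contDiff hχs.le hTS hTc C1 hC11
  obtain ⟨C4, hC41, hC4⟩ := adm_ibp μ n S T v (fun u => alph ρ Φ v u) (fun u hu => (ch.alph_smooth h u hu))
    (fun u hu => (ch.alph_low h u hu)) χ χ.contDiff hχs.le hTS hTc C2 hC21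
  have hTf : μ T ≠ ⊤ := hTc.measure_lt_top.ne
  have hmuniv : m Set.univ ≤ ENNReal.ofReal (μ T).toReal := by
    refine (hmT Set.univ).trans ?_
    rw [Measure.map_apply hΨ MeasurableSet.univ, ENNReal.ofReal_toReal hTf]
    simp
  have hT0 := (μ T).toReal_nonneg
  set C : ℝ := CV + (C3 + C4) * Ld + (μ T).toReal with hC
  have c1 : CV ≤ C := by
    have : 0 ≤ (C3 + C4) * Ld := by positivity
    linarith
  have c2 : C3 * Ld ≤ C := by
    have : 0 ≤ C4 * Ld := by positivity
    linarith
  have c3 : C4 * Ld ≤ C := by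
    have : 0 ≤ C3 * Ld := by positivity
    linarith
  have c4 : Ld ≤ C := le_trans (by nlinarith) c2
  have c5 : (μ T).toReal ≤ C := by
    have : 0 ≤ (C3 + C4) * Ld := by positivity
    linarith
  refine ⟨m, N, C, a, hNn, ⟨hCV1.trans c1, ha0, ?_, ?_, ?_, ?_, ?_, ?_, ?_⟩⟩
  · refine (hmT.trans hpush).trans ?_
    gcongr
  · refine hNm.trans ?_
    gcongr
  · exact hmuniv.trans (ENNReal.ofReal_le_ofReal c5)
  · intro y r hr
    refine (hmT _).trans ?_
    have hms : MeasurableSet {x : frontier D | ‖GG ρ A y x‖ < r} :=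
      measurableSet_lt (hmeas1 y).norm measurable_const
    rw [Measure.map_apply hΨ hms, Measure.restrict_apply (hΨ hms)]
    refine (measure_mono ?_).trans ((hCV y y.2 r hr).trans (ENNReal.ofReal_le_ofReal (by gcongr)))
    rintro u ⟨hu1, hu2⟩
    refine ⟨hu2, ?_⟩
    rw [Set.mem_preimage, Set.mem_ofPred_eq, hΨT u hu2] at hu1
    exact hu1
  · rintro x ⟨hx1, hx2⟩ r hr hr1
    refine (ha _ hx1 r hr hr1).trans (le_trans ?_ (hmR _))
    have hms : MeasurableSet {y : frontier D | ‖GG ρ A y x‖ < r} :=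
      measurableSet_lt (hmeas2 x).norm measurable_const
    rw [Measure.map_apply hΨ hms, Measure.restrict_apply (hΨ hms)]
    refine measure_mono ?_
    rintro u ⟨hu1, hu2⟩
    refine ⟨?_, hu1⟩
    rw [Set.mem_preimage, Set.mem_ofPred_eq, hΨT u (hballT hu1)]
    rw [hx2] at hu2
    exact hu2
  · intro l l' hl hll hl1 y y'
    have hl' := hl.trans_le hll
    refine (push_ibp μ (sig D) T hTm Ψ hΨ χ hχm (fun u => χ.nonneg) hχ0 C3 Ld hC31 hLd1 hpush n l l' hl hl'
      (fun x => GG ρ A y x) (fun x => GG ρ A y' x) (hmeas1 y) (hmeas1 y') (fun u => GG ρ A y (Φ u))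
      (fun u => GG ρ A y' (Φ u)) (fun u hu => by simp only [hΨT u hu]) (fun u hu => by simp only [hΨT u hu])
      (hC3 l l' hl hll hl1 _ _ (hC1 y y.2) (hC1 y' y'.2))).trans ?_
    gcongr
  · intro l l' hl hll hl1 y y'
    have hl' := hl.trans_le hll
    refine (push_ibp μ (sig D) T hTm Ψ hΨ χ hχm (fun u => χ.nonneg) hχ0 C4 Ld hC41 hLd1 hpush n l l' hl hl'
      (fun x => GG ρ A x y) (fun x => GG ρ A x y') (hmeas2 y) (hmeas2 y') (fun u => GG ρ A (Φ u) y)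
      (fun u => GG ρ A (Φ u) y') (fun u hu => by simp only [hΨT u hu]) (fun u hu => by simp only [hΨT u hu])
      (hC4 l l' hl hll hl1 _ _ (hC2 y y.2) (hC2 y' y'.2))).trans ?_
    gcongr

lemma locM_exists {n : ℕ} (hn : 1 ≤ n) {D U : Set (Cn n)} {ρ : Cn n → ℝ} {M δ c A K B : ℝ} (h : Geo D U ρ M δ c A K)
    (hB : GeoC D ρ A B) (x0 : frontier D) :
    ∃ m N C c, N ∈ nhds x0 ∧ LocM D ρ A m N C c := by
  obtain ⟨ν, hν, i, q, v, Φ, R, L, ch⟩ := chart_exists h x0 x0.2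
  exact locM_chart hn h hB (finrank_ker_phi ν hν hn) x0.2 ch
end

noncomputable section
open scoped ENNReal
set_option linter.unusedSectionVars false
set_option linter.unusedVariables false

lemma kL_bound (n : ℕ) (c l : ℝ) (hc : 0 < c) (hl : 0 < l) (z : ℂ)
    (h : c * (l + ‖z‖) ≤ ‖(l:ℂ) + z‖) : ‖kL n l z‖ ≤ (c ^ (n+2))⁻¹ * (l * (l ^ (n+1))⁻¹) := by
  refine (norm_kL_le n c l hc hl z h).trans ?_
  unfold mL
  have := norm_nonneg z
  gcongr
  linarith

/-- summing an oscillatory estimate over finitely many measures -/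
lemma sum_osc {X ι : Type} [MeasurableSpace X] (F : Finset ι) (m : ι → Measure X) [∀ i, IsFiniteMeasure (m i)]
    (σ : Measure X) (C : ι → ℝ) (hC : ∀ i, 1 ≤ C i) (s Cs : ℝ) (hs : 0 ≤ s) (hCs : ∑ i ∈ F, C i ≤ Cs)
    (hσ : σ ≤ ENNReal.ofReal Cs • ∑ i ∈ F, m i) (k : X → ℂ) (hk : Measurable k) (b : ℝ) (hb : ∀ x, ‖k x‖ ≤ b)
    (w : X → ℝ≥0∞) (h : ∀ i ∈ F, ‖∫ x, k x ∂(m i)‖ₑ ≤ ENNReal.ofReal (C i * s) * ∫⁻ x, w x ∂σ) (C' : ℝ)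
    (hC' : Cs * Cs ≤ C') :
    ‖∫ x, k x ∂(∑ i ∈ F, m i)‖ₑ ≤ ENNReal.ofReal (C' * s) * ∫⁻ x, w x ∂(∑ i ∈ F, m i) := by
  have hCs0 : 0 ≤ Cs := le_trans (Finset.sum_nonneg fun i _ => by linarith [hC i]) hCs
  rw [integral_finsetSum_measure (fun i hi => Integrable.of_bound hk.aestronglyMeasurable b (Filter.Eventually.of_forall hb))]
  calc ‖∑ i ∈ F, ∫ x, k x ∂(m i)‖ₑ ≤ ∑ i ∈ F, ‖∫ x, k x ∂(m i)‖ₑ := enorm_sum_le _ _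
    _ ≤ ∑ i ∈ F, ENNReal.ofReal (C i * s) * ∫⁻ x, w x ∂σ := Finset.sum_le_sum h
    _ = ENNReal.ofReal ((∑ i ∈ F, C i) * s) * ∫⁻ x, w x ∂σ := by
      rw [← Finset.sum_mul, ← ENNReal.ofReal_sum_of_nonneg, ← Finset.sum_mul]
      intro i _; have := hC i; positivity
    _ ≤ ENNReal.ofReal (Cs * s) * ∫⁻ x, w x ∂(ENNReal.ofReal Cs • ∑ i ∈ F, m i) := by
      gcongr
    _ = ENNReal.ofReal (Cs * Cs * s) * ∫⁻ x, w x ∂(∑ i ∈ F, m i) := by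
      rw [lintegral_smul_measure, smul_eq_mul, ← mul_assoc, ← ENNReal.ofReal_mul (by positivity)]
      congr 2; ring
    _ ≤ _ := by gcongr

set_option maxHeartbeats 1000000 in
lemma qhyp_exists {n : ℕ} (hn : 1 ≤ n) {D U : Set (Cn n)} {ρ : Cn n → ℝ} {M δ c0 A K B : ℝ} (h : Geo D U ρ M δ c0 A K)
    (hB : GeoC D ρ A B) : ∃ (μ : Measure (frontier D)) (a : ℝ≥0∞) (c C : ℝ), IsFiniteMeasure μ ∧ a ≠ ⊤ ∧ 
      sig D ≤ a • μ ∧ μ ≤ a • sig D ∧ QHyp μ n (fun x y : frontier D => GG ρ A y x) c C ∧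
      (∀ x y : frontier D, c * dist x y ^ 2 ≤ ‖GG ρ A y x‖) ∧ (∀ x y : frontier D, ‖GG ρ A y x‖ ≤ C * dist x y) := by
  have hB1 := hB.hB
  choose m N C c hN hm using locM_exists hn h hB
  have : CompactSpace (frontier D) := isCompact_iff_compactSpace.1 h.pre.comp
  obtain ⟨F, -, hF⟩ := (isCompact_univ (X := frontier D)).elim_nhds_subcover N (fun x _ => hN x)
  have hfin : ∀ i, IsFiniteMeasure (m i) := fun i => ⟨(hm i).fin.trans_lt ENNReal.ofReal_lt_top⟩
  set μ : Measure (frontier D) := ∑ i ∈ F, m i with hμ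
  set Cs : ℝ := ∑ i ∈ F, C i with hCs
  have hCi : ∀ i ∈ F, C i ≤ Cs := fun i hi => 
    Finset.single_le_sum (f := C) (fun j _ => by linarith [(hm j).hC]) hi
  have hCs0 : 0 ≤ Cs := Finset.sum_nonneg (fun j _ => by linarith [(hm j).hC])
  set Cf : ℝ := Cs * Cs + Cs * B ^ n + B with hCf
  have f1 : Cs * Cs ≤ Cf := by
    have : 0 ≤ Cs * B ^ n := by positivity
    linarith
  have f2 : Cs * B ^ n ≤ Cf := by nlinarith
  have f3 : B ≤ Cf := by
    have : 0 ≤ Cs * B ^ n := by positivity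
    nlinarith
  have f4 : Cs ≤ Cf := le_trans (le_mul_of_one_le_right hCs0 (one_le_pow₀ hB1)) f2
  set cf : ℝ := (∑ i ∈ F, (c i)⁻¹ + B)⁻¹ with hcf
  have hs0 : 0 ≤ ∑ i ∈ F, (c i)⁻¹ := Finset.sum_nonneg (fun j _ => inv_nonneg.2 (hm j).hc.le)
  have hcf0 : 0 < cf := by positivity
  have hcfB : cf ≤ B⁻¹ := inv_anti₀ (by linarith) (by linarith)
  have hcf1 : cf ≤ 1 := hcfB.trans (inv_le_one_of_one_le₀ hB1)
  have hci : ∀ i ∈ F, cf ≤ c i := by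
    intro i hi
    have h1 : (c i)⁻¹ ≤ ∑ i ∈ F, (c i)⁻¹ :=
      Finset.single_le_sum (f := fun i => (c i)⁻¹) (fun j _ => inv_nonneg.2 (hm j).hc.le) hi
    exact inv_le_of_inv_le₀ (hm i).hc (by linarith)
  have hμs : ∀ s, μ s = ∑ i ∈ F, m i s := fun s => by rw [hμ, Measure.finsetSum_apply]
  have hσμ : sig D ≤ ENNReal.ofReal Cs • μ := by
    refine Measure.le_iff.2 (fun s hs => ?_)
    calc sig D s ≤ sig D (⋃ i ∈ F, s ∩ N i) := by
          refine measure_mono (fun x hx => ?_)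
          have := hF (Set.mem_univ x)
          simp only [Set.mem_iUnion] at this ⊢
          obtain ⟨i, hi, hxi⟩ := this
          exact ⟨i, hi, hx, hxi⟩
      _ ≤ ∑ i ∈ F, sig D (s ∩ N i) := measure_biUnion_finset_le _ _
      _ ≤ ∑ i ∈ F, ENNReal.ofReal Cs * m i s := by
          refine Finset.sum_le_sum (fun i hi => ?_)
          have := (hm i).m2 s
          rw [Measure.restrict_apply hs, Measure.smul_apply, smul_eq_mul] at this
          refine this.trans ?_
          have := hCi i hi
          gcongr
      _ = _ := by rw [← Finset.mul_sum, Measure.smul_apply, smul_eq_mul, hμs]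
  have hμσ : μ ≤ ENNReal.ofReal Cs • sig D := by
    refine Measure.le_iff.2 (fun s hs => ?_)
    rw [hμs, Measure.smul_apply, smul_eq_mul, hCs, ENNReal.ofReal_sum_of_nonneg (fun j _ => by linarith [(hm j).hC]),
      Finset.sum_mul]
    exact Finset.sum_le_sum (fun i _ => (hm i).m1 s)
  have hV : ∀ y : frontier D, ∀ r : ℝ, 0 < r → μ {x : frontier D | ‖GG ρ A y x‖ < r} ≤ ENNReal.ofReal (Cs * r ^ n) := by
    intro y r hr
    rw [hμs, hCs, Finset.sum_mul, ENNReal.ofReal_sum_of_nonneg (fun j _ => by have := (hm j).hC; positivity)]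
    exact Finset.sum_le_sum (fun i _ => (hm i).V y r hr)
  have hcG := GG_cont h
  have hmeas1 : ∀ y : frontier D, Measurable (fun x : frontier D => GG ρ A y x) := fun y =>
    (hcG.comp (by fun_prop : Continuous fun x : frontier D => (y, x))).measurable
  have hmeas2 : ∀ y : frontier D, Measurable (fun x : frontier D => GG ρ A x y) := fun y =>
    (hcG.comp (by fun_prop : Continuous fun x : frontier D => (x, y))).measurable
  have hsec : ∀ w z : frontier D, ∀ l : ℝ, 0 < l → cf * (l + ‖GG ρ A w z‖) ≤ ‖(l:ℂ) + GG ρ A w z‖ := by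
    intro w z l hl
    have h1 := hB.sec w w.2 z z.2 l hl
    calc cf * (l + ‖GG ρ A w z‖) ≤ B⁻¹ * (l + ‖GG ρ A w z‖) := by gcongr
      _ ≤ B⁻¹ * (B * ‖(l:ℂ) + GG ρ A w z‖) := by gcongr
      _ = _ := by field_simp
  have kb : ∀ l l' : ℝ, 0 < l → 0 < l' → ∀ a b a' b' : frontier D, 
      ‖kL n l (GG ρ A a b) * (starRingEnd ℂ) (kL n l' (GG ρ A a' b'))‖ ≤ 
      ((cf ^ (n+2))⁻¹ * (l * (l ^ (n+1))⁻¹)) * ((cf ^ (n+2))⁻¹ * (l' * (l' ^ (n+1))⁻¹)) := by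
    intro l l' hl hl' a b a' b'
    rw [norm_mul, RCLike.norm_conj]
    have h1 := kL_bound n cf l hcf0 hl _ (hsec a b l hl)
    have h2 := kL_bound n cf l' hcf0 hl' _ (hsec a' b' l' hl')
    gcongr
  have km : ∀ l l' : ℝ, ∀ f f' : frontier D → ℂ, Measurable f → Measurable f' → 
      Measurable (fun x => kL n l (f x) * (starRingEnd ℂ) (kL n l' (f' x))) := by
    intro l l' f f' hf hf'
    have m1 : Measurable (fun x => kL n l (f x)) := (measurable_kL n l).comp hf
    have m2 : Measurable (fun x => kL n l' (f' x)) := (measurable_kL n l').comp hf'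
    exact m1.mul (Complex.continuous_conj.measurable.comp m2)
  have hμfin : IsFiniteMeasure μ := by rw [hμ]; infer_instance
  refine ⟨μ, ENNReal.ofReal Cs, cf, Cf, hμfin, ENNReal.ofReal_ne_top, hσμ, hμσ, ⟨⟨?_, hcf0, hcf1, by linarith, ?_, ?_, ?_, ?_, ?_⟩, 
    ?_, ?_, ?_, ?_⟩, ?_, ?_⟩
  · exact (hcG.comp continuous_swap).measurable
  · exact fun x y l hl => hsec y x l hl
  · intro x r hr
    refine (measure_mono ?_).trans ((hV x (B * r) (by positivity)).trans (ENNReal.ofReal_le_ofReal ?_))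
    · intro y hy
      have h1 := hB.sym x x.2 y y.2
      have h2 : ‖GG ρ A y x‖ < r := hy
      show ‖GG ρ A x y‖ < B * r
      exact h1.trans_lt (by gcongr)
    · rw [mul_pow, ← mul_assoc]; gcongr
  · intro y r hr
    exact (hV y r hr).trans (ENNReal.ofReal_le_ofReal (by gcongr))
  · intro l l' hl hll hl1 y y'
    exact sum_osc F m (sig D) C (fun i => (hm i).hC) (√(l / l')) Cs (Real.sqrt_nonneg _) le_rfl hσμ _
      (km l l' _ _ (hmeas1 y) (hmeas1 y')) _ (fun x => kb l l' hl (hl.trans_le hll) y x y' x) _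
      (fun i _ => (hm i).I1 l l' hl hll hl1 y y') Cf f1
  · intro l l' hl hll hl1 y y'
    exact sum_osc F m (sig D) C (fun i => (hm i).hC) (√(l / l')) Cs (Real.sqrt_nonneg _) le_rfl hσμ _
      (km l l' _ _ (hmeas2 y) (hmeas2 y')) _ (fun x => kb l l' hl (hl.trans_le hll) x y x y') _
      (fun i _ => (hm i).I2 l l' hl hll hl1 y y') Cf f1
  · intro x r hr hr1
    have := hF (Set.mem_univ x)
    simp only [Set.mem_iUnion] at this
    obtain ⟨i, hi, hxi⟩ := this
    have h1 := (hm i).low x hxi r hr hr1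
    have h2 := hci i hi
    refine (ENNReal.ofReal_le_ofReal (by gcongr)).trans (h1.trans ?_)
    rw [hμs]
    exact Finset.single_le_sum (f := fun i => m i {y : frontier D | ‖GG ρ A y x‖ < r}) (fun _ _ => zero_le) hi
  · exact fun x y => (hB.bdd y y.2 x x.2).trans f3
  · exact fun x y u => (hB.R1 x x.2 y y.2 u u.2).trans (by gcongr)
  · exact fun x y u => (hB.R2 x x.2 y y.2 u u.2).trans (by gcongr)
  · intro x y
    have h1 := hB.d2 y y.2 x x.2
    have e : dist x y = ‖(y : Cn n) - x‖ := by rw [Subtype.dist_eq, dist_eq_norm, norm_sub_rev]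
    rw [e]
    calc cf * ‖(y : Cn n) - x‖ ^ 2 ≤ B⁻¹ * (B * ‖GG ρ A y x‖) := by gcongr
      _ = _ := by field_simp
  · intro x y
    have e : dist x y = ‖(y : Cn n) - x‖ := by rw [Subtype.dist_eq, dist_eq_norm, norm_sub_rev]
    rw [e]
    exact (hB.dup y y.2 x x.2).trans (by gcongr)

theorem main_final
    {n : ℕ} (hn : 1 ≤ n) (D U : Set (Cn n)) (ρ : Cn n → ℝ)
    (hDo : IsOpen D) (hDb : Bornology.IsBounded D)
    (hUo : IsOpen U) (hUb : frontier D ⊆ U)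
    (hρ : ContDiffOn ℝ 2 ρ U)
    (hdef : U ∩ D = {w ∈ U | ρ w < 0})
    (hgrad : ∀ w ∈ U, fderiv ℝ ρ w ≠ 0)
    (c : ℝ) (hc : 0 < c)
    (hconv : ∀ w ∈ frontier D, ∀ z ∈ closure D,
      c * ‖w - z‖ ^ 2 ≤ ‖delPair ρ w (w - z)‖)
    (p : ℝ) (hp : 1 < p) :
    ∃ A : ℝ, ∀ ε : ℝ, 0 < ε → ∀ f : Cn n → ℂ,
      MemLp f (ENNReal.ofReal p) (bSigma D) →
      eLpNorm
        (fun z : Cn n => ∫ w in {w : Cn n | ε < ‖delPair ρ w (w - z)‖},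
          f w * (delPair ρ w (w - z) ^ n)⁻¹ ∂(bSigma D))
        (ENNReal.ofReal p) (bSigma D)
      ≤ ENNReal.ofReal A * eLpNorm f (ENNReal.ofReal p) (bSigma D) := by
  obtain ⟨M, δ, c0, A, K, h⟩ := geo_exists D U ρ hDo hDb hUo hUb hρ hdef hgrad c hc hconv
  obtain ⟨B, hB⟩ := h.conseq
  obtain ⟨μ, a, c1, C1, hfin, ha, h1, h2, hQ, hlow, hup⟩ := qhyp_exists hn h hB
  have hσfin : IsFiniteMeasure (sig D) := ⟨(h1 Set.univ).trans_lt (by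
    rw [Measure.smul_apply, smul_eq_mul]; exact ENNReal.mul_lt_top ha.lt_top (measure_lt_top _ _))⟩
  have hdp : ∀ w z : frontier D, delPair ρ w (w - z) = gg ρ w z := by
    intro w z
    exact delPair_eq ρ w _ ((hρ.contDiffAt (hUo.mem_nhds (hUb w.2))).differentiableAt (by norm_num))
  have hgm : Measurable (Function.uncurry (fun x y : frontier D => gg ρ y x)) :=
    ((gg_cont h).comp continuous_swap).measurable
  obtain ⟨A1, hA1, hA⟩ := hQ.trunc (fun x => GG_self ρ A x) hlow hup (fun x y : frontier D => gg ρ y x) hgm B hB.hB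
    (fun x y => hB.dif y y.2 x x.2) (fun x y => hB.dn y y.2 x x.2) (fun x y => hB.up y y.2 x x.2) p hp
  set A2 : ℝ≥0∞ := a ^ (1 / p) * (a * (A1 * a ^ (1 / p))) with hA2
  have hA2t : A2 ≠ ⊤ := by
    have : a ^ (1 / p) ≠ ⊤ := ENNReal.rpow_ne_top_of_nonneg (by positivity) ha
    exact ENNReal.mul_ne_top this (ENNReal.mul_ne_top ha (ENNReal.mul_ne_top hA1 this))
  refine ⟨A2.toReal, fun ε hε f hf => ?_⟩
  rw [ENNReal.ofReal_toReal hA2t]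
  refine subtype_transfer (frontier D) isClosed_frontier.measurableSet _ (fun w z => delPair ρ w (w - z)) n ε ?_ p A2 ?_ f hf
  · intro z
    simp only [hdp]
    exact ((gg_cont h).comp (by fun_prop : Continuous fun x : frontier D => (x, z))).measurable
  · intro f hf
    simp only [hdp]
    exact change_measure a ha h1 h2 (fun x y : frontier D => trK n ε (gg ρ y x)) A1 p hp (fun f hf => hA ε hε f hf) f hf
end

/-- For a bounded domain `D ⊂ ℂⁿ` of class `C²` that is strongly
ℂ-linearly convex, the truncated Cauchy–Leray integrals are bounded on `Lᵖ(bD, σ)`,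
`1 < p < ∞`, uniformly in the truncation parameter `ε`. -/
theorem cauchyLeray_truncated_Lp_bounded
    {n : ℕ} (hn : 1 ≤ n) (D U : Set (Cn n)) (ρ : Cn n → ℝ)
    (hDo : IsOpen D) (hDconn : IsConnected D) (hDb : Bornology.IsBounded D)
    (hUo : IsOpen U) (hUb : frontier D ⊆ U)
    (hρ : ContDiffOn ℝ 2 ρ U)
    (hdef : U ∩ D = {w ∈ U | ρ w < 0})
    (hgrad : ∀ w ∈ U, fderiv ℝ ρ w ≠ 0)
    (c : ℝ) (hc : 0 < c)
    (hconv : ∀ w ∈ frontier D, ∀ z ∈ closure D,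
      c * ‖w - z‖ ^ 2 ≤ ‖delPair ρ w (w - z)‖)
    (p : ℝ) (hp : 1 < p) :
    ∃ A : ℝ, ∀ ε : ℝ, 0 < ε → ∀ f : Cn n → ℂ,
      MemLp f (ENNReal.ofReal p) (bSigma D) →
      eLpNorm
        (fun z : Cn n => ∫ w in {w : Cn n | ε < ‖delPair ρ w (w - z)‖},
          f w * (delPair ρ w (w - z) ^ n)⁻¹ ∂(bSigma D))
        (ENNReal.ofReal p) (bSigma D)
      ≤ ENNReal.ofReal A * eLpNorm f (ENNReal.ofReal p) (bSigma D) := by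
  exact main_final hn D U ρ hDo hDb hUo hUb hρ hdef hgrad c hc hconv p hp

end
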